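/- For each a ∈ {0,1,2,3,4,5}, the formal power series Σ_{n≥0} (11·N(a,11,11n+6) − p(11n+6))·q^n equals 11·Θ(b_1,b_2,b_3,b_4,b_5), where the integer coefficient vector (b_1,b_2,b_3,b_4,b_5) is: for a=0: (0,0,2,2,−2); for a=1: (−1,1,−1,−2,1); for a=2: (1,0,−1,2,0); for a=3: (1,0,1,−1,−1); for a=4: (0,−1,1,0,2); for a=5: (−1,0,−1,0,−1). -/

import Mathlib

/-- `p n`: the number of partitions of `n`. -/
def partitionCount (n : ℕ) : ℕ := Fintype.card (Nat.Partition n)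

/-- The rank of a partition: its largest part minus its number of parts
(the empty partition has rank 0). -/
def partitionRank {n : ℕ} (π : Nat.Partition n) : ℤ :=
  (π.parts.sup : ℤ) - (Multiset.card π.parts : ℤ)

/-- The crank of a partition `π`: if `π` has no parts equal to 1, it is the largest part;
otherwise it is (number of parts larger than the number of ones) − (number of ones). -/
def partitionCrank {n : ℕ} (π : Nat.Partition n) : ℤ :=
  if π.parts.count 1 = 0 then (π.parts.sup : ℤ)
  else ((π.parts.filter fun x => π.parts.count 1 < x).card : ℤ) - (π.parts.count 1 : ℤ)

/-- `rankCount a r n` = `N(a,r,n)`: the number of partitions of `n` whose rank is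
congruent to `a` modulo `r`. -/
def rankCount (a r : ℤ) (n : ℕ) : ℕ :=
  (Finset.univ.filter fun π : Nat.Partition n => partitionRank π % r = a % r).card

/-- `crankCount a n` = `M(a,11,n)`: for `n ≠ 1`, the number of partitions of `n` whose crank
is congruent to `a` modulo 11; at `n = 1` the standard convention `M(0,11,1) = −1`,
`M(1,11,1) = M(10,11,1) = 1`, and `M(a,11,1) = 0` otherwise. -/
def crankCount (a : ℤ) (n : ℕ) : ℤ :=
  if n = 1 then
    if a % 11 = 0 then -1
    else if a % 11 = 1 ∨ a % 11 = 10 then 1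
    else 0
  else ((Finset.univ.filter fun π : Nat.Partition n => partitionCrank π % 11 = a % 11).card : ℤ)

noncomputable section

/-- The Euler product `J_m = (q^m;q^m)_∞` as a q-series, via the pentagonal number theorem:
`J_m = Σ_{k∈ℤ} (−1)^k q^{m·k(3k−1)/2}` (the condition below is the exponent equation
cleared of denominators; all solutions `k` satisfy `|k| ≤ n`). -/
def Jser (m : ℤ) : PowerSeries ℚ :=
  PowerSeries.mk fun n =>
    ∑ k ∈ Finset.Icc (-(n : ℤ)) (n : ℤ),
      if m * (k * (3 * k - 1)) = 2 * (n : ℤ) then (-1 : ℚ) ^ k.natAbs else 0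

/-- The theta function `j(a,m) = Σ_{k∈ℤ} (−1)^k q^{m·k(k−1)/2 + a·k}` (for `0 < a < m`;
the condition below is the exponent equation cleared of denominators; all solutions `k`
satisfy `|k| ≤ n`). -/
def jtheta (a m : ℤ) : PowerSeries ℚ :=
  PowerSeries.mk fun n =>
    ∑ k ∈ Finset.Icc (-(n : ℤ)) (n : ℤ),
      if m * (k * (k - 1)) + 2 * a * k = 2 * (n : ℤ) then (-1 : ℚ) ^ k.natAbs else 0

/-- `P_i := j(i, 11)`. -/
def Pser (i : ℤ) : PowerSeries ℚ := jtheta i 11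

/-- The theta combination `Θ(b₁,b₂,b₃,b₄,b₅)`. -/
def ThetaSer (b1 b2 b3 b4 b5 : ℤ) : PowerSeries ℚ :=
  (Jser 11) ^ 6 * ((Jser 1)⁻¹) ^ 2 *
    ( (b1 : PowerSeries ℚ) * PowerSeries.X ^ 2 * (Pser 4)⁻¹ * ((Pser 5)⁻¹) ^ 2
    + (b2 : PowerSeries ℚ) * ((Pser 1)⁻¹) ^ 2 * (Pser 3)⁻¹
    + (b3 : PowerSeries ℚ) * PowerSeries.X * (Pser 1)⁻¹ * ((Pser 4)⁻¹) ^ 2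
    + (b4 : PowerSeries ℚ) * PowerSeries.X * ((Pser 2)⁻¹) ^ 2 * (Pser 5)⁻¹
    + (b5 : PowerSeries ℚ) * PowerSeries.X * (Pser 2)⁻¹ * ((Pser 3)⁻¹) ^ 2 )

/-- Monomials in the five theta values `t 1, …, t 5`. -/
noncomputable def mn (t : ℤ → ℂ) (a b c d e : ℤ) : ℂ :=
  t 1 ^ a * t 2 ^ b * t 3 ^ c * t 4 ^ d * t 5 ^ e

theorem mn_mul {t : ℤ → ℂ} (h1 : t 1 ≠ 0) (h2 : t 2 ≠ 0) (h3 : t 3 ≠ 0) (h4 : t 4 ≠ 0)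
    (h5 : t 5 ≠ 0) (a b c d e a' b' c' d' e' : ℤ) :
    mn t a b c d e * mn t a' b' c' d' e' = mn t (a + a') (b + b') (c + c') (d + d') (e + e') := by
  simp only [mn, zpow_add₀ h1, zpow_add₀ h2, zpow_add₀ h3, zpow_add₀ h4, zpow_add₀ h5]
  ring

theorem mn_pow (t : ℤ → ℂ) (a b c d e : ℤ) (n : ℕ) :
    mn t a b c d e ^ n = mn t (a * n) (b * n) (c * n) (d * n) (e * n) := by
  simp only [mn, zpow_mul, zpow_natCast, mul_pow]

/-- Numerators of the eleven graded pieces of the dissected quotient, multiplied by `11`. -/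
noncomputable def numer (t : ℤ → ℂ) (x y : ℂ) : ℕ → ℂ
  | 0 => mn t 1 (-3) (-2) (-5) (-4) * (- 22 - 11*y + 22*x - 11*x^2)
  | 1 => mn t 3 (-3) (-3) (-5) (-5) * (- 3 - 6*y + 5*x - 13*x*y - 18*x^2 - 3*x^3)
  | 2 => mn t 3 (-2) (-3) (-5) (-6) * (- 1 + 9*y + 9*x - 8*x*y + 5*x^2 - 12*x^3)
  | 3 => mn t 3 (-1) (-3) (-5) (-7) * (- 6*y + 11*x + 13*x*y - 12*x^2 - 6*x^2*y - 4*x^3)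
  | 4 => mn t 4 (-2) (-2) (-6) (-7) * (- 7 - 3*y + 8*x + 10*x*y + 13*x^2 - 11*x^2*y - 18*x^3)
  | 5 => mn t 2 (-1) (-3) (-5) (-6) * (2 + 4*y - 7*x + 5*x*y + 12*x^2 - 9*x^3)
  | 6 => mn t 3 (-2) (-2) (-6) (-6) * (9 + 7*y - 15*x - 16*x*y + 10*x^2 - 13*x^3)
  | 7 => mn t 3 (-3) (-2) (-5) (-6) * (- 4 + 14*y + 14*x - 21*x*y - 13*x^2 - 4*x^3)
  | 8 => mn t 3 (-2) (-2) (-5) (-7) * (- 5 - 21*y + 12*x + 37*x*y - 19*x^2 - 11*x^2*y + 17*x^3)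
  | 9 => mn t 3 (-1) (-2) (-5) (-8) * (- 1 + 10*y + 9*x - x*y - 15*x^2 - 10*x^2*y + 7*x^3)
  | 10 => mn t 2 (-2) (-2) (-5) (-6) * (8 + 16*y - 17*x - 13*x*y + 15*x^2 - 3*x^3)
  | _ => 0

/-- The reciprocal of the fourth power of the theta constant, as a function of the theta values. -/
noncomputable def discr (t : ℤ → ℂ) (x y : ℂ) : ℂ :=
  mn t 3 (-2) (-2) (-5) (-6) * (1 + 2*y + 2*x - 3*x*y - 5*x^2 + x^3)

section Graded
variable {t : ℤ → ℂ} (h1 : t 1 ≠ 0) (h2 : t 2 ≠ 0) (h3 : t 3 ≠ 0) (h4 : t 4 ≠ 0) (h5 : t 5 ≠ 0)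
  {x y u z : ℂ} (hx : x = mn t (-2) (-1) 1 1 1) (hy : y = mn t (-3) (-1) 1 0 3)
  (hu' : u = mn t (-2) 0 (-1) 1 2) (hz' : z = mn t (-4) 1 0 1 2)
  (hu : u = x - 1) (hz : z = x + y) (hc : y ^ 2 + y = x ^ 3 - x ^ 2)
include h1 h2 h3 h4 h5 hx hy hu' hz' hu hz hc

theorem graded_numer_0 :
    numer t x y 0 - mn t (-1) 1 0 0 0 * numer t x y 8 + mn t 0 (-1) 0 1 0 * numer t x y 10
    - mn t 0 0 (-1) 0 1 * numer t x y 6 + mn t 0 0 1 (-1) 0 * numer t x y 7 - mn t 1 0 0 0 (-1) * numer t x y 2 =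
      discr t x y * (2 * mn t (-3) 3 (-1) 0 0 + 2 * mn t (-2) 1 (-1) 2 (-1) + 1 * mn t (-1) (-2) 2 1 (-1) + 3 * mn t 0 (-3) 0 3 (-1)) := by
  have e0 : mn t 0 0 0 0 0 * mn t 1 (-3) (-2) (-5) (-4) = mn t 15 (-1) (-4) (-8) (-15) * (x^1*y^2*u^1*z^1) := by
    simp only [hx, hy, hu', hz', mn_pow, mn_mul h1 h2 h3 h4 h5]; norm_num [mn]
  have e1 : mn t (-1) 1 0 0 0 * mn t 3 (-2) (-2) (-5) (-7) = mn t 15 (-1) (-4) (-8) (-15) * (x^1*y^1*z^2) := by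
    simp only [hx, hy, hz', mn_pow, mn_mul h1 h2 h3 h4 h5]; norm_num [mn]
  have e2 : mn t 0 (-1) 0 1 0 * mn t 2 (-2) (-2) (-5) (-6) = mn t 15 (-1) (-4) (-8) (-15) * (x^2*y^1*u^1*z^1) := by
    simp only [hx, hy, hu', hz', mn_pow, mn_mul h1 h2 h3 h4 h5]; norm_num [mn]
  have e3 : mn t 0 0 (-1) 0 1 * mn t 3 (-2) (-2) (-6) (-6) = mn t 15 (-1) (-4) (-8) (-15) * (y^2*u^1*z^1) := by
    simp only [hy, hu', hz', mn_pow, mn_mul h1 h2 h3 h4 h5]; norm_num [mn]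
  have e4 : mn t 0 0 1 (-1) 0 * mn t 3 (-3) (-2) (-5) (-6) = mn t 15 (-1) (-4) (-8) (-15) * (x^1*y^2*z^1) := by
    simp only [hx, hy, hz', mn_pow, mn_mul h1 h2 h3 h4 h5]; norm_num [mn]
  have e5 : mn t 1 0 0 0 (-1) * mn t 3 (-2) (-3) (-5) (-6) = mn t 15 (-1) (-4) (-8) (-15) * (x^1*y^1*u^1*z^1) := by
    simp only [hx, hy, hu', hz', mn_pow, mn_mul h1 h2 h3 h4 h5]; norm_num [mn]
  have e6 : mn t (-3) 3 (-1) 0 0 * mn t 3 (-2) (-2) (-5) (-6) = mn t 15 (-1) (-4) (-8) (-15) * (y^1*z^3) := by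
    simp only [hy, hz', mn_pow, mn_mul h1 h2 h3 h4 h5]; norm_num [mn]
  have e7 : mn t (-2) 1 (-1) 2 (-1) * mn t 3 (-2) (-2) (-5) (-6) = mn t 15 (-1) (-4) (-8) (-15) * (x^2*u^1*z^2) := by
    simp only [hx, hu', hz', mn_pow, mn_mul h1 h2 h3 h4 h5]; norm_num [mn]
  have e8 : mn t (-1) (-2) 2 1 (-1) * mn t 3 (-2) (-2) (-5) (-6) = mn t 15 (-1) (-4) (-8) (-15) * (x^3*y^1*z^1) := by
    simp only [hx, hy, hz', mn_pow, mn_mul h1 h2 h3 h4 h5]; norm_num [mn]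
  have e9 : mn t 0 (-3) 0 3 (-1) * mn t 3 (-2) (-2) (-5) (-6) = mn t 15 (-1) (-4) (-8) (-15) * (x^4*u^2) := by
    simp only [hx, hu', mn_pow, mn_mul h1 h2 h3 h4 h5]; norm_num [mn]
  have h : (x^1*y^2*u^1*z^1) * (- 22 - 11*y + 22*x - 11*x^2)
      + (-1) * (x^1*y^1*z^2) * (- 5 - 21*y + 12*x + 37*x*y - 19*x^2 - 11*x^2*y + 17*x^3)
      + (x^2*y^1*u^1*z^1) * (8 + 16*y - 17*x - 13*x*y + 15*x^2 - 3*x^3)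
      + (-1) * (y^2*u^1*z^1) * (9 + 7*y - 15*x - 16*x*y + 10*x^2 - 13*x^3)
      + (x^1*y^2*z^1) * (- 4 + 14*y + 14*x - 21*x*y - 13*x^2 - 4*x^3)
      + (-1) * (x^1*y^1*u^1*z^1) * (- 1 + 9*y + 9*x - 8*x*y + 5*x^2 - 12*x^3)
      + (-2) * (y^1*z^3) * (1 + 2*y + 2*x - 3*x*y - 5*x^2 + x^3)
      + (-2) * (x^2*u^1*z^2) * (1 + 2*y + 2*x - 3*x*y - 5*x^2 + x^3)
      + (-1) * (x^3*y^1*z^1) * (1 + 2*y + 2*x - 3*x*y - 5*x^2 + x^3)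
      + (-3) * (x^4*u^2) * (1 + 2*y + 2*x - 3*x*y - 5*x^2 + x^3) = 0 := by
    rw [hu, hz]
    linear_combination (9*y^2 - 4*y^3 + 8*x*y + x*y^2 + 6*x*y^3 - x^2 + 3*x^2*y - 25*x^2*y^2 + x^3 - 20*x^3*y + 9*x^3*y^2 + 11*x^4 - x^4*y - 16*x^5 + 3*x^6) * hc
  have e : mn t 0 0 0 0 0 = 1 := by simp [mn]
  rw [e] at e0
  simp only [numer, discr]
  linear_combination (- 22 - 11*y + 22*x - 11*x^2) * e0
    + (-1) * (- 5 - 21*y + 12*x + 37*x*y - 19*x^2 - 11*x^2*y + 17*x^3) * e1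
    + (8 + 16*y - 17*x - 13*x*y + 15*x^2 - 3*x^3) * e2
    + (-1) * (9 + 7*y - 15*x - 16*x*y + 10*x^2 - 13*x^3) * e3
    + (- 4 + 14*y + 14*x - 21*x*y - 13*x^2 - 4*x^3) * e4
    + (-1) * (- 1 + 9*y + 9*x - 8*x*y + 5*x^2 - 12*x^3) * e5
    + (-2) * (1 + 2*y + 2*x - 3*x*y - 5*x^2 + x^3) * e6
    + (-2) * (1 + 2*y + 2*x - 3*x*y - 5*x^2 + x^3) * e7
    + (-1) * (1 + 2*y + 2*x - 3*x*y - 5*x^2 + x^3) * e8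
    + (-3) * (1 + 2*y + 2*x - 3*x*y - 5*x^2 + x^3) * e9
    + mn t 15 (-1) (-4) (-8) (-15) * h

theorem graded_numer_1 :
    numer t x y 1 - mn t (-1) 1 0 0 0 * numer t x y 9 + mn t 0 (-1) 0 1 0 * numer t x y 0
    - mn t 0 0 (-1) 0 1 * numer t x y 7 + mn t 0 0 1 (-1) 0 * numer t x y 8 - mn t 1 0 0 0 (-1) * numer t x y 3 =
      discr t x y * (- 11 * mn t (-1) 0 0 1 (-1)) := by
  have e0 : mn t 0 0 0 0 0 * mn t 3 (-3) (-3) (-5) (-5) = mn t 10 (-2) (-2) (-7) (-12) * (y^1*u^2) := by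
    simp only [hy, hu', mn_pow, mn_mul h1 h2 h3 h4 h5]; norm_num [mn]
  have e1 : mn t (-1) 1 0 0 0 * mn t 3 (-1) (-2) (-5) (-8) = mn t 10 (-2) (-2) (-7) (-12) * (z^2) := by
    simp only [hz', mn_pow, mn_mul h1 h2 h3 h4 h5]; norm_num [mn]
  have e2 : mn t 0 (-1) 0 1 0 * mn t 1 (-3) (-2) (-5) (-4) = mn t 10 (-2) (-2) (-7) (-12) * (x^1*y^1*u^2) := by
    simp only [hx, hy, hu', mn_pow, mn_mul h1 h2 h3 h4 h5]; norm_num [mn]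
  have e3 : mn t 0 0 (-1) 0 1 * mn t 3 (-3) (-2) (-5) (-6) = mn t 10 (-2) (-2) (-7) (-12) * (y^1*u^2) := by
    simp only [hy, hu', mn_pow, mn_mul h1 h2 h3 h4 h5]; norm_num [mn]
  have e4 : mn t 0 0 1 (-1) 0 * mn t 3 (-2) (-2) (-5) (-7) = mn t 10 (-2) (-2) (-7) (-12) * (y^1*z^1) := by
    simp only [hy, hz', mn_pow, mn_mul h1 h2 h3 h4 h5]; norm_num [mn]
  have e5 : mn t 1 0 0 0 (-1) * mn t 3 (-1) (-3) (-5) (-7) = mn t 10 (-2) (-2) (-7) (-12) * (u^1*z^1) := by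
    simp only [hu', hz', mn_pow, mn_mul h1 h2 h3 h4 h5]; norm_num [mn]
  have e6 : mn t (-1) 0 0 1 (-1) * mn t 3 (-2) (-2) (-5) (-6) = mn t 10 (-2) (-2) (-7) (-12) * (x^1*u^1*z^1) := by
    simp only [hx, hu', hz', mn_pow, mn_mul h1 h2 h3 h4 h5]; norm_num [mn]
  have h : (y^1*u^2) * (- 3 - 6*y + 5*x - 13*x*y - 18*x^2 - 3*x^3)
      + (-1) * (z^2) * (- 1 + 10*y + 9*x - x*y - 15*x^2 - 10*x^2*y + 7*x^3)
      + (x^1*y^1*u^2) * (- 22 - 11*y + 22*x - 11*x^2)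
      + (-1) * (y^1*u^2) * (- 4 + 14*y + 14*x - 21*x*y - 13*x^2 - 4*x^3)
      + (y^1*z^1) * (- 5 - 21*y + 12*x + 37*x*y - 19*x^2 - 11*x^2*y + 17*x^3)
      + (-1) * (u^1*z^1) * (- 6*y + 11*x + 13*x*y - 12*x^2 - 6*x^2*y - 4*x^3)
      + (11) * (x^1*u^1*z^1) * (1 + 2*y + 2*x - 3*x*y - 5*x^2 + x^3) = 0 := by
    rw [hu, hz]
    linear_combination (1 - 31*y - 42*x + 38*x*y + 58*x^2 - x^2*y - 11*x^3) * hc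
  have e : mn t 0 0 0 0 0 = 1 := by simp [mn]
  rw [e] at e0
  simp only [numer, discr]
  linear_combination (- 3 - 6*y + 5*x - 13*x*y - 18*x^2 - 3*x^3) * e0
    + (-1) * (- 1 + 10*y + 9*x - x*y - 15*x^2 - 10*x^2*y + 7*x^3) * e1
    + (- 22 - 11*y + 22*x - 11*x^2) * e2
    + (-1) * (- 4 + 14*y + 14*x - 21*x*y - 13*x^2 - 4*x^3) * e3
    + (- 5 - 21*y + 12*x + 37*x*y - 19*x^2 - 11*x^2*y + 17*x^3) * e4
    + (-1) * (- 6*y + 11*x + 13*x*y - 12*x^2 - 6*x^2*y - 4*x^3) * e5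
    + (11) * (1 + 2*y + 2*x - 3*x*y - 5*x^2 + x^3) * e6
    + mn t 10 (-2) (-2) (-7) (-12) * h

theorem graded_numer_2 :
    numer t x y 2 - mn t (-1) 1 0 0 0 * numer t x y 10 + mn t 0 (-1) 0 1 0 * numer t x y 1
    - mn t 0 0 (-1) 0 1 * numer t x y 8 + mn t 0 0 1 (-1) 0 * numer t x y 9 - mn t 1 0 0 0 (-1) * numer t x y 4 =
      discr t x y * (11 * mn t (-1) (-1) 1 (-1) 1) := by
  have e0 : mn t 0 0 0 0 0 * mn t 3 (-2) (-3) (-5) (-6) = mn t 11 (-3) (-1) (-8) (-12) * (u^2*z^1) := by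
    simp only [hu', hz', mn_pow, mn_mul h1 h2 h3 h4 h5]; norm_num [mn]
  have e1 : mn t (-1) 1 0 0 0 * mn t 2 (-2) (-2) (-5) (-6) = mn t 11 (-3) (-1) (-8) (-12) * (u^1*z^2) := by
    simp only [hu', hz', mn_pow, mn_mul h1 h2 h3 h4 h5]; norm_num [mn]
  have e2 : mn t 0 (-1) 0 1 0 * mn t 3 (-3) (-3) (-5) (-5) = mn t 11 (-3) (-1) (-8) (-12) * (x^1*u^3) := by
    simp only [hx, hu', mn_pow, mn_mul h1 h2 h3 h4 h5]; norm_num [mn]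
  have e3 : mn t 0 0 (-1) 0 1 * mn t 3 (-2) (-2) (-5) (-7) = mn t 11 (-3) (-1) (-8) (-12) * (u^2*z^1) := by
    simp only [hu', hz', mn_pow, mn_mul h1 h2 h3 h4 h5]; norm_num [mn]
  have e4 : mn t 0 0 1 (-1) 0 * mn t 3 (-1) (-2) (-5) (-8) = mn t 11 (-3) (-1) (-8) (-12) * (z^2) := by
    simp only [hz', mn_pow, mn_mul h1 h2 h3 h4 h5]; norm_num [mn]
  have e5 : mn t 1 0 0 0 (-1) * mn t 4 (-2) (-2) (-6) (-7) = mn t 11 (-3) (-1) (-8) (-12) * (u^1*z^1) := by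
    simp only [hu', hz', mn_pow, mn_mul h1 h2 h3 h4 h5]; norm_num [mn]
  have e6 : mn t (-1) (-1) 1 (-1) 1 * mn t 3 (-2) (-2) (-5) (-6) = mn t 11 (-3) (-1) (-8) (-12) * (y^1*u^1*z^1) := by
    simp only [hy, hu', hz', mn_pow, mn_mul h1 h2 h3 h4 h5]; norm_num [mn]
  have h : (u^2*z^1) * (- 1 + 9*y + 9*x - 8*x*y + 5*x^2 - 12*x^3)
      + (-1) * (u^1*z^2) * (8 + 16*y - 17*x - 13*x*y + 15*x^2 - 3*x^3)
      + (x^1*u^3) * (- 3 - 6*y + 5*x - 13*x*y - 18*x^2 - 3*x^3)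
      + (-1) * (u^2*z^1) * (- 5 - 21*y + 12*x + 37*x*y - 19*x^2 - 11*x^2*y + 17*x^3)
      + (z^2) * (- 1 + 10*y + 9*x - x*y - 15*x^2 - 10*x^2*y + 7*x^3)
      + (-1) * (u^1*z^1) * (- 7 - 3*y + 8*x + 10*x*y + 13*x^2 - 11*x^2*y - 18*x^3)
      + (-11) * (y^1*u^1*z^1) * (1 + 2*y + 2*x - 3*x*y - 5*x^2 + x^3) = 0 := by
    rw [hu, hz]
    linear_combination (- 3 + 48*y + 62*x - 85*x*y - 101*x^2 + 36*x^2*y + 38*x^3 + 3*x^4) * hc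
  have e : mn t 0 0 0 0 0 = 1 := by simp [mn]
  rw [e] at e0
  simp only [numer, discr]
  linear_combination (- 1 + 9*y + 9*x - 8*x*y + 5*x^2 - 12*x^3) * e0
    + (-1) * (8 + 16*y - 17*x - 13*x*y + 15*x^2 - 3*x^3) * e1
    + (- 3 - 6*y + 5*x - 13*x*y - 18*x^2 - 3*x^3) * e2
    + (-1) * (- 5 - 21*y + 12*x + 37*x*y - 19*x^2 - 11*x^2*y + 17*x^3) * e3
    + (- 1 + 10*y + 9*x - x*y - 15*x^2 - 10*x^2*y + 7*x^3) * e4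
    + (-1) * (- 7 - 3*y + 8*x + 10*x*y + 13*x^2 - 11*x^2*y - 18*x^3) * e5
    + (-11) * (1 + 2*y + 2*x - 3*x*y - 5*x^2 + x^3) * e6
    + mn t 11 (-3) (-1) (-8) (-12) * h

theorem graded_numer_3 :
    numer t x y 3 - mn t (-1) 1 0 0 0 * numer t x y 0 + mn t 0 (-1) 0 1 0 * numer t x y 2
    - mn t 0 0 (-1) 0 1 * numer t x y 9 + mn t 0 0 1 (-1) 0 * numer t x y 10 - mn t 1 0 0 0 (-1) * numer t x y 5 =
      0 := by
  have e0 : mn t 0 0 0 0 0 * mn t 3 (-1) (-3) (-5) (-7) = mn t 9 (-2) (-2) (-7) (-11) * (u^1*z^1) := by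
    simp only [hu', hz', mn_pow, mn_mul h1 h2 h3 h4 h5]; norm_num [mn]
  have e1 : mn t (-1) 1 0 0 0 * mn t 1 (-3) (-2) (-5) (-4) = mn t 9 (-2) (-2) (-7) (-11) * (y^1*u^1*z^1) := by
    simp only [hy, hu', hz', mn_pow, mn_mul h1 h2 h3 h4 h5]; norm_num [mn]
  have e2 : mn t 0 (-1) 0 1 0 * mn t 3 (-2) (-3) (-5) (-6) = mn t 9 (-2) (-2) (-7) (-11) * (x^1*u^2) := by
    simp only [hx, hu', mn_pow, mn_mul h1 h2 h3 h4 h5]; norm_num [mn]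
  have e3 : mn t 0 0 (-1) 0 1 * mn t 3 (-1) (-2) (-5) (-8) = mn t 9 (-2) (-2) (-7) (-11) * (u^1*z^1) := by
    simp only [hu', hz', mn_pow, mn_mul h1 h2 h3 h4 h5]; norm_num [mn]
  have e4 : mn t 0 0 1 (-1) 0 * mn t 2 (-2) (-2) (-5) (-6) = mn t 9 (-2) (-2) (-7) (-11) * (y^1*z^1) := by
    simp only [hy, hz', mn_pow, mn_mul h1 h2 h3 h4 h5]; norm_num [mn]
  have e5 : mn t 1 0 0 0 (-1) * mn t 2 (-1) (-3) (-5) (-6) = mn t 9 (-2) (-2) (-7) (-11) * (u^1*z^1) := by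
    simp only [hu', hz', mn_pow, mn_mul h1 h2 h3 h4 h5]; norm_num [mn]
  have h : (u^1*z^1) * (- 6*y + 11*x + 13*x*y - 12*x^2 - 6*x^2*y - 4*x^3)
      + (-1) * (y^1*u^1*z^1) * (- 22 - 11*y + 22*x - 11*x^2)
      + (x^1*u^2) * (- 1 + 9*y + 9*x - 8*x*y + 5*x^2 - 12*x^3)
      + (-1) * (u^1*z^1) * (- 1 + 10*y + 9*x - x*y - 15*x^2 - 10*x^2*y + 7*x^3)
      + (y^1*z^1) * (8 + 16*y - 17*x - 13*x*y + 15*x^2 - 3*x^3)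
      + (-1) * (u^1*z^1) * (2 + 4*y - 7*x + 5*x*y + 12*x^2 - 9*x^3) = 0 := by
    rw [hu, hz]
    linear_combination (1 + 5*y + 5*x - 2*x*y - 15*x^2 + 12*x^3) * hc
  have e : mn t 0 0 0 0 0 = 1 := by simp [mn]
  rw [e] at e0
  simp only [numer]
  linear_combination (- 6*y + 11*x + 13*x*y - 12*x^2 - 6*x^2*y - 4*x^3) * e0
    + (-1) * (- 22 - 11*y + 22*x - 11*x^2) * e1
    + (- 1 + 9*y + 9*x - 8*x*y + 5*x^2 - 12*x^3) * e2
    + (-1) * (- 1 + 10*y + 9*x - x*y - 15*x^2 - 10*x^2*y + 7*x^3) * e3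
    + (8 + 16*y - 17*x - 13*x*y + 15*x^2 - 3*x^3) * e4
    + (-1) * (2 + 4*y - 7*x + 5*x*y + 12*x^2 - 9*x^3) * e5
    + mn t 9 (-2) (-2) (-7) (-11) * h

theorem graded_numer_4 :
    numer t x y 4 - mn t (-1) 1 0 0 0 * numer t x y 1 + mn t 0 (-1) 0 1 0 * numer t x y 3
    - mn t 0 0 (-1) 0 1 * numer t x y 10 + mn t 0 0 1 (-1) 0 * numer t x y 0 - mn t 1 0 0 0 (-1) * numer t x y 6 =
      0 := by
  have e0 : mn t 0 0 0 0 0 * mn t 4 (-2) (-2) (-6) (-7) = mn t 7 (-1) (-3) (-6) (-10) * (y^1) := by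
    simp only [hy, mn_pow, mn_mul h1 h2 h3 h4 h5]; norm_num [mn]
  have e1 : mn t (-1) 1 0 0 0 * mn t 3 (-3) (-3) (-5) (-5) = mn t 7 (-1) (-3) (-6) (-10) * (y^1*u^1) := by
    simp only [hy, hu', mn_pow, mn_mul h1 h2 h3 h4 h5]; norm_num [mn]
  have e2 : mn t 0 (-1) 0 1 0 * mn t 3 (-1) (-3) (-5) (-7) = mn t 7 (-1) (-3) (-6) (-10) * (x^1*u^1) := by
    simp only [hx, hu', mn_pow, mn_mul h1 h2 h3 h4 h5]; norm_num [mn]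
  have e3 : mn t 0 0 (-1) 0 1 * mn t 2 (-2) (-2) (-5) (-6) = mn t 7 (-1) (-3) (-6) (-10) * (y^1*u^1) := by
    simp only [hy, hu', mn_pow, mn_mul h1 h2 h3 h4 h5]; norm_num [mn]
  have e4 : mn t 0 0 1 (-1) 0 * mn t 1 (-3) (-2) (-5) (-4) = mn t 7 (-1) (-3) (-6) (-10) * (y^2) := by
    simp only [hy, mn_pow, mn_mul h1 h2 h3 h4 h5]; norm_num [mn]
  have e5 : mn t 1 0 0 0 (-1) * mn t 3 (-2) (-2) (-6) (-6) = mn t 7 (-1) (-3) (-6) (-10) * (y^1) := by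
    simp only [hy, mn_pow, mn_mul h1 h2 h3 h4 h5]; norm_num [mn]
  have h : (y^1) * (- 7 - 3*y + 8*x + 10*x*y + 13*x^2 - 11*x^2*y - 18*x^3)
      + (-1) * (y^1*u^1) * (- 3 - 6*y + 5*x - 13*x*y - 18*x^2 - 3*x^3)
      + (x^1*u^1) * (- 6*y + 11*x + 13*x*y - 12*x^2 - 6*x^2*y - 4*x^3)
      + (-1) * (y^1*u^1) * (8 + 16*y - 17*x - 13*x*y + 15*x^2 - 3*x^3)
      + (y^2) * (- 22 - 11*y + 22*x - 11*x^2)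
      + (-1) * (y^1) * (9 + 7*y - 15*x - 16*x*y + 10*x^2 - 13*x^3) = 0 := by
    rw [hu]
    linear_combination (- 11 - 11*y + 12*x + 4*x^2) * hc
  have e : mn t 0 0 0 0 0 = 1 := by simp [mn]
  rw [e] at e0
  simp only [numer]
  linear_combination (- 7 - 3*y + 8*x + 10*x*y + 13*x^2 - 11*x^2*y - 18*x^3) * e0
    + (-1) * (- 3 - 6*y + 5*x - 13*x*y - 18*x^2 - 3*x^3) * e1
    + (- 6*y + 11*x + 13*x*y - 12*x^2 - 6*x^2*y - 4*x^3) * e2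
    + (-1) * (8 + 16*y - 17*x - 13*x*y + 15*x^2 - 3*x^3) * e3
    + (- 22 - 11*y + 22*x - 11*x^2) * e4
    + (-1) * (9 + 7*y - 15*x - 16*x*y + 10*x^2 - 13*x^3) * e5
    + mn t 7 (-1) (-3) (-6) (-10) * h

theorem graded_numer_5 :
    numer t x y 5 - mn t (-1) 1 0 0 0 * numer t x y 2 + mn t 0 (-1) 0 1 0 * numer t x y 4
    - mn t 0 0 (-1) 0 1 * numer t x y 0 + mn t 0 0 1 (-1) 0 * numer t x y 1 - mn t 1 0 0 0 (-1) * numer t x y 7 =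
      0 := by
  have e0 : mn t 0 0 0 0 0 * mn t 2 (-1) (-3) (-5) (-6) = mn t 6 (-2) (-3) (-6) (-8) * (z^1) := by
    simp only [hz', mn_pow, mn_mul h1 h2 h3 h4 h5]; norm_num [mn]
  have e1 : mn t (-1) 1 0 0 0 * mn t 3 (-2) (-3) (-5) (-6) = mn t 6 (-2) (-3) (-6) (-8) * (z^1) := by
    simp only [hz', mn_pow, mn_mul h1 h2 h3 h4 h5]; norm_num [mn]
  have e2 : mn t 0 (-1) 0 1 0 * mn t 4 (-2) (-2) (-6) (-7) = mn t 6 (-2) (-3) (-6) (-8) * (x^1) := by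
    simp only [hx, mn_pow, mn_mul h1 h2 h3 h4 h5]; norm_num [mn]
  have e3 : mn t 0 0 (-1) 0 1 * mn t 1 (-3) (-2) (-5) (-4) = mn t 6 (-2) (-3) (-6) (-8) * (y^1*u^1) := by
    simp only [hy, hu', mn_pow, mn_mul h1 h2 h3 h4 h5]; norm_num [mn]
  have e4 : mn t 0 0 1 (-1) 0 * mn t 3 (-3) (-3) (-5) (-5) = mn t 6 (-2) (-3) (-6) (-8) * (y^1) := by
    simp only [hy, mn_pow, mn_mul h1 h2 h3 h4 h5]; norm_num [mn]
  have e5 : mn t 1 0 0 0 (-1) * mn t 3 (-3) (-2) (-5) (-6) = mn t 6 (-2) (-3) (-6) (-8) * (x^1) := by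
    simp only [hx, mn_pow, mn_mul h1 h2 h3 h4 h5]; norm_num [mn]
  have h : (z^1) * (2 + 4*y - 7*x + 5*x*y + 12*x^2 - 9*x^3)
      + (-1) * (z^1) * (- 1 + 9*y + 9*x - 8*x*y + 5*x^2 - 12*x^3)
      + (x^1) * (- 7 - 3*y + 8*x + 10*x*y + 13*x^2 - 11*x^2*y - 18*x^3)
      + (-1) * (y^1*u^1) * (- 22 - 11*y + 22*x - 11*x^2)
      + (y^1) * (- 3 - 6*y + 5*x - 13*x*y - 18*x^2 - 3*x^3)
      + (-1) * (x^1) * (- 4 + 14*y + 14*x - 21*x*y - 13*x^2 - 4*x^3) = 0 := by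
    rw [hu, hz]
    linear_combination (- 22 + 11*x) * hc
  have e : mn t 0 0 0 0 0 = 1 := by simp [mn]
  rw [e] at e0
  simp only [numer]
  linear_combination (2 + 4*y - 7*x + 5*x*y + 12*x^2 - 9*x^3) * e0
    + (-1) * (- 1 + 9*y + 9*x - 8*x*y + 5*x^2 - 12*x^3) * e1
    + (- 7 - 3*y + 8*x + 10*x*y + 13*x^2 - 11*x^2*y - 18*x^3) * e2
    + (-1) * (- 22 - 11*y + 22*x - 11*x^2) * e3
    + (- 3 - 6*y + 5*x - 13*x*y - 18*x^2 - 3*x^3) * e4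
    + (-1) * (- 4 + 14*y + 14*x - 21*x*y - 13*x^2 - 4*x^3) * e5
    + mn t 6 (-2) (-3) (-6) (-8) * h

theorem graded_numer_6 :
    numer t x y 6 - mn t (-1) 1 0 0 0 * numer t x y 3 + mn t 0 (-1) 0 1 0 * numer t x y 5
    - mn t 0 0 (-1) 0 1 * numer t x y 1 + mn t 0 0 1 (-1) 0 * numer t x y 2 - mn t 1 0 0 0 (-1) * numer t x y 8 =
      discr t x y * (11 * mn t 0 0 0 (-1) 0) := by
  have e0 : mn t 0 0 0 0 0 * mn t 3 (-2) (-2) (-6) (-6) = mn t 10 (-2) (-3) (-7) (-11) * (y^1*z^1) := by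
    simp only [hy, hz', mn_pow, mn_mul h1 h2 h3 h4 h5]; norm_num [mn]
  have e1 : mn t (-1) 1 0 0 0 * mn t 3 (-1) (-3) (-5) (-7) = mn t 10 (-2) (-3) (-7) (-11) * (z^2) := by
    simp only [hz', mn_pow, mn_mul h1 h2 h3 h4 h5]; norm_num [mn]
  have e2 : mn t 0 (-1) 0 1 0 * mn t 2 (-1) (-3) (-5) (-6) = mn t 10 (-2) (-3) (-7) (-11) * (x^1*u^1*z^1) := by
    simp only [hx, hu', hz', mn_pow, mn_mul h1 h2 h3 h4 h5]; norm_num [mn]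
  have e3 : mn t 0 0 (-1) 0 1 * mn t 3 (-3) (-3) (-5) (-5) = mn t 10 (-2) (-3) (-7) (-11) * (y^1*u^2) := by
    simp only [hy, hu', mn_pow, mn_mul h1 h2 h3 h4 h5]; norm_num [mn]
  have e4 : mn t 0 0 1 (-1) 0 * mn t 3 (-2) (-3) (-5) (-6) = mn t 10 (-2) (-3) (-7) (-11) * (y^1*z^1) := by
    simp only [hy, hz', mn_pow, mn_mul h1 h2 h3 h4 h5]; norm_num [mn]
  have e5 : mn t 1 0 0 0 (-1) * mn t 3 (-2) (-2) (-5) (-7) = mn t 10 (-2) (-3) (-7) (-11) * (x^1*z^1) := by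
    simp only [hx, hz', mn_pow, mn_mul h1 h2 h3 h4 h5]; norm_num [mn]
  have e6 : mn t 0 0 0 (-1) 0 * mn t 3 (-2) (-2) (-5) (-6) = mn t 10 (-2) (-3) (-7) (-11) * (y^1*z^1) := by
    simp only [hy, hz', mn_pow, mn_mul h1 h2 h3 h4 h5]; norm_num [mn]
  have h : (y^1*z^1) * (9 + 7*y - 15*x - 16*x*y + 10*x^2 - 13*x^3)
      + (-1) * (z^2) * (- 6*y + 11*x + 13*x*y - 12*x^2 - 6*x^2*y - 4*x^3)
      + (x^1*u^1*z^1) * (2 + 4*y - 7*x + 5*x*y + 12*x^2 - 9*x^3)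
      + (-1) * (y^1*u^2) * (- 3 - 6*y + 5*x - 13*x*y - 18*x^2 - 3*x^3)
      + (y^1*z^1) * (- 1 + 9*y + 9*x - 8*x*y + 5*x^2 - 12*x^3)
      + (-1) * (x^1*z^1) * (- 5 - 21*y + 12*x + 37*x*y - 19*x^2 - 11*x^2*y + 17*x^3)
      + (-11) * (y^1*z^1) * (1 + 2*y + 2*x - 3*x*y - 5*x^2 + x^3) = 0 := by
    rw [hu, hz]
    linear_combination (3 - 11*x - 4*x*y + x^2 + 6*x^2*y + 9*x^3) * hc
  have e : mn t 0 0 0 0 0 = 1 := by simp [mn]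
  rw [e] at e0
  simp only [numer, discr]
  linear_combination (9 + 7*y - 15*x - 16*x*y + 10*x^2 - 13*x^3) * e0
    + (-1) * (- 6*y + 11*x + 13*x*y - 12*x^2 - 6*x^2*y - 4*x^3) * e1
    + (2 + 4*y - 7*x + 5*x*y + 12*x^2 - 9*x^3) * e2
    + (-1) * (- 3 - 6*y + 5*x - 13*x*y - 18*x^2 - 3*x^3) * e3
    + (- 1 + 9*y + 9*x - 8*x*y + 5*x^2 - 12*x^3) * e4
    + (-1) * (- 5 - 21*y + 12*x + 37*x*y - 19*x^2 - 11*x^2*y + 17*x^3) * e5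
    + (-11) * (1 + 2*y + 2*x - 3*x*y - 5*x^2 + x^3) * e6
    + mn t 10 (-2) (-3) (-7) (-11) * h

theorem graded_numer_7 :
    numer t x y 7 - mn t (-1) 1 0 0 0 * numer t x y 4 + mn t 0 (-1) 0 1 0 * numer t x y 6
    - mn t 0 0 (-1) 0 1 * numer t x y 2 + mn t 0 0 1 (-1) 0 * numer t x y 3 - mn t 1 0 0 0 (-1) * numer t x y 9 =
      0 := by
  have e0 : mn t 0 0 0 0 0 * mn t 3 (-3) (-2) (-5) (-6) = mn t 10 (-1) (-3) (-7) (-12) * (x^1*y^1*u^1) := by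
    simp only [hx, hy, hu', mn_pow, mn_mul h1 h2 h3 h4 h5]; norm_num [mn]
  have e1 : mn t (-1) 1 0 0 0 * mn t 4 (-2) (-2) (-6) (-7) = mn t 10 (-1) (-3) (-7) (-12) * (y^1*z^1) := by
    simp only [hy, hz', mn_pow, mn_mul h1 h2 h3 h4 h5]; norm_num [mn]
  have e2 : mn t 0 (-1) 0 1 0 * mn t 3 (-2) (-2) (-6) (-6) = mn t 10 (-1) (-3) (-7) (-12) * (x^1*y^1*u^1) := by
    simp only [hx, hy, hu', mn_pow, mn_mul h1 h2 h3 h4 h5]; norm_num [mn]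
  have e3 : mn t 0 0 (-1) 0 1 * mn t 3 (-2) (-3) (-5) (-6) = mn t 10 (-1) (-3) (-7) (-12) * (y^1*u^2) := by
    simp only [hy, hu', mn_pow, mn_mul h1 h2 h3 h4 h5]; norm_num [mn]
  have e4 : mn t 0 0 1 (-1) 0 * mn t 3 (-1) (-3) (-5) (-7) = mn t 10 (-1) (-3) (-7) (-12) * (y^1*z^1) := by
    simp only [hy, hz', mn_pow, mn_mul h1 h2 h3 h4 h5]; norm_num [mn]
  have e5 : mn t 1 0 0 0 (-1) * mn t 3 (-1) (-2) (-5) (-8) = mn t 10 (-1) (-3) (-7) (-12) * (x^1*z^1) := by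
    simp only [hx, hz', mn_pow, mn_mul h1 h2 h3 h4 h5]; norm_num [mn]
  have h : (x^1*y^1*u^1) * (- 4 + 14*y + 14*x - 21*x*y - 13*x^2 - 4*x^3)
      + (-1) * (y^1*z^1) * (- 7 - 3*y + 8*x + 10*x*y + 13*x^2 - 11*x^2*y - 18*x^3)
      + (x^1*y^1*u^1) * (9 + 7*y - 15*x - 16*x*y + 10*x^2 - 13*x^3)
      + (-1) * (y^1*u^2) * (- 1 + 9*y + 9*x - 8*x*y + 5*x^2 - 12*x^3)
      + (y^1*z^1) * (- 6*y + 11*x + 13*x*y - 12*x^2 - 6*x^2*y - 4*x^3)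
      + (-1) * (x^1*z^1) * (- 1 + 10*y + 9*x - x*y - 15*x^2 - 10*x^2*y + 7*x^3) = 0 := by
    rw [hu, hz]
    linear_combination (1 - 3*y - 8*x + 3*x*y + 7*x^2 + 5*x^2*y) * hc
  have e : mn t 0 0 0 0 0 = 1 := by simp [mn]
  rw [e] at e0
  simp only [numer]
  linear_combination (- 4 + 14*y + 14*x - 21*x*y - 13*x^2 - 4*x^3) * e0
    + (-1) * (- 7 - 3*y + 8*x + 10*x*y + 13*x^2 - 11*x^2*y - 18*x^3) * e1
    + (9 + 7*y - 15*x - 16*x*y + 10*x^2 - 13*x^3) * e2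
    + (-1) * (- 1 + 9*y + 9*x - 8*x*y + 5*x^2 - 12*x^3) * e3
    + (- 6*y + 11*x + 13*x*y - 12*x^2 - 6*x^2*y - 4*x^3) * e4
    + (-1) * (- 1 + 10*y + 9*x - x*y - 15*x^2 - 10*x^2*y + 7*x^3) * e5
    + mn t 10 (-1) (-3) (-7) (-12) * h

theorem graded_numer_8 :
    numer t x y 8 - mn t (-1) 1 0 0 0 * numer t x y 5 + mn t 0 (-1) 0 1 0 * numer t x y 7
    - mn t 0 0 (-1) 0 1 * numer t x y 3 + mn t 0 0 1 (-1) 0 * numer t x y 4 - mn t 1 0 0 0 (-1) * numer t x y 10 =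
      0 := by
  have e0 : mn t 0 0 0 0 0 * mn t 3 (-2) (-2) (-5) (-7) = mn t 11 (-2) (-2) (-8) (-12) * (x^1*u^1*z^1) := by
    simp only [hx, hu', hz', mn_pow, mn_mul h1 h2 h3 h4 h5]; norm_num [mn]
  have e1 : mn t (-1) 1 0 0 0 * mn t 2 (-1) (-3) (-5) (-6) = mn t 11 (-2) (-2) (-8) (-12) * (u^1*z^2) := by
    simp only [hu', hz', mn_pow, mn_mul h1 h2 h3 h4 h5]; norm_num [mn]
  have e2 : mn t 0 (-1) 0 1 0 * mn t 3 (-3) (-2) (-5) (-6) = mn t 11 (-2) (-2) (-8) (-12) * (x^2*u^2) := by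
    simp only [hx, hu', mn_pow, mn_mul h1 h2 h3 h4 h5]; norm_num [mn]
  have e3 : mn t 0 0 (-1) 0 1 * mn t 3 (-1) (-3) (-5) (-7) = mn t 11 (-2) (-2) (-8) (-12) * (u^2*z^1) := by
    simp only [hu', hz', mn_pow, mn_mul h1 h2 h3 h4 h5]; norm_num [mn]
  have e4 : mn t 0 0 1 (-1) 0 * mn t 4 (-2) (-2) (-6) (-7) = mn t 11 (-2) (-2) (-8) (-12) * (y^1*z^1) := by
    simp only [hy, hz', mn_pow, mn_mul h1 h2 h3 h4 h5]; norm_num [mn]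
  have e5 : mn t 1 0 0 0 (-1) * mn t 2 (-2) (-2) (-5) (-6) = mn t 11 (-2) (-2) (-8) (-12) * (x^1*u^1*z^1) := by
    simp only [hx, hu', hz', mn_pow, mn_mul h1 h2 h3 h4 h5]; norm_num [mn]
  have h : (x^1*u^1*z^1) * (- 5 - 21*y + 12*x + 37*x*y - 19*x^2 - 11*x^2*y + 17*x^3)
      + (-1) * (u^1*z^2) * (2 + 4*y - 7*x + 5*x*y + 12*x^2 - 9*x^3)
      + (x^2*u^2) * (- 4 + 14*y + 14*x - 21*x*y - 13*x^2 - 4*x^3)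
      + (-1) * (u^2*z^1) * (- 6*y + 11*x + 13*x*y - 12*x^2 - 6*x^2*y - 4*x^3)
      + (y^1*z^1) * (- 7 - 3*y + 8*x + 10*x*y + 13*x^2 - 11*x^2*y - 18*x^3)
      + (-1) * (x^1*u^1*z^1) * (8 + 16*y - 17*x - 13*x*y + 15*x^2 - 3*x^3) = 0 := by
    rw [hu, hz]
    linear_combination (y + 5*x + 11*x*y + 11*x^2 - 16*x^2*y - 24*x^3 + 4*x^4) * hc
  have e : mn t 0 0 0 0 0 = 1 := by simp [mn]
  rw [e] at e0
  simp only [numer]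
  linear_combination (- 5 - 21*y + 12*x + 37*x*y - 19*x^2 - 11*x^2*y + 17*x^3) * e0
    + (-1) * (2 + 4*y - 7*x + 5*x*y + 12*x^2 - 9*x^3) * e1
    + (- 4 + 14*y + 14*x - 21*x*y - 13*x^2 - 4*x^3) * e2
    + (-1) * (- 6*y + 11*x + 13*x*y - 12*x^2 - 6*x^2*y - 4*x^3) * e3
    + (- 7 - 3*y + 8*x + 10*x*y + 13*x^2 - 11*x^2*y - 18*x^3) * e4
    + (-1) * (8 + 16*y - 17*x - 13*x*y + 15*x^2 - 3*x^3) * e5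
    + mn t 11 (-2) (-2) (-8) (-12) * h

theorem graded_numer_9 :
    numer t x y 9 - mn t (-1) 1 0 0 0 * numer t x y 6 + mn t 0 (-1) 0 1 0 * numer t x y 8
    - mn t 0 0 (-1) 0 1 * numer t x y 4 + mn t 0 0 1 (-1) 0 * numer t x y 5 - mn t 1 0 0 0 (-1) * numer t x y 0 =
      discr t x y * (- 11 * mn t (-2) 1 (-1) 1 0) := by
  have e0 : mn t 0 0 0 0 0 * mn t 3 (-1) (-2) (-5) (-8) = mn t 9 (-1) (-3) (-7) (-11) * (x^1*z^1) := by
    simp only [hx, hz', mn_pow, mn_mul h1 h2 h3 h4 h5]; norm_num [mn]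
  have e1 : mn t (-1) 1 0 0 0 * mn t 3 (-2) (-2) (-6) (-6) = mn t 9 (-1) (-3) (-7) (-11) * (y^1*z^1) := by
    simp only [hy, hz', mn_pow, mn_mul h1 h2 h3 h4 h5]; norm_num [mn]
  have e2 : mn t 0 (-1) 0 1 0 * mn t 3 (-2) (-2) (-5) (-7) = mn t 9 (-1) (-3) (-7) (-11) * (x^2*u^1) := by
    simp only [hx, hu', mn_pow, mn_mul h1 h2 h3 h4 h5]; norm_num [mn]
  have e3 : mn t 0 0 (-1) 0 1 * mn t 4 (-2) (-2) (-6) (-7) = mn t 9 (-1) (-3) (-7) (-11) * (y^1*u^1) := by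
    simp only [hy, hu', mn_pow, mn_mul h1 h2 h3 h4 h5]; norm_num [mn]
  have e4 : mn t 0 0 1 (-1) 0 * mn t 2 (-1) (-3) (-5) (-6) = mn t 9 (-1) (-3) (-7) (-11) * (y^1*z^1) := by
    simp only [hy, hz', mn_pow, mn_mul h1 h2 h3 h4 h5]; norm_num [mn]
  have e5 : mn t 1 0 0 0 (-1) * mn t 1 (-3) (-2) (-5) (-4) = mn t 9 (-1) (-3) (-7) (-11) * (x^1*y^1*u^1) := by
    simp only [hx, hy, hu', mn_pow, mn_mul h1 h2 h3 h4 h5]; norm_num [mn]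
  have e6 : mn t (-2) 1 (-1) 1 0 * mn t 3 (-2) (-2) (-5) (-6) = mn t 9 (-1) (-3) (-7) (-11) * (x^1*u^1*z^1) := by
    simp only [hx, hu', hz', mn_pow, mn_mul h1 h2 h3 h4 h5]; norm_num [mn]
  have h : (x^1*z^1) * (- 1 + 10*y + 9*x - x*y - 15*x^2 - 10*x^2*y + 7*x^3)
      + (-1) * (y^1*z^1) * (9 + 7*y - 15*x - 16*x*y + 10*x^2 - 13*x^3)
      + (x^2*u^1) * (- 5 - 21*y + 12*x + 37*x*y - 19*x^2 - 11*x^2*y + 17*x^3)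
      + (-1) * (y^1*u^1) * (- 7 - 3*y + 8*x + 10*x*y + 13*x^2 - 11*x^2*y - 18*x^3)
      + (y^1*z^1) * (2 + 4*y - 7*x + 5*x*y + 12*x^2 - 9*x^3)
      + (-1) * (x^1*y^1*u^1) * (- 22 - 11*y + 22*x - 11*x^2)
      + (11) * (x^1*u^1*z^1) * (1 + 2*y + 2*x - 3*x*y - 5*x^2 + x^3) = 0 := by
    rw [hu, hz]
    linear_combination (- 7 - 3*y - 26*x + 21*x*y + 67*x^2 - 28*x^3) * hc
  have e : mn t 0 0 0 0 0 = 1 := by simp [mn]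
  rw [e] at e0
  simp only [numer, discr]
  linear_combination (- 1 + 10*y + 9*x - x*y - 15*x^2 - 10*x^2*y + 7*x^3) * e0
    + (-1) * (9 + 7*y - 15*x - 16*x*y + 10*x^2 - 13*x^3) * e1
    + (- 5 - 21*y + 12*x + 37*x*y - 19*x^2 - 11*x^2*y + 17*x^3) * e2
    + (-1) * (- 7 - 3*y + 8*x + 10*x*y + 13*x^2 - 11*x^2*y - 18*x^3) * e3
    + (2 + 4*y - 7*x + 5*x*y + 12*x^2 - 9*x^3) * e4
    + (-1) * (- 22 - 11*y + 22*x - 11*x^2) * e5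
    + (11) * (1 + 2*y + 2*x - 3*x*y - 5*x^2 + x^3) * e6
    + mn t 9 (-1) (-3) (-7) (-11) * h

theorem graded_numer_10 :
    numer t x y 10 - mn t (-1) 1 0 0 0 * numer t x y 7 + mn t 0 (-1) 0 1 0 * numer t x y 9
    - mn t 0 0 (-1) 0 1 * numer t x y 5 + mn t 0 0 1 (-1) 0 * numer t x y 6 - mn t 1 0 0 0 (-1) * numer t x y 1 =
      0 := by
  have e0 : mn t 0 0 0 0 0 * mn t 2 (-2) (-2) (-5) (-6) = mn t 13 (-1) (-3) (-8) (-14) * (x^1*y^1*u^1*z^1) := by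
    simp only [hx, hy, hu', hz', mn_pow, mn_mul h1 h2 h3 h4 h5]; norm_num [mn]
  have e1 : mn t (-1) 1 0 0 0 * mn t 3 (-3) (-2) (-5) (-6) = mn t 13 (-1) (-3) (-8) (-14) * (x^1*y^1*u^1*z^1) := by
    simp only [hx, hy, hu', hz', mn_pow, mn_mul h1 h2 h3 h4 h5]; norm_num [mn]
  have e2 : mn t 0 (-1) 0 1 0 * mn t 3 (-1) (-2) (-5) (-8) = mn t 13 (-1) (-3) (-8) (-14) * (x^2*u^1*z^1) := by
    simp only [hx, hu', hz', mn_pow, mn_mul h1 h2 h3 h4 h5]; norm_num [mn]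
  have e3 : mn t 0 0 (-1) 0 1 * mn t 2 (-1) (-3) (-5) (-6) = mn t 13 (-1) (-3) (-8) (-14) * (y^1*u^2*z^1) := by
    simp only [hy, hu', hz', mn_pow, mn_mul h1 h2 h3 h4 h5]; norm_num [mn]
  have e4 : mn t 0 0 1 (-1) 0 * mn t 3 (-2) (-2) (-6) (-6) = mn t 13 (-1) (-3) (-8) (-14) * (y^2*z^1) := by
    simp only [hy, hz', mn_pow, mn_mul h1 h2 h3 h4 h5]; norm_num [mn]
  have e5 : mn t 1 0 0 0 (-1) * mn t 3 (-3) (-3) (-5) (-5) = mn t 13 (-1) (-3) (-8) (-14) * (x^1*y^1*u^2) := by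
    simp only [hx, hy, hu', mn_pow, mn_mul h1 h2 h3 h4 h5]; norm_num [mn]
  have h : (x^1*y^1*u^1*z^1) * (8 + 16*y - 17*x - 13*x*y + 15*x^2 - 3*x^3)
      + (-1) * (x^1*y^1*u^1*z^1) * (- 4 + 14*y + 14*x - 21*x*y - 13*x^2 - 4*x^3)
      + (x^2*u^1*z^1) * (- 1 + 10*y + 9*x - x*y - 15*x^2 - 10*x^2*y + 7*x^3)
      + (-1) * (y^1*u^2*z^1) * (2 + 4*y - 7*x + 5*x*y + 12*x^2 - 9*x^3)
      + (y^2*z^1) * (9 + 7*y - 15*x - 16*x*y + 10*x^2 - 13*x^3)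
      + (-1) * (x^1*y^1*u^2) * (- 3 - 6*y + 5*x - 13*x*y - 18*x^2 - 3*x^3) = 0 := by
    rw [hu, hz]
    linear_combination (- 2*y + 7*y^2 + x + 9*x*y - 16*x*y^2 - 9*x^2 - 6*x^2*y + 15*x^3 - 10*x^3*y - 7*x^4) * hc
  have e : mn t 0 0 0 0 0 = 1 := by simp [mn]
  rw [e] at e0
  simp only [numer]
  linear_combination (8 + 16*y - 17*x - 13*x*y + 15*x^2 - 3*x^3) * e0
    + (-1) * (- 4 + 14*y + 14*x - 21*x*y - 13*x^2 - 4*x^3) * e1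
    + (- 1 + 10*y + 9*x - x*y - 15*x^2 - 10*x^2*y + 7*x^3) * e2
    + (-1) * (2 + 4*y - 7*x + 5*x*y + 12*x^2 - 9*x^3) * e3
    + (9 + 7*y - 15*x - 16*x*y + 10*x^2 - 13*x^3) * e4
    + (-1) * (- 3 - 6*y + 5*x - 13*x*y - 18*x^2 - 3*x^3) * e5
    + mn t 13 (-1) (-3) (-8) (-14) * h

end Graded

section Graded
variable {t : ℤ → ℂ} (h1 : t 1 ≠ 0) (h2 : t 2 ≠ 0) (h3 : t 3 ≠ 0) (h4 : t 4 ≠ 0) (h5 : t 5 ≠ 0)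
  {x y u z : ℂ} (hx : x = mn t (-2) (-1) 1 1 1) (hy : y = mn t (-3) (-1) 1 0 3)
  (hu' : u = mn t (-2) 0 (-1) 1 2) (hz' : z = mn t (-4) 1 0 1 2)
  (hu : u = x - 1) (hz : z = x + y) (hc : y ^ 2 + y = x ^ 3 - x ^ 2)
include h1 h2 h3 h4 h5 hx hy hu' hz' hu hz hc

/-- The discriminant of the curve, expressed in its theta coordinates. -/
theorem discr_eq {b2 b4 b6 b8 : ℂ} (r6 : b6 * t 1 ^ 8 = t 2 ^ 2) (r8 : b8 * t 1 ^ 9 = t 3)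
    (r4 : (b4 * b8 - b6 ^ 2) * (t 2 * t 1 ^ 12) = t 4) (r2 : 4 * b8 = b2 * b6 - b4 ^ 2) :
    -b2 ^ 2 * b8 - 8 * b4 ^ 3 - 27 * b6 ^ 2 + 9 * b2 * b4 * b6 = discr t x y := by
  have a6 : b6 = t 2 ^ 2 / t 1 ^ 8 := by field_simp; exact r6
  have a8 : b8 = t 3 / t 1 ^ 9 := by field_simp; exact r8
  have a4 : b4 = (t 4 / (t 2 * t 1 ^ 12) + b6 ^ 2) / b8 := by
    have : b8 ≠ 0 := by rw [a8]; positivity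
    field_simp; linear_combination r4
  have a2 : b2 = (4 * b8 + b4 ^ 2) / b6 := by
    have : b6 ≠ 0 := by rw [a6]; positivity
    field_simp; linear_combination -r2
  have d : -b2 ^ 2 * b8 - 8 * b4 ^ 3 - 27 * b6 ^ 2 + 9 * b2 * b4 * b6 = (-16) * mn t (-11) (-4) 3 0 0 + (-8) * mn t (-8) (-6) 0 2 0 + (20) * mn t (-12) (-1) 0 1 0 + (1) * mn t (-16) 4 0 0 0 + (-1) * mn t (-5) (-8) (-3) 4 0 + (-3) * mn t (-9) (-3) (-3) 3 0 + (-3) * mn t (-13) 2 (-3) 2 0 + (-1) * mn t (-17) 7 (-3) 1 0 := by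
    rw [a2, a4, a8, a6]
    simp only [mn, zpow_neg, zpow_zero, zpow_ofNat, zpow_one]
    field_simp
    ring
  have e0 : mn t (-11) (-4) 3 0 0 = mn t 21 (-2) (-2) (-9) (-20) * (x^4*y^2*u^1*z^4) := by
    simp only [hx, hy, hu', hz', mn_pow, mn_mul h1 h2 h3 h4 h5]; norm_num [mn]
  have e1 : mn t (-8) (-6) 0 2 0 = mn t 21 (-2) (-2) (-9) (-20) * (x^5*y^1*u^4*z^2) := by
    simp only [hx, hy, hu', hz', mn_pow, mn_mul h1 h2 h3 h4 h5]; norm_num [mn]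
  have e2 : mn t (-12) (-1) 0 1 0 = mn t 21 (-2) (-2) (-9) (-20) * (x^3*y^1*u^2*z^5) := by
    simp only [hx, hy, hu', hz', mn_pow, mn_mul h1 h2 h3 h4 h5]; norm_num [mn]
  have e3 : mn t (-16) 4 0 0 0 = mn t 21 (-2) (-2) (-9) (-20) * (x^1*y^1*z^8) := by
    simp only [hx, hy, hz', mn_pow, mn_mul h1 h2 h3 h4 h5]; norm_num [mn]
  have e4 : mn t (-5) (-8) (-3) 4 0 = mn t 21 (-2) (-2) (-9) (-20) * (x^6*u^7) := by
    simp only [hx, hu', mn_pow, mn_mul h1 h2 h3 h4 h5]; norm_num [mn]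
  have e5 : mn t (-9) (-3) (-3) 3 0 = mn t 21 (-2) (-2) (-9) (-20) * (x^4*u^5*z^3) := by
    simp only [hx, hu', hz', mn_pow, mn_mul h1 h2 h3 h4 h5]; norm_num [mn]
  have e6 : mn t (-13) 2 (-3) 2 0 = mn t 21 (-2) (-2) (-9) (-20) * (x^2*u^3*z^6) := by
    simp only [hx, hu', hz', mn_pow, mn_mul h1 h2 h3 h4 h5]; norm_num [mn]
  have e7 : mn t (-17) 7 (-3) 1 0 = mn t 21 (-2) (-2) (-9) (-20) * (u^1*z^9) := by
    simp only [hu', hz', mn_pow, mn_mul h1 h2 h3 h4 h5]; norm_num [mn]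
  have e8 : mn t 3 (-2) (-2) (-5) (-6) = mn t 21 (-2) (-2) (-9) (-20) * (y^2*u^2*z^2) := by
    simp only [hy, hu', hz', mn_pow, mn_mul h1 h2 h3 h4 h5]; norm_num [mn]
  have h : (-16) * (x^4*y^2*u^1*z^4) * (1)
      + (-8) * (x^5*y^1*u^4*z^2) * (1)
      + (20) * (x^3*y^1*u^2*z^5) * (1)
      + (x^1*y^1*z^8) * (1)
      + (-1) * (x^6*u^7) * (1)
      + (-3) * (x^4*u^5*z^3) * (1)
      + (-3) * (x^2*u^3*z^6) * (1)
      + (-1) * (u^1*z^9) * (1)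
      + (-1) * (y^2*u^2*z^2) * (1 + 2*y + 2*x - 3*x*y - 5*x^2 + x^3) = 0 := by
    rw [hu, hz]
    linear_combination (- y^3 - y^4 + y^5 - y^6 + y^7 - 2*x*y^2 - 2*x*y^3 + 9*x*y^4 - 9*x*y^5 + 9*x*y^6 - x^2*y + 23*x^2*y^3 - 32*x^2*y^4 + 36*x^2*y^5 - x^2*y^6 + 2*x^3*y + 22*x^3*y^2 - 61*x^3*y^3 + 92*x^3*y^4 - 7*x^3*y^5 + x^4 + 5*x^4*y - 61*x^4*y^2 + 160*x^4*y^3 - 33*x^4*y^4 - 3*x^5 - 23*x^5*y + 161*x^5*y^2 - 95*x^5*y^3 + 6*x^6 + 68*x^6*y - 125*x^6*y^2 + 11*x^6*y^3 - 7*x^7 - 61*x^7*y + 26*x^7*y^2 + 6*x^8 + 17*x^8*y - 3*x^9 + x^10) * hc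
  rw [discr]
  linear_combination (-16) * (1) * e0
    + (-8) * (1) * e1
    + (20) * (1) * e2
    + (1) * e3
    + (-1) * (1) * e4
    + (-3) * (1) * e5
    + (-3) * (1) * e6
    + (-1) * (1) * e7
    + (-1) * (1 + 2*y + 2*x - 3*x*y - 5*x^2 + x^3) * e8
    + mn t 21 (-2) (-2) (-9) (-20) * h + d

/-- The surviving graded piece, as a combination of reciprocals of theta monomials. -/
theorem numer_zero_eq : numer t x y 0 =
    11 * (-mn t (-4) (-2) (-3) (-2) (-2) + mn t (-3) (-2) (-2) (-4) (-2) - mn t (-2) (-4) (-2) (-2) (-3)) := by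

  have e0 : mn t 1 (-3) (-2) (-5) (-4) = mn t 4 (-2) (-3) (-5) (-7) * (y^1) := by
    simp only [hy, mn_pow, mn_mul h1 h2 h3 h4 h5]; norm_num [mn]
  have e1 : mn t (-4) (-2) (-3) (-2) (-2) = mn t 4 (-2) (-3) (-5) (-7) * (x^1*u^1*z^1) := by
    simp only [hx, hu', hz', mn_pow, mn_mul h1 h2 h3 h4 h5]; norm_num [mn]
  have e2 : mn t (-3) (-2) (-2) (-4) (-2) = mn t 4 (-2) (-3) (-5) (-7) * (y^1*z^1) := by
    simp only [hy, hz', mn_pow, mn_mul h1 h2 h3 h4 h5]; norm_num [mn]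
  have e3 : mn t (-2) (-4) (-2) (-2) (-3) = mn t 4 (-2) (-3) (-5) (-7) * (x^2*u^1) := by
    simp only [hx, hu', mn_pow, mn_mul h1 h2 h3 h4 h5]; norm_num [mn]
  have h : (y^1) * (- 22 - 11*y + 22*x - 11*x^2)
      + (11) * (x^1*u^1*z^1) * (1)
      + (-11) * (y^1*z^1) * (1)
      + (11) * (x^2*u^1) * (1) = 0 := by
    rw [hu, hz]
    linear_combination (- 22) * hc
  rw [numer]
  linear_combination (- 22 - 11*y + 22*x - 11*x^2) * e0
    + (11) * (1) * e1
    + (-11) * (1) * e2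
    + (11) * (1) * e3
    + mn t 4 (-2) (-3) (-5) (-7) * h

end Graded

/-- The relations between theta values on the `11`-torsion and the associated
logarithmic derivatives, with theta constant `D`. -/
structure ThetaData (θ L : ℤ → ℂ) (D : ℂ) : Prop where
  odd : ∀ n, θ (-n) = -θ n
  antiper : ∀ n, θ (n + 11) = -θ n
  ne : ∀ n, ¬ (11 : ℤ) ∣ n → θ n ≠ 0
  three_term : ∀ a b c d, θ (a + b) * θ (a - b) * (θ (c + d) * θ (c - d))
    - θ (a + c) * θ (a - c) * (θ (b + d) * θ (b - d)) + θ (a + d) * θ (a - d) * (θ (b + c) * θ (b - c)) = 0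
  log_odd : ∀ n, ¬ (11 : ℤ) ∣ n → L (-n) = -L n
  log_per : ∀ n, ¬ (11 : ℤ) ∣ n → L (n + 11) = L n
  four_point : ∀ a b c, ¬ (11 : ℤ) ∣ a → ¬ (11 : ℤ) ∣ b → ¬ (11 : ℤ) ∣ c → ¬ (11 : ℤ) ∣ a + b + c →
    (L a + L b + L c - L (a + b + c)) * (θ a * θ b * θ c * θ (a + b + c)) =
      -(D * (θ (a + b) * θ (a + c) * θ (b + c)))
  curve : ∀ n, ¬ (11 : ℤ) ∣ n → ∃ b2 b4 b6 b8 : ℂ,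
    b6 * θ n ^ 8 = θ (2 * n) ^ 2 ∧ b8 * θ n ^ 9 = θ (3 * n) ∧
    (b4 * b8 - b6 ^ 2) * (θ (2 * n) * θ n ^ 12) = θ (4 * n) ∧ 4 * b8 = b2 * b6 - b4 ^ 2 ∧
    D ^ 4 * (-b2 ^ 2 * b8 - 8 * b4 ^ 3 - 27 * b6 ^ 2 + 9 * b2 * b4 * b6) = 1

namespace ThetaData
variable {θ L : ℤ → ℂ} {D : ℂ} (h : ThetaData θ L D)
include h

theorem eleven_sub (n : ℤ) : θ (11 - n) = θ n := by
  rw [sub_eq_neg_add, h.antiper, h.odd, neg_neg]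

theorem log_eleven_sub (n : ℤ) (hn : ¬ (11 : ℤ) ∣ n) : L (11 - n) = -L n := by
  rw [sub_eq_neg_add, h.log_per _ (by omega), h.log_odd n hn]

theorem antiper_mul (g n : ℤ) (hg : Odd g) : θ (n + g * 11) = -θ n := by
  obtain ⟨k, rfl⟩ := hg
  have key : ∀ n, θ (n + k * 22) = θ n := by
    induction k with
    | zero => intro n; simp
    | succ k ih =>
      intro n
      rw [show n + ((k : ℤ) + 1) * 22 = (n + k * 22) + 11 + 11 by ring, h.antiper, h.antiper, neg_neg, ih]
    | pred k ih =>
      intro n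
      have := h.antiper (n + (-(k : ℤ) - 1) * 22)
      have h2 := h.antiper (n + (-(k : ℤ) - 1) * 22 + 11)
      rw [show n + (-(k : ℤ) - 1) * 22 + 11 + 11 = n + -(k : ℤ) * 22 by ring, ih] at h2
      rw [h2, this, neg_neg]
  rw [show n + (2 * k + 1) * 11 = n + 11 + k * 22 by ring, key, h.antiper]

theorem log_per_mul (g n : ℤ) (hn : ¬ (11 : ℤ) ∣ n) : L (n + g * 11) = L n := by
  induction g with
  | zero => simp
  | succ k ih => rw [show n + ((k : ℤ) + 1) * 11 = (n + k * 11) + 11 by ring, h.log_per _ (by omega), ih]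
  | pred k ih =>
    rw [← ih, ← h.log_per (n + (-(k : ℤ) - 1) * 11) (by omega)]
    congr 1; ring

theorem scale {g : ℤ} (hg : Odd g) (hg' : ¬ (11 : ℤ) ∣ g) :
    ThetaData (fun n => θ (g * n)) (fun n => L (g * n)) D := by
  have hp : Prime (11 : ℤ) := Int.prime_iff_natAbs_prime.mpr (by norm_num)
  have hn : ∀ n, ¬ (11 : ℤ) ∣ n → ¬ (11 : ℤ) ∣ g * n := fun n hn hd =>
    (hp.dvd_or_dvd hd).elim hg' hn
  refine ⟨fun n => ?_, fun n => ?_, fun n hn' => h.ne _ (hn n hn'), fun a b c d => ?_, fun n hn' => ?_, fun n hn' => ?_,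
    fun a b c ha hb hc hs => ?_, fun n hn' => ?_⟩
  · rw [mul_neg, h.odd]
  · rw [mul_add, h.antiper_mul _ _ hg]
  · simpa only [mul_add, mul_sub] using h.three_term (g * a) (g * b) (g * c) (g * d)
  · rw [mul_neg, h.log_odd _ (hn n hn')]
  · rw [mul_add, h.log_per_mul _ _ (hn n hn')]
  · have := h.four_point (g * a) (g * b) (g * c) (hn a ha) (hn b hb) (hn c hc)
      (by simpa only [mul_add] using hn _ hs)
    simpa only [mul_add] using this
  · obtain ⟨b2, b4, b6, b8, H⟩ := h.curve (g * n) (hn n hn')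
    refine ⟨b2, b4, b6, b8, ?_⟩
    rw [show g * (2 * n) = 2 * (g * n) by ring, show g * (3 * n) = 3 * (g * n) by ring,
      show g * (4 * n) = 4 * (g * n) by ring]
    exact H

end ThetaData

/-- The abscissa of the torsion point. -/
noncomputable def absc (t : ℤ → ℂ) : ℂ := mn t (-2) (-1) 1 1 1
/-- The ordinate of the torsion point. -/
noncomputable def ordi (t : ℤ → ℂ) : ℂ := mn t (-3) (-1) 1 0 3

namespace ThetaData
variable {θ L : ℤ → ℂ} {D : ℂ} (h : ThetaData θ L D)
include h

theorem theta_values : θ 6 = θ 5 ∧ θ 7 = θ 4 ∧ θ 8 = θ 3 ∧ θ 9 = θ 2 := by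
  refine ⟨?_, ?_, ?_, ?_⟩
  · simpa using h.eleven_sub 5
  · simpa using h.eleven_sub 4
  · simpa using h.eleven_sub 3
  · simpa using h.eleven_sub 2

theorem ne_values : θ 1 ≠ 0 ∧ θ 2 ≠ 0 ∧ θ 3 ≠ 0 ∧ θ 4 ≠ 0 ∧ θ 5 ≠ 0 :=
  ⟨h.ne _ (by norm_num), h.ne _ (by norm_num), h.ne _ (by norm_num), h.ne _ (by norm_num), h.ne _ (by norm_num)⟩

theorem absc_sub_one : mn θ (-2) 0 (-1) 1 2 = absc θ - 1 := by
  obtain ⟨h1, h2, h3, h4, h5⟩ := h.ne_values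
  obtain ⟨e6, e7, e8, e9⟩ := h.theta_values
  have r := h.three_term 5 3 1 0
  norm_num [e6, e7, e8, e9] at r
  simp only [absc, mn, zpow_neg, zpow_zero, zpow_ofNat, zpow_one]
  field_simp
  linear_combination r

theorem absc_add_ordi : mn θ (-4) 1 0 1 2 = absc θ + ordi θ := by
  obtain ⟨h1, h2, h3, h4, h5⟩ := h.ne_values
  obtain ⟨e6, e7, e8, e9⟩ := h.theta_values
  have r := h.three_term 5 2 1 0
  norm_num [e6, e7, e8, e9] at r
  simp only [absc, ordi, mn, zpow_neg, zpow_zero, zpow_ofNat, zpow_one]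
  field_simp
  linear_combination -r

theorem ordi_add_one : mn θ (-3) (-1) 0 3 1 = ordi θ + 1 := by
  obtain ⟨h1, h2, h3, h4, h5⟩ := h.ne_values
  obtain ⟨e6, e7, e8, e9⟩ := h.theta_values
  have r := h.three_term 5 4 1 0
  norm_num [e6, e7, e8, e9] at r
  simp only [ordi, mn, zpow_neg, zpow_zero, zpow_ofNat, zpow_one]
  field_simp
  linear_combination -r

theorem on_curve : ordi θ ^ 2 + ordi θ = absc θ ^ 3 - absc θ ^ 2 := by
  obtain ⟨h1, h2, h3, h4, h5⟩ := h.ne_values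
  have e : ordi θ * mn θ (-3) (-1) 0 3 1 = absc θ ^ 2 * mn θ (-2) 0 (-1) 1 2 := by
    rw [absc, ordi, mn_pow, mn_mul h1 h2 h3 h4 h5, mn_mul h1 h2 h3 h4 h5]; norm_num
  rw [h.ordi_add_one, h.absc_sub_one] at e
  linear_combination e

theorem discr_eq_one : D ^ 4 * discr θ (absc θ) (ordi θ) = 1 := by
  obtain ⟨h1, h2, h3, h4, h5⟩ := h.ne_values
  obtain ⟨b2, b4, b6, b8, r6, r8, r4, r2, hd⟩ := h.curve 1 (by norm_num)
  norm_num at r6 r8 r4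
  rw [← discr_eq h1 h2 h3 h4 h5 (x := absc θ) (y := ordi θ) rfl rfl rfl rfl h.absc_sub_one h.absc_add_ordi h.on_curve r6 r8
    r4 r2]
  exact hd

theorem log_sum (hD : D ≠ 0) : 11 * (L 1 + L 2) = -(D * (2 * mn θ (-3) 3 (-1) 0 0 + 2 * mn θ (-2) 1 (-1) 2 (-1)
    + mn θ (-1) (-2) 2 1 (-1) + 3 * mn θ 0 (-3) 0 3 (-1))) := by
  obtain ⟨h1, h2, h3, h4, h5⟩ := h.ne_values
  obtain ⟨e6, e7, e8, e9⟩ := h.theta_values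
  have f1 := h.four_point 1 1 1 (by norm_num) (by norm_num) (by norm_num) (by norm_num)
  have f2 := h.four_point 1 1 3 (by norm_num) (by norm_num) (by norm_num) (by norm_num)
  have f3 := h.four_point 1 2 2 (by norm_num) (by norm_num) (by norm_num) (by norm_num)
  have f4 := h.four_point 2 2 2 (by norm_num) (by norm_num) (by norm_num) (by norm_num)
  have l6 := h.log_eleven_sub 5 (by norm_num)
  norm_num at f1 f2 f3 f4 l6
  rw [l6, e6] at f4
  have g1 : L 1 + L 1 + L 1 - L 3 = -(D * mn θ (-3) 3 (-1) 0 0) := by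
    simp only [mn, zpow_neg, zpow_zero, zpow_ofNat, zpow_one]; field_simp; linear_combination f1
  have g2 : L 1 + L 1 + L 3 - L 5 = -(D * mn θ (-2) 1 (-1) 2 (-1)) := by
    simp only [mn, zpow_neg, zpow_zero, zpow_ofNat, zpow_one]; field_simp; linear_combination f2
  have g3 : L 1 + L 2 + L 2 - L 5 = -(D * mn θ (-1) (-2) 2 1 (-1)) := by
    simp only [mn, zpow_neg, zpow_zero, zpow_ofNat, zpow_one]; field_simp; linear_combination f3
  have g4 : L 2 + L 2 + L 2 - -L 5 = -(D * mn θ 0 (-3) 0 3 (-1)) := by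
    simp only [mn, zpow_neg, zpow_zero, zpow_ofNat, zpow_one]; field_simp; linear_combination f4
  linear_combination 2 * g1 + 2 * g2 + g3 + 3 * g4

/-- The quotient of the completed sum by the signed theta sum is the sum of the graded pieces. -/
theorem sum_numer (hD : D ≠ 0) :
    (1 - mn θ (-1) 1 0 0 0 + mn θ 0 (-1) 0 1 0 - mn θ 0 0 (-1) 0 1 + mn θ 0 0 1 (-1) 0 - mn θ 1 0 0 0 (-1)) *
      (D ^ 5 * ∑ c ∈ Finset.range 11, numer θ (absc θ) (ordi θ) c) =
    11 * (-(L 1 + L 2) + D * (-mn θ (-2) 1 (-1) 1 0 + mn θ (-1) (-1) 1 (-1) 1 - mn θ (-1) 0 0 1 (-1)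
      + mn θ 0 0 0 (-1) 0)) := by
  obtain ⟨h1, h2, h3, h4, h5⟩ := h.ne_values
  have hu := h.absc_sub_one
  have hz := h.absc_add_ordi
  have hc := h.on_curve
  have q0 := graded_numer_0 h1 h2 h3 h4 h5 (x := absc θ) (y := ordi θ) rfl rfl rfl rfl hu hz hc
  have q1 := graded_numer_1 h1 h2 h3 h4 h5 (x := absc θ) (y := ordi θ) rfl rfl rfl rfl hu hz hc
  have q2 := graded_numer_2 h1 h2 h3 h4 h5 (x := absc θ) (y := ordi θ) rfl rfl rfl rfl hu hz hc
  have q3 := graded_numer_3 h1 h2 h3 h4 h5 (x := absc θ) (y := ordi θ) rfl rfl rfl rfl hu hz hc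
  have q4 := graded_numer_4 h1 h2 h3 h4 h5 (x := absc θ) (y := ordi θ) rfl rfl rfl rfl hu hz hc
  have q5 := graded_numer_5 h1 h2 h3 h4 h5 (x := absc θ) (y := ordi θ) rfl rfl rfl rfl hu hz hc
  have q6 := graded_numer_6 h1 h2 h3 h4 h5 (x := absc θ) (y := ordi θ) rfl rfl rfl rfl hu hz hc
  have q7 := graded_numer_7 h1 h2 h3 h4 h5 (x := absc θ) (y := ordi θ) rfl rfl rfl rfl hu hz hc
  have q8 := graded_numer_8 h1 h2 h3 h4 h5 (x := absc θ) (y := ordi θ) rfl rfl rfl rfl hu hz hc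
  have q9 := graded_numer_9 h1 h2 h3 h4 h5 (x := absc θ) (y := ordi θ) rfl rfl rfl rfl hu hz hc
  have q10 := graded_numer_10 h1 h2 h3 h4 h5 (x := absc θ) (y := ordi θ) rfl rfl rfl rfl hu hz hc
  have hl := h.log_sum hD
  have hd := h.discr_eq_one
  simp only [Finset.sum_range_succ, Finset.sum_range_zero]
  linear_combination D ^ 5 * (q0 + q1 + q2 + q3 + q4 + q5 + q6 + q7 + q8 + q9 + q10) + hl
    + D * hd * (2 * mn θ (-3) 3 (-1) 0 0 + 2 * mn θ (-2) 1 (-1) 2 (-1) + mn θ (-1) (-2) 2 1 (-1)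
      + 3 * mn θ 0 (-3) 0 3 (-1) + 11 * (-mn θ (-2) 1 (-1) 1 0 + mn θ (-1) (-1) 1 (-1) 1 - mn θ (-1) 0 0 1 (-1)
      + mn θ 0 0 0 (-1) 0))

theorem numer_zero : numer θ (absc θ) (ordi θ) 0 =
    11 * (-mn θ (-4) (-2) (-3) (-2) (-2) + mn θ (-3) (-2) (-2) (-4) (-2) - mn θ (-2) (-4) (-2) (-2) (-3)) := by
  obtain ⟨h1, h2, h3, h4, h5⟩ := h.ne_values
  exact numer_zero_eq h1 h2 h3 h4 h5 (x := absc θ) (y := ordi θ) rfl rfl rfl rfl h.absc_sub_one h.absc_add_ordi h.on_curve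

end ThetaData

section Twist
variable {t s : ℤ → ℂ} {w : ℂ} (hw : w ^ 11 = 1) (e1 : s 1 = w * t 1) (e2 : s 2 = w ^ 4 * t 2)
  (e3 : s 3 = w ^ 9 * t 3) (e4 : s 4 = w ^ 16 * t 4) (e5 : s 5 = w ^ 25 * t 5)
include hw e1 e2 e3 e4 e5

theorem mn_twist (a b c d e : ℤ) : mn s a b c d e = w ^ (a + 4 * b + 9 * c + 16 * d + 25 * e) * mn t a b c d e := by
  have hw0 : w ≠ 0 := by rintro rfl; norm_num at hw
  simp only [mn, e1, e2, e3, e4, e5, mul_zpow, zpow_add₀ hw0, zpow_mul, ← zpow_natCast w]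
  push_cast
  ring

theorem mn_twist_of_eq {a b c d e : ℤ} (k : ℤ) (r : ℕ) (hk : a + 4 * b + 9 * c + 16 * d + 25 * e = 11 * k + r) :
    mn s a b c d e = w ^ r * mn t a b c d e := by
  have hw0 : w ≠ 0 := by rintro rfl; norm_num at hw
  rw [mn_twist hw e1 e2 e3 e4 e5, hk, zpow_add₀ hw0, zpow_mul, show w ^ (11 : ℤ) = 1 from hw, one_zpow, one_mul,
    zpow_natCast]

theorem numer_twist {c : ℕ} (hc : c < 11) : numer s (absc s) (ordi s) c = w ^ c * numer t (absc t) (ordi t) c := by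
  have H := @mn_twist_of_eq t s w hw e1 e2 e3 e4 e5
  have ex : absc s = absc t := by rw [absc, H 4 0 (by norm_num), absc]; simp
  have ey : ordi s = ordi t := by rw [ordi, H 7 0 (by norm_num), ordi]; simp
  rw [ex, ey]
  interval_cases c
  · rw [numer, numer, H (-19) 0 (by norm_num)]; ring
  · rw [numer, numer, H (-22) 1 (by norm_num)]; ring
  · rw [numer, numer, H (-24) 2 (by norm_num)]; ring
  · rw [numer, numer, H (-26) 3 (by norm_num)]; ring
  · rw [numer, numer, H (-27) 4 (by norm_num)]; ring
  · rw [numer, numer, H (-24) 5 (by norm_num)]; ring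
  · rw [numer, numer, H (-25) 6 (by norm_num)]; ring
  · rw [numer, numer, H (-24) 7 (by norm_num)]; ring
  · rw [numer, numer, H (-26) 8 (by norm_num)]; ring
  · rw [numer, numer, H (-28) 9 (by norm_num)]; ring
  · rw [numer, numer, H (-24) 10 (by norm_num)]; ring

end Twist

section

/-- The triangular numbers `n (n - 1) / 2`, for integral `n`. -/
@[irreducible] def tri (n : ℤ) : ℤ := n * (n - 1) / 2

theorem two_tri (n : ℤ) : 2 * tri n = n * (n - 1) := by
  rw [tri]
  exact Int.mul_ediv_cancel' ((Int.even_mul_pred_self n).two_dvd)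

theorem tri_add (m n : ℤ) : tri (m + n) = tri m + tri n + m * n := by
  have h1 := two_tri (m + n)
  have h2 := two_tri m
  have h3 := two_tri n
  nlinarith

theorem tri_neg (n : ℤ) : tri (-n) = tri n + n := by
  have h1 := two_tri (-n)
  have h2 := two_tri n
  nlinarith

theorem tri_succ (n : ℤ) : tri (n + 1) = tri n + n := by
  have h1 := two_tri (n + 1)
  have h2 := two_tri n
  nlinarith

theorem tri_zero : tri 0 = 0 := by simp [tri]

theorem tri_one : tri 1 = 0 := by simp [tri]

theorem summable_nat_tri {r : ℝ} (hr : 0 < r) (hr1 : r < 1) {c : ℝ} (hc : 0 < c) :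
    Summable fun n : ℕ => r ^ tri (n : ℤ) * c ^ (n : ℤ) := by
  have hpos : ∀ n : ℕ, 0 < r ^ tri (n : ℤ) * c ^ (n : ℤ) := fun n =>
    mul_pos (zpow_pos hr _) (zpow_pos hc _)
  have h : Filter.Tendsto (fun n : ℕ => c * r ^ n) Filter.atTop (nhds (c * 0)) :=
    (tendsto_pow_atTop_nhds_zero_of_lt_one hr.le hr1).const_mul c
  rw [mul_zero] at h
  refine summable_of_ratio_test_tendsto_lt_one (l := 0) one_pos
    (Filter.Eventually.of_forall fun n => (hpos n).ne') (h.congr fun n => ?_)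
  rw [Real.norm_of_nonneg (hpos n).le, Real.norm_of_nonneg (hpos (n + 1)).le,
    eq_div_iff (hpos n).ne', Nat.cast_add, Nat.cast_one, tri_succ, zpow_add₀ hr.ne',
    zpow_add₀ hc.ne', zpow_one, zpow_natCast r n]
  ring

theorem summable_tri {r c : ℝ} (hr : 0 < r) (hr1 : r < 1) (hc : 0 < c) :
    Summable fun n : ℤ => r ^ tri n * c ^ n := by
  refine Summable.of_nat_of_neg (summable_nat_tri hr hr1 hc)
    ((summable_nat_tri hr hr1 (div_pos hr hc)).congr fun n => ?_)
  rw [tri_neg, zpow_add₀ hr.ne', div_zpow, zpow_neg, div_eq_mul_inv]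
  ring

variable {Q : ℂ}

theorem summable_norm_tri (h0 : Q ≠ 0) (h1 : ‖Q‖ < 1) {k : ℕ} (hk : k ≠ 0) (w : ℂ) (hw : w ≠ 0) :
    Summable fun n : ℤ => ‖Q ^ (k * tri n) * w ^ n‖ := by
  have hq : 0 < ‖Q‖ := norm_pos_iff.mpr h0
  refine (summable_tri (r := ‖Q‖ ^ k) (c := ‖w‖) (by positivity)
    (pow_lt_one₀ hq.le h1 hk) (norm_pos_iff.mpr hw)).congr fun n => ?_
  rw [norm_mul, norm_zpow, norm_zpow, zpow_mul, zpow_natCast]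

/-- A uniform bound away from the poles. -/
theorem exists_inv_bound (h0 : Q ≠ 0) (h1 : ‖Q‖ < 1) {x : ℂ} (hx0 : x ≠ 0)
    (hx : ∀ n : ℤ, x * Q ^ n ≠ 1) : ∃ C : ℝ, 0 < C ∧ ∀ n : ℤ, ‖(1 - x * Q ^ n)⁻¹‖ ≤ C := by
  have hq : 0 < ‖Q‖ := norm_pos_iff.mpr h0
  have lim : ∀ z : ℂ, Filter.Tendsto (fun n : ℕ => z * Q ^ n) Filter.atTop (nhds 0) := by
    intro z
    have := (tendsto_pow_atTop_nhds_zero_of_norm_lt_one h1).const_mul z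
    rwa [mul_zero] at this
  have nz : ∀ n : ℤ, 1 - x * Q ^ n ≠ 0 := fun n h => hx n (sub_eq_zero.mp h).symm
  have b1 : BddAbove (Set.range fun n : ℕ => ‖(1 - x * Q ^ (n : ℤ))⁻¹‖) := by
    have : Filter.Tendsto (fun n : ℕ => ‖(1 - x * Q ^ (n : ℤ))⁻¹‖) Filter.atTop (nhds ‖(1 - 0 : ℂ)⁻¹‖) := by
      refine (((lim x).const_sub 1).inv₀ (by simp)).norm.congr fun n => by simp
    exact this.bddAbove_range
  have b2 : BddAbove (Set.range fun n : ℕ => ‖(1 - x * Q ^ (-(n : ℤ)))⁻¹‖) := by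
    have : Filter.Tendsto (fun n : ℕ => ‖(1 - x * Q ^ (-(n : ℤ)))⁻¹‖) Filter.atTop
        (nhds ‖(0 : ℂ) * (0 - 1)⁻¹‖) := by
      have h := ((lim x⁻¹).mul (((lim x⁻¹).sub_const 1).inv₀ (by simp))).norm
      refine h.congr fun n => ?_
      congr 1
      have e1 := nz (-n)
      rw [zpow_neg, zpow_natCast] at e1 ⊢
      have hQn : Q ^ n ≠ 0 := pow_ne_zero _ h0
      have e2 : x⁻¹ * Q ^ n - 1 ≠ 0 := by
        intro h
        apply e1
        field_simp at h ⊢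
        linear_combination h
      field_simp
    exact this.bddAbove_range
  obtain ⟨C1, hC1⟩ := b1
  obtain ⟨C2, hC2⟩ := b2
  refine ⟨max 1 (max C1 C2), by positivity, fun n => ?_⟩
  rcases Int.eq_nat_or_neg n with ⟨m, rfl | rfl⟩
  · exact (hC1 ⟨m, rfl⟩).trans ((le_max_left _ _).trans (le_max_right _ _))
  · exact (hC2 ⟨m, rfl⟩).trans ((le_max_right _ _).trans (le_max_right _ _))

/-- The theta series with nome `Q`. -/
noncomputable def jt (Q x : ℂ) : ℂ := ∑' n : ℤ, (-1) ^ n * Q ^ tri n * x ^ n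

theorem norm_neg_one_zpow (n : ℤ) : ‖(-1 : ℂ) ^ n‖ = 1 := by simp

theorem summable_jt (h0 : Q ≠ 0) (h1 : ‖Q‖ < 1) {x : ℂ} (hx : x ≠ 0) :
    Summable fun n : ℤ => (-1) ^ n * Q ^ tri n * x ^ n := by
  apply Summable.of_norm
  refine (summable_norm_tri h0 h1 one_ne_zero x hx).congr fun n => ?_
  simp

theorem neg_one_zpow_mul_self (n : ℤ) : (-1 : ℂ) ^ n * (-1) ^ n = 1 := by
  rw [← mul_zpow]; simp

theorem neg_one_zpow_neg (n : ℤ) : (-1 : ℂ) ^ (-n) = (-1) ^ n := by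
  rw [zpow_neg, inv_eq_of_mul_eq_one_left (neg_one_zpow_mul_self n)]

theorem jt_mul_zpow (h0 : Q ≠ 0) {x : ℂ} (hx : x ≠ 0) (m : ℤ) :
    jt Q (x * Q ^ m) = (-1) ^ m * Q ^ (-tri m) * x ^ (-m) * jt Q x := by
  unfold jt
  rw [← (Equiv.addRight m).tsum_eq (fun n : ℤ => (-1) ^ n * Q ^ tri n * x ^ n), ← tsum_mul_left]
  refine tsum_congr fun n => ?_
  simp only [Equiv.coe_addRight]
  have e : Q ^ tri (n + m) = Q ^ tri n * Q ^ tri m * Q ^ (m * n) := by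
    rw [tri_add, zpow_add₀ h0, zpow_add₀ h0, mul_comm n m]
  rw [e, mul_zpow, ← zpow_mul, zpow_add₀ (by norm_num : (-1 : ℂ) ≠ 0), zpow_add₀ hx, zpow_neg, zpow_neg]
  have : Q ^ tri m ≠ 0 := zpow_ne_zero _ h0
  have : x ^ m ≠ 0 := zpow_ne_zero _ hx
  field_simp
  linear_combination -neg_one_zpow_mul_self m

theorem jt_inv (h0 : Q ≠ 0) {x : ℂ} (hx : x ≠ 0) : jt Q x⁻¹ = -x⁻¹ * jt Q x := by
  have h : jt Q (x⁻¹ * Q) = jt Q x := by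
    unfold jt
    rw [← (Equiv.neg ℤ).tsum_eq (fun n : ℤ => (-1) ^ n * Q ^ tri n * x ^ n)]
    refine tsum_congr fun n => ?_
    simp only [Equiv.neg_apply, neg_one_zpow_neg, tri_neg, zpow_add₀ h0, mul_zpow, inv_zpow']
    ring
  have h2 := jt_mul_zpow h0 (inv_ne_zero hx) 1
  rw [zpow_one, h] at h2
  rw [h2]
  simp [tri_one]
  field_simp

theorem jt_one (h0 : Q ≠ 0) : jt Q 1 = 0 := by
  have := jt_inv h0 (x := 1) one_ne_zero
  simp only [inv_one] at this
  linear_combination this / 2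

theorem jt_zpow (h0 : Q ≠ 0) (m : ℤ) : jt Q (Q ^ m) = 0 := by
  have := jt_mul_zpow h0 one_ne_zero m
  rw [one_mul, jt_one h0, mul_zero] at this
  exact this

theorem differentiableAt_jt (h0 : Q ≠ 0) (h1 : ‖Q‖ < 1) {x : ℂ} (hx : x ≠ 0) :
    DifferentiableAt ℂ (jt Q) x := by
  have hx' : 0 < ‖x‖ := norm_pos_iff.mpr hx
  let s : Set ℂ := {z | ‖x‖ / 2 < ‖z‖ ∧ ‖z‖ < 2 * ‖x‖}
  have hs : IsOpen s := (isOpen_lt continuous_const continuous_norm).inter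
    (isOpen_lt continuous_norm continuous_const)
  have hxs : x ∈ s := ⟨by linarith, by linarith⟩
  have hq : 0 < ‖Q‖ := norm_pos_iff.mpr h0
  have hsum : Summable fun n : ℤ =>
      ‖Q‖ ^ tri n * (2 * ‖x‖) ^ n + ‖Q‖ ^ tri n * (‖x‖ / 2) ^ n :=
    (summable_tri hq h1 (by positivity)).add (summable_tri hq h1 (by positivity))
  refine (Complex.differentiableOn_tsum_of_summable_norm hsum ?_ hs ?_).differentiableAt (hs.mem_nhds hxs)
  · intro n z hz
    have : z ≠ 0 := norm_pos_iff.mp (lt_trans (by positivity) hz.1)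
    exact (((differentiableAt_zpow (m := n)).mpr (Or.inl this)).const_mul _).differentiableWithinAt
  · intro n z hz
    rw [norm_mul, norm_mul, norm_neg_one_zpow, one_mul, norm_zpow, norm_zpow, ← mul_add]
    apply mul_le_mul_of_nonneg_left _ (by positivity)
    rcases le_or_gt 0 n with hn | hn
    · have := zpow_le_zpow_left₀ hn (norm_nonneg z) hz.2.le
      have : 0 < (‖x‖ / 2) ^ n := by positivity
      linarith
    · have h3 := zpow_le_zpow_left₀ (n := -n) (by lia) (by positivity) hz.1.le
      rw [zpow_neg, zpow_neg, inv_le_inv₀ (by positivity) (zpow_pos (lt_trans (by positivity) hz.1) _)] at h3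
      have : 0 < (2 * ‖x‖) ^ n := by positivity
      linarith

end

section

open Filter Topology Finset

section

variable {Q : ℂ}

/-- Gaussian binomial coefficients. -/
noncomputable def gb (Q : ℂ) : ℕ → ℕ → ℂ
  | _, 0 => 1
  | 0, _ + 1 => 0
  | M + 1, k + 1 => gb Q M k + Q ^ (k + 1) * gb Q M (k + 1)

/-- Finite `q`-Pochhammer symbols. -/
noncomputable def qp (Q z : ℂ) (n : ℕ) : ℂ := ∏ i ∈ range n, (1 - z * Q ^ i)

theorem gb_succ_succ (M k : ℕ) : gb Q (M + 1) (k + 1) = gb Q M k + Q ^ (k + 1) * gb Q M (k + 1) := by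
  rw [gb]

theorem gb_zero_right (M : ℕ) : gb Q M 0 = 1 := by cases M <;> simp [gb]

theorem gb_eq_zero (M : ℕ) : ∀ k, M < k → gb Q M k = 0 := by
  induction M with
  | zero => intro k hk; cases k with
    | zero => lia
    | succ k => simp [gb]
  | succ M ih => intro k hk; cases k with
    | zero => lia
    | succ k => rw [gb, ih k (by lia), ih (k + 1) (by lia)]; simp

theorem gb_succ_succ' (h0 : Q ≠ 0) (M : ℕ) : ∀ k,
    gb Q (M + 1) (k + 1) = gb Q M (k + 1) + Q ^ ((M : ℤ) - k) * gb Q M k := by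
  induction M with
  | zero => intro k; cases k with
    | zero => simp [gb]
    | succ k => simp [gb]
  | succ M ih =>
    intro k
    cases k with
    | zero =>
      have h := ih 0
      have h' := gb_succ_succ (Q := Q) M 0
      rw [gb_zero_right] at h h'
      rw [gb_succ_succ, gb_zero_right]
      have e2 : Q ^ ((M : ℤ) + 1) = Q ^ (M : ℤ) * Q := by rw [zpow_add₀ h0, zpow_one]
      push_cast at h ⊢
      simp only [sub_zero] at h ⊢
      rw [e2]
      linear_combination Q * h - h'
    | succ k =>
      rw [gb_succ_succ (M + 1) (k + 1)]
      have e1 : Q ^ ((M : ℤ) - k) = Q ^ ((M : ℤ) - (k + 1 : ℕ)) * Q := by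
        rw [← zpow_add_one₀ h0]; congr 1; push_cast; ring
      have e2 : Q ^ (((M + 1 : ℕ) : ℤ) - (k + 1 : ℕ)) = Q ^ ((M : ℤ) - (k + 1 : ℕ)) * Q := by
        rw [← zpow_add_one₀ h0]; congr 1; push_cast; ring
      have h := gb_succ_succ (Q := Q) M (k + 1)
      have h' := gb_succ_succ (Q := Q) M k
      have i1 := ih (k + 1)
      have i2 := ih k
      rw [e1] at i2
      rw [e2]
      linear_combination Q ^ (k + 1 + 1) * i1 - h - Q ^ ((M : ℤ) - (k + 1 : ℕ)) * Q * h' + i2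

theorem qp_succ (z : ℂ) (n : ℕ) : qp Q z (n + 1) = qp Q z n * (1 - z * Q ^ n) := by
  rw [qp, prod_range_succ, qp]

theorem qp_succ' (z : ℂ) (n : ℕ) : qp Q z (n + 1) = (1 - z) * qp Q (z * Q) n := by
  rw [qp, prod_range_succ', qp, pow_zero, mul_one, mul_comm]
  congr 1
  refine prod_congr rfl fun i _ => ?_
  rw [pow_succ]; ring

theorem gb_mul_qp (a b : ℕ) : gb Q (a + b) a * (qp Q Q a * qp Q Q b) = qp Q Q (a + b) := by
  induction a generalizing b with
  | zero => simp [gb_zero_right, qp]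
  | succ a ih =>
    induction b with
    | zero =>
      have h := ih 0
      rw [add_zero] at h ⊢
      rw [gb, gb_eq_zero a (a + 1) (by lia), qp_succ]
      linear_combination (1 - Q * Q ^ a) * h
    | succ b ihb =>
      have h := ih (b + 1)
      rw [show a + 1 + (b + 1) = (a + (b + 1)) + 1 by ring, gb, qp_succ Q (a + (b + 1)),
        qp_succ Q a, qp_succ Q b, ← h, qp_succ Q b]
      rw [show a + 1 + b = a + (b + 1) by ring] at ihb
      rw [← h, qp_succ Q a, qp_succ Q b] at ihb
      rw [pow_add]
      linear_combination Q ^ (a + 1) * (1 - Q * Q ^ b) * ihb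

theorem sum_gb (z : ℂ) (M : ℕ) :
    ∑ k ∈ range (M + 1), gb Q M k * ((-1) ^ k * Q ^ (k.choose 2) * z ^ k) = qp Q z M := by
  induction M generalizing z with
  | zero => simp [gb, qp]
  | succ M ih =>
    rw [sum_range_succ', qp_succ', ← ih]
    have e : ∀ k, gb Q (M + 1) (k + 1) * ((-1) ^ (k + 1) * Q ^ ((k + 1).choose 2) * z ^ (k + 1)) =
        -z * (gb Q M k * ((-1) ^ k * Q ^ (k.choose 2) * (z * Q) ^ k)) +
        gb Q M (k + 1) * ((-1) ^ (k + 1) * Q ^ ((k + 1).choose 2) * (z * Q) ^ (k + 1)) := by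
      intro k
      rw [gb, Nat.choose_succ_succ' k 1, Nat.choose_one_right, pow_add Q k]
      ring
    rw [sum_congr rfl fun k _ => e k, sum_add_distrib, ← mul_sum]
    have h2 := sum_range_succ' (fun k => gb Q M k * ((-1) ^ k * Q ^ (k.choose 2) * (z * Q) ^ k)) (M + 1)
    rw [sum_range_succ, gb_eq_zero M (M + 1) (by lia), zero_mul, add_zero] at h2
    rw [gb_zero_right] at h2 ⊢
    simp only [Nat.choose_zero_succ, pow_zero, mul_one] at h2 ⊢
    linear_combination -h2

theorem sum_gb_div (h0 : Q ≠ 0) (M : ℕ) : ∀ (N : ℕ) (z : ℂ), N ≤ M → (∀ k : ℕ, 1 - z * Q ^ k ≠ 0) →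
    ∑ k ∈ range (M + 1), gb Q M k * ((-1) ^ k * Q ^ (tri k + k - N * k) / (1 - z * Q ^ k)) =
      z ^ N * qp Q Q M / qp Q z (M + 1) := by
  induction M with
  | zero =>
    intro N z hN hz
    obtain rfl : N = 0 := by lia
    simp [gb, qp, tri_zero]
  | succ M ih =>
    intro N z hN hz
    have hz' : ∀ k : ℕ, 1 - z * Q * Q ^ k ≠ 0 := fun k => by
      have := hz (k + 1); rwa [pow_succ', ← mul_assoc] at this
    have hqp : ∀ z : ℂ, (∀ k : ℕ, 1 - z * Q ^ k ≠ 0) → qp Q z (M + 1) ≠ 0 := fun z hz =>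
      prod_ne_zero_iff.mpr fun i _ => hz i
    have n1 := hqp z hz
    have n2 := hqp (z * Q) hz'
    have n3 := hz (M + 1)
    have n4 := hz 0
    rw [pow_zero, mul_one] at n4
    have r1 : ∀ c : ℂ, c / qp Q z (M + 1) = c * (1 - z * Q ^ (M + 1)) / qp Q z (M + 1 + 1) := by
      intro c; rw [qp_succ z (M + 1), mul_div_mul_right _ _ n3]
    have r2 : ∀ c : ℂ, c / qp Q (z * Q) (M + 1) = c * (1 - z) / qp Q z (M + 1 + 1) := by
      intro c; rw [qp_succ' z (M + 1), mul_comm (1 - z), mul_div_mul_right _ _ n4]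
    rcases Nat.lt_or_ge N (M + 1) with hlt | hge
    · have e : ∀ k : ℕ, gb Q (M + 1) (k + 1) * ((-1) ^ (k + 1) *
          Q ^ (tri (k + 1 : ℕ) + (k + 1 : ℕ) - N * (k + 1 : ℕ)) / (1 - z * Q ^ (k + 1))) =
          gb Q M (k + 1) * ((-1) ^ (k + 1) *
            Q ^ (tri (k + 1 : ℕ) + (k + 1 : ℕ) - N * (k + 1 : ℕ)) / (1 - z * Q ^ (k + 1)))
          - Q ^ ((M : ℤ) + 1 - N) *
            (gb Q M k * ((-1) ^ k * Q ^ (tri k + k - N * k) / (1 - z * Q * Q ^ k))) := by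
        intro k
        have e3 : Q ^ (tri (k + 1 : ℕ) + (k + 1 : ℕ) - N * (k + 1 : ℕ)) * Q ^ ((M : ℤ) - k) =
            Q ^ ((M : ℤ) + 1 - N) * Q ^ (tri k + k - N * k) := by
          rw [← zpow_add₀ h0, ← zpow_add₀ h0]
          congr 1
          push_cast
          rw [tri_succ]
          ring
        have e4 : z * Q * Q ^ k = z * Q ^ (k + 1) := by rw [pow_succ]; ring
        rw [gb_succ_succ' h0, e4]
        linear_combination gb Q M k * ((-1) ^ (k + 1) / (1 - z * Q ^ (k + 1))) * e3
      have h2 := sum_range_succ' (fun k : ℕ => gb Q M k * ((-1) ^ k * Q ^ (tri k + k - N * k) / (1 - z * Q ^ k))) (M + 1)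
      rw [sum_range_succ, gb_eq_zero M (M + 1) (by lia), zero_mul, add_zero, ih N z (by lia) hz] at h2
      rw [sum_range_succ', sum_congr rfl fun k _ => e k, sum_sub_distrib, ← mul_sum,
        ih N (z * Q) (by lia) hz', gb_zero_right]
      rw [gb_zero_right] at h2
      have e5 : Q ^ ((M : ℤ) + 1 - N) * (z * Q) ^ N = Q ^ (M + 1) * z ^ N := by
        have : Q ^ ((M : ℤ) + 1 - N) * Q ^ N = Q ^ (M + 1) := by
          rw [← zpow_natCast Q N, ← zpow_add₀ h0, ← zpow_natCast]
          congr 1; push_cast; ring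
        rw [mul_pow, ← this]; ring
      have e6 : Q ^ ((M : ℤ) + 1 - N) * ((z * Q) ^ N * qp Q Q M / qp Q (z * Q) (M + 1)) =
          Q ^ (M + 1) * z ^ N * qp Q Q M / qp Q (z * Q) (M + 1) := by
        rw [← e5]; ring
      rw [e6, r2]
      rw [r1] at h2
      rw [qp_succ Q M]
      linear_combination -h2
    · obtain rfl : N = M + 1 := by lia
      have e : ∀ k : ℕ, gb Q (M + 1) (k + 1) * ((-1) ^ (k + 1) *
          Q ^ (tri (k + 1 : ℕ) + (k + 1 : ℕ) - (M + 1 : ℕ) * (k + 1 : ℕ)) / (1 - z * Q ^ (k + 1))) =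
          gb Q M (k + 1) * ((-1) ^ (k + 1) *
            Q ^ (tri (k + 1 : ℕ) + (k + 1 : ℕ) - M * (k + 1 : ℕ)) / (1 - z * Q ^ (k + 1)))
          - Q ^ (-(M : ℤ)) *
            (gb Q M k * ((-1) ^ k * Q ^ (tri k + k - M * k) / (1 - z * Q * Q ^ k))) := by
        intro k
        have e3 : Q ^ (tri (k + 1 : ℕ) + (k + 1 : ℕ) - (M + 1 : ℕ) * (k + 1 : ℕ)) =
            Q ^ (-(M : ℤ)) * Q ^ (tri k + k - M * k) := by
          rw [← zpow_add₀ h0]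
          congr 1
          push_cast
          rw [tri_succ]
          ring
        have e3' : Q ^ (tri (k + 1 : ℕ) + (k + 1 : ℕ) - M * (k + 1 : ℕ)) =
            Q ^ (-(M : ℤ)) * Q ^ (tri k + k - M * k) * Q ^ (k + 1) := by
          rw [← zpow_add₀ h0, ← zpow_natCast Q (k + 1), ← zpow_add₀ h0]
          congr 1
          push_cast
          rw [tri_succ]
          ring
        have e4 : z * Q * Q ^ k = z * Q ^ (k + 1) := by rw [pow_succ]; ring
        rw [gb, e4, e3, e3']
        ring
      have h2 := sum_range_succ' (fun k : ℕ => gb Q M k * ((-1) ^ k * Q ^ (tri k + k - M * k) / (1 - z * Q ^ k))) (M + 1)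
      rw [sum_range_succ, gb_eq_zero M (M + 1) (by lia), zero_mul, add_zero, ih M z le_rfl hz] at h2
      rw [sum_range_succ', sum_congr rfl fun k _ => e k, sum_sub_distrib, ← mul_sum,
        ih M (z * Q) le_rfl hz', gb_zero_right]
      rw [gb_zero_right] at h2
      have e6 : Q ^ (-(M : ℤ)) * ((z * Q) ^ M * qp Q Q M / qp Q (z * Q) (M + 1)) =
          z ^ M * qp Q Q M / qp Q (z * Q) (M + 1) := by
        have : Q ^ (-(M : ℤ)) * Q ^ M = 1 := by
          rw [← zpow_natCast Q M, ← zpow_add₀ h0]; simp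
        rw [mul_pow]
        linear_combination z ^ M * qp Q Q M / qp Q (z * Q) (M + 1) * this
      rw [e6, r2]
      rw [r1] at h2
      rw [qp_succ Q M]
      simp only [Nat.cast_zero, mul_zero] at h2 ⊢
      linear_combination -h2

/-- The infinite product `∏ (1 - z Q^i)`. -/
noncomputable def qpi (Q z : ℂ) : ℂ := ∏' i : ℕ, (1 - z * Q ^ i)

theorem summable_norm_geom (h1 : ‖Q‖ < 1) (z : ℂ) : Summable fun i : ℕ => ‖-(z * Q ^ i)‖ := by
  refine ((summable_geometric_of_lt_one (norm_nonneg _) h1).mul_left ‖z‖).congr fun i => ?_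
  rw [norm_neg, norm_mul, norm_pow]

theorem multipliable_qpi (h1 : ‖Q‖ < 1) (z : ℂ) : Multipliable fun i : ℕ => 1 - z * Q ^ i := by
  simpa [sub_eq_add_neg] using multipliable_one_add_of_summable (summable_norm_geom h1 z)

theorem tendsto_qp (h1 : ‖Q‖ < 1) (z : ℂ) : Tendsto (qp Q z) atTop (𝓝 (qpi Q z)) :=
  (multipliable_qpi h1 z).hasProd.tendsto_prod_nat

theorem qpi_ne_zero (h1 : ‖Q‖ < 1) {z : ℂ} (hz : ∀ i : ℕ, 1 - z * Q ^ i ≠ 0) : qpi Q z ≠ 0 := by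
  have := tprod_one_add_ne_zero_of_summable (f := fun i : ℕ => -(z * Q ^ i))
    (fun i => by simpa [sub_eq_add_neg] using hz i) (summable_norm_geom h1 z)
  simp only [← sub_eq_add_neg] at this
  exact this

theorem one_sub_mul_pow_ne (h1 : ‖Q‖ < 1) (i : ℕ) : 1 - Q * Q ^ i ≠ 0 := by
  intro h
  have h2 : ‖Q * Q ^ i‖ = 1 := by rw [← sub_eq_zero.mp h]; simp
  rw [← pow_succ', norm_pow] at h2
  exact (pow_lt_one₀ (norm_nonneg _) h1 (Nat.succ_ne_zero i)).ne h2

theorem qpi_self_ne_zero (h1 : ‖Q‖ < 1) : qpi Q Q ≠ 0 := qpi_ne_zero h1 (one_sub_mul_pow_ne h1)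

theorem tendsto_sum_gb (h1 : ‖Q‖ < 1) {g : ℤ → ℂ} (hg : Summable fun n => ‖g n‖) :
    Tendsto (fun N : ℕ => ∑ k ∈ range (2 * N + 1), gb Q (2 * N) k * g (k - N)) atTop
      (𝓝 ((∑' n, g n) / qpi Q Q)) := by
  have hne : ∀ n, qp Q Q n ≠ 0 := fun n => prod_ne_zero_iff.mpr fun i _ => one_sub_mul_pow_ne h1 i
  obtain ⟨C, hC⟩ := (tendsto_qp h1 Q).norm.bddAbove_range
  obtain ⟨C', hC'⟩ := ((tendsto_qp h1 Q).inv₀ (qpi_self_ne_zero h1)).norm.bddAbove_range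
  have hC2 : ∀ n, ‖qp Q Q n‖ ≤ C := fun n => hC ⟨n, rfl⟩
  have hC3 : ∀ n, ‖(qp Q Q n)⁻¹‖ ≤ C' := fun n => hC' ⟨n, rfl⟩
  have hC0 : 0 ≤ C := (norm_nonneg _).trans (hC2 0)
  have hC0' : 0 ≤ C' := (norm_nonneg _).trans (hC3 0)
  have closed : ∀ a b, gb Q (a + b) a = qp Q Q (a + b) * (qp Q Q a)⁻¹ * (qp Q Q b)⁻¹ := by
    intro a b
    rw [← gb_mul_qp]
    have := hne a
    have := hne b
    field_simp
  have bound : ∀ M k, ‖gb Q M k‖ ≤ C * C' * C' := by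
    intro M k
    rcases le_or_gt k M with h | h
    · obtain ⟨b, rfl⟩ := Nat.exists_eq_add_of_le h
      rw [closed, norm_mul, norm_mul]
      gcongr
      · exact hC2 _
      · exact hC3 _
      · exact hC3 _
    · rw [gb_eq_zero _ _ h, norm_zero]; positivity
  let f : ℕ → ℤ → ℂ := fun N n => if n ∈ Finset.Icc (-(N : ℤ)) N then gb Q (2 * N) (n + N).toNat * g n else 0
  have e1 : ∀ N, ∑ k ∈ range (2 * N + 1), gb Q (2 * N) k * g (k - N) = ∑' n, f N n := by
    intro N
    rw [tsum_eq_sum (s := Finset.Icc (-(N : ℤ)) N) (fun b hb => if_neg hb)]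
    refine sum_bij (fun (k : ℕ) _ => (k : ℤ) - N) ?_ ?_ ?_ ?_
    · intro k hk; simp only [mem_range, mem_Icc] at *; lia
    · intro a _ b _ h; lia
    · intro n hn
      simp only [mem_Icc] at hn
      exact ⟨(n + N).toNat, by simp only [mem_range]; lia, by lia⟩
    · intro k hk
      have : (k : ℤ) - N ∈ Finset.Icc (-(N : ℤ)) N := by simp only [mem_range, mem_Icc] at *; lia
      simp only [f, if_pos this]
      simp
  simp only [e1]
  rw [div_eq_mul_inv, mul_comm, ← tsum_mul_left]
  refine tendsto_tsum_of_dominated_convergence (bound := fun n => C * C' * C' * ‖g n‖)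
    (hg.mul_left _) ?_ (Eventually.of_forall fun N n => ?_)
  · intro n
    have key : Tendsto (fun N : ℕ => qp Q Q (2 * N) * (qp Q Q (n + N).toNat)⁻¹ *
        (qp Q Q ((N : ℤ) - n).toNat)⁻¹ * g n) atTop (𝓝 ((qpi Q Q)⁻¹ * g n)) := by
      have t1 : Tendsto (fun N : ℕ => 2 * N) atTop atTop := tendsto_atTop_atTop.mpr fun b => ⟨b, fun a h => by lia⟩
      have t2 : Tendsto (fun N : ℕ => (n + N).toNat) atTop atTop :=
        tendsto_atTop_atTop.mpr fun b => ⟨b + n.natAbs, fun a h => by lia⟩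
      have t3 : Tendsto (fun N : ℕ => ((N : ℤ) - n).toNat) atTop atTop :=
        tendsto_atTop_atTop.mpr fun b => ⟨b + n.natAbs, fun a h => by lia⟩
      have l := tendsto_qp h1 Q
      have l' := l.inv₀ (qpi_self_ne_zero h1)
      have := ((l.comp t1).mul (l'.comp t2)).mul (l'.comp t3)
      rw [mul_inv_cancel₀ (qpi_self_ne_zero h1), one_mul] at this
      exact this.mul_const _
    refine key.congr' ?_
    · filter_upwards [eventually_ge_atTop n.natAbs] with N hN
      have : n ∈ Finset.Icc (-(N : ℤ)) N := by simp only [mem_Icc]; lia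
      simp only [f, if_pos this]
      have e : 2 * N = (n + N).toNat + ((N : ℤ) - n).toNat := by lia
      have h := closed (n + N).toNat ((N : ℤ) - n).toNat
      rw [← e] at h
      rw [h]
  · by_cases h : n ∈ Finset.Icc (-(N : ℤ)) N
    · simp only [f, if_pos h, norm_mul]
      gcongr
      exact bound _ _
    · simp only [f, if_neg h, norm_zero]
      positivity

theorem tri_nat (k : ℕ) : tri k = (k.choose 2 : ℕ) := by
  have h := two_tri k
  have h2 := Nat.triangle_succ (k - 1)
  cases k with
  | zero => simp [tri_zero]
  | succ k =>
    rw [Nat.choose_two_right]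
    have := Nat.div_mul_cancel (Nat.even_mul_pred_self (k + 1)).two_dvd
    simp only [Nat.add_sub_cancel] at this ⊢
    have h3 : (((k + 1) * k / 2 : ℕ) : ℤ) * 2 = (k + 1) * k := by exact_mod_cast this
    push_cast at h ⊢
    push_cast at h3
    linarith

/-- Splitting off the factors with negative exponents. -/
theorem qp_shift (h0 : Q ≠ 0) {x : ℂ} (hx : x ≠ 0) (N M : ℕ) :
    qp Q (x * Q ^ (-(N : ℤ))) (N + M) =
      (-x) ^ N * Q ^ (-tri (N + 1)) * qp Q (Q / x) N * qp Q x M := by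
  induction N with
  | zero => simp [qp, tri_one]
  | succ N ih =>
    rw [show N + 1 + M = (N + M) + 1 by ring, qp_succ',
      show x * Q ^ (-((N + 1 : ℕ) : ℤ)) * Q = x * Q ^ (-(N : ℤ)) by
        rw [mul_assoc, ← zpow_add_one₀ h0]; congr 2; push_cast; ring, ih, qp_succ (Q / x)]
    have e : Q ^ (-tri ((N + 1 : ℕ) + 1)) = Q ^ (-tri (N + 1)) * Q ^ (-((N + 1 : ℕ) : ℤ)) := by
      rw [← zpow_add₀ h0, tri_succ]; congr 1; push_cast; ring
    rw [e]
    have e2 : Q ^ (-((N + 1 : ℕ) : ℤ)) * Q ^ (N + 1) = 1 := by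
      rw [← zpow_natCast Q (N + 1), ← zpow_add₀ h0]; simp
    have e3 : 1 - x * Q ^ (-((N + 1 : ℕ) : ℤ)) = -x * Q ^ (-((N + 1 : ℕ) : ℤ)) * (1 - Q / x * Q ^ N) := by
      have : x * (Q / x) = Q := by field_simp
      rw [pow_succ] at e2
      linear_combination -e2 + Q ^ (-((N + 1 : ℕ) : ℤ)) * Q ^ N * -this
    rw [e3]
    ring

/-- The Jacobi triple product. -/
theorem jt_eq_prod (h0 : Q ≠ 0) (h1 : ‖Q‖ < 1) {x : ℂ} (hx : x ≠ 0) :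
    jt Q x = qpi Q Q * qpi Q x * qpi Q (Q / x) := by
  have hs : Summable fun n : ℤ => ‖(-1 : ℂ) ^ n * Q ^ tri n * x ^ n‖ := (summable_jt h0 h1 hx).norm
  have t1 := tendsto_sum_gb h1 hs
  have t2 := (tendsto_qp h1 (Q / x)).mul (tendsto_qp h1 x)
  have e : ∀ N : ℕ, ∑ k ∈ range (2 * N + 1), gb Q (2 * N) k *
      ((-1 : ℂ) ^ ((k : ℤ) - N) * Q ^ tri (k - N) * x ^ ((k : ℤ) - N)) = qp Q (Q / x) N * qp Q x N := by
    intro N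
    have h := sum_gb (Q := Q) (x * Q ^ (-(N : ℤ))) (2 * N)
    rw [two_mul, qp_shift h0 hx] at h
    have ec : (-x) ^ N * Q ^ (-tri (N + 1)) ≠ 0 :=
      mul_ne_zero (pow_ne_zero _ (neg_ne_zero.mpr hx)) (zpow_ne_zero _ h0)
    apply mul_left_cancel₀ ec
    rw [← mul_assoc, ← h, mul_sum, two_mul]
    refine sum_congr rfl fun k _ => ?_
    have e1 : Q ^ (-tri (N + 1)) * Q ^ tri ((k : ℤ) - N) = Q ^ k.choose 2 * (Q ^ (-(N : ℤ))) ^ k := by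
      rw [← zpow_natCast Q (k.choose 2), ← tri_nat, ← zpow_natCast (Q ^ (-(N : ℤ))), ← zpow_mul,
        ← zpow_add₀ h0, ← zpow_add₀ h0, tri_succ, sub_eq_add_neg, tri_add, tri_neg]
      congr 1; ring
    have e2 : x ^ N * x ^ ((k : ℤ) - N) = x ^ k := by
      rw [← zpow_natCast x N, ← zpow_add₀ hx, ← zpow_natCast]; congr 1; ring
    have e3 : (-1 : ℂ) ^ N * (-1) ^ ((k : ℤ) - N) = (-1) ^ k := by
      rw [← zpow_natCast (-1 : ℂ) N, ← zpow_add₀ (by norm_num), ← zpow_natCast]; congr 1; ring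
    rw [neg_pow, mul_pow, ← e2, ← e3]
    linear_combination gb Q (N + N) k * (-1 : ℂ) ^ N * (-1) ^ ((k : ℤ) - N) * x ^ N * x ^ ((k : ℤ) - N) * e1
  simp only [e] at t1
  have h := tendsto_nhds_unique t1 t2
  rw [div_eq_iff (qpi_self_ne_zero h1)] at h
  rw [jt, h]
  ring

theorem jt_ne_zero (h0 : Q ≠ 0) (h1 : ‖Q‖ < 1) {x : ℂ} (hx0 : x ≠ 0) (hx : ∀ n : ℤ, x * Q ^ n ≠ 1) :
    jt Q x ≠ 0 := by
  rw [jt_eq_prod h0 h1 hx0]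
  refine mul_ne_zero (mul_ne_zero (qpi_self_ne_zero h1) (qpi_ne_zero h1 fun i h => ?_))
    (qpi_ne_zero h1 fun i h => ?_)
  · apply hx i; rw [zpow_natCast]; linear_combination -h
  · apply hx (-(i + 1 : ℕ))
    rw [zpow_neg, zpow_natCast, pow_succ, mul_inv_eq_one₀ (mul_ne_zero (pow_ne_zero _ h0) h0)]
    field_simp at h
    linear_combination h

theorem summable_norm_neg_tri (h0 : Q ≠ 0) (h1 : ‖Q‖ < 1) {k : ℕ} (hk : k ≠ 0) {w x : ℂ} (hw : w ≠ 0)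
    (hx0 : x ≠ 0) (hx : ∀ n : ℤ, x * Q ^ n ≠ 1) (s : ℤ) (e : ℤ → ℂ) (he : ∀ n, ‖e n‖ = 1) :
    Summable fun n : ℤ => ‖e n * Q ^ (k * tri n + s * n) * w ^ n / (1 - x * Q ^ n)‖ := by
  obtain ⟨C, hC, hb⟩ := exists_inv_bound h0 h1 hx0 hx
  refine Summable.of_nonneg_of_le (fun _ => norm_nonneg _) (fun n => ?_)
    ((summable_norm_tri h0 h1 hk (Q ^ s * w) (mul_ne_zero (zpow_ne_zero _ h0) hw)).mul_left C)
  rw [div_eq_mul_inv, norm_mul, norm_mul, norm_mul, he, one_mul, mul_comm, zpow_add₀ h0, zpow_mul Q s,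
    ← norm_mul, mul_assoc, ← mul_zpow]
  gcongr
  exact hb n

/-- The partial fraction expansion of the reciprocal theta function. -/
theorem recip_jt (h0 : Q ≠ 0) (h1 : ‖Q‖ < 1) {x : ℂ} (hx0 : x ≠ 0) (hx : ∀ n : ℤ, x * Q ^ n ≠ 1) :
    ∑' n : ℤ, (-1) ^ n * Q ^ (tri n + n) / (1 - x * Q ^ n) = qpi Q Q ^ 3 / jt Q x := by
  have hs : Summable fun n : ℤ => ‖(-1 : ℂ) ^ n * Q ^ (tri n + n) / (1 - x * Q ^ n)‖ := by
    refine (summable_norm_neg_tri h0 h1 one_ne_zero one_ne_zero hx0 hx 1 _ norm_neg_one_zpow).congr fun n => ?_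
    simp
  have t1 := tendsto_sum_gb h1 hs
  have nz1 : ∀ i : ℕ, 1 - x * Q ^ i ≠ 0 := fun i h => hx i (by rw [zpow_natCast]; linear_combination -h)
  have nz2 : ∀ i : ℕ, 1 - Q / x * Q ^ i ≠ 0 := fun i h => by
    apply hx (-(i + 1 : ℕ))
    rw [zpow_neg, zpow_natCast, pow_succ, mul_inv_eq_one₀ (mul_ne_zero (pow_ne_zero _ h0) h0)]
    field_simp at h
    linear_combination h
  have t2 : Tendsto (fun N : ℕ => qp Q Q (2 * N) / (qp Q (Q / x) N * qp Q x (N + 1))) atTop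
      (𝓝 (qpi Q Q / (qpi Q (Q / x) * qpi Q x))) := by
    have a1 : Tendsto (fun N : ℕ => 2 * N) atTop atTop := tendsto_atTop_atTop.mpr fun b => ⟨b, fun a h => by lia⟩
    exact ((tendsto_qp h1 Q).comp a1).div ((tendsto_qp h1 (Q / x)).mul
      ((tendsto_qp h1 x).comp (tendsto_add_atTop_nat 1)))
      (mul_ne_zero (qpi_ne_zero h1 nz2) (qpi_ne_zero h1 nz1))
  have e : ∀ N : ℕ, ∑ k ∈ range (2 * N + 1), gb Q (2 * N) k *
      ((-1 : ℂ) ^ ((k : ℤ) - N) * Q ^ (tri (k - N) + (k - N)) / (1 - x * Q ^ ((k : ℤ) - N))) =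
        qp Q Q (2 * N) / (qp Q (Q / x) N * qp Q x (N + 1)) := by
    intro N
    have ez : ∀ k : ℕ, x * Q ^ (-(N : ℤ)) * Q ^ k = x * Q ^ ((k : ℤ) - N) := fun k => by
      rw [mul_assoc, ← zpow_natCast Q k, ← zpow_add₀ h0]; congr 2; ring
    have h := sum_gb_div h0 (2 * N) N (x * Q ^ (-(N : ℤ))) (by lia)
      (fun k h => hx (k - N) (by rw [← ez]; linear_combination -h))
    rw [show 2 * N + 1 = N + (N + 1) by ring, qp_shift h0 hx0] at h
    rw [show 2 * N + 1 = N + (N + 1) by ring]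
    have hm : ((-1 : ℂ) ^ N)⁻¹ = (-1) ^ N := by rw [← inv_pow]; norm_num
    have ec : (x * Q ^ (-(N : ℤ))) ^ N * ((-x) ^ N * Q ^ (-tri (N + 1)))⁻¹ = (-1) ^ N * Q ^ (-tri N) := by
      rw [mul_pow, neg_pow, ← zpow_natCast (Q ^ (-(N : ℤ))), ← zpow_mul, mul_inv, mul_inv, zpow_neg Q (tri _),
        inv_inv, hm]
      have e2 : Q ^ (-(N : ℤ) * N) * Q ^ tri (N + 1) = Q ^ (-tri N) := by
        rw [← zpow_add₀ h0]; congr 1; have := two_tri N; rw [tri_succ]; linarith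
      have : x ^ N * (x ^ N)⁻¹ = 1 := mul_inv_cancel₀ (pow_ne_zero _ hx0)
      rw [← e2]
      linear_combination (-1 : ℂ) ^ N * Q ^ (-(N : ℤ) * N) * Q ^ tri (N + 1) * this
    have h' : ∑ k ∈ range (N + (N + 1)), gb Q (2 * N) k *
        ((-1) ^ k * Q ^ (tri k + k - N * k) / (1 - x * Q ^ (-(N : ℤ)) * Q ^ k)) =
        (-1) ^ N * Q ^ (-tri N) * (qp Q Q (2 * N) / (qp Q (Q / x) N * qp Q x (N + 1))) := by
      rw [h, ← ec]
      simp only [div_eq_mul_inv, mul_inv]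
      ring
    have ed : (-1 : ℂ) ^ N * Q ^ (-tri N) ≠ 0 := mul_ne_zero (by simp) (zpow_ne_zero _ h0)
    apply mul_left_cancel₀ ed
    rw [← h', mul_sum]
    refine sum_congr rfl fun k _ => ?_
    have e1 : Q ^ (-tri N) * Q ^ (tri ((k : ℤ) - N) + (k - N)) = Q ^ (tri k + k - N * k) := by
      rw [← zpow_add₀ h0, sub_eq_add_neg, tri_add, tri_neg]
      congr 1; ring
    have e3 : (-1 : ℂ) ^ N * (-1) ^ ((k : ℤ) - N) = (-1) ^ k := by
      rw [← zpow_natCast (-1 : ℂ) N, ← zpow_add₀ (by norm_num), ← zpow_natCast]; congr 1; ring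
    rw [ez, ← e1, ← e3]
    ring
  simp only [e] at t1
  have h := tendsto_nhds_unique t1 t2
  rw [div_eq_iff (qpi_self_ne_zero h1)] at h
  rw [h, jt_eq_prod h0 h1 hx0]
  have := qpi_self_ne_zero h1
  have := qpi_ne_zero h1 nz1
  have := qpi_ne_zero h1 nz2
  field_simp

/-- `x` is nonzero and not a power of `Q`. -/
def NP (Q x : ℂ) : Prop := x ≠ 0 ∧ ∀ n : ℤ, x * Q ^ n ≠ 1

theorem NP.inv (h0 : Q ≠ 0) {x : ℂ} (h : NP Q x) : NP Q x⁻¹ := by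
  refine ⟨inv_ne_zero h.1, fun n hn => h.2 (-n) ?_⟩
  rw [zpow_neg]
  have : Q ^ n ≠ 0 := zpow_ne_zero _ h0
  rw [inv_mul_eq_one₀ h.1] at hn
  rw [hn, mul_inv_cancel₀ this]

theorem NP.mul_zpow (h0 : Q ≠ 0) {x : ℂ} (h : NP Q x) (m : ℤ) : NP Q (x * Q ^ m) := by
  refine ⟨mul_ne_zero h.1 (zpow_ne_zero _ h0), fun n hn => h.2 (m + n) ?_⟩
  rwa [zpow_add₀ h0, ← mul_assoc]

theorem NP.sub_ne {x : ℂ} (h : NP Q x) (n : ℤ) : 1 - x * Q ^ n ≠ 0 :=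
  fun hh => h.2 n (sub_eq_zero.mp hh).symm

/-- Level two Appell sums. -/
noncomputable def App2 (Q x w : ℂ) : ℂ := ∑' n : ℤ, Q ^ (2 * tri n + 2 * n) * w ^ n / (1 - x * Q ^ n)

/-- Level three Appell sums. -/
noncomputable def App (Q x w : ℂ) : ℂ :=
  ∑' n : ℤ, (-1) ^ n * Q ^ (3 * tri n + 3 * n) * w ^ n / (1 - x * Q ^ n)

theorem summable_norm_coef (h0 : Q ≠ 0) (h1 : ‖Q‖ < 1) {k : ℕ} (hk : k ≠ 0) {w : ℂ} (hw : w ≠ 0)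
    (s : ℤ) (e : ℤ → ℂ) (he : ∀ n, ‖e n‖ = 1) :
    Summable fun n : ℤ => ‖e n * Q ^ (k * tri n + s * n) * w ^ n‖ := by
  refine (summable_norm_tri h0 h1 hk (Q ^ s * w) (mul_ne_zero (zpow_ne_zero _ h0) hw)).congr fun n => ?_
  rw [mul_assoc, norm_mul (e n), he, one_mul, zpow_add₀ h0, zpow_mul Q s, mul_zpow, mul_assoc]

theorem summable_norm_div (h0 : Q ≠ 0) (h1 : ‖Q‖ < 1) {x : ℂ} (hx : NP Q x) {f : ℤ → ℂ}
    (hf : Summable fun n => ‖f n‖) : Summable fun n => ‖f n / (1 - x * Q ^ n)‖ := by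
  obtain ⟨C, hC, hb⟩ := exists_inv_bound h0 h1 hx.1 hx.2
  refine Summable.of_nonneg_of_le (fun _ => norm_nonneg _) (fun n => ?_) (hf.mul_left C)
  rw [div_eq_mul_inv, norm_mul, mul_comm]
  gcongr
  exact hb n

theorem tsum_mul_tsum_partial_fractions (h0 : Q ≠ 0) (h1 : ‖Q‖ < 1) {a b : ℂ} (ha : NP Q a) (hb : NP Q b)
    (hab : NP Q (b / a)) {f g : ℤ → ℂ} (hf : Summable fun n => ‖f n‖) (hg : Summable fun n => ‖g n‖) :
    (∑' n, f n / (1 - a * Q ^ n)) * (∑' m, g m / (1 - b * Q ^ m)) =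
      (∑' n : ℤ, f n / (1 - a * Q ^ n) * ∑' m, g m / (1 - b / a * Q ^ (-n) * Q ^ m)) +
      ∑' m : ℤ, g m / (1 - b * Q ^ m) * ∑' n, f n / (1 - a / b * Q ^ (-m) * Q ^ n) := by
  have hba : NP Q (a / b) := by rw [← inv_div]; exact hab.inv h0
  have sf := summable_norm_div h0 h1 ha hf
  have sg := summable_norm_div h0 h1 hb hg
  obtain ⟨C, hC, hbd⟩ := exists_inv_bound h0 h1 hab.1 hab.2
  obtain ⟨C', hC', hbd'⟩ := exists_inv_bound h0 h1 hba.1 hba.2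
  have s1 : Summable fun p : ℤ × ℤ => f p.1 / (1 - a * Q ^ p.1) * (g p.2 / (1 - b / a * Q ^ (-p.1) * Q ^ p.2)) := by
    apply Summable.of_norm
    refine Summable.of_nonneg_of_le (fun _ => norm_nonneg _) (fun p => ?_)
      ((sf.mul_of_nonneg hg (fun _ => norm_nonneg _) (fun _ => norm_nonneg _)).mul_left C)
    rw [norm_mul, div_eq_mul_inv (g _), norm_mul (g _), mul_assoc (b / a), ← zpow_add₀ h0]
    have := mul_le_mul_of_nonneg_left (hbd (-p.1 + p.2))
      (mul_nonneg (norm_nonneg (f p.1 / (1 - a * Q ^ p.1))) (norm_nonneg (g p.2)))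
    linarith
  have s2 : Summable fun p : ℤ × ℤ => g p.1 / (1 - b * Q ^ p.1) * (f p.2 / (1 - a / b * Q ^ (-p.1) * Q ^ p.2)) := by
    apply Summable.of_norm
    refine Summable.of_nonneg_of_le (fun _ => norm_nonneg _) (fun p => ?_)
      ((sg.mul_of_nonneg hf (fun _ => norm_nonneg _) (fun _ => norm_nonneg _)).mul_left C')
    rw [norm_mul, div_eq_mul_inv (f _), norm_mul (f _), mul_assoc (a / b), ← zpow_add₀ h0]
    have := mul_le_mul_of_nonneg_left (hbd' (-p.1 + p.2))
      (mul_nonneg (norm_nonneg (g p.1 / (1 - b * Q ^ p.1))) (norm_nonneg (f p.2)))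
    linarith
  rw [tsum_mul_tsum_of_summable_norm sf sg]
  simp only [← tsum_mul_left]
  have s2' : Summable fun p : ℤ × ℤ =>
      g p.2 / (1 - b * Q ^ p.2) * (f p.1 / (1 - a / b * Q ^ (-p.2) * Q ^ p.1)) :=
    (Equiv.prodComm ℤ ℤ).summable_iff.mpr s2
  have e2 : ∑' p : ℤ × ℤ, g p.2 / (1 - b * Q ^ p.2) * (f p.1 / (1 - a / b * Q ^ (-p.2) * Q ^ p.1)) =
      ∑' p : ℤ × ℤ, g p.1 / (1 - b * Q ^ p.1) * (f p.2 / (1 - a / b * Q ^ (-p.1) * Q ^ p.2)) :=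
    (Equiv.prodComm ℤ ℤ).tsum_eq
      (fun p : ℤ × ℤ => g p.1 / (1 - b * Q ^ p.1) * (f p.2 / (1 - a / b * Q ^ (-p.1) * Q ^ p.2)))
  rw [← s1.tsum_prod, ← s2.tsum_prod, ← e2, ← Summable.tsum_add s1 s2']
  refine tsum_congr fun ⟨n, m⟩ => ?_
  dsimp only
  have a0 := ha.1
  have b0 := hb.1
  have n1 := ha.sub_ne n
  have n2 := hb.sub_ne m
  have q1 : Q ^ n ≠ 0 := zpow_ne_zero _ h0
  have q2 : Q ^ m ≠ 0 := zpow_ne_zero _ h0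
  have n3 : a * Q ^ n - b * Q ^ m ≠ 0 := by
    intro h
    apply hab.2 (m - n)
    rw [zpow_sub₀ h0]
    field_simp
    linear_combination -h
  have e1 : (1 - b / a * Q ^ (-n) * Q ^ m) = (a * Q ^ n - b * Q ^ m) / (a * Q ^ n) := by
    rw [zpow_neg]; field_simp
  have e2 : (1 - a / b * Q ^ (-m) * Q ^ n) = -(a * Q ^ n - b * Q ^ m) / (b * Q ^ m) := by
    rw [zpow_neg]; field_simp; ring
  rw [e1, e2]
  generalize Q ^ n = A at *
  generalize Q ^ m = B at *
  rw [neg_div, div_neg, div_div_eq_mul_div, div_div_eq_mul_div, div_mul_div_comm, div_mul_div_comm,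
    ← sub_eq_zero]
  have : f n * g m / ((1 - a * A) * (1 - b * B)) - (f n * (g m * (a * A)) / ((1 - a * A) * (a * A - b * B)) +
      g m / (1 - b * B) * -(f n * (b * B) / (a * A - b * B))) =
      f n * g m * ((a * A - b * B) - a * A * (1 - b * B) + b * B * (1 - a * A)) / ((1 - a * A) * (1 - b * B) * (a * A - b * B)) := by
    field_simp
    ring
  rw [this]
  ring

theorem jt_ne (h0 : Q ≠ 0) (h1 : ‖Q‖ < 1) {x : ℂ} (h : NP Q x) : jt Q x ≠ 0 := jt_ne_zero h0 h1 h.1 h.2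

theorem inv_jt_mul_zpow_neg (h0 : Q ≠ 0) {x : ℂ} (hx : x ≠ 0) (n : ℤ) :
    (jt Q (x * Q ^ (-n)))⁻¹ = (-1) ^ n * Q ^ (tri n + n) * x⁻¹ ^ n * (jt Q x)⁻¹ := by
  rw [jt_mul_zpow h0 hx, tri_neg, mul_inv, mul_inv, mul_inv, ← zpow_neg, ← zpow_neg, ← zpow_neg]
  simp [neg_one_zpow_neg]

theorem summable_norm_u (h0 : Q ≠ 0) (h1 : ‖Q‖ < 1) :
    Summable fun n : ℤ => ‖(-1 : ℂ) ^ n * Q ^ (tri n + n)‖ := by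
  refine (summable_norm_coef h0 h1 one_ne_zero one_ne_zero 1 _ norm_neg_one_zpow).congr fun n => ?_
  simp

theorem summable_norm_v (h0 : Q ≠ 0) (h1 : ‖Q‖ < 1) {w : ℂ} (hw : w ≠ 0) :
    Summable fun n : ℤ => ‖Q ^ (2 * tri n + 2 * n) * w ^ n‖ := by
  refine (summable_norm_coef h0 h1 two_ne_zero hw 2 (fun _ => 1) (by simp)).congr fun n => ?_
  simp

theorem recip_jt_mul_jt (h0 : Q ≠ 0) (h1 : ‖Q‖ < 1) {a b : ℂ} (ha : NP Q a) (hb : NP Q b)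
    (hab : NP Q (b / a)) :
    App2 Q a (a / b) / jt Q (b / a) + App2 Q b (b / a) / jt Q (a / b) =
      qpi Q Q ^ 3 / (jt Q a * jt Q b) := by
  have hba : NP Q (a / b) := by rw [← inv_div]; exact hab.inv h0
  have h := tsum_mul_tsum_partial_fractions h0 h1 ha hb hab (summable_norm_u h0 h1) (summable_norm_u h0 h1)
  rw [recip_jt h0 h1 ha.1 ha.2, recip_jt h0 h1 hb.1 hb.2] at h
  have t : ∀ {a b : ℂ}, NP Q (b / a) → ∑' n : ℤ, (-1) ^ n * Q ^ (tri n + n) / (1 - a * Q ^ n) *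
      ∑' m : ℤ, (-1) ^ m * Q ^ (tri m + m) / (1 - b / a * Q ^ (-n) * Q ^ m) =
      qpi Q Q ^ 3 * (App2 Q a (a / b) / jt Q (b / a)) := by
    intro a b hab
    rw [App2, ← tsum_div_const, ← tsum_mul_left]
    refine tsum_congr fun n => ?_
    rw [recip_jt h0 h1 (hab.mul_zpow h0 (-n)).1 (hab.mul_zpow h0 (-n)).2, div_eq_mul_inv (_ ^ 3),
      inv_jt_mul_zpow_neg h0 hab.1, inv_div, show 2 * tri n + 2 * n = (tri n + n) + (tri n + n) by ring,
      zpow_add₀ h0 (tri n + n)]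
    linear_combination Q ^ (tri n + n) / (1 - a * Q ^ n) * (qpi Q Q ^ 3 * (Q ^ (tri n + n) * (a / b) ^ n * (jt Q (b / a))⁻¹)) * neg_one_zpow_mul_self n
  rw [t hab, t hba, ← mul_add] at h
  have hD : qpi Q Q ^ 3 ≠ 0 := pow_ne_zero _ (qpi_self_ne_zero h1)
  apply mul_left_cancel₀ hD
  rw [← h]
  have := jt_ne h0 h1 ha
  have := jt_ne h0 h1 hb
  field_simp

theorem recip_jt_mul_jt_mul_jt (h0 : Q ≠ 0) (h1 : ‖Q‖ < 1) {a b c : ℂ} (ha : NP Q a) (hb : NP Q b)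
    (hc : NP Q c) (hab : NP Q (b / a)) (hac : NP Q (c / a)) (hbc : NP Q (c / b)) :
    App Q a (a ^ 2 / (b * c)) / (jt Q (b / a) * jt Q (c / a)) +
    App Q b (b ^ 2 / (a * c)) / (jt Q (a / b) * jt Q (c / b)) +
    App Q c (c ^ 2 / (a * b)) / (jt Q (a / c) * jt Q (b / c)) =
      qpi Q Q ^ 3 / (jt Q a * jt Q b * jt Q c) := by
  have hba : NP Q (a / b) := by rw [← inv_div]; exact hab.inv h0
  have hca : NP Q (a / c) := by rw [← inv_div]; exact hac.inv h0
  have hcb : NP Q (b / c) := by rw [← inv_div]; exact hbc.inv h0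
  have a0 := ha.1
  have b0 := hb.1
  have c0 := hc.1
  have key : ∀ {a b : ℂ}, NP Q a → NP Q b → NP Q (c / a) → App2 Q a (a / b) * (qpi Q Q ^ 3 / jt Q c) =
      qpi Q Q ^ 3 * (App Q a (a ^ 2 / (b * c)) / jt Q (c / a)) +
      ∑' m : ℤ, (-1) ^ m * Q ^ (tri m + m) / (1 - c * Q ^ m) * App2 Q (a / c * Q ^ (-m)) (a / b) := by
    intro a b ha hb hac
    have h := tsum_mul_tsum_partial_fractions h0 h1 ha hc hac
      (summable_norm_v h0 h1 (div_ne_zero ha.1 hb.1)) (summable_norm_u h0 h1)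
    rw [recip_jt h0 h1 hc.1 hc.2] at h
    rw [App2, h]
    congr 1
    rw [App, ← tsum_div_const, ← tsum_mul_left]
    refine tsum_congr fun n => ?_
    rw [recip_jt h0 h1 (hac.mul_zpow h0 (-n)).1 (hac.mul_zpow h0 (-n)).2, div_eq_mul_inv (_ ^ 3),
      inv_jt_mul_zpow_neg h0 hac.1, inv_div, show 3 * tri n + 3 * n = (2 * tri n + 2 * n) + (tri n + n) by ring,
      zpow_add₀ h0 (2 * tri n + 2 * n), show a ^ 2 / (b * c) = a / b * (a / c) by field_simp, mul_zpow]
    ring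
  have k1 := key ha hb hac
  have k2 := key hb ha hbc
  have r := recip_jt_mul_jt h0 h1 ha hb hab
  have sA : ∀ {a b : ℂ}, NP Q a → NP Q b → NP Q (a / c) →
      Summable fun m : ℤ => (-1) ^ m * Q ^ (tri m + m) / (1 - c * Q ^ m) * App2 Q (a / c * Q ^ (-m)) (a / b) := by
    intro a b ha hb hca
    have sv := summable_norm_v h0 h1 (div_ne_zero ha.1 hb.1)
    obtain ⟨C, hC, hbd⟩ := exists_inv_bound h0 h1 hca.1 hca.2
    apply Summable.of_norm
    refine Summable.of_nonneg_of_le (fun _ => norm_nonneg _) (fun m => ?_)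
      ((summable_norm_div h0 h1 hc (summable_norm_u h0 h1)).mul_right
        (∑' n : ℤ, C * ‖Q ^ (2 * tri n + 2 * n) * (a / b) ^ n‖))
    rw [norm_mul]
    gcongr
    refine tsum_of_norm_bounded (sv.mul_left C).hasSum fun n => ?_
    rw [div_eq_mul_inv, norm_mul, mul_comm]
    gcongr
    rw [mul_assoc, ← zpow_add₀ h0]
    exact hbd _
  have e : (∑' m : ℤ, (-1) ^ m * Q ^ (tri m + m) / (1 - c * Q ^ m) * App2 Q (a / c * Q ^ (-m)) (a / b)) / jt Q (b / a) +
      (∑' m : ℤ, (-1) ^ m * Q ^ (tri m + m) / (1 - c * Q ^ m) * App2 Q (b / c * Q ^ (-m)) (b / a)) / jt Q (a / b) =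
      qpi Q Q ^ 3 * (App Q c (c ^ 2 / (a * b)) / (jt Q (a / c) * jt Q (b / c))) := by
    rw [← tsum_div_const, ← tsum_div_const,
      ← ((sA ha hb hca).div_const _).tsum_add ((sA hb ha hcb).div_const _), App, ← tsum_div_const,
      ← tsum_mul_left]
    refine tsum_congr fun m => ?_
    have q : Q ^ (-m) ≠ 0 := zpow_ne_zero _ h0
    have d1 : a / c * Q ^ (-m) / (b / c * Q ^ (-m)) = a / b := by field_simp
    have d2 : b / c * Q ^ (-m) / (a / c * Q ^ (-m)) = b / a := by field_simp
    have r := recip_jt_mul_jt h0 h1 (hca.mul_zpow h0 (-m)) (hcb.mul_zpow h0 (-m)) (by rw [d2]; exact hab)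
    rw [d1, d2, div_eq_mul_inv (_ ^ 3), mul_inv, inv_jt_mul_zpow_neg h0 hca.1, inv_jt_mul_zpow_neg h0 hcb.1, inv_div,
      inv_div] at r
    have e3 : Q ^ (3 * tri m + 3 * m) = Q ^ (tri m + m) * Q ^ (tri m + m) * Q ^ (tri m + m) := by
      rw [← zpow_add₀ h0, ← zpow_add₀ h0]; congr 1; ring
    rw [e3, show c ^ 2 / (a * b) = c / a * (c / b) by field_simp, mul_zpow]
    have hm := neg_one_zpow_mul_self m
    linear_combination (-1) ^ m * Q ^ (tri m + m) / (1 - c * Q ^ m) * r +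
      (-1) ^ m * Q ^ (tri m + m) / (1 - c * Q ^ m) * (qpi Q Q ^ 3 * (Q ^ (tri m + m) * (c / a) ^ m * (jt Q (a / c))⁻¹ * (Q ^ (tri m + m) * (c / b) ^ m * (jt Q (b / c))⁻¹))) * hm
  have hD : qpi Q Q ^ 3 ≠ 0 := pow_ne_zero _ (qpi_self_ne_zero h1)
  apply mul_left_cancel₀ hD
  have j1 := jt_ne h0 h1 ha
  have j2 := jt_ne h0 h1 hb
  have j3 := jt_ne h0 h1 hc
  have fin : qpi Q Q ^ 3 * (qpi Q Q ^ 3 / (jt Q a * jt Q b * jt Q c)) = (qpi Q Q ^ 3 / (jt Q a * jt Q b)) * (qpi Q Q ^ 3 / jt Q c) := by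
    field_simp
  rw [fin, ← r]
  simp only [div_eq_mul_inv, mul_inv] at *
  linear_combination -(jt Q (b * a⁻¹))⁻¹ * k1 - (jt Q (a * b⁻¹))⁻¹ * k2 - e

/-- The three-term relation between Appell sums. -/
theorem app_relation (h0 : Q ≠ 0) (h1 : ‖Q‖ < 1) {z ζ : ℂ} (hz : NP Q z) (hz1 : NP Q (z / ζ))
    (hz2 : NP Q (z * ζ)) (hζ : NP Q ζ) (hζ2 : NP Q (ζ ^ 2)) :
    App Q (z / ζ) (ζ ^ 3)⁻¹ + ζ ^ 3 * App Q (z * ζ) (ζ ^ 3) =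
      ζ * jt Q (ζ ^ 2) / jt Q ζ * App Q z 1 +
      qpi Q Q ^ 3 * jt Q ζ * jt Q (ζ ^ 2) / (jt Q (z / ζ) * jt Q z * jt Q (z * ζ)) := by
  have z0 := hz.1
  have ζ0 := hζ.1
  have d1 : z / (z / ζ) = ζ := by field_simp
  have d2 : z * ζ / (z / ζ) = ζ ^ 2 := by field_simp
  have d3 : z * ζ / z = ζ := by field_simp
  have d4 : z / ζ / z = ζ⁻¹ := by field_simp
  have d5 : z / ζ / (z * ζ) = (ζ ^ 2)⁻¹ := by field_simp
  have d6 : z / (z * ζ) = ζ⁻¹ := by field_simp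
  have w1 : (z / ζ) ^ 2 / (z * (z * ζ)) = (ζ ^ 3)⁻¹ := by field_simp
  have w2 : z ^ 2 / (z / ζ * (z * ζ)) = 1 := by field_simp
  have w3 : (z * ζ) ^ 2 / (z / ζ * z) = ζ ^ 3 := by field_simp
  have r := recip_jt_mul_jt_mul_jt h0 h1 hz1 hz hz2 (by rwa [d1]) (by rwa [d2]) (by rwa [d3])
  rw [d1, d2, d3, d4, d5, d6, w1, w2, w3, jt_inv h0 ζ0, jt_inv h0 (pow_ne_zero 2 ζ0)] at r
  have n1 := jt_ne h0 h1 hζ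
  have n2 := jt_ne h0 h1 hζ2
  have e1 : App Q (z / ζ) (ζ ^ 3)⁻¹ + ζ ^ 3 * App Q (z * ζ) (ζ ^ 3) - ζ * jt Q (ζ ^ 2) / jt Q ζ * App Q z 1 =
      jt Q ζ * jt Q (ζ ^ 2) * (App Q (z / ζ) (ζ ^ 3)⁻¹ / (jt Q ζ * jt Q (ζ ^ 2)) + App Q z 1 / (-ζ⁻¹ * jt Q ζ * jt Q ζ) +
      App Q (z * ζ) (ζ ^ 3) / (-(ζ ^ 2)⁻¹ * jt Q (ζ ^ 2) * (-ζ⁻¹ * jt Q ζ))) := by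
    field_simp
    ring
  rw [r] at e1
  rw [← sub_eq_iff_eq_add', e1]
  ring

/-- The even theta function of level two. -/
noncomputable def thF (Q a : ℂ) : ℂ := ∑' n : ℤ, Q ^ (n * n) * a ^ (2 * n)

/-- The odd-degree companion of `thF`. -/
noncomputable def thG (Q a : ℂ) : ℂ := ∑' n : ℤ, Q ^ (n * n + n) * a ^ (2 * n + 1)

theorem summable_thF (h0 : Q ≠ 0) (h1 : ‖Q‖ < 1) {a : ℂ} (ha : a ≠ 0) :
    Summable fun n : ℤ => ‖Q ^ (n * n) * a ^ (2 * n)‖ := by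
  refine (summable_norm_tri h0 h1 two_ne_zero (Q * a ^ 2) (by positivity)).congr fun n => ?_
  rw [show n * n = (2 : ℕ) * tri n + n by have := two_tri n; push_cast; linarith, zpow_add₀ h0, mul_zpow,
    mul_assoc, ← zpow_natCast a 2, ← zpow_mul a]
  norm_cast

theorem summable_thG (h0 : Q ≠ 0) (h1 : ‖Q‖ < 1) {a : ℂ} (ha : a ≠ 0) :
    Summable fun n : ℤ => ‖Q ^ (n * n + n) * a ^ (2 * n + 1)‖ := by
  refine ((summable_norm_tri h0 h1 two_ne_zero (Q ^ 2 * a ^ 2) (by positivity)).mul_right ‖a‖).congr fun n => ?_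
  rw [show n * n + n = (2 : ℕ) * tri n + 2 * n by have := two_tri n; push_cast; linarith, zpow_add₀ h0, mul_zpow,
    zpow_add₀ ha, zpow_mul Q 2, zpow_one, ← norm_mul, ← zpow_natCast a 2, ← zpow_mul a]
  norm_cast
  ring_nf

theorem thF_neg (a : ℂ) : thF Q (-a) = thF Q a := by
  refine tsum_congr fun n => ?_
  rw [zpow_mul (-a), zpow_mul a]; norm_num [-zpow_natCast]

theorem thG_neg {a : ℂ} (ha : a ≠ 0) : thG Q (-a) = -thG Q a := by
  rw [thG, thG, ← tsum_neg]
  refine tsum_congr fun n => ?_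
  rw [zpow_add₀ (neg_ne_zero.mpr ha), zpow_add₀ ha, zpow_mul, zpow_mul]; norm_num

theorem thF_mul {p : ℂ} (hp : p ≠ 0) {a : ℂ} (ha : a ≠ 0) : thF (p ^ 2) (p * a) = a⁻¹ * thG (p ^ 2) a := by
  rw [thF, thG, ← tsum_mul_left]
  refine tsum_congr fun n => ?_
  rw [zpow_add₀ ha, mul_zpow, zpow_add₀ (pow_ne_zero 2 hp), ← zpow_natCast p 2, ← zpow_mul p _ n]
  push_cast
  field_simp

theorem thG_mul {p : ℂ} (hp : p ≠ 0) {a : ℂ} (ha : a ≠ 0) :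
    thG (p ^ 2) (p * a) = p⁻¹ * a⁻¹ * thF (p ^ 2) a := by
  rw [thF, thG, ← tsum_mul_left, ← (Equiv.subRight (1 : ℤ)).tsum_eq]
  refine tsum_congr fun n => ?_
  simp only [Equiv.subRight_apply]
  rw [← zpow_natCast p 2, ← zpow_mul, ← zpow_mul, mul_zpow,
    show 2 * (n - 1) + 1 = 2 * n + -1 by ring, zpow_add₀ ha, ← mul_assoc, ← zpow_add₀ hp,
    show ((2 : ℕ) : ℤ) * ((n - 1) * (n - 1) + (n - 1)) + (2 * n + -1) = ((2 : ℕ) : ℤ) * (n * n) + -1 by push_cast; ring,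
    zpow_add₀ hp, zpow_neg_one, zpow_neg_one]
  ring

/-- Pairs of integers according to the parity of their sum. -/
noncomputable def pairEquiv : (ℤ × ℤ) ⊕ (ℤ × ℤ) ≃ ℤ × ℤ :=
  Equiv.ofBijective (Sum.elim (fun p => (p.1 + 1 + p.2, p.1 + 1 - p.2)) (fun p => (p.1 + p.2 + 1, p.1 - p.2))) (by
    constructor
    · rintro (⟨a, b⟩ | ⟨a, b⟩) (⟨c, d⟩ | ⟨c, d⟩) h <;> simp only [Sum.elim_inl, Sum.elim_inr, Prod.mk.injEq] at h
      · rw [show a = c by omega, show b = d by omega]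
      · omega
      · omega
      · rw [show a = c by omega, show b = d by omega]
    · rintro ⟨m, n⟩
      rcases Int.even_or_odd' (m + n) with ⟨s, h | h⟩
      · exact ⟨Sum.inl (s - 1, m - s), by simp only [Sum.elim_inl, Prod.mk.injEq]; constructor <;> omega⟩
      · exact ⟨Sum.inr (s, m - s - 1), by simp only [Sum.elim_inr, Prod.mk.injEq]; constructor <;> omega⟩)

theorem pairEquiv_inl (s d : ℤ) : pairEquiv (Sum.inl (s, d)) = (s + 1 + d, s + 1 - d) := rfl

theorem pairEquiv_inr (s d : ℤ) : pairEquiv (Sum.inr (s, d)) = (s + d + 1, s - d) := rfl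

theorem jt_mul_jt (h0 : Q ≠ 0) (h1 : ‖Q‖ < 1) {a b : ℂ} (ha : a ≠ 0) (hb : b ≠ 0) :
    jt Q (a * b) * jt Q (a / b) = a * (thG Q a * thF Q b - thF Q a * thG Q b) := by
  have s1 := (summable_jt h0 h1 (mul_ne_zero ha hb)).norm
  have s2 := (summable_jt h0 h1 (div_ne_zero ha hb)).norm
  have e : HasSum (fun p : (ℤ × ℤ) ⊕ (ℤ × ℤ) => (fun q : ℤ × ℤ => ((-1) ^ q.1 * Q ^ tri q.1 * (a * b) ^ q.1) *
      ((-1) ^ q.2 * Q ^ tri q.2 * (a / b) ^ q.2)) (pairEquiv p)) (jt Q (a * b) * jt Q (a / b)) := by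
    rw [jt, jt, tsum_mul_tsum_of_summable_norm s1 s2]
    exact (pairEquiv.hasSum_iff).mpr (summable_mul_of_summable_norm s1 s2).hasSum
  have sGa := summable_thG h0 h1 ha
  have sGb := summable_thG h0 h1 hb
  have sFa := summable_thF h0 h1 ha
  have sFb := summable_thF h0 h1 hb
  have r1 : HasSum (fun p : ℤ × ℤ => a * ((Q ^ (p.1 * p.1 + p.1) * a ^ (2 * p.1 + 1)) * (Q ^ (p.2 * p.2) * b ^ (2 * p.2))))
      (a * (thG Q a * thF Q b)) := by
    rw [thG, thF, tsum_mul_tsum_of_summable_norm sGa sFb]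
    exact (summable_mul_of_summable_norm sGa sFb).hasSum.mul_left _
  have r2 : HasSum (fun p : ℤ × ℤ => -a * ((Q ^ (p.1 * p.1) * a ^ (2 * p.1)) * (Q ^ (p.2 * p.2 + p.2) * b ^ (2 * p.2 + 1))))
      (-a * (thF Q a * thG Q b)) := by
    rw [thG, thF, tsum_mul_tsum_of_summable_norm sFa sGb]
    exact (summable_mul_of_summable_norm sFa sGb).hasSum.mul_left _
  have q1 : ∀ m n : ℤ, (-1 : ℂ) ^ m * Q ^ tri m * (a * b) ^ m * ((-1) ^ n * Q ^ tri n * (a / b) ^ n) =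
      (-1) ^ (m + n) * Q ^ (tri m + tri n) * (a ^ (m + n) * b ^ (m - n)) := by
    intro m n
    rw [zpow_add₀ (by norm_num : (-1 : ℂ) ≠ 0), zpow_add₀ h0, zpow_add₀ ha, zpow_sub₀ hb, mul_zpow, div_zpow]
    ring
  rw [mul_sub]
  have t2 := r1.sum (f := Sum.elim _ _) (h₂ := r2)
  rw [sub_eq_add_neg, ← neg_mul]
  refine e.unique (t2.congr_fun ?_)
  rintro (⟨s, d⟩ | ⟨s, d⟩)
  · simp only [Sum.elim_inl, pairEquiv_inl, q1]
    rw [show tri (s + 1 + d) + tri (s + 1 - d) = (s * s + s) + d * d by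
      have h1 := two_tri (s + 1 + d); have h2 := two_tri (s + 1 - d); nlinarith,
      show s + 1 + d + (s + 1 - d) = 2 * s + 1 + 1 by ring, show s + 1 + d - (s + 1 - d) = 2 * d by ring,
      zpow_add₀ h0 (s * s + s), zpow_add₀ ha (2 * s + 1) 1, zpow_one, Even.neg_one_zpow (⟨s + 1, by ring⟩ : Even (2 * s + 1 + 1))]
    ring
  · simp only [Sum.elim_inr, pairEquiv_inr, q1]
    rw [show tri (s + d + 1) + tri (s - d) = s * s + (d * d + d) by
      have h1 := two_tri (s + d + 1); have h2 := two_tri (s - d); nlinarith,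
      show s + d + 1 + (s - d) = 2 * s + 1 by ring, show s + d + 1 - (s - d) = 2 * d + 1 by ring,
      zpow_add₀ h0 (s * s), zpow_add₀ ha (2 * s) 1, zpow_one, Odd.neg_one_zpow (⟨s, by ring⟩ : Odd (2 * s + 1))]
    ring

theorem qpi_mul_qpi_neg (h1 : ‖Q‖ < 1) (z : ℂ) : qpi Q z * qpi Q (-z) = qpi (Q ^ 2) (z ^ 2) := by
  rw [qpi, qpi, ← (multipliable_qpi h1 z).tprod_mul (multipliable_qpi h1 (-z)), qpi]
  refine tprod_congr fun i => ?_
  rw [← pow_mul, mul_comm 2 i, pow_mul]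
  ring

theorem qpi_split (h1 : ‖Q‖ < 1) (z : ℂ) : qpi Q z = qpi (Q ^ 2) z * qpi (Q ^ 2) (z * Q) := by
  have h2 : ‖Q ^ 2‖ < 1 := by rw [norm_pow]; exact pow_lt_one₀ (norm_nonneg _) h1 two_ne_zero
  have m1 : Multipliable fun k : ℕ => 1 - z * Q ^ (2 * k) :=
    (multipliable_qpi h2 z).congr fun k => by rw [pow_mul]
  have m2 : Multipliable fun k : ℕ => 1 - z * Q ^ (2 * k + 1) :=
    (multipliable_qpi h2 (z * Q)).congr fun k => by rw [pow_succ Q (2 * k), pow_mul]; ring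
  rw [qpi, ← tprod_even_mul_odd (f := fun i => 1 - z * Q ^ i) m1 m2, qpi, qpi]
  congr 1
  · exact tprod_congr fun k => by rw [pow_mul]
  · exact tprod_congr fun k => by rw [pow_succ Q (2 * k), pow_mul]; ring

theorem norm_sq_lt_one {p : ℂ} (h1 : ‖p‖ < 1) : ‖p ^ 2‖ < 1 := by
  rw [norm_pow]; exact pow_lt_one₀ (norm_nonneg _) h1 two_ne_zero

theorem jt_duplication {p : ℂ} (h0 : p ≠ 0) (h1 : ‖p‖ < 1) {x : ℂ} (hx : x ≠ 0) :
    qpi (p ^ 2) (p ^ 2) ^ 3 * jt (p ^ 2) (x ^ 2) =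
      jt (p ^ 2) x * jt (p ^ 2) (-x) * jt (p ^ 2) (p * x) * jt (p ^ 2) (-(p * x)) := by
  have H0 := pow_ne_zero 2 h0
  have H1 := norm_sq_lt_one h1
  have key : ∀ z : ℂ, qpi (p ^ 2) z * qpi (p ^ 2) (-z) * qpi (p ^ 2) (p * z) * qpi (p ^ 2) (-(p * z)) =
      qpi (p ^ 2) (z ^ 2) := by
    intro z
    rw [← qpi_mul_qpi_neg h1 z, qpi_split h1 z, qpi_split h1 (-z), mul_comm z p, neg_mul, mul_comm z p]
    ring
  rw [jt_eq_prod H0 H1 hx, jt_eq_prod H0 H1 (pow_ne_zero 2 hx), jt_eq_prod H0 H1 (neg_ne_zero.mpr hx),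
    jt_eq_prod H0 H1 (mul_ne_zero h0 hx), jt_eq_prod H0 H1 (neg_ne_zero.mpr (mul_ne_zero h0 hx)),
    ← key x, show p ^ 2 / x ^ 2 = (p / x) ^ 2 by ring, ← key (p / x),
    show p ^ 2 / x = p * (p / x) by ring, show p ^ 2 / -x = -(p * (p / x)) by rw [div_neg]; ring,
    show p ^ 2 / (p * x) = p / x by field_simp, show p ^ 2 / -(p * x) = -(p / x) by rw [div_neg]; field_simp]
  ring

theorem jt_half_periods {p : ℂ} (h0 : p ≠ 0) (h1 : ‖p‖ < 1) :
    jt (p ^ 2) (-1) * jt (p ^ 2) p * jt (p ^ 2) (-p) = 2 * qpi (p ^ 2) (p ^ 2) ^ 3 := by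
  have H0 := pow_ne_zero 2 h0
  have H1 := norm_sq_lt_one h1
  have s1 : qpi (p ^ 2) (-1) = 2 * qpi (p ^ 2) (-p ^ 2) := by
    have m : Multipliable fun k : ℕ => 1 - (-1) * (p ^ 2) ^ (k + 1) :=
      (multipliable_qpi H1 (-p ^ 2)).congr fun k => by ring
    have e := tprod_eq_zero_mul' (f := fun k : ℕ => 1 - (-1) * (p ^ 2) ^ k) m
    rw [qpi, e, qpi, pow_zero]
    congr 1
    · norm_num
    · exact tprod_congr fun k => by ring
  have s2 := qpi_mul_qpi_neg H1 p
  have s3 := qpi_mul_qpi_neg H1 (p ^ 2)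
  have s4 := qpi_split H1 (p ^ 2)
  have e : qpi (p ^ 2) (-p ^ 2) * (qpi (p ^ 2) p * qpi (p ^ 2) (-p)) = 1 := by
    apply mul_left_cancel₀ (qpi_self_ne_zero H1)
    rw [s2, ← mul_assoc, s3, s4, ← pow_two (p ^ 2)]
    ring
  rw [jt_eq_prod H0 H1 (by norm_num), jt_eq_prod H0 H1 h0, jt_eq_prod H0 H1 (neg_ne_zero.mpr h0), s1,
    show p ^ 2 / -1 = -p ^ 2 by ring, show p ^ 2 / p = p by field_simp, show p ^ 2 / -p = -p by rw [div_neg]; field_simp]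
  linear_combination 2 * qpi (p ^ 2) (p ^ 2) ^ 3 * (qpi (p ^ 2) (-p ^ 2) * (qpi (p ^ 2) p * qpi (p ^ 2) (-p)) + 1) * e

theorem exists_lower_bound (h0 : Q ≠ 0) (h1 : ‖Q‖ < 1) {x : ℂ} (hx : NP Q x) :
    ∃ c : ℝ, 0 < c ∧ ∀ n : ℤ, c ≤ ‖1 - x * Q ^ n‖ ∧ c * ‖Q ^ n‖ ≤ ‖1 - x * Q ^ n‖ := by
  obtain ⟨C, hC, hb⟩ := exists_inv_bound h0 h1 hx.1 hx.2
  obtain ⟨C', hC', hb'⟩ := exists_inv_bound h0 h1 (hx.inv h0).1 (hx.inv h0).2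
  have hx0 : 0 < ‖x‖ := norm_pos_iff.mpr hx.1
  have key : ∀ {K : ℝ} {w : ℂ}, 0 < K → w ≠ 0 → ‖w⁻¹‖ ≤ K → K⁻¹ ≤ ‖w‖ := by
    intro K w hK hw h
    rw [norm_inv] at h
    exact inv_le_of_inv_le₀ (norm_pos_iff.mpr hw) h
  refine ⟨min C⁻¹ (C'⁻¹ * ‖x‖), by positivity, fun n => ⟨(min_le_left _ _).trans (key hC (hx.sub_ne n) (hb n)), ?_⟩⟩
  have e : 1 - x * Q ^ n = -(1 - x⁻¹ * Q ^ (-n)) * x * Q ^ n := by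
    have := zpow_ne_zero n h0
    have := hx.1
    rw [zpow_neg]
    field_simp
    ring
  rw [e, norm_mul, norm_mul, norm_neg]
  gcongr
  exact (min_le_right _ _).trans (mul_le_mul_of_nonneg_right (key hC' ((hx.inv h0).sub_ne _) (hb' _)) hx0.le)

theorem lower_bound_one (h0 : Q ≠ 0) (h1 : ‖Q‖ < 1) {n : ℤ} (hn : n ≠ 0) :
    1 - ‖Q‖ ≤ ‖1 - 1 * Q ^ n‖ ∧ (1 - ‖Q‖) * ‖Q ^ n‖ ≤ ‖1 - 1 * Q ^ n‖ := by
  have key : ∀ k : ℕ, 1 - ‖Q‖ ≤ ‖1 - Q ^ (k + 1)‖ := by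
    intro k
    have h := norm_sub_norm_le (1 : ℂ) (Q ^ (k + 1))
    rw [norm_one, norm_pow] at h
    have : ‖Q‖ ^ (k + 1) ≤ ‖Q‖ := by
      rw [pow_succ]; exact mul_le_of_le_one_left (norm_nonneg _) (pow_le_one₀ (norm_nonneg _) h1.le)
    linarith
  have hq : 0 < ‖Q‖ := norm_pos_iff.mpr h0
  rw [one_mul]
  rcases lt_or_gt_of_ne hn with h | h
  · obtain ⟨k, hk⟩ := Int.eq_negSucc_of_lt_zero h
    rw [hk, zpow_negSucc]
    have hp := pow_pos hq (k + 1)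
    have e : 1 - (Q ^ (k + 1))⁻¹ = -(1 - Q ^ (k + 1)) * (Q ^ (k + 1))⁻¹ := by field_simp; ring
    have h3 : 1 ≤ ‖(Q ^ (k + 1))⁻¹‖ := by
      rw [norm_inv, norm_pow]
      exact one_le_inv_iff₀.mpr ⟨hp, pow_le_one₀ hq.le h1.le⟩
    rw [e, norm_mul, norm_neg]
    refine ⟨?_, by gcongr; exact key k⟩
    nlinarith [key k, norm_nonneg (1 - Q ^ (k + 1))]
  · obtain ⟨k, rfl⟩ : ∃ k : ℕ, n = (k + 1 : ℕ) := ⟨(n - 1).toNat, by omega⟩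
    rw [zpow_natCast]
    refine ⟨key k, ?_⟩
    have : ‖Q ^ (k + 1)‖ ≤ 1 := by rw [norm_pow]; exact pow_le_one₀ hq.le h1.le
    nlinarith [key k]

theorem norm_one_sub_ge {x x₀ w : ℂ} {c : ℝ} (hc : c ≤ ‖1 - x₀ * w‖) (hc' : c * ‖w‖ ≤ ‖1 - x₀ * w‖)
    (hx : ‖x - x₀‖ ≤ c / 2) : c / 2 ≤ ‖1 - x * w‖ ∧ c / 2 * ‖w‖ ≤ ‖1 - x * w‖ := by
  have e : 1 - x * w = (1 - x₀ * w) - (x - x₀) * w := by ring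
  have h := norm_sub_norm_le (1 - x₀ * w) ((x - x₀) * w)
  rw [← e, norm_mul] at h
  have := mul_le_mul_of_nonneg_right hx (norm_nonneg w)
  constructor <;> linarith

theorem tendsto_tsum_div (h1 : ‖Q‖ < 1) {x₀ : ℂ} {f : ℤ → ℂ} (hf : Summable fun n => ‖f n‖)
    {c : ℝ} (hc : 0 < c)
    (hb : ∀ n : ℤ, f n ≠ 0 → c ≤ ‖1 - x₀ * Q ^ n‖ ∧ c * ‖Q ^ n‖ ≤ ‖1 - x₀ * Q ^ n‖) :
    Tendsto (fun x => ∑' n : ℤ, f n / (1 - x * Q ^ n)) (𝓝 x₀) (𝓝 (∑' n : ℤ, f n / (1 - x₀ * Q ^ n))) := by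
  refine tendsto_tsum_of_dominated_convergence (bound := fun n => ‖f n‖ * (c / 2)⁻¹) (hf.mul_right _) ?_ ?_
  · intro n
    rcases eq_or_ne (f n) 0 with h | h
    · simp [h]
    · refine Tendsto.div tendsto_const_nhds ?_ (norm_pos_iff.mp (hc.trans_le (hb n h).1))
      exact tendsto_const_nhds.sub (tendsto_id.mul_const _)
  · have : ∀ᶠ x in 𝓝 x₀, ‖x - x₀‖ < c / 2 := by
      have := Metric.ball_mem_nhds x₀ (half_pos hc)
      filter_upwards [this] with x hx
      rwa [Metric.mem_ball, dist_eq_norm] at hx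
    filter_upwards [this] with x hx n
    rcases eq_or_ne (f n) 0 with h | h
    · simp [h]
    · rw [norm_div, div_eq_mul_inv]
      gcongr
      exact (norm_one_sub_ge (hb n h).1 (hb n h).2 hx.le).1

theorem NP.of_jt_ne_zero (h0 : Q ≠ 0) {x : ℂ} (hx : x ≠ 0) (h : jt Q x ≠ 0) : NP Q x := by
  refine ⟨hx, fun n hn => h ?_⟩
  have : x = Q ^ (-n) := by rw [zpow_neg]; exact eq_inv_of_mul_eq_one_left hn
  rw [this, jt_zpow h0]

theorem NP.eventually (h0 : Q ≠ 0) (h1 : ‖Q‖ < 1) {x : ℂ} (hx : NP Q x) : ∀ᶠ z in 𝓝 x, NP Q z := by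
  have h := (differentiableAt_jt h0 h1 hx.1).continuousAt.eventually_ne (jt_ne h0 h1 hx)
  filter_upwards [h, continuousAt_id.eventually_ne hx.1] with z hz hz0
  exact NP.of_jt_ne_zero h0 hz0 hz

theorem eventually_NP_one (h0 : Q ≠ 0) (h1 : ‖Q‖ < 1) : ∀ᶠ z in 𝓝[≠] (1 : ℂ), NP Q z := by
  have hc : 0 < (1 - ‖Q‖) / 2 := by linarith
  have : ∀ᶠ x in 𝓝 (1 : ℂ), ‖x - 1‖ < (1 - ‖Q‖) / 2 := by
    filter_upwards [Metric.ball_mem_nhds (1 : ℂ) hc] with x hx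
    rwa [Metric.mem_ball, dist_eq_norm] at hx
  filter_upwards [self_mem_nhdsWithin, mem_nhdsWithin_of_mem_nhds this,
    mem_nhdsWithin_of_mem_nhds (continuousAt_id.eventually_ne one_ne_zero)] with x hx1 hx hx0
  refine ⟨hx0, fun n hn => ?_⟩
  rcases eq_or_ne n 0 with rfl | h
  · simp at hn
    exact hx1 hn
  · have := (norm_one_sub_ge (lower_bound_one h0 h1 h).1 (lower_bound_one h0 h1 h).2 hx.le).1
    rw [hn, sub_self, norm_zero] at this
    linarith

theorem tendsto_tail (h0 : Q ≠ 0) (h1 : ‖Q‖ < 1) {f : ℤ → ℂ} (hf : Summable fun n => ‖f n‖) (hf0 : f 0 = 0) :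
    Tendsto (fun x => ∑' n : ℤ, f n / (1 - x * Q ^ n)) (𝓝 1) (𝓝 (∑' n : ℤ, f n / (1 - Q ^ n))) := by
  have := tendsto_tsum_div (x₀ := 1) h1 hf (c := 1 - ‖Q‖) (by linarith)
    (fun n hn => lower_bound_one h0 h1 (fun h => hn (by rw [h, hf0])))
  simpa using this

theorem tendsto_App (h0 : Q ≠ 0) (h1 : ‖Q‖ < 1) {x w : ℂ} (hx : NP Q x) (hw : w ≠ 0) :
    Tendsto (fun z => App Q z w) (𝓝 x) (𝓝 (App Q x w)) := by
  obtain ⟨c, hc, hb⟩ := exists_lower_bound h0 h1 hx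
  exact tendsto_tsum_div h1 (summable_norm_coef h0 h1 (k := 3) (by norm_num) hw 3 _ norm_neg_one_zpow) hc
    fun n _ => hb n

/-- `jt` divided by its zero at `1`. -/
noncomputable def jq (Q x : ℂ) : ℂ := dslope (jt Q) 1 x

theorem jt_eq_mul_jq (h0 : Q ≠ 0) (x : ℂ) : jt Q x = (x - 1) * jq Q x := by
  have := sub_smul_dslope (jt Q) 1 x
  rw [jt_one h0, sub_zero, smul_eq_mul] at this
  exact this.symm

theorem differentiableAt_jq (h0 : Q ≠ 0) (h1 : ‖Q‖ < 1) : DifferentiableAt ℂ (jq Q) 1 := by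
  have hs : ({0}ᶜ : Set ℂ) ∈ 𝓝 (1 : ℂ) := isOpen_compl_singleton.mem_nhds (by simp)
  have : DifferentiableOn ℂ (jt Q) {0}ᶜ := fun x hx => (differentiableAt_jt h0 h1 hx).differentiableWithinAt
  exact ((Complex.differentiableOn_dslope hs).mpr this).differentiableAt hs

theorem jq_inv (h0 : Q ≠ 0) {x : ℂ} (hx : x ≠ 0) : jq Q x⁻¹ = jq Q x := by
  rcases eq_or_ne x 1 with rfl | h
  · simp
  · have h1 := jt_inv h0 hx
    rw [jt_eq_mul_jq h0, jt_eq_mul_jq h0] at h1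
    have : x - 1 ≠ 0 := sub_ne_zero.mpr h
    have e : x⁻¹ - 1 = -x⁻¹ * (x - 1) := by field_simp; ring
    rw [e, mul_assoc] at h1
    exact mul_left_cancel₀ this (mul_left_cancel₀ (neg_ne_zero.mpr (inv_ne_zero hx)) h1)

theorem hasDerivAt_jq (h0 : Q ≠ 0) (h1 : ‖Q‖ < 1) : HasDerivAt (jq Q) 0 1 := by
  have h := (differentiableAt_jq h0 h1).hasDerivAt
  have hi : HasDerivAt (fun x : ℂ => x⁻¹) (-1) 1 := by simpa using hasDerivAt_inv (one_ne_zero (α := ℂ))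
  have h2 : HasDerivAt (fun x : ℂ => jq Q x⁻¹) (deriv (jq Q) 1 * (-1)) 1 := by
    refine HasDerivAt.comp (h₂ := jq Q) 1 ?_ hi
    rwa [inv_one]
  have h3 : HasDerivAt (jq Q) (deriv (jq Q) 1 * (-1)) 1 := by
    refine h2.congr_of_eventuallyEq ?_
    filter_upwards [continuousAt_id.eventually_ne (one_ne_zero (α := ℂ))] with x hx
    exact (jq_inv h0 hx).symm
  have e := h.unique h3
  have : deriv (jq Q) 1 = 0 := by linear_combination e / 2
  rwa [this] at h

theorem jq_one (h0 : Q ≠ 0) (h1 : ‖Q‖ < 1) : jq Q 1 = -qpi Q Q ^ 3 := by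
  let f : ℤ → ℂ := fun n => if n = 0 then 0 else (-1) ^ n * Q ^ (tri n + n)
  have hf : Summable fun n => ‖f n‖ := by
    refine Summable.of_nonneg_of_le (fun _ => norm_nonneg _) (fun n => ?_) (summable_norm_u h0 h1)
    dsimp only [f]
    split_ifs
    · rw [norm_zero]; exact norm_nonneg _
    · exact le_rfl
  have t := tendsto_tail h0 h1 hf (by simp [f])
  have cj := (differentiableAt_jt h0 h1 (one_ne_zero)).continuousAt.tendsto
  have cq := (differentiableAt_jq h0 h1).continuousAt.tendsto
  have lim := (cq.neg.add (cj.mul t)).mono_left (nhdsWithin_le_nhds (s := {1}ᶜ))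
  rw [jt_one h0, zero_mul, add_zero] at lim
  have lim2 : Tendsto (fun _ : ℂ => qpi Q Q ^ 3) (𝓝[≠] 1) (𝓝 (-jq Q 1)) := by
    refine lim.congr' ?_
    filter_upwards [eventually_NP_one h0 h1] with x hx
    have r := recip_jt h0 h1 hx.1 hx.2
    have j0 := jt_ne h0 h1 hx
    rw [eq_div_iff j0] at r
    rw [← r, (summable_norm_div h0 h1 hx (summable_norm_u h0 h1)).of_norm.tsum_eq_add_tsum_ite 0, add_mul,
      mul_comm _ (jt Q x), mul_comm _ (jt Q x)]
    congr 1
    · have := hx.sub_ne 0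
      rw [zpow_zero, mul_one] at this
      rw [jt_eq_mul_jq h0, zpow_zero, zpow_zero, tri_zero]
      simp only [add_zero, zpow_zero, mul_one]
      field_simp
      ring
    · congr 1
      refine tsum_congr fun n => ?_
      dsimp only [f]
      split_ifs <;> simp
  have := tendsto_nhds_unique lim2 tendsto_const_nhds
  rw [← this, neg_neg]

/-- The logarithmic derivative of `jt`. -/
noncomputable def lam (Q x : ℂ) : ℂ := x * deriv (jt Q) x / jt Q x

theorem lam_inv (h0 : Q ≠ 0) (h1 : ‖Q‖ < 1) {x : ℂ} (hx : NP Q x) : lam Q x⁻¹ = 1 - lam Q x := by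
  have x0 := hx.1
  have d1 : HasDerivAt (fun z => jt Q z⁻¹) (deriv (jt Q) x⁻¹ * -(x ^ 2)⁻¹) x :=
    HasDerivAt.comp (h₂ := jt Q) x (differentiableAt_jt h0 h1 (inv_ne_zero x0)).hasDerivAt (hasDerivAt_inv x0)
  have d2 : HasDerivAt (fun z => -z⁻¹ * jt Q z) (-(-(x ^ 2)⁻¹) * jt Q x + -x⁻¹ * deriv (jt Q) x) x :=
    (hasDerivAt_inv x0).neg.mul (differentiableAt_jt h0 h1 x0).hasDerivAt
  have d3 : HasDerivAt (fun z => jt Q z⁻¹) (-(-(x ^ 2)⁻¹) * jt Q x + -x⁻¹ * deriv (jt Q) x) x := by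
    refine d2.congr_of_eventuallyEq ?_
    filter_upwards [continuousAt_id.eventually_ne x0] with z hz
    exact jt_inv h0 hz
  have e := d1.unique d3
  have j0 := jt_ne h0 h1 hx
  rw [lam, lam, jt_inv h0 x0]
  have e2 : deriv (jt Q) x⁻¹ = -jt Q x + x * deriv (jt Q) x := by
    generalize deriv (jt Q) x⁻¹ = d at e ⊢
    field_simp at e
    linear_combination -e
  rw [e2]
  field_simp
  ring

theorem lam_mul (h0 : Q ≠ 0) (h1 : ‖Q‖ < 1) {x : ℂ} (hx : NP Q x) : lam Q (x * Q) = lam Q x - 1 := by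
  have x0 := hx.1
  have f : ∀ {z : ℂ}, z ≠ 0 → jt Q (z * Q) = -z⁻¹ * jt Q z := by
    intro z hz
    have := jt_mul_zpow h0 hz 1
    simpa [tri_one] using this
  have d1 : HasDerivAt (fun z => jt Q (z * Q)) (deriv (jt Q) (x * Q) * Q) x := by
    refine HasDerivAt.comp (h₂ := jt Q) x (differentiableAt_jt h0 h1 (mul_ne_zero x0 h0)).hasDerivAt ?_
    simpa using (hasDerivAt_id x).mul_const Q
  have d2 : HasDerivAt (fun z => -z⁻¹ * jt Q z) (-(-(x ^ 2)⁻¹) * jt Q x + -x⁻¹ * deriv (jt Q) x) x :=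
    (hasDerivAt_inv x0).neg.mul (differentiableAt_jt h0 h1 x0).hasDerivAt
  have d3 : HasDerivAt (fun z => jt Q (z * Q)) (-(-(x ^ 2)⁻¹) * jt Q x + -x⁻¹ * deriv (jt Q) x) x := by
    refine d2.congr_of_eventuallyEq ?_
    filter_upwards [continuousAt_id.eventually_ne x0] with z hz
    exact f hz
  have e := d1.unique d3
  have j0 := jt_ne h0 h1 hx
  rw [lam, lam, f x0, mul_assoc, mul_comm Q, e]
  field_simp
  ring

/-- The level three Appell sum at its pole, with the singular term removed. -/
noncomputable def AppPole (Q w : ℂ) : ℂ :=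
  ∑' n : ℤ, if n = 0 then 0 else (-1) ^ n * Q ^ (3 * tri n + 3 * n) * w ^ n / (1 - Q ^ n)

theorem App_eq_add_tail (h0 : Q ≠ 0) (h1 : ‖Q‖ < 1) {x w : ℂ} (hx : NP Q x) (hw : w ≠ 0) :
    App Q x w = 1 / (1 - x) +
      ∑' n : ℤ, (if n = 0 then 0 else (-1) ^ n * Q ^ (3 * tri n + 3 * n) * w ^ n) / (1 - x * Q ^ n) := by
  have s : Summable fun n : ℤ => (-1) ^ n * Q ^ (3 * tri n + 3 * n) * w ^ n / (1 - x * Q ^ n) :=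
    (summable_norm_div h0 h1 hx (summable_norm_coef h0 h1 (k := 3) (by norm_num) hw 3 _
      norm_neg_one_zpow)).of_norm
  rw [App, s.tsum_eq_add_tsum_ite 0]
  congr 1
  · simp [tri_zero]
  · refine tsum_congr fun n => ?_
    split_ifs <;> simp

theorem summable_tail_coef (h0 : Q ≠ 0) (h1 : ‖Q‖ < 1) {w : ℂ} (hw : w ≠ 0) :
    Summable fun n : ℤ => ‖(if n = 0 then 0 else (-1 : ℂ) ^ n * Q ^ (3 * tri n + 3 * n) * w ^ n)‖ := by
  refine Summable.of_nonneg_of_le (fun _ => norm_nonneg _) (fun n => ?_)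
    (summable_norm_coef h0 h1 (k := 3) (by norm_num) hw 3 _ norm_neg_one_zpow)
  split_ifs
  · rw [norm_zero]; exact norm_nonneg _
  · exact le_rfl

theorem App_polar_relation (h0 : Q ≠ 0) (h1 : ‖Q‖ < 1) {ζ : ℂ} (hζ : NP Q ζ) (hζ2 : NP Q (ζ ^ 2)) :
    AppPole Q (ζ ^ 3)⁻¹ + ζ ^ 3 * App Q (ζ ^ 2) (ζ ^ 3) =
      ζ * jt Q (ζ ^ 2) / jt Q ζ * App Q ζ 1 + (lam Q ζ + lam Q (ζ ^ 2)) := by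
  have ζ0 := hζ.1
  have j1 := jt_ne h0 h1 hζ
  have j2 := jt_ne h0 h1 hζ2
  have hD : qpi Q Q ^ 3 ≠ 0 := pow_ne_zero _ (qpi_self_ne_zero h1)
  have jq1 := jq_one h0 h1
  obtain ⟨D, hDdef⟩ : ∃ D, D = qpi Q Q ^ 3 := ⟨_, rfl⟩
  rw [← hDdef] at hD jq1
  have cont : ContinuousAt (fun x : ℂ => x * ζ) 1 := by fun_prop
  have cont2 : ContinuousAt (fun x : ℂ => x * ζ ^ 2) 1 := by fun_prop
  have hw : (ζ ^ 3)⁻¹ ≠ 0 := inv_ne_zero (pow_ne_zero _ ζ0)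
  -- the regular part of the product term
  let h : ℂ → ℂ := fun x => -D * jt Q ζ * jt Q (ζ ^ 2) / (jq Q x * (jt Q (x * ζ) * jt Q (x * ζ ^ 2)))
  have h_one : h 1 = 1 := by
    simp only [h, one_mul]
    rw [jq1]
    field_simp
  have dj : ∀ {a : ℂ}, a ≠ 0 → HasDerivAt (fun x => jt Q (x * a)) (deriv (jt Q) a * a) 1 := by
    intro a ha
    have h2 : HasDerivAt (fun x : ℂ => x * a) a 1 := by simpa using (hasDerivAt_id (1 : ℂ)).mul_const a
    refine HasDerivAt.comp (h₂ := jt Q) 1 ?_ h2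
    rw [one_mul]
    exact (differentiableAt_jt h0 h1 ha).hasDerivAt
  have dh : HasDerivAt h (-(lam Q ζ + lam Q (ζ ^ 2))) 1 := by
    have d := (hasDerivAt_const (1 : ℂ) (-D * jt Q ζ * jt Q (ζ ^ 2))).fun_div
      ((hasDerivAt_jq h0 h1).fun_mul ((dj ζ0).fun_mul (dj (pow_ne_zero 2 ζ0)))) (by
        rw [one_mul, one_mul, jq1]
        exact mul_ne_zero (neg_ne_zero.mpr hD) (mul_ne_zero j1 j2))
    refine d.congr_deriv ?_
    rw [one_mul, one_mul, jq1, lam, lam]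
    clear hDdef
    field_simp
    ring
  have slope_lim : Tendsto (fun x => (x - 1)⁻¹ * (h x - 1)) (𝓝[≠] 1) (𝓝 (-(lam Q ζ + lam Q (ζ ^ 2)))) := by
    have := hasDerivAt_iff_tendsto_slope.mp dh
    refine this.congr fun x => ?_
    rw [slope_def_field, h_one, div_eq_inv_mul]
  have lim1 := (tendsto_tail h0 h1 (summable_tail_coef h0 h1 hw) (by simp)).mono_left
    (nhdsWithin_le_nhds (s := {1}ᶜ))
  have e1 : (∑' n : ℤ, (if n = 0 then 0 else (-1) ^ n * Q ^ (3 * tri n + 3 * n) * (ζ ^ 3)⁻¹ ^ n) / (1 - Q ^ n)) =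
      AppPole Q (ζ ^ 3)⁻¹ := by
    refine tsum_congr fun n => ?_
    split_ifs <;> simp
  rw [e1] at lim1
  have c1 : Tendsto (fun x : ℂ => x * ζ) (𝓝 1) (𝓝 ζ) := by simpa [ContinuousAt] using cont
  have c2 : Tendsto (fun x : ℂ => x * ζ ^ 2) (𝓝 1) (𝓝 (ζ ^ 2)) := by simpa [ContinuousAt] using cont2
  have lim2 := ((tendsto_App h0 h1 hζ2 (pow_ne_zero 3 ζ0)).comp c2).mono_left (nhdsWithin_le_nhds (s := {1}ᶜ))
  have lim3 := ((tendsto_App h0 h1 hζ one_ne_zero).comp c1).mono_left (nhdsWithin_le_nhds (s := {1}ᶜ))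
  have lim := (lim1.add (lim2.const_mul (ζ ^ 3))).sub ((lim3.const_mul (ζ * jt Q (ζ ^ 2) / jt Q ζ)).sub slope_lim)
  have z : Tendsto (fun _ : ℂ => (0 : ℂ)) (𝓝[≠] (1 : ℂ)) (𝓝 (AppPole Q (ζ ^ 3)⁻¹ + ζ ^ 3 * App Q (ζ ^ 2) (ζ ^ 3) -
      (ζ * jt Q (ζ ^ 2) / jt Q ζ * App Q ζ 1 - -(lam Q ζ + lam Q (ζ ^ 2))))) := by
    refine lim.congr' ?_
    filter_upwards [eventually_NP_one h0 h1, self_mem_nhdsWithin,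
      mem_nhdsWithin_of_mem_nhds (c1.eventually (hζ.eventually h0 h1)),
      mem_nhdsWithin_of_mem_nhds (c2.eventually (hζ2.eventually h0 h1))] with x hx hx1 n1 n2
    have a1 : x * ζ / ζ = x := by field_simp
    have a2 : x * ζ * ζ = x * ζ ^ 2 := by ring
    have r := app_relation h0 h1 (z := x * ζ) (ζ := ζ) n1 (by rwa [a1]) (by rwa [a2]) hζ hζ2
    rw [a1, a2, App_eq_add_tail h0 h1 hx hw, ← hDdef] at r
    have x1 : x - 1 ≠ 0 := sub_ne_zero.mpr hx1
    have x2 : 1 - x ≠ 0 := fun hh => x1 (by linear_combination -hh)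
    have jx := jt_ne h0 h1 hx
    have jx1 := jt_ne h0 h1 n1
    have jx2 := jt_ne h0 h1 n2
    rw [jt_eq_mul_jq h0 x] at jx
    have jqx : jq Q x ≠ 0 := right_ne_zero_of_mul jx
    have e2 : D * jt Q ζ * jt Q (ζ ^ 2) / (jt Q x * jt Q (x * ζ) * jt Q (x * ζ ^ 2)) - 1 / (1 - x) =
        -((x - 1)⁻¹ * (h x - 1)) := by
      rw [jt_eq_mul_jq h0 x]
      simp only [h]
      have : 1 - x = -(x - 1) := by ring
      rw [this]
      clear hDdef
      field_simp
      ring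
    simp only [Function.comp_apply]
    linear_combination r + e2
  have := tendsto_nhds_unique z tendsto_const_nhds
  linear_combination this

/-- The four-point relation for the logarithmic derivative of `jt`. -/
theorem lam_four_point (h0 : Q ≠ 0) (h1 : ‖Q‖ < 1) {a b c : ℂ} (ha : NP Q a) (hb : NP Q b) (hc : NP Q c)
    (habc : NP Q (a * b * c)) :
    lam Q a + lam Q b + lam Q c - lam Q (a * b * c) =
      1 - qpi Q Q ^ 3 * (jt Q (a * b) * jt Q (a * c) * jt Q (b * c)) /
        (jt Q a * jt Q b * jt Q c * jt Q (a * b * c)) := by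
  have a0 := ha.1
  have b0 := hb.1
  have c0 := hc.1
  obtain ⟨w, hw⟩ := IsAlgClosed.exists_pow_nat_eq (a * b) (n := 2) (by norm_num)
  have w0 : w ≠ 0 := by
    rintro rfl
    exact mul_ne_zero a0 b0 (by rw [← hw]; norm_num)
  -- the quadratic relation between products of theta functions
  have pl : ∀ z : ℂ, z ≠ 0 → (jt Q (z * w) * jt Q (z / w)) * (jt Q (a / w * (w * c)) * jt Q (a / w / (w * c))) * w -
      (jt Q (z * (a / w)) * jt Q (z / (a / w))) * (jt Q (w * (w * c)) * jt Q (w / (w * c))) * (a / w) +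
      (jt Q (z * (w * c)) * jt Q (z / (w * c))) * (jt Q (w * (a / w)) * jt Q (w / (a / w))) * (a / w) = 0 := by
    intro z hz
    have u0 := div_ne_zero a0 w0
    have v0 := mul_ne_zero w0 c0
    rw [jt_mul_jt h0 h1 hz w0, jt_mul_jt h0 h1 u0 v0, jt_mul_jt h0 h1 hz u0, jt_mul_jt h0 h1 w0 v0,
      jt_mul_jt h0 h1 hz v0, jt_mul_jt h0 h1 w0 u0]
    ring
  have dj : ∀ {z k : ℂ}, z ≠ 0 → k ≠ 0 → HasDerivAt (fun x => jt Q (x * k)) (deriv (jt Q) (z * k) * k) z := by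
    intro z k hz hk
    have h2 : HasDerivAt (fun x : ℂ => x * k) k z := by simpa using (hasDerivAt_id z).mul_const k
    exact HasDerivAt.comp (h₂ := jt Q) z (differentiableAt_jt h0 h1 (mul_ne_zero hz hk)).hasDerivAt h2
  have dj1 : deriv (jt Q) 1 = -qpi Q Q ^ 3 := by
    rw [← jq_one h0 h1, jq, dslope_same]
  have n1 := jt_ne h0 h1 ha
  have n2 := jt_ne h0 h1 hb
  have n3 := jt_ne h0 h1 hc
  have n4 := jt_ne h0 h1 habc
  have m1 : w * (a / w) = a := by field_simp
  have m2 : w * (a / w)⁻¹ = b := by field_simp; exact hw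
  have m2' : w / (a / w) = b := by rw [div_eq_mul_inv, m2]
  have m3 : w * (w * c) = a * b * c := by rw [← hw]; ring
  have m4 : w * (w * c)⁻¹ = c⁻¹ := by field_simp
  have m4' : w / (w * c) = c⁻¹ := by field_simp
  have m5 : a / w * (w * c) = a * c := by field_simp
  have m6 : a / w / (w * c) = (b * c)⁻¹ := by
    rw [div_div, show w * (w * c) = a * (b * c) by rw [m3]; ring, div_mul_cancel_left₀ a0]
  have m7 : w * w = a * b := by rw [← hw]; ring
  have der := (((((dj w0 w0).fun_mul (dj w0 (inv_ne_zero w0))).mul_const (jt Q (a / w * (w * c)) * jt Q (a / w / (w * c)))).mul_const w).sub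
    ((((dj w0 (div_ne_zero a0 w0)).fun_mul (dj w0 (inv_ne_zero (div_ne_zero a0 w0)))).mul_const (jt Q (w * (w * c)) * jt Q (w / (w * c)))).mul_const (a / w))).add
    ((((dj w0 (mul_ne_zero w0 c0)).fun_mul (dj w0 (inv_ne_zero (mul_ne_zero w0 c0)))).mul_const (jt Q (w * (a / w)) * jt Q (w / (a / w)))).mul_const (a / w))
  have zero := (hasDerivAt_const w (0 : ℂ)).congr_of_eventuallyEq (f₁ := _) (by
    filter_upwards [continuousAt_id.eventually_ne w0] with z hz
    exact pl z hz)
  have e := HasDerivAt.unique (der.congr_of_eventuallyEq (by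
    filter_upwards with z
    simp only [Pi.add_apply, Pi.sub_apply, div_eq_mul_inv])) zero
  rw [m1, m2, m2', m3, m4, m4', m5, m6, m7, mul_inv_cancel₀ w0, dj1, jt_one h0, jt_inv h0 c0,
    jt_inv h0 (mul_ne_zero b0 c0)] at e
  have li := lam_inv h0 h1 hc
  have la : deriv (jt Q) a = lam Q a * jt Q a / a := by rw [lam]; field_simp
  have lb : deriv (jt Q) b = lam Q b * jt Q b / b := by rw [lam]; field_simp
  have labc : deriv (jt Q) (a * b * c) = lam Q (a * b * c) * jt Q (a * b * c) / (a * b * c) := by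
    rw [lam]; field_simp
  have lc : deriv (jt Q) c⁻¹ = -(1 - lam Q c) * jt Q c := by
    rw [← li, lam, jt_inv h0 c0]
    field_simp
  rw [lc, la, lb, labc] at e
  generalize lam Q (a * b * c) = l4, lam Q a = l1, lam Q b = l2, lam Q c = l3, jt Q (a * b * c) = j4,
    jt Q a = j1, jt Q b = j2, jt Q c = j3, jt Q (a * b) = k1, jt Q (a * c) = k2, jt Q (b * c) = k3,
    qpi Q Q ^ 3 = D at e n1 n2 n3 n4 ⊢
  clear la lb labc lc li der zero pl habc hb
  have hbw : b = w ^ 2 / a := by rw [hw]; field_simp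
  rw [hbw] at e
  field_simp at e ⊢
  refine mul_left_cancel₀ a0 ?_
  linear_combination e

end

/-- The theta function at `t ^ (264 * n)`, with nome `t ^ 2904`, in its odd normalization. -/
noncomputable def thv (t : ℂ) (n : ℤ) : ℂ := t ^ (363 - 132 * n) * jt (t ^ 2904) (t ^ (264 * n))

/-- The even theta function at `t ^ (264 * n)`. -/
noncomputable def thf (t : ℂ) (n : ℤ) : ℂ := thF (t ^ 2904) (t ^ (264 * n))

/-- The second even theta function at `t ^ (264 * n)`. -/
noncomputable def thg (t : ℂ) (n : ℤ) : ℂ := t ^ 726 * thG (t ^ 2904) (t ^ (264 * n))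

/-- The cube of the eta function, the derivative of the odd theta function at the origin. -/
noncomputable def thD (t : ℂ) : ℂ := t ^ 363 * qpi (t ^ 2904) (t ^ 2904) ^ 3

section Theta
variable {t : ℂ} (t0 : t ≠ 0) (t1 : ‖t‖ < 1)

include t1 in
theorem norm_pow_lt_one {k : ℕ} (hk : k ≠ 0) : ‖t ^ k‖ < 1 := by
  rw [norm_pow]; exact pow_lt_one₀ (norm_nonneg _) t1 hk

include t0 t1

theorem thv_mul_thv (m n : ℤ) : thv t (m + n) * thv t (m - n) = thg t m * thf t n - thf t m * thg t n := by
  have h := jt_mul_jt (pow_ne_zero 2904 t0) (norm_pow_lt_one t1 (by norm_num))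
    (zpow_ne_zero (264 * m) t0) (zpow_ne_zero (264 * n) t0)
  rw [← zpow_add₀ t0, ← zpow_sub₀ t0, ← mul_add, ← mul_sub] at h
  rw [thv, thv, mul_mul_mul_comm, h, ← zpow_add₀ t0, ← mul_assoc, ← zpow_add₀ t0,
    show 363 - 132 * (m + n) + (363 - 132 * (m - n)) + 264 * m = ((726 : ℕ) : ℤ) by push_cast; ring,
    zpow_natCast, thg, thg, thf, thf]
  ring

theorem jt_neg_sq (x : ℂ) (hx : x ≠ 0) : jt (t ^ 2904) (-x) ^ 2 =
    x * (thG (t ^ 2904) x * thF (t ^ 2904) 1 + thF (t ^ 2904) x * thG (t ^ 2904) 1) := by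
  have h := jt_mul_jt (pow_ne_zero 2904 t0) (norm_pow_lt_one t1 (by norm_num)) (neg_ne_zero.mpr hx) one_ne_zero
  rw [mul_one, div_one, thF_neg, thG_neg hx] at h
  rw [sq, h]
  ring

theorem jt_half_sq (x : ℂ) (hx : x ≠ 0) : jt (t ^ 2904) (t ^ 1452 * x) ^ 2 =
    thF (t ^ 2904) x * thF (t ^ 2904) 1 - t ^ 1452 * (thG (t ^ 2904) x * thG (t ^ 2904) 1) := by
  have p0 := pow_ne_zero 1452 t0
  have h := jt_mul_jt (pow_ne_zero 2904 t0) (norm_pow_lt_one t1 (by norm_num)) (mul_ne_zero p0 hx) one_ne_zero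
  rw [mul_one, div_one, show t ^ 2904 = (t ^ 1452) ^ 2 by ring, thF_mul p0 hx, thG_mul p0 hx] at h
  rw [sq, show t ^ 2904 = (t ^ 1452) ^ 2 by ring, h]
  generalize t ^ 1452 = p at p0 ⊢
  field_simp

theorem thv_two_mul_sq (n : ℤ) : thD t ^ 2 * thv t (2 * n) ^ 2 =
    thv t n ^ 2 * ((thg t n * thf t 0 + thf t n * thg t 0) * (thf t n * thf t 0 - thg t n * thg t 0) *
      (thf t n * thf t 0 + thg t n * thg t 0)) := by
  have p0 := pow_ne_zero 1452 t0
  have x0 := zpow_ne_zero (264 * n) t0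
  have d := congrArg (· ^ 2) (jt_duplication p0 (norm_pow_lt_one t1 (by norm_num)) x0)
  simp only [mul_pow] at d
  rw [show ((t ^ 1452) ^ 2 : ℂ) = t ^ 2904 by ring, jt_neg_sq t0 t1 _ x0, jt_half_sq t0 t1 _ x0, ← mul_neg,
    jt_half_sq t0 t1 _ (neg_ne_zero.mpr x0), thF_neg, thG_neg x0, ← zpow_natCast (t ^ (264 * n)) 2, ← zpow_mul,
    show 264 * n * ((2 : ℕ) : ℤ) = 264 * (2 * n) by push_cast; ring] at d
  rw [thv, thv, thD, thf, thf, thg, thg, mul_zero, zpow_zero]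
  have e1 : t ^ (363 - 132 * (2 * n)) = t ^ 363 * (t ^ (132 * n))⁻¹ ^ 2 := by
    rw [← zpow_neg, ← zpow_natCast (t ^ (-(132 * n))), ← zpow_mul, ← zpow_natCast t 363, ← zpow_add₀ t0]
    congr 1; push_cast; ring
  have e2 : t ^ (363 - 132 * n) = t ^ 363 * (t ^ (132 * n))⁻¹ := by
    rw [← zpow_neg, ← zpow_natCast t 363, ← zpow_add₀ t0]
    congr 1
  have e3 : t ^ (264 * n) = (t ^ (132 * n)) ^ 2 := by
    rw [← zpow_natCast (t ^ (132 * n)), ← zpow_mul]; congr 1; push_cast; ring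
  rw [e1, e2]
  have w0 := zpow_ne_zero (132 * n) t0
  generalize jt (t ^ 2904) (t ^ (264 * n)) = A, jt (t ^ 2904) (t ^ (264 * (2 * n))) = B,
    thG (t ^ 2904) (t ^ (264 * n)) = C, thF (t ^ 2904) (t ^ (264 * n)) = E, qpi (t ^ 2904) (t ^ 2904) = F,
    thG (t ^ 2904) 1 = G, thF (t ^ 2904) 1 = H at d ⊢
  rw [e3] at d
  generalize t ^ (132 * n) = w at w0 d ⊢
  rw [show t ^ 1452 = (t ^ 726) ^ 2 by ring] at d
  rw [show t ^ 726 = (t ^ 363) ^ 2 by ring] at d ⊢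
  have s0 := pow_ne_zero 363 t0
  generalize t ^ 363 = s at d s0 ⊢
  field_simp
  linear_combination d

theorem four_mul_thD_sq : 4 * thD t ^ 2 = 2 * (thf t 0 * thg t 0) * (thf t 0 ^ 2 - thg t 0 ^ 2) *
    (thf t 0 ^ 2 + thg t 0 ^ 2) := by
  have p0 := pow_ne_zero 1452 t0
  have d := congrArg (· ^ 2) (jt_half_periods p0 (norm_pow_lt_one t1 (by norm_num)))
  have a2 := jt_half_sq t0 t1 1 one_ne_zero
  have a3 := jt_half_sq t0 t1 (-1) (neg_ne_zero.mpr one_ne_zero)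
  rw [thF_neg, thG_neg one_ne_zero] at a3
  simp only [mul_pow, mul_one, mul_neg] at d a2 a3
  rw [show ((t ^ 1452) ^ 2 : ℂ) = t ^ 2904 by ring, jt_neg_sq t0 t1 _ one_ne_zero, a2, a3] at d
  rw [thD, thf, thg, mul_zero, zpow_zero]
  rw [show t ^ 1452 = (t ^ 726) ^ 2 by ring] at d
  rw [show t ^ 726 = (t ^ 363) ^ 2 by ring] at d ⊢
  linear_combination -(t ^ 363) ^ 2 * d

theorem thv_four_mul (n : ℤ) : thv t (4 * n) * (2 * thD t ^ 2) =
    thv t (2 * n) * (2 * (thg t n * thf t n) * (thf t n ^ 2 - thg t n ^ 2) * (thf t n ^ 2 + thg t n ^ 2)) := by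
  have p0 := pow_ne_zero 1452 t0
  have H0 := pow_ne_zero 2904 t0
  have H1 : ‖t ^ 2904‖ < 1 := norm_pow_lt_one t1 (by norm_num)
  have x0 := zpow_ne_zero (264 * n) t0
  have d := jt_duplication p0 (norm_pow_lt_one t1 (by norm_num)) (pow_ne_zero 2 x0)
  have d2 := jt_half_periods p0 (norm_pow_lt_one t1 (by norm_num))
  have b1 := jt_mul_jt H0 H1 x0 (neg_ne_zero.mpr x0)
  have b2 := jt_mul_jt H0 H1 (mul_ne_zero p0 x0) x0
  have b3 := jt_mul_jt H0 H1 (neg_ne_zero.mpr (mul_ne_zero p0 x0)) x0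
  have Hp : (t ^ 1452) ^ 2 = t ^ 2904 := by ring
  have F1 := thF_mul p0 x0
  have G1 := thG_mul p0 x0
  rw [thF_neg, thG_neg x0] at b1
  rw [Hp] at d d2 F1 G1
  rw [thF_neg, thG_neg (mul_ne_zero p0 x0), F1, G1, neg_div] at b3
  rw [F1, G1] at b2
  rw [mul_div_cancel_right₀ _ x0] at b2 b3
  rw [show t ^ (264 * n) / -t ^ (264 * n) = -1 by field_simp] at b1
  rw [show t ^ (264 * n) * -t ^ (264 * n) = -(t ^ (264 * n)) ^ 2 by ring] at b1
  rw [show t ^ 1452 * t ^ (264 * n) * t ^ (264 * n) = t ^ 1452 * (t ^ (264 * n)) ^ 2 by ring] at b2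
  rw [show -(t ^ 1452 * t ^ (264 * n)) * t ^ (264 * n) = -(t ^ 1452 * (t ^ (264 * n)) ^ 2) by ring] at b3
  have x2 : (t ^ (264 * n)) ^ 2 = t ^ (264 * (2 * n)) := by
    rw [← zpow_natCast (t ^ (264 * n)) 2, ← zpow_mul]; congr 1; push_cast; ring
  have x4 : ((t ^ (264 * n)) ^ 2) ^ 2 = t ^ (264 * (4 * n)) := by
    rw [← pow_mul, ← zpow_natCast (t ^ (264 * n)), ← zpow_mul]; congr 1; push_cast; ring
  rw [x4] at d
  rw [x2] at d b1 b2 b3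
  rw [thv, thv, thD, thf, thg]
  have e1 : t ^ (363 - 132 * (4 * n)) = t ^ 363 * (t ^ (264 * n))⁻¹ ^ 2 := by
    rw [← zpow_neg, ← zpow_natCast (t ^ (-(264 * n))), ← zpow_mul, ← zpow_natCast t 363, ← zpow_add₀ t0]
    congr 1; push_cast; ring
  have e2 : t ^ (363 - 132 * (2 * n)) = t ^ 363 * (t ^ (264 * n))⁻¹ := by
    rw [← zpow_neg, ← zpow_natCast t 363, ← zpow_add₀ t0]
    congr 1; ring
  rw [e1, e2]
  generalize jt (t ^ 2904) (t ^ (264 * (4 * n))) = A, jt (t ^ 2904) (t ^ (264 * (2 * n))) = B,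
    jt (t ^ 2904) (-t ^ (264 * (2 * n))) = B1, jt (t ^ 2904) (t ^ 1452 * t ^ (264 * (2 * n))) = B2,
    jt (t ^ 2904) (-(t ^ 1452 * t ^ (264 * (2 * n)))) = B3, jt (t ^ 2904) (-1) = M1,
    jt (t ^ 2904) (t ^ 1452) = M2, jt (t ^ 2904) (-t ^ 1452) = M3,
    thG (t ^ 2904) (t ^ (264 * n)) = C, thF (t ^ 2904) (t ^ (264 * n)) = E,
    qpi (t ^ 2904) (t ^ 2904) = F at d d2 b1 b2 b3 ⊢
  generalize t ^ (264 * n) = w at x0 b1 b2 b3 ⊢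
  rw [show t ^ 1452 = (t ^ 726) ^ 2 by ring] at b2 b3 p0
  rw [show t ^ 726 = (t ^ 363) ^ 2 by ring] at b2 b3 p0 ⊢
  have s0 := pow_ne_zero 363 t0
  generalize t ^ 363 = s at b2 b3 s0 p0 ⊢
  have b2' : B2 * M2 = E ^ 2 - s ^ 4 * C ^ 2 := by rw [b2]; field_simp
  have b3' : B3 * M3 = E ^ 2 + s ^ 4 * C ^ 2 := by rw [b3]; field_simp; ring
  have key : F ^ 3 * A * (2 * F ^ 3) = B * (w * (2 * C * E)) * (E ^ 2 - s ^ 4 * C ^ 2) * (E ^ 2 + s ^ 4 * C ^ 2) := by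
    rw [d, ← b2', ← b3', ← d2, show w * (2 * C * E) = B1 * M1 by rw [b1]; ring]
    ring
  field_simp
  linear_combination key / 2

theorem thf_two_mul_relation (n : ℤ) : thf t 0 * thg t 0 * (thg t (2 * n) * thf t 0 + thf t (2 * n) * thg t 0) =
    2 * thg t n ^ 2 * thf t n ^ 2 := by
  have H0 := pow_ne_zero 2904 t0
  have H1 : ‖t ^ 2904‖ < 1 := norm_pow_lt_one t1 (by norm_num)
  have x0 := zpow_ne_zero (264 * n) t0
  have b1 := jt_mul_jt H0 H1 x0 (neg_ne_zero.mpr x0)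
  rw [thF_neg, thG_neg x0, show t ^ (264 * n) / -t ^ (264 * n) = -1 by field_simp,
    show t ^ (264 * n) * -t ^ (264 * n) = -(t ^ (264 * n)) ^ 2 by ring] at b1
  have b2 := jt_neg_sq t0 t1 1 one_ne_zero
  have b3 := jt_neg_sq t0 t1 _ (pow_ne_zero 2 x0)
  have b4 := congrArg (· ^ 2) b1
  simp only [mul_pow] at b4
  rw [b2, b3] at b4
  have x2 : (t ^ (264 * n)) ^ 2 = t ^ (264 * (2 * n)) := by
    rw [← zpow_natCast (t ^ (264 * n)) 2, ← zpow_mul]; congr 1; push_cast; ring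
  have y0 := zpow_ne_zero (264 * (2 * n)) t0
  rw [x2] at b4
  rw [thf, thf, thf, thg, thg, thg, mul_zero, zpow_zero]
  refine mul_left_cancel₀ y0 ?_
  linear_combination (t ^ 726) ^ 2 * b4 / 2

theorem thv_neg (n : ℤ) : thv t (-n) = -thv t n := by
  rw [thv, thv, show 264 * -n = -(264 * n) by ring, zpow_neg, jt_inv (pow_ne_zero _ t0) (zpow_ne_zero _ t0),
    show 363 - 132 * -n = 363 - 132 * n + 264 * n by ring, zpow_add₀ t0]
  field_simp [zpow_ne_zero (264 * n) t0]

/-- The theta values satisfy the division polynomial relations of an elliptic curve with discriminant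
`(thD t) ^ (-4)`. -/
theorem exists_curve {n : ℤ} (hn : thv t n ≠ 0) (hD : thD t ≠ 0) : ∃ b2 b4 b6 b8 : ℂ,
    b6 * thv t n ^ 8 = thv t (2 * n) ^ 2 ∧ b8 * thv t n ^ 9 = thv t (3 * n) ∧
    (b4 * b8 - b6 ^ 2) * (thv t (2 * n) * thv t n ^ 12) = thv t (4 * n) ∧ 4 * b8 = b2 * b6 - b4 ^ 2 ∧
    thD t ^ 4 * (-b2 ^ 2 * b8 - 8 * b4 ^ 3 - 27 * b6 ^ 2 + 9 * b2 * b4 * b6) = 1 := by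
  have r1 := thv_mul_thv t0 t1 n 0
  have r2 := thv_mul_thv t0 t1 (2 * n) 0
  have r3 := thv_mul_thv t0 t1 (2 * n) n
  have r4 := thv_two_mul_sq t0 t1 n
  have r5 := four_mul_thD_sq t0 t1
  have r6 := thv_four_mul t0 t1 n
  have r7 := thf_two_mul_relation t0 t1 n
  simp only [add_zero, sub_zero, show 2 * n + n = 3 * n by ring, show 2 * n - n = n by ring] at r1 r2 r3
  generalize thv t n = v1, thv t (2 * n) = v2, thv t (3 * n) = v3, thv t (4 * n) = v4, thf t n = f,
    thg t n = g, thf t 0 = a, thg t 0 = b, thf t (2 * n) = f2, thg t (2 * n) = g2, thD t = D at *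
  have nz : 2 * (a * b) * (a ^ 2 - b ^ 2) * (a ^ 2 + b ^ 2) ≠ 0 := by
    rw [← r5]; exact mul_ne_zero (by norm_num) (pow_ne_zero 2 hD)
  have hN := right_ne_zero_of_mul nz
  have hM := right_ne_zero_of_mul (left_ne_zero_of_mul nz)
  have hab := right_ne_zero_of_mul (left_ne_zero_of_mul (left_ne_zero_of_mul nz))
  have ha := left_ne_zero_of_mul hab
  have hb := right_ne_zero_of_mul hab
  have hW : g * a - f * b ≠ 0 := by rw [← r1]; exact mul_ne_zero hn hn
  obtain ⟨W, hWdef⟩ : ∃ W, W = g * a - f * b := ⟨_, rfl⟩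
  obtain ⟨M, hMdef⟩ : ∃ M, M = a ^ 2 - b ^ 2 := ⟨_, rfl⟩
  obtain ⟨N, hNdef⟩ : ∃ N, N = a ^ 2 + b ^ 2 := ⟨_, rfl⟩
  rw [← hWdef] at hW r1
  rw [← hMdef] at hM r5
  rw [← hNdef] at hN r5
  obtain ⟨e1, h1⟩ : ∃ e, e = (g * a + f * b) / (2 * (a * b) * W) := ⟨_, rfl⟩
  obtain ⟨e2, h2⟩ : ∃ e, e = (f * a - g * b) / (M * W) := ⟨_, rfl⟩
  obtain ⟨e3, h3⟩ : ∃ e, e = (f * a + g * b) / (N * W) := ⟨_, rfl⟩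
  have d12 : e1 - e2 = N / (2 * (a * b) * M) := by
    rw [h1, h2]; field_simp; rw [hMdef, hNdef, hWdef]; ring
  have d13 : e1 - e3 = M / (2 * (a * b) * N) := by
    rw [h1, h3]; field_simp; rw [hMdef, hNdef, hWdef]; ring
  have d23 : e2 - e3 = -(2 * (a * b)) / (M * N) := by
    rw [h2, h3]; field_simp; rw [hMdef, hNdef, hWdef]; ring
  have k1 : e1 * e2 + e1 * e3 - e2 * e3 = g * f / (a * b * W ^ 2) := by
    rw [h1, h2, h3]; field_simp; rw [hMdef, hNdef]; ring
  have k2 : e1 * e2 + e2 * e3 - e1 * e3 = (f ^ 2 - g ^ 2) / (M * W ^ 2) := by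
    rw [h1, h2, h3]; field_simp; rw [hMdef, hNdef]; ring
  have k3 : e1 * e3 + e2 * e3 - e1 * e2 = (f ^ 2 + g ^ 2) / (N * W ^ 2) := by
    rw [h1, h2, h3]; field_simp; rw [hMdef, hNdef]; ring
  have D2 : D ^ 2 = a * b * M * N / 2 := by linear_combination r5 / 4
  have hv2 : v2 ^ 2 = 4 * e1 * e2 * e3 * W ^ 4 := by
    refine mul_left_cancel₀ (pow_ne_zero 2 hD) ?_
    rw [r4, D2, h1, h2, h3, sq v1, r1]
    field_simp
    norm_num
  have W4 : v1 ^ 8 = W ^ 4 := by rw [← r1]; ring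
  have hv3 : v3 * v1 = (4 * (e1 + e2 + e3) * (e1 * e2 * e3) - (e1 * e2 + e1 * e3 + e2 * e3) ^ 2) * W ^ 5 := by
    have s : 4 * (e1 + e2 + e3) * (e1 * e2 * e3) - (e1 * e2 + e1 * e3 + e2 * e3) ^ 2 =
        4 * e1 * e2 * e3 * e1 - (g * f / (a * b * W ^ 2)) ^ 2 := by rw [← k1]; ring
    have w5 : 4 * e1 * e2 * e3 * e1 * W ^ 5 = v2 ^ 2 * (e1 * W) := by rw [hv2]; ring
    rw [s, sub_mul, w5, h1, r3]
    rw [← sq] at r2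
    rw [r2]
    field_simp
    rw [hWdef]
    linear_combination (f * b - g * a) * r7
  refine ⟨4 * (e1 + e2 + e3), 2 * (e1 * e2 + e1 * e3 + e2 * e3), 4 * (e1 * e2 * e3),
    4 * (e1 + e2 + e3) * (e1 * e2 * e3) - (e1 * e2 + e1 * e3 + e2 * e3) ^ 2, ?_, ?_, ?_, ?_, ?_⟩
  · rw [W4, hv2]; ring
  · refine mul_right_cancel₀ hn ?_
    rw [hv3, ← r1]; ring
  · refine mul_right_cancel₀ (mul_ne_zero two_ne_zero (pow_ne_zero 2 hD)) ?_
    have s : 2 * (e1 * e2 + e1 * e3 + e2 * e3) * (4 * (e1 + e2 + e3) * (e1 * e2 * e3) -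
        (e1 * e2 + e1 * e3 + e2 * e3) ^ 2) - (4 * (e1 * e2 * e3)) ^ 2 =
        2 * ((e1 * e2 + e1 * e3 - e2 * e3) * (e1 * e2 + e2 * e3 - e1 * e3) * (e1 * e3 + e2 * e3 - e1 * e2)) := by ring
    rw [r6, s, k1, k2, k3, D2, show v1 ^ 12 = W ^ 6 by rw [← r1]; ring]
    field_simp
  · ring
  · have s : -(4 * (e1 + e2 + e3)) ^ 2 * (4 * (e1 + e2 + e3) * (e1 * e2 * e3) - (e1 * e2 + e1 * e3 + e2 * e3) ^ 2) -
        8 * (2 * (e1 * e2 + e1 * e3 + e2 * e3)) ^ 3 - 27 * (4 * (e1 * e2 * e3)) ^ 2 +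
        9 * (4 * (e1 + e2 + e3)) * (2 * (e1 * e2 + e1 * e3 + e2 * e3)) * (4 * (e1 * e2 * e3)) =
        16 * ((e1 - e2) * (e1 - e3) * (e2 - e3)) ^ 2 := by ring
    rw [s, d12, d13, d23, show D ^ 4 = (D ^ 2) ^ 2 by ring, D2]
    field_simp
    ring
end Theta

/-- The theta values, normalized to be odd and antiperiodic in the index. -/
noncomputable def thw (t : ℂ) (n : ℤ) : ℂ := t ^ (12 * n ^ 2) * thv t n

/-- The logarithmic derivatives, normalized to be odd and periodic in the index. -/
noncomputable def lamw (t : ℂ) (n : ℤ) : ℂ := lam (t ^ 2904) (t ^ (264 * n)) - 1 / 2 + n / 11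

section ThetaValues
variable {t : ℂ} (t0 : t ≠ 0) (t1 : ‖t‖ < 1)
include t0 t1

theorem zpow_ne_one {n : ℤ} (hn : n ≠ 0) : t ^ n ≠ 1 := by
  intro h
  have h2 : ‖t‖ ^ n = 1 := by rw [← norm_zpow, h, norm_one]
  rcases (zpow_eq_one_iff_right₀ (norm_nonneg t) t1.ne).mp h2 with h3
  exact hn h3

theorem NP_index {n : ℤ} (hn : ¬ (11 : ℤ) ∣ n) : NP (t ^ 2904) (t ^ (264 * n)) := by
  refine ⟨zpow_ne_zero _ t0, fun m h => ?_⟩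
  rw [← zpow_natCast t 2904, ← zpow_mul, ← zpow_add₀ t0] at h
  refine zpow_ne_one t0 t1 ?_ h
  push_cast
  omega

theorem thv_ne_zero {n : ℤ} (hn : ¬ (11 : ℤ) ∣ n) : thv t n ≠ 0 :=
  mul_ne_zero (zpow_ne_zero _ t0) (jt_ne (pow_ne_zero _ t0) (norm_pow_lt_one t1 (by norm_num)) (NP_index t0 t1 hn))

theorem thD_ne_zero : thD t ≠ 0 :=
  mul_ne_zero (pow_ne_zero _ t0) (pow_ne_zero _ (qpi_self_ne_zero (norm_pow_lt_one t1 (by norm_num))))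

theorem thetaData : ThetaData (thw t) (lamw t) (thD t) := by
  have H0 := pow_ne_zero 2904 t0
  have H1 : ‖t ^ 2904‖ < 1 := norm_pow_lt_one t1 (by norm_num)
  have per : ∀ n : ℤ, t ^ (264 * (n + 11)) = t ^ (264 * n) * t ^ 2904 := fun n => by
    rw [← zpow_natCast t 2904, ← zpow_add₀ t0]; congr 1; push_cast; ring
  refine ⟨fun n => ?_, fun n => ?_, fun n hn => mul_ne_zero (zpow_ne_zero _ t0) (thv_ne_zero t0 t1 hn),
    fun a b c d => ?_, fun n hn => ?_, fun n hn => ?_, fun a b c ha hb hc hs => ?_, fun n hn => ?_⟩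
  · rw [thw, thw, thv_neg t0 t1, neg_sq, mul_neg]
  · rw [thw, thw, thv, thv, per]
    have := jt_mul_zpow H0 (zpow_ne_zero (264 * n) t0) 1
    rw [zpow_one] at this
    rw [this, ← zpow_natCast t 2904, ← zpow_mul, ← zpow_mul]
    simp only [← mul_assoc, ← zpow_add₀ t0, zpow_one]
    rw [mul_neg, mul_one, neg_mul, neg_mul, neg_mul, ← zpow_add₀ t0, ← zpow_add₀ t0]
    congr 3
    simp only [tri_one]
    push_cast
    ring
  · have e : ∀ a b c d : ℤ, thw t (a + b) * thw t (a - b) * (thw t (c + d) * thw t (c - d)) =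
        t ^ (24 * (a ^ 2 + b ^ 2 + c ^ 2 + d ^ 2)) *
          ((thg t a * thf t b - thf t a * thg t b) * (thg t c * thf t d - thf t c * thg t d)) := by
      intro a b c d
      rw [← thv_mul_thv t0 t1, ← thv_mul_thv t0 t1, show 24 * (a ^ 2 + b ^ 2 + c ^ 2 + d ^ 2) =
        12 * (a + b) ^ 2 + 12 * (a - b) ^ 2 + 12 * (c + d) ^ 2 + 12 * (c - d) ^ 2 by ring, zpow_add₀ t0,
        zpow_add₀ t0, zpow_add₀ t0, thw, thw, thw, thw]
      ring
    rw [e, e, e, show a ^ 2 + c ^ 2 + b ^ 2 + d ^ 2 = a ^ 2 + b ^ 2 + c ^ 2 + d ^ 2 by ring,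
      show a ^ 2 + d ^ 2 + b ^ 2 + c ^ 2 = a ^ 2 + b ^ 2 + c ^ 2 + d ^ 2 by ring]
    ring
  · rw [lamw, lamw, show 264 * -n = -(264 * n) by ring, zpow_neg, lam_inv H0 H1 (NP_index t0 t1 hn)]
    push_cast
    ring
  · rw [lamw, lamw, per, lam_mul H0 H1 (NP_index t0 t1 hn)]
    push_cast
    ring
  · have f := lam_four_point H0 H1 (NP_index t0 t1 ha) (NP_index t0 t1 hb) (NP_index t0 t1 hc)
      (by simpa only [← zpow_add₀ t0, ← mul_add] using NP_index t0 t1 hs)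
    simp only [← zpow_add₀ t0, ← mul_add] at f
    have f' : lamw t a + lamw t b + lamw t c - lamw t (a + b + c) =
        -(qpi (t ^ 2904) (t ^ 2904) ^ 3 * (jt (t ^ 2904) (t ^ (264 * (a + b))) * jt (t ^ 2904) (t ^ (264 * (a + c))) *
          jt (t ^ 2904) (t ^ (264 * (b + c)))) / (jt (t ^ 2904) (t ^ (264 * a)) * jt (t ^ 2904) (t ^ (264 * b)) *
          jt (t ^ 2904) (t ^ (264 * c)) * jt (t ^ 2904) (t ^ (264 * (a + b + c))))) := by
      rw [lamw, lamw, lamw, lamw]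
      push_cast
      linear_combination f
    have ja := jt_ne H0 H1 (NP_index t0 t1 ha)
    have jb := jt_ne H0 H1 (NP_index t0 t1 hb)
    have jc := jt_ne H0 H1 (NP_index t0 t1 hc)
    have js := jt_ne H0 H1 (NP_index t0 t1 hs)
    have e1 : t ^ (12 * a ^ 2) * t ^ (363 - 132 * a) * (t ^ (12 * b ^ 2) * t ^ (363 - 132 * b)) *
        (t ^ (12 * c ^ 2) * t ^ (363 - 132 * c)) * (t ^ (12 * (a + b + c) ^ 2) * t ^ (363 - 132 * (a + b + c))) =
        t ^ 363 * (t ^ (12 * (a + b) ^ 2) * t ^ (363 - 132 * (a + b)) * (t ^ (12 * (a + c) ^ 2) * t ^ (363 - 132 * (a + c))) *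
        (t ^ (12 * (b + c) ^ 2) * t ^ (363 - 132 * (b + c)))) := by
      simp only [← zpow_natCast t 363, ← zpow_add₀ t0]
      congr 1
      push_cast
      ring
    rw [f', thD, thw, thw, thw, thw, thw, thw, thw, thv, thv, thv, thv, thv, thv, thv]
    field_simp
    linear_combination -(qpi (t ^ 2904) (t ^ 2904) ^ 3 * (jt (t ^ 2904) (t ^ (264 * (a + b))) *
      jt (t ^ 2904) (t ^ (264 * (a + c))) * jt (t ^ 2904) (t ^ (264 * (b + c))))) * e1
  · obtain ⟨b2, b4, b6, b8, r6, r8, r4, r2, hd⟩ := exists_curve t0 t1 (thv_ne_zero t0 t1 hn) (thD_ne_zero t0 t1)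
    have pw : ∀ (m : ℤ) (k : ℕ), m = 12 * n ^ 2 * k → t ^ m = (t ^ (12 * n ^ 2)) ^ k := fun m k hm => by
      rw [hm, ← zpow_natCast (t ^ (12 * n ^ 2)) k, ← zpow_mul]
    refine ⟨b2, b4, b6, b8, ?_, ?_, ?_, r2, hd⟩
    · rw [thw, thw, pw (12 * (2 * n) ^ 2) 4 (by push_cast; ring), mul_pow, mul_pow, ← r6]
      ring
    · rw [thw, thw, pw (12 * (3 * n) ^ 2) 9 (by push_cast; ring), ← r8]
      ring
    · rw [thw, thw, thw, pw (12 * (2 * n) ^ 2) 4 (by push_cast; ring), pw (12 * (4 * n) ^ 2) 16 (by push_cast; ring),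
        ← r4]
      ring

end ThetaValues

section

variable {Q : ℂ}

/-- The numerator theta series `Σ (-1)^n Q^(3 n (n-1)/2 + s n) w^n`. -/
noncomputable def thC (Q : ℂ) (s : ℤ) (w : ℂ) : ℂ := ∑' n : ℤ, (-1) ^ n * Q ^ (3 * tri n + s * n) * w ^ n

theorem App_quasiperiodic (h0 : Q ≠ 0) (h1 : ‖Q‖ < 1) {x w : ℂ} (hx : NP Q x) (hw : w ≠ 0) :
    x ^ 3 * App Q x w + w * App Q (x * Q) w = -(thC Q 0 w + x * thC Q 1 w + x ^ 2 * thC Q 2 w) := by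
  have s : ∀ i : ℤ, Summable fun n : ℤ => (-1) ^ n * Q ^ (3 * tri n + i * n) * w ^ n := fun i =>
    (summable_norm_coef h0 h1 (k := 3) (by norm_num) hw i _ norm_neg_one_zpow).of_norm
  have s3 : Summable fun n : ℤ => (-1) ^ n * Q ^ (3 * tri n + 3 * n) * w ^ n / (1 - x * Q ^ n) :=
    (summable_norm_div h0 h1 hx (summable_norm_coef h0 h1 (k := 3) (by norm_num) hw 3 _
      norm_neg_one_zpow)).of_norm
  have s0 : Summable fun n : ℤ => (-1) ^ n * Q ^ (3 * tri n + 0 * n) * w ^ n / (1 - x * Q ^ n) :=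
    (summable_norm_div h0 h1 hx (summable_norm_coef h0 h1 (k := 3) (by norm_num) hw 0 _
      norm_neg_one_zpow)).of_norm
  have e : w * App Q (x * Q) w = -∑' n : ℤ, (-1) ^ n * Q ^ (3 * tri n + 0 * n) * w ^ n / (1 - x * Q ^ n) := by
    rw [App, ← tsum_mul_left, ← tsum_neg, ← (Equiv.addRight (1 : ℤ)).tsum_eq (fun n : ℤ =>
      -((-1) ^ n * Q ^ (3 * tri n + 0 * n) * w ^ n / (1 - x * Q ^ n)))]
    refine tsum_congr fun n => ?_
    simp only [Equiv.coe_addRight]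
    rw [tri_succ, show 3 * (tri n + n) + 0 * (n + 1) = 3 * tri n + 3 * n by ring, zpow_add_one₀ (by norm_num),
      zpow_add_one₀ hw, zpow_add_one₀ h0]
    ring
  rw [e, App, thC, thC, thC, ← tsum_mul_left, ← tsum_mul_left, ← tsum_mul_left, ← tsum_neg,
    ← (s3.mul_left _).tsum_add s0.neg, ← (s 0).tsum_add ((s 1).mul_left _),
    ← ((s 0).add ((s 1).mul_left _)).tsum_add ((s 2).mul_left _), ← tsum_neg]
  refine tsum_congr fun n => ?_
  have hn := hx.sub_ne n
  simp only [zpow_add₀ h0, mul_comm _ n, zpow_mul Q n]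
  generalize Q ^ n = u at *
  have e3 : u ^ (3 : ℤ) = u ^ 3 := by norm_cast
  have e2 : u ^ (2 : ℤ) = u ^ 2 := by norm_cast
  rw [e3, e2, zpow_zero, zpow_one]
  field_simp
  ring

theorem countable_not_NP (c : ℂ) (hc : c ≠ 0) (h0 : Q ≠ 0) : {z : ℂ | ¬ NP Q (z * c)}.Countable := by
  refine ((Set.countable_singleton (0 : ℂ)).union (Set.countable_range fun n : ℤ => (Q ^ n)⁻¹ * c⁻¹)).mono ?_
  intro z hz
  simp only [NP, ne_eq, mul_eq_zero, hc, or_false, Set.mem_setOf_eq, not_and, not_forall, not_not] at hz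
  by_cases h : z = 0
  · exact Or.inl h
  · obtain ⟨n, hn⟩ := hz h
    refine Or.inr ⟨n, ?_⟩
    have := zpow_ne_zero n h0
    rw [← one_div, ← hn]
    field_simp

/-- The quintuple product identity. -/
theorem thC_quintuple (h0 : Q ≠ 0) (h1 : ‖Q‖ < 1) {ζ : ℂ} (hζ : NP Q ζ) (hζ2 : NP Q (ζ ^ 2)) :
    ζ * thC Q 1 (ζ ^ 3) + ζ ^ 2 * thC Q 1 (ζ ^ 3)⁻¹ = ζ * jt Q (ζ ^ 2) / jt Q ζ * thC Q 1 1 := by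
  have ζ0 := hζ.1
  have ζ3 : ζ ^ 3 ≠ 0 := pow_ne_zero 3 ζ0
  set κ := ζ * jt Q (ζ ^ 2) / jt Q ζ
  let c : ℤ → ℂ := fun s => ζ ^ (3 - s) * thC Q s (ζ ^ 3)⁻¹ + ζ ^ s * thC Q s (ζ ^ 3) - κ * thC Q s 1
  have key : ∀ z : ℂ, NP Q z → NP Q (z / ζ) → NP Q (z * ζ) → c 0 + c 1 * z + c 2 * z ^ 2 = 0 := by
    intro z hz hz1 hz2
    have r1 := app_relation h0 h1 hz hz1 hz2 hζ hζ2
    have q1 : z * Q / ζ = z / ζ * Q := by ring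
    have q2 : z * Q * ζ = z * ζ * Q := by ring
    have r2 := app_relation h0 h1 (z := z * Q) (by simpa using hz.mul_zpow h0 1)
      (by rw [q1]; simpa using hz1.mul_zpow h0 1) (by rw [q2]; simpa using hz2.mul_zpow h0 1) hζ hζ2
    rw [q1, q2] at r2
    have p : ∀ {x : ℂ}, x ≠ 0 → jt Q (x * Q) = -x⁻¹ * jt Q x := by
      intro x hx
      have := jt_mul_zpow h0 hx 1
      simpa [tri_one] using this
    rw [p hz.1, p hz1.1, p hz2.1] at r2
    have u1 := App_quasiperiodic h0 h1 hz1 (inv_ne_zero ζ3)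
    have u2 := App_quasiperiodic h0 h1 hz2 ζ3
    have u3 := App_quasiperiodic h0 h1 hz one_ne_zero
    have n1 := jt_ne h0 h1 hz
    have n2 := jt_ne h0 h1 hz1
    have n3 := jt_ne h0 h1 hz2
    have z0 := hz.1
    have r3 : App Q (z / ζ * Q) (ζ ^ 3)⁻¹ + ζ ^ 3 * App Q (z * ζ * Q) (ζ ^ 3) = κ * App Q (z * Q) 1 -
        z ^ 3 * (qpi Q Q ^ 3 * jt Q ζ * jt Q (ζ ^ 2) / (jt Q (z / ζ) * jt Q z * jt Q (z * ζ))) := by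
      rw [r2, sub_eq_add_neg]
      congr 1
      field_simp
    have u1' : z ^ 3 * App Q (z / ζ) (ζ ^ 3)⁻¹ + App Q (z / ζ * Q) (ζ ^ 3)⁻¹ =
        -(ζ ^ 3 * thC Q 0 (ζ ^ 3)⁻¹ + ζ ^ 2 * z * thC Q 1 (ζ ^ 3)⁻¹ + ζ * z ^ 2 * thC Q 2 (ζ ^ 3)⁻¹) := by
      have := congrArg (ζ ^ 3 * ·) u1
      field_simp at this ⊢
      linear_combination this
    have e0 : ζ ^ (3 - 0 : ℤ) = ζ ^ 3 := by norm_cast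
    have e1 : ζ ^ (3 - 1 : ℤ) = ζ ^ 2 := by norm_cast
    have e2 : ζ ^ (3 - 2 : ℤ) = ζ := by norm_num
    have f2 : ζ ^ (2 : ℤ) = ζ ^ 2 := by norm_cast
    simp only [c, e0, e1, e2, f2, zpow_zero, zpow_one]
    rw [one_mul] at u3
    linear_combination u1' + u2 - κ * u3 - z ^ 3 * r1 - r3
  have hinf : {z : ℂ | NP Q z ∧ NP Q (z / ζ) ∧ NP Q (z * ζ)}.Infinite := by
    intro hf
    have hc := ((countable_not_NP (Q := Q) 1 one_ne_zero h0).union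
      ((countable_not_NP (Q := Q) ζ⁻¹ (inv_ne_zero ζ0) h0).union (countable_not_NP ζ ζ0 h0))).union hf.countable
    refine not_countable_complex (hc.mono fun z _ => ?_)
    simp only [Set.mem_union, Set.mem_setOf_eq, mul_one, ← div_eq_mul_inv]
    by_cases a1 : NP Q z <;> by_cases a2 : NP Q (z / ζ) <;> by_cases a3 : NP Q (z * ζ) <;> simp [a1, a2, a3]
  have hp : Polynomial.C (c 0) + Polynomial.C (c 1) * Polynomial.X + Polynomial.C (c 2) * Polynomial.X ^ 2 = 0 := by
    refine Polynomial.eq_zero_of_infinite_isRoot _ (hinf.mono fun z hz => ?_)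
    simpa using key z hz.1 hz.2.1 hz.2.2
  have h := congrArg (fun p => Polynomial.coeff p 1) hp
  simp [Polynomial.coeff_X, Polynomial.coeff_C] at h
  have e1 : ζ ^ (3 - 1 : ℤ) = ζ ^ 2 := by norm_cast
  simp only [c, e1, zpow_one] at h
  linear_combination h

theorem qpi_split_nat (h1 : ‖Q‖ < 1) (z : ℂ) {r : ℕ} (hr : r ≠ 0) :
    qpi Q z = ∏ i : Fin r, qpi (Q ^ r) (z * Q ^ (i : ℕ)) := by
  haveI : NeZero r := ⟨hr⟩
  have hr1 : ‖Q ^ r‖ < 1 := by rw [norm_pow]; exact pow_lt_one₀ (norm_nonneg _) h1 hr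
  let e : Fin r × ℕ ≃ ℕ := (Equiv.prodComm _ _).trans (Nat.divModEquiv r).symm
  have he : ∀ p : Fin r × ℕ, 1 - z * Q ^ e p = 1 - z * Q ^ (p.1 : ℕ) * (Q ^ r) ^ p.2 := by
    rintro ⟨i, k⟩
    simp only [e, Equiv.trans_apply, Equiv.prodComm_apply, Prod.swap, Nat.divModEquiv_symm_apply]
    rw [← pow_mul, mul_assoc, ← pow_add]
    congr 3
    ring
  have m : Multipliable fun p : Fin r × ℕ => 1 - z * Q ^ (p.1 : ℕ) * (Q ^ r) ^ p.2 :=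
    ((e.multipliable_iff).mpr (multipliable_qpi h1 z)).congr he
  have h2 := m.tprod_prod' fun i => multipliable_qpi hr1 (z * Q ^ (i : ℕ))
  unfold qpi
  rw [← e.tprod_eq, tprod_congr he, h2]
  exact tprod_fintype _

theorem thC_one_one (h0 : Q ≠ 0) (h1 : ‖Q‖ < 1) : thC Q 1 1 = qpi Q Q := by
  have h3 : ‖Q ^ 3‖ < 1 := by rw [norm_pow]; exact pow_lt_one₀ (norm_nonneg _) h1 (by norm_num)
  have e : thC Q 1 1 = jt (Q ^ 3) Q := by
    refine tsum_congr fun n => ?_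
    rw [zpow_add₀ h0, one_mul, one_zpow, mul_one, zpow_mul, mul_assoc]
    norm_cast
  rw [e, jt_eq_prod (pow_ne_zero 3 h0) h3 h0, qpi_split_nat h1 Q (r := 3) (by norm_num), Fin.prod_univ_three]
  simp only [Fin.val_zero, Fin.val_one, Fin.val_two, pow_zero, pow_one, mul_one]
  rw [show Q ^ 3 / Q = Q * Q by field_simp, show Q ^ 3 = Q * Q ^ 2 by ring]
  ring

end

theorem norm_inv_one_sub_zpow_le {y : ℂ} (h0 : y ≠ 0) (h1 : ‖y‖ < 1) {n : ℤ} (hn : n ≠ 0) :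
    ‖(1 - y ^ n)⁻¹‖ ≤ (1 - ‖y‖)⁻¹ := by
  have hy : 0 < ‖y‖ := norm_pos_iff.mpr h0
  rw [norm_inv]
  refine inv_anti₀ (by linarith) ?_
  rcases lt_or_gt_of_ne hn with h | h
  · have e1 : ‖y‖⁻¹ ≤ ‖y ^ n‖ := by
      rw [norm_zpow, ← zpow_neg_one]
      exact zpow_le_zpow_right_of_le_one₀ hy h1.le (by omega)
    have e2 : 1 ≤ ‖y‖⁻¹ * 1 := by rw [mul_one]; exact (one_le_inv₀ hy).mpr h1.le
    have e3 := norm_sub_norm_le (y ^ n) 1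
    rw [norm_one, norm_sub_rev] at e3
    have e4 : ‖y‖⁻¹ * ‖y‖ = 1 := inv_mul_cancel₀ hy.ne'
    nlinarith
  · have e1 : ‖y ^ n‖ ≤ ‖y‖ := by
      rw [norm_zpow]
      simpa using zpow_le_zpow_right_of_le_one₀ hy h1.le (show (1 : ℤ) ≤ n by omega)
    have e3 := norm_sub_norm_le 1 (y ^ n)
    rw [norm_one] at e3
    linarith

theorem tsum_int_eq_sum_residues {f : ℤ → ℂ} (hf : Summable f) :
    ∑' N, f N = ∑ i : Fin 11, ∑' n : ℤ, f (11 * n + i) := by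
  let e : Fin 11 × ℤ ≃ ℤ := (Equiv.prodComm _ _).trans (Int.divModEquiv 11).symm
  have he : ∀ p : Fin 11 × ℤ, f (e p) = f (11 * p.2 + p.1) := by
    rintro ⟨i, k⟩
    congr 1
    change k * ((11 : ℕ) : ℤ) + (i : ℕ) = _
    push_cast
    ring
  have s : Summable fun p : Fin 11 × ℤ => f (11 * p.2 + p.1) := ((e.summable_iff).mpr hf).congr he
  rw [← e.tsum_eq, tsum_congr he, s.tsum_prod, tsum_fintype]

theorem tsum_int_eq_symm_sum {f : ℤ → ℂ} (hf : Summable f) {l : ℤ} (hl : ¬ (11 : ℤ) ∣ l) :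
    ∑' N, f N = (∑' n : ℤ, f (11 * n)) +
      ∑ j ∈ Finset.range 5, ((∑' n : ℤ, f (11 * n + l * (j + 1))) + ∑' n : ℤ, f (11 * n - l * (j + 1))) := by
  haveI : Fact (Nat.Prime 11) := ⟨by norm_num⟩
  let S : ZMod 11 → ℂ := fun z => ∑' n : ℤ, f (11 * n + (z.val : ℤ))
  have hS : ∀ k : ℤ, ∑' n : ℤ, f (11 * n + k) = S k := by
    intro k
    have hv : (((k : ZMod 11).val : ℕ) : ℤ) = k % 11 := ZMod.val_intCast k
    simp only [S, hv]
    rw [← (Equiv.addRight (k / 11)).tsum_eq fun n => f (11 * n + k % 11)]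
    refine tsum_congr fun n => ?_
    simp only [Equiv.coe_addRight]
    congr 1
    omega
  have h : ∑' N, f N = ∑ z : ZMod 11, S z := tsum_int_eq_sum_residues hf
  have hl' : (l : ZMod 11) ≠ 0 := fun h => hl ((ZMod.intCast_zmod_eq_zero_iff_dvd l 11).mp h)
  have h2 : ∑ z : ZMod 11, S z = ∑ z : ZMod 11, S (l * z) :=
    (Fintype.sum_equiv (Equiv.mulLeft₀ (l : ZMod 11) hl') _ _ fun z => rfl).symm
  have h3 : ∑ z : ZMod 11, S (l * z) = ∑ i ∈ Finset.range 11, S (l * (i : ZMod 11)) := by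
    rw [Finset.sum_range]
    refine Fintype.sum_congr _ _ fun z => ?_
    congr 2
    exact (ZMod.natCast_zmod_val z).symm
  have h4 : ∀ j : ℕ, ∑' n : ℤ, f (11 * n - l * (j + 1)) = S (l * ((10 - j : ℤ) : ZMod 11)) := by
    intro j
    have := hS (-(l * (j + 1)))
    simp only [← sub_eq_add_neg] at this
    rw [this]
    congr 1
    push_cast
    have e : (11 : ZMod 11) = 0 := rfl
    linear_combination (-(l : ZMod 11)) * e
  have h5 := hS 0
  simp only [add_zero] at h5
  rw [h, h2, h3, h5]
  simp only [h4, hS]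
  simp [Finset.sum_range_succ]
  norm_num
  ring

theorem neg_one_zpow_mul_of_odd {l : ℤ} (hl : Odd l) (j : ℤ) : (-1 : ℂ) ^ (l * j) = (-1) ^ j := by
  rw [zpow_mul, hl.neg_one_zpow]

section Dissection
variable {t : ℂ} (t0 : t ≠ 0) (t1 : ‖t‖ < 1)

/-- The quotient `Σ ± θ (2 k) / θ k` over residues `k` modulo eleven up to sign. -/
noncomputable def thE (θ : ℤ → ℂ) : ℂ :=
  1 + ∑ j ∈ Finset.range 5, (-1) ^ (j + 1) * (θ (2 * (j + 1)) / θ (j + 1))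

include t0 t1

omit t1 in
theorem thw_eq (n : ℤ) : thw t n = t ^ (12 * n ^ 2 + 363 - 132 * n) * jt (t ^ 2904) (t ^ (264 * n)) := by
  rw [thw, thv, ← mul_assoc, ← zpow_add₀ t0]
  congr 2
  ring

omit t1 in
theorem zpow_two_index (k : ℤ) : t ^ (264 * (2 * k)) = (t ^ (264 * k)) ^ 2 := by
  rw [← zpow_natCast, ← zpow_mul]; congr 1; push_cast; ring

omit t1 in
theorem thw_two_div (k : ℤ) : thw t (2 * k) / thw t k =
    t ^ (36 * k ^ 2 - 396 * k) * (t ^ (264 * k) * jt (t ^ 2904) ((t ^ (264 * k)) ^ 2) / jt (t ^ 2904) (t ^ (264 * k))) := by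
  rw [thw_eq t0, thw_eq t0, zpow_two_index t0, mul_div_mul_comm, ← zpow_sub₀ t0, mul_div_assoc, ← mul_assoc (t ^ (36 * k ^ 2 - 396 * k)),
    ← zpow_add₀ t0]
  congr 2
  ring

theorem summable_euler : Summable fun N : ℤ => (-1) ^ N * t ^ (36 * N ^ 2 - 132 * N) := by
  refine ((summable_norm_coef (pow_ne_zero 24 t0) (norm_pow_lt_one t1 (k := 24) (by norm_num)) (k := 3) (by norm_num)
    (zpow_ne_zero (-96) t0) 0 _ norm_neg_one_zpow).of_norm).congr fun N => ?_
  rw [← zpow_natCast t 24, ← zpow_mul, ← zpow_mul, mul_assoc, ← zpow_add₀ t0]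
  congr 2
  have := two_tri N
  push_cast
  linear_combination 36 * this

theorem euler_dissection {l : ℤ} (hl : ¬ (11 : ℤ) ∣ l) (hl2 : Odd l) :
    qpi (t ^ 24) (t ^ 24) = t ^ 120 * qpi (t ^ 2904) (t ^ 2904) * thE fun n => thw t (l * n) := by
  have H0 := pow_ne_zero 2904 t0
  have H1 : ‖t ^ 2904‖ < 1 := norm_pow_lt_one t1 (by norm_num)
  have e1 : qpi (t ^ 24) (t ^ 24) = t ^ 120 * ∑' N : ℤ, (-1) ^ N * t ^ (36 * N ^ 2 - 132 * N) := by
    rw [← thC_one_one (pow_ne_zero 24 t0) (norm_pow_lt_one t1 (by norm_num)), thC, ← tsum_mul_left,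
      ← ((Equiv.neg ℤ).trans (Equiv.addRight 2)).tsum_eq]
    refine tsum_congr fun n => ?_
    simp only [Equiv.trans_apply, Equiv.neg_apply, Equiv.coe_addRight, one_zpow, mul_one, one_mul]
    have sg : (-1 : ℂ) ^ (-n + 2) = (-1) ^ n := by
      rw [zpow_add₀ (by norm_num), neg_one_zpow_neg]; norm_num
    rw [← zpow_natCast t 24, ← zpow_natCast t 120, ← zpow_mul, mul_left_comm, ← zpow_add₀ t0, sg]
    congr 2
    have := two_tri (-n + 2)
    push_cast
    linear_combination 36 * this
  have e2 : ∀ k : ℤ, ∑' n : ℤ, (-1) ^ (11 * n + k) * t ^ (36 * (11 * n + k) ^ 2 - 132 * (11 * n + k)) =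
      (-1) ^ k * t ^ (36 * k ^ 2 - 132 * k) * thC (t ^ 2904) 1 (t ^ (792 * k)) := by
    intro k
    rw [thC, ← tsum_mul_left]
    refine tsum_congr fun n => ?_
    rw [zpow_add₀ (by norm_num), neg_one_zpow_mul_of_odd (by decide), ← zpow_natCast t 2904, ← zpow_mul, ← zpow_mul]
    have : 36 * (11 * n + k) ^ 2 - 132 * (11 * n + k) =
        (36 * k ^ 2 - 132 * k) + ((2904 : ℕ) : ℤ) * (3 * tri n + 1 * n) + 792 * k * n := by
      have := two_tri n
      push_cast
      linear_combination -4356 * this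
    rw [this, zpow_add₀ t0, zpow_add₀ t0]
    ring
  rw [e1, tsum_int_eq_symm_sum (summable_euler t0 t1) hl, thE, mul_assoc]
  congr 1
  have e20 := e2 0
  simp only [add_zero, zpow_zero, mul_zero, one_mul, zero_pow two_ne_zero, sub_zero] at e20
  rw [e20, thC_one_one H0 H1, mul_add, mul_one, Finset.mul_sum]
  congr 1
  refine Finset.sum_congr rfl fun j hj => ?_
  rw [Finset.mem_range] at hj
  have hk : ¬ (11 : ℤ) ∣ l * ((j : ℤ) + 1) := fun h => by
    rcases Int.Prime.dvd_mul' (by norm_num : Nat.Prime 11) h with h | h <;> omega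
  have hk2 : ¬ (11 : ℤ) ∣ 2 * (l * ((j : ℤ) + 1)) := by omega
  set k := l * ((j : ℤ) + 1) with hkd
  simp only [sub_eq_add_neg] at e2 ⊢
  rw [e2 k, e2 (-k), show l * (2 * ((j : ℤ) + 1)) = 2 * k by rw [hkd]; ring, thw_two_div t0]
  have z1 := NP_index t0 t1 hk
  have z2 := NP_index t0 t1 hk2
  have hs := zpow_two_index t0 k
  have hc : t ^ (792 * k) = (t ^ (264 * k)) ^ 3 := by
    rw [← zpow_natCast, ← zpow_mul]; congr 1; push_cast; ring
  rw [hs] at z2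
  have quin := thC_quintuple H0 H1 z1 z2
  rw [thC_one_one H0 H1] at quin
  have hc' : t ^ (792 * -k) = ((t ^ (264 * k)) ^ 3)⁻¹ := by
    rw [← hc, ← zpow_neg]; congr 1; ring
  have sg : (-1 : ℂ) ^ k = (-1) ^ (j + 1) := by
    rw [hkd, neg_one_zpow_mul_of_odd hl2]; norm_cast
  rw [hc, hc', neg_one_zpow_neg, sg]
  have p1 : t ^ (36 * k ^ 2 + -(132 * k)) = t ^ (36 * k ^ 2 - 396 * k) * t ^ (264 * k) := by
    rw [← zpow_add₀ t0]; congr 1; ring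
  have p2 : t ^ (36 * (-k) ^ 2 + -(132 * -k)) = t ^ (36 * k ^ 2 - 396 * k) * (t ^ (264 * k)) ^ 2 := by
    rw [← hs, ← zpow_add₀ t0]; congr 1; ring
  rw [p1, p2]
  linear_combination (-1) ^ (j + 1) * t ^ (36 * k ^ 2 - 396 * k) * quin

end Dissection

/-- The Lambert series `Σ_{n ≠ 0} (-1)^n q^(n (3 n + 1) / 2 + b n) / (1 - q^(11 n))` at `q = t ^ 24`. -/
noncomputable def lamS (t : ℂ) (b : ℤ) : ℂ :=
  ∑' n : ℤ, if n = 0 then 0 else (-1) ^ n * t ^ (12 * n * (3 * n + 1) + 24 * b * n) / (1 - t ^ (264 * n))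

/-- The summand of the shifted Lambert series. -/
noncomputable def lamTerm (t : ℂ) (l N : ℤ) : ℂ :=
  if N = -l then 0 else (-1) ^ N * t ^ (36 * N ^ 2 + 396 * N) / (1 - t ^ (264 * (l + N)))

section Dissection
variable {t : ℂ} (t0 : t ≠ 0) (t1 : ‖t‖ < 1)
include t0 t1

theorem norm_inv_one_sub_le {n : ℤ} (hn : n ≠ 0) : ‖(1 - t ^ (264 * n))⁻¹‖ ≤ (1 - ‖t ^ 264‖)⁻¹ := by
  have := norm_inv_one_sub_zpow_le (pow_ne_zero 264 t0) (norm_pow_lt_one t1 (by norm_num)) hn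
  rwa [← zpow_natCast t 264, ← zpow_mul] at this

theorem summable_norm_gauss {a : ℤ} (k : ℕ) (hk : k ≠ 0) :
    Summable fun N : ℤ => ‖(-1) ^ N * t ^ (k * N ^ 2 + a * N)‖ := by
  refine ((summable_norm_coef (pow_ne_zero 2 t0) (norm_pow_lt_one t1 (k := 2) (by norm_num)) hk
    (zpow_ne_zero (a + k) t0) 0 _ norm_neg_one_zpow)).congr fun N => ?_
  rw [← zpow_natCast t 2, ← zpow_mul, ← zpow_mul, mul_assoc, ← zpow_add₀ t0]
  congr 3
  have := two_tri N
  push_cast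
  linear_combination k * this

theorem summable_lamTerm (l : ℤ) : Summable (lamTerm t l) := by
  refine Summable.of_norm_bounded ((summable_norm_gauss t0 t1 (a := 396) 36 (by norm_num)).mul_right
    (1 - ‖t ^ 264‖)⁻¹) fun N => ?_
  have hp : 0 ≤ (1 - ‖t ^ 264‖)⁻¹ :=
    inv_nonneg.mpr (by have := norm_pow_lt_one t1 (k := 264) (by norm_num); linarith)
  rw [lamTerm]
  split_ifs with h
  · rw [norm_zero]; positivity
  · rw [div_eq_mul_inv, norm_mul]
    exact mul_le_mul_of_nonneg_left (norm_inv_one_sub_le t0 t1 (by omega)) (norm_nonneg _)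

omit t1 in
theorem lamS_eq (l : ℤ) (hl : Odd l) :
    lamS t (16 - 3 * l) = -(t ^ (396 * l - 36 * l ^ 2) * ∑' N, lamTerm t l N) := by
  rw [lamS, ← tsum_mul_left, ← tsum_neg, ← (Equiv.addRight l).tsum_eq]
  refine tsum_congr fun N => ?_
  simp only [Equiv.coe_addRight, lamTerm, show N + l = 0 ↔ N = -l by omega]
  split_ifs with h
  · simp
  · rw [zpow_add₀ (by norm_num), hl.neg_one_zpow, add_comm N l,
      show 12 * (l + N) * (3 * (l + N) + 1) + 24 * (16 - 3 * l) * (l + N) =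
        (396 * l - 36 * l ^ 2) + (36 * N ^ 2 + 396 * N) by ring, zpow_add₀ t0]
    ring

omit t1 in
theorem lamTerm_class_exponent (n k : ℤ) : (-1 : ℂ) ^ (11 * n + k) * t ^ (36 * (11 * n + k) ^ 2 + 396 * (11 * n + k)) =
    (-1) ^ k * t ^ (36 * k ^ 2 + 396 * k) * ((-1) ^ n * (t ^ 2904) ^ (3 * tri n + 3 * n) * (t ^ (792 * k)) ^ n) := by
  rw [zpow_add₀ (by norm_num), neg_one_zpow_mul_of_odd (by decide), ← zpow_natCast t 2904, ← zpow_mul, ← zpow_mul]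
  have : 36 * (11 * n + k) ^ 2 + 396 * (11 * n + k) =
      (36 * k ^ 2 + 396 * k) + ((2904 : ℕ) : ℤ) * (3 * tri n + 3 * n) + 792 * k * n := by
    have := two_tri n
    push_cast
    linear_combination -4356 * this
  rw [this, zpow_add₀ t0, zpow_add₀ t0]
  ring

omit t1 in
theorem tsum_lamTerm_class {l k : ℤ} (h : ¬ (11 : ℤ) ∣ l + k) : ∑' n : ℤ, lamTerm t l (11 * n + k) =
    (-1) ^ k * t ^ (36 * k ^ 2 + 396 * k) * App (t ^ 2904) (t ^ (264 * (l + k))) (t ^ (792 * k)) := by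
  rw [App, ← tsum_mul_left]
  refine tsum_congr fun n => ?_
  rw [lamTerm, if_neg (by omega), lamTerm_class_exponent t0, mul_div_assoc]
  congr 3
  rw [← zpow_natCast t 2904, ← zpow_mul, ← zpow_add₀ t0]
  congr 2
  push_cast
  ring

omit t1 in
theorem tsum_lamTerm_polar (l : ℤ) : ∑' n : ℤ, lamTerm t l (11 * n + -l) =
    (-1) ^ l * t ^ (36 * l ^ 2 - 396 * l) * AppPole (t ^ 2904) (t ^ (792 * l))⁻¹ := by
  rw [AppPole, ← tsum_mul_left]
  refine tsum_congr fun n => ?_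
  rw [lamTerm]
  by_cases h : n = 0
  · rw [if_pos (by omega), if_pos h, mul_zero]
  · rw [if_neg (by omega), if_neg h, lamTerm_class_exponent t0, ← zpow_neg, neg_one_zpow_neg, mul_div_assoc,
      show 36 * (-l) ^ 2 + 396 * -l = 36 * l ^ 2 - 396 * l by ring, show 792 * -l = -(792 * l) by ring]
    rw [← zpow_natCast t 2904, ← zpow_mul t _ n, ← zpow_mul t _ n, show 264 * (l + (11 * n + -l)) = ((2904 : ℕ) : ℤ) * n by push_cast; ring]

omit t1 in
theorem zpow_three_index (k : ℤ) : t ^ (792 * k) = (t ^ (264 * k)) ^ 3 := by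
  rw [← zpow_natCast, ← zpow_mul]; congr 1; push_cast; ring

theorem lamTerm_pair {l k : ℤ} (hl : ¬ (11 : ℤ) ∣ l) (hk : ¬ (11 : ℤ) ∣ k) (h1 : ¬ (11 : ℤ) ∣ l + k)
    (h2 : ¬ (11 : ℤ) ∣ l - k) :
    (∑' n : ℤ, lamTerm t l (11 * n + k)) + ∑' n : ℤ, lamTerm t l (11 * n - k) =
      (-1) ^ k * (thw t (2 * k) / thw t k * App (t ^ 2904) (t ^ (264 * l)) 1 +
        t ^ (36 * l ^ 2 - 396 * l) * (thD t * (thw t k * thw t (2 * k) / (thw t (l - k) * thw t l * thw t (l + k))))) := by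
  have H0 := pow_ne_zero 2904 t0
  have H1 : ‖t ^ 2904‖ < 1 := norm_pow_lt_one t1 (by norm_num)
  have m1 : t ^ (264 * (l + k)) = t ^ (264 * l) * t ^ (264 * k) := by rw [← zpow_add₀ t0]; congr 1; ring
  have m2 : t ^ (264 * (l - k)) = t ^ (264 * l) / t ^ (264 * k) := by rw [← zpow_sub₀ t0]; congr 1; ring
  have hk2 : ¬ (11 : ℤ) ∣ 2 * k := by omega
  have n1 := NP_index t0 t1 h1
  have n2 := NP_index t0 t1 h2
  have n3 := NP_index t0 t1 hk2
  rw [m1] at n1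
  rw [m2] at n2
  rw [zpow_two_index t0] at n3
  have rel := app_relation H0 H1 (NP_index t0 t1 hl) n2 n1 (NP_index t0 t1 hk) n3
  have c1 := tsum_lamTerm_class t0 h1
  have c2 := tsum_lamTerm_class t0 (l := l) (k := -k) (by rwa [← sub_eq_add_neg])
  simp only [← sub_eq_add_neg] at c2
  have e3 : t ^ (792 * -k) = ((t ^ (264 * k)) ^ 3)⁻¹ := by
    rw [← zpow_three_index t0, ← zpow_neg]; congr 1; ring
  rw [c1, c2, m1, m2, e3, zpow_three_index t0, neg_one_zpow_neg, thw_two_div t0]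
  have p1 : t ^ (36 * k ^ 2 + 396 * k) = t ^ (36 * k ^ 2 - 396 * k) * (t ^ (264 * k)) ^ 3 := by
    rw [← zpow_three_index t0, ← zpow_add₀ t0]; congr 1; ring
  have p2 : t ^ (36 * (-k) ^ 2 + 396 * -k) = t ^ (36 * k ^ 2 - 396 * k) := by congr 1; ring
  have p3 : t ^ (36 * l ^ 2 - 396 * l) * (thD t * (thw t k * thw t (2 * k) / (thw t (l - k) * thw t l * thw t (l + k)))) =
      t ^ (36 * k ^ 2 - 396 * k) * (qpi (t ^ 2904) (t ^ 2904) ^ 3 * jt (t ^ 2904) (t ^ (264 * k)) *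
        jt (t ^ 2904) ((t ^ (264 * k)) ^ 2) / (jt (t ^ 2904) (t ^ (264 * l) / t ^ (264 * k)) *
        jt (t ^ 2904) (t ^ (264 * l)) * jt (t ^ 2904) (t ^ (264 * l) * t ^ (264 * k)))) := by
    rw [thD, thw_eq t0, thw_eq t0, thw_eq t0, thw_eq t0, thw_eq t0, m1, m2, zpow_two_index t0]
    have x1 := jt_ne H0 H1 n1
    have x2 := jt_ne H0 H1 n2
    have x3 := jt_ne H0 H1 (NP_index t0 t1 hl)
    have ex : t ^ (36 * l ^ 2 - 396 * l) * (t ^ 363 * (t ^ (12 * k ^ 2 + 363 - 132 * k) *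
        t ^ (12 * (2 * k) ^ 2 + 363 - 132 * (2 * k)))) = t ^ (36 * k ^ 2 - 396 * k) *
        (t ^ (12 * (l - k) ^ 2 + 363 - 132 * (l - k)) * t ^ (12 * l ^ 2 + 363 - 132 * l) *
          t ^ (12 * (l + k) ^ 2 + 363 - 132 * (l + k))) := by
      rw [← zpow_natCast t 363]
      simp only [← zpow_add₀ t0]
      congr 1
      push_cast
      ring
    have y1 := zpow_ne_zero (12 * (l - k) ^ 2 + 363 - 132 * (l - k)) t0
    have y2 := zpow_ne_zero (12 * l ^ 2 + 363 - 132 * l) t0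
    have y3 := zpow_ne_zero (12 * (l + k) ^ 2 + 363 - 132 * (l + k)) t0
    generalize t ^ (36 * k ^ 2 - 396 * k) = A1 at *
    generalize t ^ (12 * (l - k) ^ 2 + 363 - 132 * (l - k)) = A2 at *
    generalize t ^ (12 * l ^ 2 + 363 - 132 * l) = A3 at *
    generalize t ^ (12 * (l + k) ^ 2 + 363 - 132 * (l + k)) = A4 at *
    generalize t ^ (12 * k ^ 2 + 363 - 132 * k) = A5 at *
    generalize t ^ (12 * (2 * k) ^ 2 + 363 - 132 * (2 * k)) = A6 at *
    generalize t ^ (36 * l ^ 2 - 396 * l) = A7 at *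
    generalize t ^ (264 * l) / t ^ (264 * k) = B1 at *
    generalize t ^ (264 * l) * t ^ (264 * k) = B2 at *
    generalize qpi (t ^ 2904) (t ^ 2904) = J at *
    field_simp
    linear_combination J ^ 3 * jt (t ^ 2904) (t ^ (264 * k)) * jt (t ^ 2904) ((t ^ (264 * k)) ^ 2) * ex
  rw [p1, p2, p3]
  linear_combination (-1) ^ k * t ^ (36 * k ^ 2 - 396 * k) * rel

theorem lamTerm_pair_polar {l : ℤ} (hl : ¬ (11 : ℤ) ∣ l) :
    (∑' n : ℤ, lamTerm t l (11 * n + l)) + ∑' n : ℤ, lamTerm t l (11 * n - l) =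
      (-1) ^ l * (thw t (2 * l) / thw t l * App (t ^ 2904) (t ^ (264 * l)) 1 +
        t ^ (36 * l ^ 2 - 396 * l) * (lam (t ^ 2904) (t ^ (264 * l)) + lam (t ^ 2904) (t ^ (264 * (2 * l))))) := by
  have H0 := pow_ne_zero 2904 t0
  have H1 : ‖t ^ 2904‖ < 1 := norm_pow_lt_one t1 (by norm_num)
  have hl2 : ¬ (11 : ℤ) ∣ 2 * l := by omega
  have n3 := NP_index t0 t1 hl2
  rw [zpow_two_index t0] at n3
  have rel := App_polar_relation H0 H1 (NP_index t0 t1 hl) n3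
  have c1 := tsum_lamTerm_class t0 (l := l) (k := l) (by omega)
  have c2 := tsum_lamTerm_polar t0 l
  simp only [← sub_eq_add_neg] at c2
  have m1 : t ^ (264 * (l + l)) = (t ^ (264 * l)) ^ 2 := by rw [← zpow_two_index t0]; congr 1; ring
  have p1 : t ^ (36 * l ^ 2 + 396 * l) = t ^ (36 * l ^ 2 - 396 * l) * (t ^ (264 * l)) ^ 3 := by
    rw [← zpow_three_index t0, ← zpow_add₀ t0]; congr 1; ring
  rw [c1, c2, m1, zpow_two_index t0, zpow_three_index t0, thw_two_div t0, p1]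
  linear_combination (-1) ^ l * t ^ (36 * l ^ 2 - 396 * l) * rel

theorem lamS_dissection {l : ℤ} (hl : ¬ (11 : ℤ) ∣ l) (hl2 : Odd l) :
    lamS t (16 - 3 * l) - (11 - 3 * l) / 11 =
      -(t ^ (396 * l - 36 * l ^ 2) * thE (fun n => thw t (l * n)) * App (t ^ 2904) (t ^ (264 * l)) 1) +
      (lamw t (l * 1) + lamw t (l * 2)) - thD t * ∑ j ∈ Finset.range 4, (-1) ^ j *
        (thw t (l * (j + 2)) * thw t (l * (2 * (j + 2))) /
          (thw t (l * (-(j + 1))) * thw t (l * 1) * thw t (l * (j + 3)))) := by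
  have c0 := tsum_lamTerm_class t0 (l := l) (k := 0) (by simpa using hl)
  simp only [add_zero, zpow_zero, mul_zero, one_mul, zero_pow two_ne_zero] at c0
  rw [lamS_eq t0 l hl2, tsum_int_eq_symm_sum (summable_lamTerm t0 t1 l) hl, c0, Finset.sum_range_succ']
  have X := zpow_ne_zero (396 * l - 36 * l ^ 2) t0
  have XY : t ^ (396 * l - 36 * l ^ 2) * t ^ (36 * l ^ 2 - 396 * l) = 1 := by
    rw [← zpow_add₀ t0]; simp
  set A := App (t ^ 2904) (t ^ (264 * l)) 1
  have hp : ∑ j ∈ Finset.range 4, ((∑' n : ℤ, lamTerm t l (11 * n + l * (((j + 1 : ℕ) : ℤ) + 1))) +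
      ∑' n : ℤ, lamTerm t l (11 * n - l * (((j + 1 : ℕ) : ℤ) + 1))) =
      (∑ j ∈ Finset.range 4, (-1) ^ j * (thw t (l * (2 * (((j + 1 : ℕ) : ℤ) + 1))) /
        thw t (l * (((j + 1 : ℕ) : ℤ) + 1)))) * A + t ^ (36 * l ^ 2 - 396 * l) * (thD t *
      ∑ j ∈ Finset.range 4, (-1) ^ j * (thw t (l * (j + 2)) * thw t (l * (2 * (j + 2))) /
          (thw t (l * (-(j + 1))) * thw t (l * 1) * thw t (l * (j + 3))))) := by
    rw [Finset.mul_sum, Finset.mul_sum, Finset.sum_mul, ← Finset.sum_add_distrib]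
    refine Finset.sum_congr rfl fun j hj => ?_
    rw [Finset.mem_range] at hj
    have dv : ∀ m : ℤ, ¬ (11 : ℤ) ∣ m → ¬ (11 : ℤ) ∣ l * m := fun m hm h => by
      rcases Int.Prime.dvd_mul' (by norm_num : Nat.Prime 11) h with h | h
      · exact hl h
      · exact hm h
    have e1 : l + l * (((j + 1 : ℕ) : ℤ) + 1) = l * (j + 3) := by push_cast; ring
    have e2 : l - l * (((j + 1 : ℕ) : ℤ) + 1) = l * (-(j + 1)) := by push_cast; ring
    have e3 : 2 * (l * (((j + 1 : ℕ) : ℤ) + 1)) = l * (2 * (((j + 1 : ℕ) : ℤ) + 1)) := by ring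
    have sg : (-1 : ℂ) ^ (l * (((j + 1 : ℕ) : ℤ) + 1)) = (-1) ^ j := by
      rw [neg_one_zpow_mul_of_odd hl2, show ((j + 1 : ℕ) : ℤ) + 1 = ((j + 2 : ℕ) : ℤ) by push_cast; ring, zpow_natCast,
        pow_add]
      norm_num
    rw [lamTerm_pair t0 t1 hl (dv _ (by omega)) (by rw [e1]; exact dv _ (by omega)) (by rw [e2]; exact dv _ (by omega)),
      e1, e2, e3, sg, mul_one, show (((j + 1 : ℕ) : ℤ) + 1) = (j : ℤ) + 2 by push_cast; ring]
    ring
  have hq := lamTerm_pair_polar t0 t1 hl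
  rw [hl2.neg_one_zpow, mul_comm 2 l] at hq
  rw [hp, thE, Finset.sum_range_succ' _ 4]
  have sg : ∑ j ∈ Finset.range 4, (-1 : ℂ) ^ (j + 1 + 1) * (thw t (l * (2 * (((j + 1 : ℕ) : ℤ) + 1))) /
        thw t (l * (((j + 1 : ℕ) : ℤ) + 1))) = ∑ j ∈ Finset.range 4, (-1) ^ j *
        (thw t (l * (2 * (((j + 1 : ℕ) : ℤ) + 1))) / thw t (l * (((j + 1 : ℕ) : ℤ) + 1))) :=
    Finset.sum_congr rfl fun j _ => by rw [pow_add, pow_add]; norm_num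
  rw [sg]
  simp only [Nat.cast_zero, zero_add, mul_one, pow_one, hq, lamw]
  push_cast
  linear_combination (-(lam (t ^ 2904) (t ^ (264 * l)) + lam (t ^ 2904) (t ^ (264 * (l * 2)))) * (-1) -
    thD t * ∑ j ∈ Finset.range 4, (-1) ^ j * (thw t (l * (j + 2)) * thw t (l * (2 * (j + 2))) /
          (thw t (l * (-(j + 1))) * thw t l * thw t (l * (j + 3))))) * XY

end Dissection

/-- The sum of the eleven graded pieces attached to the multiplier `l`. -/
noncomputable def gradedTerm (t : ℂ) (l : ℤ) (c : ℕ) : ℂ :=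
  numer (fun n => thw t (l * n)) (absc fun n => thw t (l * n)) (ordi fun n => thw t (l * n)) c

theorem ThetaData.thE_eq {θ L : ℤ → ℂ} {D : ℂ} (h : ThetaData θ L D) : thE θ =
    1 - mn θ (-1) 1 0 0 0 + mn θ 0 (-1) 0 1 0 - mn θ 0 0 (-1) 0 1 + mn θ 0 0 1 (-1) 0 - mn θ 1 0 0 0 (-1) := by
  obtain ⟨h6, h7, h8, h9⟩ := h.theta_values
  have h10 : θ 10 = θ 1 := h.eleven_sub 1
  simp only [thE, Finset.sum_range_succ, Finset.sum_range_zero, mn]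
  norm_num [h6, h7, h8, h9, h10]
  ring

theorem ThetaData.sum_quotients_eq {θ L : ℤ → ℂ} {D : ℂ} (h : ThetaData θ L D) :
    ∑ j ∈ Finset.range 4, (-1) ^ j * (θ (j + 2) * θ (2 * (j + 2)) / (θ (-(j + 1)) * θ 1 * θ (j + 3))) =
      -mn θ (-2) 1 (-1) 1 0 + mn θ (-1) (-1) 1 (-1) 1 - mn θ (-1) 0 0 1 (-1) + mn θ 0 0 0 (-1) 0 := by
  obtain ⟨h6, h7, h8, h9⟩ := h.theta_values
  obtain ⟨h1, h2, h3, h4, h5⟩ := h.ne_values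
  have h10 : θ 10 = θ 1 := h.eleven_sub 1
  simp only [Finset.sum_range_succ, Finset.sum_range_zero, mn]
  norm_num [h6, h7, h8, h9, h10, h.odd]
  have z2 : θ 1 ^ (-2 : ℤ) = (θ 1 ^ 2)⁻¹ := by rw [zpow_neg]; norm_cast
  try rw [z2]
  field_simp
  ring

section Quotient
variable {t : ℂ} (t0 : t ≠ 0) (t1 : ‖t‖ < 1)
include t0 t1

/-- The eleven-fold dissection of the Lambert series. -/
theorem lamS_quotient {l : ℤ} (hl : ¬ (11 : ℤ) ∣ l) (hl2 : Odd l) :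
    t ^ 120 * qpi (t ^ 2904) (t ^ 2904) * (11 * (lamS t (16 - 3 * l) - (11 - 3 * l) / 11)) =
      qpi (t ^ 24) (t ^ 24) * (-(11 * t ^ (396 * l - 36 * l ^ 2) * App (t ^ 2904) (t ^ (264 * l)) 1) -
        thD t ^ 5 * ∑ c ∈ Finset.range 11, gradedTerm t l c) := by
  have h := (thetaData t0 t1).scale hl2 hl
  have s := h.sum_numer (thD_ne_zero t0 t1)
  rw [← h.thE_eq, ← h.sum_quotients_eq] at s
  rw [lamS_dissection t0 t1 hl hl2, euler_dissection t0 t1 hl hl2]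
  simp only [gradedTerm]
  linear_combination (t ^ 120 * qpi (t ^ 2904) (t ^ 2904)) * s

end Quotient

/-- The multisets of positive integers, that is, the partitions. -/
def posM : Set (Multiset ℕ) := {s | 0 ∉ s}

theorem YoungDiagram.sup_rowLens (μ : YoungDiagram) :
    (μ.rowLens : Multiset ℕ).sup = μ.rowLen 0 := by
  apply le_antisymm
  · rw [Multiset.sup_le]
    intro b hb
    rw [Multiset.mem_coe, YoungDiagram.rowLens, List.mem_map] at hb
    obtain ⟨i, -, rfl⟩ := hb
    exact μ.rowLen_anti 0 i (Nat.zero_le _)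
  · rcases Nat.eq_zero_or_pos (μ.rowLen 0) with h | h
    · rw [h]; exact Nat.zero_le _
    · apply Multiset.le_sup
      rw [Multiset.mem_coe, YoungDiagram.rowLens, List.mem_map]
      refine ⟨0, ?_, rfl⟩
      rw [List.mem_range, ← YoungDiagram.mem_iff_lt_colLen, YoungDiagram.mem_iff_lt_rowLen]
      exact h

theorem YoungDiagram.sum_rowLens (μ : YoungDiagram) :
    (μ.rowLens : Multiset ℕ).sum = μ.card := by
  rw [Multiset.sum_coe, YoungDiagram.rowLens, YoungDiagram.card,
    Finset.card_eq_sum_card_fiberwise (f := Prod.fst) (t := Finset.range (μ.colLen 0))]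
  · rw [← List.sum_toFinset _ (List.nodup_range), List.toFinset_range]
    refine Finset.sum_congr rfl fun i _ => ?_
    rw [YoungDiagram.rowLen_eq_card]
    rfl
  · intro c hc
    rw [Finset.mem_coe, Finset.mem_range, ← YoungDiagram.mem_iff_lt_colLen]
    exact μ.up_left_mem le_rfl (Nat.zero_le _) hc

theorem YoungDiagram.card_transpose (μ : YoungDiagram) : μ.transpose.card = μ.card := by
  rw [YoungDiagram.card, YoungDiagram.card, YoungDiagram.transpose]
  simp

theorem YoungDiagram.coe_rowLens_injective {μ ν : YoungDiagram}
    (h : (μ.rowLens : Multiset ℕ) = ν.rowLens) : μ = ν := by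
  rw [Multiset.coe_eq_coe] at h
  have h' := h.eq_of_sortedGE μ.rowLens_sorted ν.rowLens_sorted
  apply YoungDiagram.equivListRowLens.injective
  exact Subtype.ext h'

theorem YoungDiagram.exists_coe_rowLens {s : Multiset ℕ} (hs : s ∈ posM) :
    ∃ μ : YoungDiagram, (μ.rowLens : Multiset ℕ) = s := by
  have h1 : (s.sort (· ≥ ·)).SortedGE := by
    exact (Multiset.pairwise_sort s (· ≥ ·)).sortedGE
  have h2 : ∀ x ∈ s.sort (· ≥ ·), 0 < x := by
    intro x hx
    rw [Multiset.mem_sort] at hx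
    exact Nat.pos_of_ne_zero fun h => hs (h ▸ hx)
  refine ⟨YoungDiagram.ofRowLens _ h1, ?_⟩
  rw [YoungDiagram.rowLens_ofRowLens_eq_self h2, Multiset.sort_eq]

theorem exists_conjugation : ∃ c : Multiset ℕ → Multiset ℕ, ∀ s ∈ posM,
    c s ∈ posM ∧ c (c s) = s ∧ (c s).sum = s.sum ∧ (c s).sup = s.card ∧ (c s).card = s.sup := by
  classical
  let c : Multiset ℕ → Multiset ℕ := fun s =>
    if h : ∃ μ : YoungDiagram, (μ.rowLens : Multiset ℕ) = s then
      (h.choose.transpose.rowLens : Multiset ℕ) else s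
  have hc : ∀ μ : YoungDiagram, c (μ.rowLens : Multiset ℕ) = (μ.transpose.rowLens : Multiset ℕ) := by
    intro μ
    have h : ∃ ν : YoungDiagram, (ν.rowLens : Multiset ℕ) = μ.rowLens := ⟨μ, rfl⟩
    simp only [c]
    rw [dif_pos h, YoungDiagram.coe_rowLens_injective h.choose_spec]
  refine ⟨c, fun s hs => ?_⟩
  obtain ⟨μ, rfl⟩ := YoungDiagram.exists_coe_rowLens hs
  rw [hc, hc, YoungDiagram.transpose_transpose]
  refine ⟨?_, rfl, ?_, ?_, ?_⟩
  · intro h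
    exact absurd (YoungDiagram.pos_of_mem_rowLens _ 0 (Multiset.mem_coe.mp h)) (lt_irrefl 0)
  · rw [YoungDiagram.sum_rowLens, YoungDiagram.sum_rowLens, YoungDiagram.card_transpose]
  · rw [YoungDiagram.sup_rowLens, YoungDiagram.rowLen_transpose, Multiset.coe_card,
      YoungDiagram.length_rowLens]
  · rw [YoungDiagram.sup_rowLens, Multiset.coe_card,
      YoungDiagram.length_rowLens, YoungDiagram.colLen_transpose]

/-- The partitions and the multisets of positive integers correspond. -/
def partitionSigmaEquiv : (Σ n, Nat.Partition n) ≃ posM where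
  toFun x := ⟨x.2.parts, fun h => absurd (x.2.parts_pos h) (lt_irrefl 0)⟩
  invFun s := ⟨s.1.sum, ⟨s.1, fun {i} hi => Nat.pos_of_ne_zero fun h => s.2 (h ▸ hi), rfl⟩⟩
  left_inv := by
    rintro ⟨n, p⟩
    obtain ⟨s, h1, h2⟩ := p
    subst h2
    rfl
  right_inv _ := rfl

theorem Nat.Partition.card_le_two_pow (n : ℕ) : Fintype.card (Nat.Partition n) ≤ 2 ^ n := by
  refine (Fintype.card_le_of_surjective _ (Nat.Partition.ofComposition_surj (n := n))).trans ?_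
  rw [composition_card]
  exact Nat.pow_le_pow_right (by norm_num) (Nat.sub_le _ _)

section Subset
variable {α : Type*} {f : α → ℝ} {S T : Set α}

theorem summable_subset_of_summable (h : Summable fun x : T => f x) (hS : S ⊆ T) :
    Summable fun x : S => f x :=
  h.comp_injective (Set.inclusion_injective hS)

theorem tsum_subset_le_of_nonneg (hf : ∀ x, 0 ≤ f x) (h : Summable fun x : T => f x) (hS : S ⊆ T) :
    ∑' x : S, f x ≤ ∑' x : T, f x :=
  (summable_subset_of_summable h hS).tsum_le_tsum_of_inj (Set.inclusion hS)
    (Set.inclusion_injective hS) (fun c _ => hf c) (fun _ => le_rfl) h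

theorem tsum_union_of_disjoint {f : α → ℂ} (hd : Disjoint S T) (h : Summable fun x : S => f x)
    (h' : Summable fun x : T => f x) : ∑' x : ↑(S ∪ T), f x = ∑' x : S, f x + ∑' x : T, f x :=
  Summable.tsum_union_disjoint hd h h'

end Subset

section Weight
variable {q : ℂ}

theorem summable_norm_partition (hq : ‖q‖ < 1 / 2) :
    Summable fun x : Σ n, Nat.Partition n => ‖q‖ ^ x.1 := by
  rw [summable_sigma_of_nonneg fun x => by positivity]
  refine ⟨fun n => Summable.of_finite, ?_⟩
  have h2 : ‖(2 * ‖q‖)‖ < 1 := by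
    rw [Real.norm_of_nonneg (by positivity)]; linarith
  refine Summable.of_nonneg_of_le (fun n => by positivity) (fun n => ?_)
    (summable_geometric_of_norm_lt_one h2)
  rw [tsum_fintype]
  change ∑ _b : Nat.Partition n, ‖q‖ ^ n ≤ _
  rw [Finset.sum_const, nsmul_eq_mul, mul_pow, Finset.card_univ]
  gcongr
  exact_mod_cast Nat.Partition.card_le_two_pow n

theorem summable_norm_posM (hq : ‖q‖ < 1 / 2) :
    Summable fun s : posM => ‖q ^ (s : Multiset ℕ).sum‖ := by
  rw [← partitionSigmaEquiv.summable_iff]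
  refine (summable_norm_partition hq).congr fun x => ?_
  rw [Function.comp_apply, norm_pow]
  congr 1
  exact x.2.parts_sum.symm

/-- The generating function of a set of partitions. -/
noncomputable def gfM (q : ℂ) (S : Set (Multiset ℕ)) : ℂ := ∑' s : S, q ^ (s : Multiset ℕ).sum

theorem summable_norm_gfM (hq : ‖q‖ < 1 / 2) {S : Set (Multiset ℕ)} (hS : S ⊆ posM) :
    Summable fun s : S => ‖q ^ (s : Multiset ℕ).sum‖ :=
  summable_subset_of_summable (f := fun s : Multiset ℕ => ‖q ^ s.sum‖) (summable_norm_posM hq) hS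

theorem summable_gfM (hq : ‖q‖ < 1 / 2) {S : Set (Multiset ℕ)} (hS : S ⊆ posM) :
    Summable fun s : S => q ^ (s : Multiset ℕ).sum :=
  (summable_norm_gfM hq hS).of_norm

theorem norm_gfM_le (hq : ‖q‖ < 1 / 2) {S : Set (Multiset ℕ)} (hS : S ⊆ posM) :
    ‖gfM q S‖ ≤ ∑' s : posM, ‖q ^ (s : Multiset ℕ).sum‖ :=
  (norm_tsum_le_tsum_norm (summable_norm_gfM hq hS)).trans
    (tsum_subset_le_of_nonneg (f := fun s : Multiset ℕ => ‖q ^ s.sum‖) (fun _ => norm_nonneg _) (summable_norm_posM hq) hS)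

theorem gfM_union (hq : ‖q‖ < 1 / 2) {S T : Set (Multiset ℕ)} (hS : S ⊆ posM) (hT : T ⊆ posM)
    (h : Disjoint S T) : gfM q (S ∪ T) = gfM q S + gfM q T :=
  tsum_union_of_disjoint (f := fun s : Multiset ℕ => q ^ s.sum) h (summable_gfM hq hS)
    (summable_gfM hq hT)

theorem gfM_singleton_zero : gfM q {0} = 1 := by
  rw [gfM, tsum_singleton (0 : Multiset ℕ) fun s => q ^ s.sum]
  simp

end Weight

theorem Multiset.sup_mem_of_ne_zero {s : Multiset ℕ} (hs : s ≠ 0) : s.sup ∈ s := by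
  induction s using Multiset.induction_on with
  | empty => exact absurd rfl hs
  | cons a s ih =>
    rw [Multiset.sup_cons]
    rcases eq_or_ne s 0 with rfl | h
    · simp
    · rcases le_total a s.sup with h1 | h1
      · rw [sup_eq_right.mpr h1]; exact Multiset.mem_cons_of_mem (ih h)
      · rw [sup_eq_left.mpr h1]; exact Multiset.mem_cons_self _ _

theorem cons_mem_posM {a : ℕ} {s : Multiset ℕ} : a ::ₘ s ∈ posM ↔ a ≠ 0 ∧ s ∈ posM := by
  simp [posM, eq_comm]

theorem eq_zero_of_sup_eq_zero {s : Multiset ℕ} (hs : s ∈ posM) (h : s.sup = 0) : s = 0 := by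
  by_contra h1
  exact hs (h ▸ Multiset.sup_mem_of_ne_zero h1)

/-- The nonempty partitions of rank at least `r`. -/
def rankGE (r : ℤ) : Set (Multiset ℕ) := {s | s ∈ posM ∧ s ≠ 0 ∧ r ≤ (s.sup : ℤ) - s.card}

theorem rankGE_subset (r : ℤ) : rankGE r ⊆ posM := fun _ h => h.1

theorem gfM_image (q : ℂ) {ι : Type*} {T : Set ι} {g : ι → Multiset ℕ} (hg : Set.InjOn g T) :
    gfM q (g '' T) = ∑' x : T, q ^ (g x).sum :=
  tsum_image (fun s : Multiset ℕ => q ^ s.sum) hg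

theorem gfM_conjugate (q : ℂ) (p : ℕ → ℕ → Prop) :
    gfM q {s | s ∈ posM ∧ s ≠ 0 ∧ p s.sup s.card} = gfM q {s | s ∈ posM ∧ s ≠ 0 ∧ p s.card s.sup} := by
  obtain ⟨c, hc⟩ := exists_conjugation
  have h0 : ∀ s ∈ posM, s ≠ 0 → c s ≠ 0 := by
    intro s hs h1 h2
    have h3 := (hc s hs).2.2.2.2
    rw [h2, Multiset.card_zero] at h3
    exact h1 (eq_zero_of_sup_eq_zero hs h3.symm)
  have h1 : {s | s ∈ posM ∧ s ≠ 0 ∧ p s.sup s.card} =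
      c '' {s | s ∈ posM ∧ s ≠ 0 ∧ p s.card s.sup} := by
    ext s
    constructor
    · rintro ⟨hs, hn, hp⟩
      obtain ⟨c1, c2, c3, c4, c5⟩ := hc s hs
      refine ⟨c s, ⟨c1, h0 s hs hn, ?_⟩, c2⟩
      rw [c4, c5]; exact hp
    · rintro ⟨s, ⟨hs, hn, hp⟩, rfl⟩
      obtain ⟨c1, c2, c3, c4, c5⟩ := hc s hs
      refine ⟨c1, h0 s hs hn, ?_⟩
      rw [c4, c5]; exact hp
  rw [h1, gfM_image, gfM]
  · refine tsum_congr fun s => ?_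
    rw [(hc s.1 s.2.1).2.2.1]
  · intro s hs u hu h
    rw [← (hc s hs.1).2.1, ← (hc u hu.1).2.1, h]

section Rank
variable {q : ℂ}

theorem gfM_rankGE_nat (hq : ‖q‖ < 1 / 2) (s : ℕ) :
    gfM q (rankGE s) = q ^ (s + 1) * (1 + gfM q (rankGE (-s - 2))) := by
  obtain ⟨c, hc⟩ := exists_conjugation
  let K : Set (ℕ × Multiset ℕ) := {p | p.2 ∈ posM ∧ p.2.sup ≤ p.1 ∧ p.2.card ≤ p.1 + s + 1}
  let f : ℕ × Multiset ℕ → Multiset ℕ := fun p => (p.1 + s + 1) ::ₘ c p.2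
  let g : ℕ × Multiset ℕ → Multiset ℕ := fun p => if p.1 = 0 then p.2 else p.1 ::ₘ p.2
  have fsup : ∀ p ∈ K, (f p).sup = p.1 + s + 1 := by
    rintro p ⟨h1, h2, h3⟩
    obtain ⟨c1, c2, c3, c4, c5⟩ := hc p.2 h1
    simp only [f, Multiset.sup_cons]
    rw [c4]; exact sup_eq_left.mpr h3
  have gsup : ∀ p ∈ K, (g p).sup = p.1 := by
    rintro p ⟨h1, h2, h3⟩
    simp only [g]
    split_ifs with h
    · omega
    · rw [Multiset.sup_cons]; exact sup_eq_left.mpr h2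
  have finj : Set.InjOn f K := by
    intro p hp r hr h
    have h1 : p.1 = r.1 := by
      have := congrArg Multiset.sup h
      rw [fsup p hp, fsup r hr] at this
      omega
    simp only [f, h1] at h
    rw [Multiset.cons_inj_right] at h
    refine Prod.ext h1 ?_
    rw [← (hc p.2 hp.1).2.1, ← (hc r.2 hr.1).2.1, h]
  have ginj : Set.InjOn g K := by
    intro p hp r hr h
    have h1 : p.1 = r.1 := by
      have := congrArg Multiset.sup h
      rwa [gsup p hp, gsup r hr] at this
    refine Prod.ext h1 ?_
    simp only [g, h1] at h
    split_ifs at h with h2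
    · exact h
    · rwa [Multiset.cons_inj_right] at h
  have fim : rankGE s = f '' K := by
    ext x
    constructor
    · rintro ⟨hx, hn, hr⟩
      obtain ⟨τ, hτ⟩ := Multiset.exists_cons_of_mem (Multiset.sup_mem_of_ne_zero hn)
      have hp : τ ∈ posM := by
        rw [hτ, cons_mem_posM] at hx; exact hx.2
      obtain ⟨c1, c2, c3, c4, c5⟩ := hc τ hp
      have hcard : x.card = τ.card + 1 := by
        conv_lhs => rw [hτ]
        simp
      have hle : τ.sup ≤ x.sup := by
        conv_rhs => rw [hτ]
        simp
      have hA : x.sup - s - 1 + s + 1 = x.sup := by omega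
      refine ⟨(x.sup - s - 1, c τ), ⟨c1, ?_, ?_⟩, ?_⟩
      · change (c τ).sup ≤ x.sup - s - 1
        rw [c4]; omega
      · change (c τ).card ≤ x.sup - s - 1 + s + 1
        rw [c5]; omega
      · change (x.sup - s - 1 + s + 1) ::ₘ c (c τ) = x
        rw [c2, hA, ← hτ]
    · rintro ⟨p, hp, rfl⟩
      obtain ⟨c1, c2, c3, c4, c5⟩ := hc p.2 hp.1
      refine ⟨cons_mem_posM.mpr ⟨by omega, c1⟩, Multiset.cons_ne_zero, ?_⟩
      rw [fsup p hp]
      have h2 := hp.2.1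
      simp only [f, Multiset.card_cons, c5]
      push_cast
      omega
  have gim : rankGE (-s - 2) ∪ {0} = g '' K := by
    ext x
    constructor
    · rintro (⟨hx, hn, hr⟩ | rfl)
      · obtain ⟨τ, hτ⟩ := Multiset.exists_cons_of_mem (Multiset.sup_mem_of_ne_zero hn)
        have hp : x.sup ≠ 0 ∧ τ ∈ posM := by
          rw [hτ, cons_mem_posM] at hx; exact hx
        have hcard : x.card = τ.card + 1 := by
          conv_lhs => rw [hτ]
          simp
        have hle : τ.sup ≤ x.sup := by
          conv_rhs => rw [hτ]
          simp
        refine ⟨(x.sup, τ), ⟨hp.2, hle, ?_⟩, ?_⟩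
        · change τ.card ≤ x.sup + s + 1
          omega
        · simp only [g]
          rw [if_neg hp.1, ← hτ]
      · refine ⟨(0, 0), ⟨by simp [posM], by simp, by simp⟩, by simp [g]⟩
    · rintro ⟨p, hp, rfl⟩
      have h1 := gsup p hp
      by_cases h : p.1 = 0
      · right
        simp only [g, if_pos h]
        have h2 := hp.2.1
        exact eq_zero_of_sup_eq_zero hp.1 (by omega)
      · left
        refine ⟨?_, ?_, ?_⟩
        · simp only [g, if_neg h]
          exact cons_mem_posM.mpr ⟨h, hp.1⟩
        · simp only [g, if_neg h]
          exact Multiset.cons_ne_zero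
        · rw [h1]
          have h2 := hp.2.2
          simp only [g, if_neg h, Multiset.card_cons]
          push_cast
          omega
  have hdis : Disjoint (rankGE (-s - 2)) {0} := by
    rw [Set.disjoint_singleton_right]
    exact fun h => h.2.1 rfl
  have h1 : 1 + gfM q (rankGE (-s - 2)) = gfM q (g '' K) := by
    rw [← gim, gfM_union hq (rankGE_subset _) (by simp [posM]) hdis, gfM_singleton_zero, add_comm]
  rw [h1, fim, gfM_image q finj, gfM_image q ginj, ← tsum_mul_left]
  refine tsum_congr fun p => ?_
  rw [← pow_add]
  congr 1
  obtain ⟨c1, c2, c3, c4, c5⟩ := hc p.1.2 p.2.1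
  simp only [f, g, Multiset.sum_cons, c3]
  split_ifs with h
  · omega
  · rw [Multiset.sum_cons]; omega

theorem gfM_rankGE_reflect (hq : ‖q‖ < 1 / 2) (s : ℤ) :
    gfM q (rankGE s) + gfM q (rankGE (1 - s)) = gfM q posM - 1 := by
  have h1 : gfM q (rankGE (1 - s)) =
      gfM q {x | x ∈ posM ∧ x ≠ 0 ∧ 1 - s ≤ (x.card : ℤ) - x.sup} :=
    gfM_conjugate q fun a b => 1 - s ≤ (a : ℤ) - b
  have h2 : posM = (rankGE s ∪ {x | x ∈ posM ∧ x ≠ 0 ∧ 1 - s ≤ (x.card : ℤ) - x.sup}) ∪ {0} := by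
    ext x
    constructor
    · intro hx
      by_cases h0 : x = 0
      · exact Or.inr h0
      · left
        rcases le_or_gt s ((x.sup : ℤ) - x.card) with h | h
        · exact Or.inl ⟨hx, h0, h⟩
        · exact Or.inr ⟨hx, h0, by omega⟩
    · rintro ((h | h) | h)
      · exact h.1
      · exact h.1
      · rw [h]; simp [posM]
  rw [h1, eq_sub_iff_add_eq]
  conv_rhs => rw [h2]
  rw [gfM_union hq, gfM_union hq, gfM_singleton_zero]
  · exact rankGE_subset _
  · exact fun x h => h.1
  · rw [Set.disjoint_left]
    rintro x ⟨-, -, h3⟩ ⟨-, -, h4⟩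
    omega
  · rintro x (h | h)
    · exact h.1
    · exact h.1
  · simp [posM]
  · rw [Set.disjoint_singleton_right]
    rintro (h | h)
    · exact h.2.1 rfl
    · exact h.2.1 rfl

theorem gfM_rankGE_step (hq : ‖q‖ < 1 / 2) (s : ℕ) :
    gfM q (rankGE s) = q ^ (s + 1) * (gfM q posM - gfM q (rankGE ((s + 3 : ℕ) : ℤ))) := by
  rw [gfM_rankGE_nat hq]
  have h := gfM_rankGE_reflect hq (-s - 2)
  have h2 : (1 - (-s - 2) : ℤ) = ((s + 3 : ℕ) : ℤ) := by push_cast; ring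
  rw [h2] at h
  congr 1
  linear_combination h

/-- The exponents of the series for partitions with bounded rank. -/
def rankExp (s k : ℕ) : ℕ := ∑ j ∈ Finset.range k, (s + 3 * j + 1)

theorem rankExp_succ (s k : ℕ) : rankExp s (k + 1) = rankExp s k + (s + 3 * k + 1) :=
  Finset.sum_range_succ _ _

theorem two_mul_rankExp (s k : ℕ) : 2 * (rankExp s k : ℤ) = k * (3 * k - 1) + 2 * s * k := by
  induction k with
  | zero => simp [rankExp]
  | succ k ih => rw [rankExp_succ]; push_cast; linear_combination ih

theorem gfM_rankGE_eq_sum (hq : ‖q‖ < 1 / 2) (s k : ℕ) :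
    gfM q (rankGE s) = gfM q posM * ∑ j ∈ Finset.range k, (-1) ^ j * q ^ rankExp s (j + 1) +
      (-1) ^ k * q ^ rankExp s k * gfM q (rankGE ((s + 3 * k : ℕ) : ℤ)) := by
  induction k with
  | zero => simp [rankExp]
  | succ k ih =>
    rw [ih, gfM_rankGE_step hq (s + 3 * k), Finset.sum_range_succ, rankExp_succ, pow_add q]
    have h2 : s + 3 * k + 3 = s + 3 * (k + 1) := by ring
    rw [h2]
    ring

theorem add_le_rankExp (s j : ℕ) : s + j ≤ rankExp s (j + 1) := by
  induction j with
  | zero => simp [rankExp]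
  | succ j ih => rw [rankExp_succ]; omega

theorem summable_norm_rank (hq : ‖q‖ < 1 / 2) (s : ℕ) :
    Summable fun j : ℕ => ‖(-1) ^ j * q ^ rankExp s (j + 1)‖ := by
  refine Summable.of_nonneg_of_le (fun _ => norm_nonneg _) (fun j => ?_)
    (summable_geometric_of_lt_one (norm_nonneg q) (by linarith))
  rw [norm_mul, norm_pow, norm_neg, norm_one, one_pow, one_mul, norm_pow]
  exact pow_le_pow_of_le_one (norm_nonneg q) (by linarith) (by have := add_le_rankExp s j; omega)

theorem gfM_rankGE_eq_tsum (hq : ‖q‖ < 1 / 2) (s : ℕ) :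
    gfM q (rankGE s) = gfM q posM * ∑' j : ℕ, (-1) ^ j * q ^ rankExp s (j + 1) := by
  have h1 := ((summable_norm_rank hq s).of_norm.hasSum.tendsto_sum_nat).const_mul (gfM q posM)
  have h2 : Tendsto (fun k : ℕ => (-1) ^ k * q ^ rankExp s k *
      gfM q (rankGE ((s + 3 * k : ℕ) : ℤ))) atTop (𝓝 0) := by
    have h3 : Tendsto (fun k : ℕ => ‖q‖ ^ k * ∑' s : posM, ‖q ^ (s : Multiset ℕ).sum‖) atTop
        (𝓝 (0 * ∑' s : posM, ‖q ^ (s : Multiset ℕ).sum‖)) :=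
      (tendsto_pow_atTop_nhds_zero_of_lt_one (norm_nonneg q) (by linarith)).mul_const _
    rw [zero_mul] at h3
    refine squeeze_zero_norm (fun k => ?_) h3
    rw [norm_mul, norm_mul, norm_pow, norm_neg, norm_one, one_pow, one_mul, norm_pow]
    refine mul_le_mul (pow_le_pow_of_le_one (norm_nonneg q) (by linarith) ?_)
      (norm_gfM_le hq (rankGE_subset _)) (norm_nonneg _) (by positivity)
    rcases k with - | k
    · exact Nat.zero_le _
    · have := two_mul_rankExp s (k + 1)
      zify
      push_cast at this ⊢
      nlinarith [Nat.cast_nonneg (α := ℤ) s, Nat.cast_nonneg (α := ℤ) k,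
        mul_nonneg (Nat.cast_nonneg (α := ℤ) s) (Nat.cast_nonneg (α := ℤ) k)]
  have h4 := h1.add h2
  rw [add_zero] at h4
  refine tendsto_nhds_unique ?_ h4
  refine tendsto_const_nhds.congr fun k => ?_
  exact gfM_rankGE_eq_sum hq s k

end Rank

theorem hasSum_fiber {α γ : Type*} {f : α → ℂ} {T : Set α} (hf : Summable fun x : T => f x) (g : α → γ) :
    HasSum (fun c => ∑' x : {x | x ∈ T ∧ g x = c}, f x) (∑' x : T, f x) := by
  refine (hf.hasSum.tsum_fiberwise fun x : T => g x).congr_fun ?_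
  intro c
  exact ((Equiv.subtypeSubtypeEquivSubtypeInter (fun x => x ∈ T) fun x => g x = c).tsum_eq
    (fun x : {x | x ∈ T ∧ g x = c} => f x)).symm

theorem HasSum.eq_nat_add_neg {f : ℤ → ℂ} {c : ℂ} (h : HasSum f c) :
    c = ∑' n : ℕ, f n + ∑' n : ℕ, f (-(n + 1)) := by
  rw [← h.tsum_eq]
  exact tsum_of_nat_of_neg_add_one (h.summable.comp_injective Nat.cast_injective)
    (h.summable.comp_injective fun x y hxy => by simpa using hxy)

/-- The nonempty partitions of rank `m`. -/
def rankEQ (m : ℤ) : Set (Multiset ℕ) := {s | s ∈ posM ∧ s ≠ 0 ∧ (s.sup : ℤ) - s.card = m}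

/-- The nonempty partitions of rank congruent to `a` modulo 11. -/
def rankMod (a : ℤ) : Set (Multiset ℕ) := {s | s ∈ posM ∧ s ≠ 0 ∧ ((s.sup : ℤ) - s.card) % 11 = a % 11}

/-- The building block of the generating function of a rank class. -/
noncomputable def rankTerm (q : ℂ) (b j : ℕ) : ℂ :=
  (-1) ^ j * q ^ rankExp 0 (j + 1) * (1 - q ^ (j + 1)) * q ^ (b * (j + 1))

theorem rankExp_eq (m k : ℕ) : rankExp m k = rankExp 0 k + m * k := by
  have h1 := two_mul_rankExp m k
  have h2 := two_mul_rankExp 0 k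
  zify
  push_cast at h2
  linarith

section RankMod
variable {q : ℂ}

theorem hasSum_gfM_fiber {γ : Type*} (hq : ‖q‖ < 1 / 2) {S : Set (Multiset ℕ)} (hS : S ⊆ posM)
    (g : Multiset ℕ → γ) : HasSum (fun c => gfM q {s | s ∈ S ∧ g s = c}) (gfM q S) :=
  hasSum_fiber (f := fun s : Multiset ℕ => q ^ s.sum) (summable_gfM hq hS) g

theorem gfM_rankEQ_neg (m : ℤ) : gfM q (rankEQ (-m)) = gfM q (rankEQ m) := by
  have h := gfM_conjugate q fun a b => (a : ℤ) - b = m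
  rw [rankEQ, rankEQ, h]
  congr 1
  ext s
  simp only [Set.mem_setOf_eq]
  refine and_congr_right fun _ => and_congr_right fun _ => ?_
  omega

theorem gfM_rankEQ (hq : ‖q‖ < 1 / 2) (m : ℕ) :
    gfM q (rankEQ m) = gfM q posM * ∑' j, rankTerm q m j := by
  have h1 : rankGE m = rankEQ m ∪ rankGE ((m + 1 : ℕ) : ℤ) := by
    ext s
    constructor
    · rintro ⟨h1, h2, h3⟩
      by_cases h : (s.sup : ℤ) - s.card = m
      · exact Or.inl ⟨h1, h2, h⟩
      · exact Or.inr ⟨h1, h2, by push_cast; omega⟩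
    · rintro (⟨h1, h2, h3⟩ | ⟨h1, h2, h3⟩)
      · exact ⟨h1, h2, h3.ge⟩
      · exact ⟨h1, h2, by push_cast at h3; omega⟩
  have h2 : Disjoint (rankEQ m) (rankGE ((m + 1 : ℕ) : ℤ)) := by
    rw [Set.disjoint_left]
    rintro x ⟨-, -, h3⟩ ⟨-, -, h4⟩
    push_cast at h4
    omega
  have h3 := gfM_union hq (fun s hs => hs.1) (rankGE_subset _) h2
  rw [← h1, gfM_rankGE_eq_tsum hq, gfM_rankGE_eq_tsum hq] at h3
  rw [← sub_eq_iff_eq_add] at h3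
  rw [← h3, ← mul_sub, ← Summable.tsum_sub (summable_norm_rank hq _).of_norm
    (summable_norm_rank hq _).of_norm]
  congr 1
  refine tsum_congr fun j => ?_
  rw [rankTerm, rankExp_eq m, rankExp_eq (m + 1), add_mul, one_mul, pow_add, pow_add, pow_add]
  ring

theorem norm_rankTerm_le (hq : ‖q‖ < 1 / 2) (b j : ℕ) : ‖rankTerm q b j‖ ≤ 2 * ‖q‖ ^ j * ‖q‖ ^ b := by
  have h0 := norm_nonneg q
  have e : ‖q‖ ^ rankExp 0 (j + 1) ≤ ‖q‖ ^ j :=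
    pow_le_pow_of_le_one h0 (by linarith) (by have := add_le_rankExp 0 j; omega)
  have e2 : ‖q‖ ^ (b * (j + 1)) ≤ ‖q‖ ^ b :=
    pow_le_pow_of_le_one h0 (by linarith) (Nat.le_mul_of_pos_right _ (Nat.succ_pos _))
  have e3 : ‖1 - q ^ (j + 1)‖ ≤ 2 := by
    refine (norm_sub_le _ _).trans ?_
    rw [norm_one, norm_pow]
    have := pow_le_one₀ h0 (by linarith : ‖q‖ ≤ 1) (n := j + 1)
    linarith
  rw [rankTerm, norm_mul, norm_mul, norm_mul, norm_pow, norm_neg, norm_one, one_pow, one_mul,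
    norm_pow, norm_pow]
  calc _ ≤ ‖q‖ ^ j * 2 * ‖q‖ ^ b := by gcongr
    _ = _ := by ring

theorem tsum_rankTerm_progression (hq : ‖q‖ < 1 / 2) (b : ℕ) :
    ∑' k : ℕ, ∑' j, rankTerm q (b + 11 * k) j = ∑' j, rankTerm q b j / (1 - q ^ (11 * (j + 1))) := by
  have hg := summable_geometric_of_lt_one (norm_nonneg q) (by linarith : ‖q‖ < 1)
  have hs : Summable (Function.uncurry fun k j : ℕ => rankTerm q (b + 11 * k) j) := by
    refine Summable.of_norm_bounded ((hg.mul_of_nonneg (hg.mul_left 2) (fun k => by positivity)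
      fun j => by positivity)) ?_
    rintro ⟨k, j⟩
    refine (norm_rankTerm_le hq _ _).trans ?_
    have : ‖q‖ ^ (b + 11 * k) ≤ ‖q‖ ^ k :=
      pow_le_pow_of_le_one (norm_nonneg q) (by linarith) (by omega)
    calc _ ≤ 2 * ‖q‖ ^ j * ‖q‖ ^ k := by gcongr
      _ = _ := by ring
  rw [← hs.tsum_comm]
  refine tsum_congr fun j => ?_
  have h1 : ‖q ^ (11 * (j + 1))‖ < 1 := by
    rw [norm_pow]
    exact pow_lt_one₀ (norm_nonneg q) (by linarith) (by omega)
  rw [div_eq_mul_inv, ← tsum_geometric_of_norm_lt_one h1, ← tsum_mul_left]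
  refine tsum_congr fun k => ?_
  rw [rankTerm, rankTerm, add_mul, pow_add, ← pow_mul]
  ring

theorem gfM_rankMod (hq : ‖q‖ < 1 / 2) {a : ℕ} (ha : a ≤ 10) :
    gfM q (rankMod a) = gfM q posM * (∑' j, rankTerm q a j / (1 - q ^ (11 * (j + 1))) +
      ∑' j, rankTerm q (11 - a) j / (1 - q ^ (11 * (j + 1)))) := by
  have hsub : rankMod a ⊆ posM := fun s h => h.1
  have h1 := hasSum_gfM_fiber hq hsub
    fun s : Multiset ℕ => ((s.sup : ℤ) - s.card - a) / 11
  have h2 : ∀ k : ℤ, {s | s ∈ rankMod a ∧ ((s.sup : ℤ) - s.card - a) / 11 = k} = rankEQ (a + 11 * k) := by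
    intro k
    ext s
    constructor
    · rintro ⟨⟨h1, h2, h3⟩, h4⟩
      exact ⟨h1, h2, by omega⟩
    · rintro ⟨h1, h2, h3⟩
      exact ⟨⟨h1, h2, by omega⟩, by omega⟩
  have h3 : HasSum (fun k : ℤ => gfM q (rankEQ (a + 11 * k))) (gfM q (rankMod a)) := by
    refine h1.congr_fun ?_
    intro k
    rw [h2 k]
  rw [h3.eq_nat_add_neg, mul_add]
  congr 1
  · rw [← tsum_rankTerm_progression hq, ← tsum_mul_left]
    refine tsum_congr fun k => ?_
    rw [← gfM_rankEQ hq, Nat.cast_add, Nat.cast_mul, Nat.cast_ofNat]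
  · rw [← tsum_rankTerm_progression hq, ← tsum_mul_left]
    refine tsum_congr fun k => ?_
    rw [← gfM_rankEQ hq, ← gfM_rankEQ_neg]
    congr 2
    push_cast [Nat.cast_sub (by omega : a ≤ 11)]
    ring

theorem gfM_mul_qpi (h0 : q ≠ 0) (hq : ‖q‖ < 1 / 2) : gfM q posM * qpi q q = 1 := by
  have h1 := gfM_rankGE_reflect hq 0
  have e0 := gfM_rankGE_eq_tsum hq 0
  have e1 := gfM_rankGE_eq_tsum hq 1
  have s0 := (summable_norm_rank hq 0).of_norm
  have s1 := (summable_norm_rank hq 1).of_norm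
  push_cast at e0 e1
  rw [sub_zero, e0, e1] at h1
  have hn : HasSum (fun n : ℕ => (-1 : ℂ) ^ (n : ℤ) * q ^ (3 * tri n + n) * 1 ^ (n : ℤ))
      (1 + -∑' j : ℕ, (-1) ^ j * q ^ rankExp 0 (j + 1)) := by
    have h := (hasSum_nat_add_iff' (f := fun n : ℕ => (-1 : ℂ) ^ (n : ℤ) * q ^ (3 * tri n + n) * 1 ^ (n : ℤ)) 1
      (g := 1 + -∑' j : ℕ, (-1) ^ j * q ^ rankExp 0 (j + 1))).mp
    apply h
    have e : (1 + -∑' j : ℕ, (-1) ^ j * q ^ rankExp 0 (j + 1)) -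
        ∑ i ∈ Finset.range 1, (-1 : ℂ) ^ (i : ℤ) * q ^ (3 * tri i + i) * 1 ^ (i : ℤ) =
        -∑' j : ℕ, (-1) ^ j * q ^ rankExp 0 (j + 1) := by
      simp [tri_zero]
    rw [e]
    refine s0.hasSum.neg.congr_fun fun j => ?_
    have e2 : (3 * tri ((j + 1 : ℕ) : ℤ) + ((j + 1 : ℕ) : ℤ)) = (rankExp 0 (j + 1) : ℕ) := by
      have h2 := two_tri ((j + 1 : ℕ) : ℤ)
      have h3 := two_mul_rankExp 0 (j + 1)
      push_cast at h2 h3 ⊢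
      linarith
    rw [e2, one_zpow, mul_one, zpow_natCast, zpow_natCast, pow_succ]
    ring
  have hm : HasSum (fun n : ℕ => (-1 : ℂ) ^ (-((n : ℤ) + 1)) * q ^ (3 * tri (-((n : ℤ) + 1)) + (-((n : ℤ) + 1))) * 1 ^ (-((n : ℤ) + 1)))
      (-∑' j : ℕ, (-1) ^ j * q ^ rankExp 1 (j + 1)) := by
    refine s1.hasSum.neg.congr_fun fun j => ?_
    have e2 : 3 * tri (-((j : ℤ) + 1)) + (-((j : ℤ) + 1)) = (rankExp 1 (j + 1) : ℕ) := by
      have h2 := two_tri (-((j : ℤ) + 1))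
      have h3 := two_mul_rankExp 1 (j + 1)
      push_cast at h2 h3 ⊢
      linarith
    rw [e2, one_zpow, mul_one, neg_one_zpow_neg, zpow_natCast,
      (by push_cast; ring : (j : ℤ) + 1 = ((j + 1 : ℕ) : ℤ)), zpow_natCast, pow_succ]
    ring
  have h5 := (HasSum.of_nat_of_neg_add_one (f := fun n : ℤ => (-1 : ℂ) ^ n * q ^ (3 * tri n + n) * 1 ^ n) hn hm).tsum_eq
  have h6 : thC q 1 1 = _ := (tsum_congr fun n => by rw [one_mul]).trans h5
  rw [thC_one_one h0 (by linarith)] at h6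
  rw [h6]
  linear_combination -h1

end RankMod

theorem HasSum.eq_nat_add_neg_of_zero {f : ℤ → ℂ} {c : ℂ} (h : HasSum f c) (h0 : f 0 = 0) :
    c = ∑' n : ℕ, f (n + 1) + ∑' n : ℕ, f (-(n + 1)) := by
  have h1 : Summable fun n : ℕ => f n := h.summable.comp_injective Nat.cast_injective
  rw [h.eq_nat_add_neg, h1.tsum_eq_zero_add, Nat.cast_zero, h0, _root_.zero_add]
  simp only [Nat.cast_add, Nat.cast_one]

section LambertDifference
variable {t : ℂ} (t0 : t ≠ 0) (t1 : ‖t‖ < 1)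
include t0 t1

theorem summable_lamS (b : ℤ) : Summable fun n : ℤ =>
    if n = 0 then 0 else (-1) ^ n * t ^ (12 * n * (3 * n + 1) + 24 * b * n) / (1 - t ^ (264 * n)) := by
  refine Summable.of_norm_bounded ((summable_norm_gauss t0 t1 (a := 12 + 24 * b) 36 (by norm_num)).mul_right
    (1 - ‖t ^ 264‖)⁻¹) fun n => ?_
  have hp : 0 ≤ (1 - ‖t ^ 264‖)⁻¹ :=
    inv_nonneg.mpr (by have := norm_pow_lt_one t1 (k := 264) (by norm_num); linarith)
  split_ifs with h
  · rw [norm_zero]; positivity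
  · rw [div_eq_mul_inv, norm_mul]
    have e : 12 * n * (3 * n + 1) + 24 * b * n = ((36 : ℕ) : ℤ) * n ^ 2 + (12 + 24 * b) * n := by
      push_cast; ring
    rw [e]
    exact mul_le_mul_of_nonneg_left (norm_inv_one_sub_le t0 t1 h) (norm_nonneg _)

theorem lamS_sub_lamS (a : ℕ) (ha : a ≤ 11) :
    lamS t a - lamS t (a - 1) = ∑' j, rankTerm (t ^ 24) a j / (1 - (t ^ 24) ^ (11 * (j + 1))) +
      ∑' j, rankTerm (t ^ 24) (11 - a) j / (1 - (t ^ 24) ^ (11 * (j + 1))) := by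
  have hs := (summable_lamS t0 t1 a).sub (summable_lamS t0 t1 (a - 1))
  rw [lamS, lamS, ← Summable.tsum_sub (summable_lamS t0 t1 a) (summable_lamS t0 t1 (a - 1)),
    hs.hasSum.eq_nat_add_neg_of_zero (by simp)]
  have hd : ∀ j : ℕ, 1 - (t ^ 24) ^ (11 * (j + 1)) ≠ 0 := by
    intro j h
    have h1 := norm_pow_lt_one t1 (k := 24 * (11 * (j + 1))) (by omega)
    rw [sub_eq_zero] at h
    rw [pow_mul, ← h, norm_one] at h1
    exact lt_irrefl _ h1
  have he : ∀ j : ℕ, (24 * rankExp 0 (j + 1) : ℤ) = 12 * (j + 1) * (3 * j + 2) := by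
    intro j
    have h3 := two_mul_rankExp 0 (j + 1)
    push_cast at h3
    linarith
  have z : ∀ (E : ℤ) (N : ℕ), E = 24 * N → t ^ E = (t ^ 24) ^ N := by
    rintro E N rfl
    rw [zpow_mul, zpow_natCast]
    norm_cast
  have he11 : ∀ j : ℕ, t ^ (264 * ((j : ℤ) + 1)) = (t ^ 24) ^ (11 * (j + 1)) := fun j =>
    z _ _ (by push_cast; ring)
  congr 1
  · refine tsum_congr fun j => ?_
    have hn : ((j : ℤ) + 1) ≠ 0 := by omega
    rw [if_neg hn, if_neg hn, rankTerm, he11,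
      z (12 * ((j : ℤ) + 1) * (3 * ((j : ℤ) + 1) + 1) + 24 * a * ((j : ℤ) + 1))
        (rankExp 0 (j + 1) + (j + 1) + a * (j + 1)) (by push_cast; linear_combination -he j),
      z (12 * ((j : ℤ) + 1) * (3 * ((j : ℤ) + 1) + 1) + 24 * (a - 1) * ((j : ℤ) + 1))
        (rankExp 0 (j + 1) + a * (j + 1)) (by push_cast; linear_combination -he j),
      (by push_cast; ring : (j : ℤ) + 1 = ((j + 1 : ℕ) : ℤ)), zpow_natCast, pow_succ, pow_add, pow_add, pow_add]
    ring
  · refine tsum_congr fun j => ?_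
    have hn : (-((j : ℤ) + 1)) ≠ 0 := by omega
    have hk : t ^ (264 * -((j : ℤ) + 1)) = ((t ^ 24) ^ (11 * (j + 1)))⁻¹ := by
      rw [← he11, ← zpow_neg]
      congr 1
    have hk0 : (t ^ 24) ^ (11 * (j + 1)) ≠ 0 := pow_ne_zero _ (pow_ne_zero _ t0)
    have hq0 : (t ^ 24) ^ (a * (j + 1)) ≠ 0 := pow_ne_zero _ (pow_ne_zero _ t0)
    have hsplit : (t ^ 24) ^ ((11 - a) * (j + 1)) =
        (t ^ 24) ^ (11 * (j + 1)) / (t ^ 24) ^ (a * (j + 1)) := by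
      rw [eq_div_iff hq0, ← pow_add, ← add_mul, Nat.sub_add_cancel ha]
    have hx1 : t ^ (12 * -((j : ℤ) + 1) * (3 * -((j : ℤ) + 1) + 1) + 24 * a * -((j : ℤ) + 1)) =
        (t ^ 24) ^ rankExp 0 (j + 1) / (t ^ 24) ^ (a * (j + 1)) := by
      rw [eq_div_iff hq0, ← z (24 * ((a * (j + 1) : ℕ) : ℤ)) _ rfl, ← zpow_add₀ t0]
      exact z _ _ (by push_cast; linear_combination -he j)
    have hx2 : t ^ (12 * -((j : ℤ) + 1) * (3 * -((j : ℤ) + 1) + 1) + 24 * (a - 1) * -((j : ℤ) + 1)) =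
        (t ^ 24) ^ rankExp 0 (j + 1) * (t ^ 24) ^ (j + 1) / (t ^ 24) ^ (a * (j + 1)) := by
      rw [eq_div_iff hq0, ← z (24 * ((a * (j + 1) : ℕ) : ℤ)) _ rfl, ← zpow_add₀ t0, ← pow_add]
      exact z _ _ (by push_cast; linear_combination -he j)
    have hsign : (-1 : ℂ) ^ ((j : ℤ) + 1) = -(-1) ^ j := by
      rw [(by push_cast; ring : (j : ℤ) + 1 = ((j + 1 : ℕ) : ℤ)), zpow_natCast, pow_succ]
      ring
    rw [if_neg hn, if_neg hn, rankTerm, neg_one_zpow_neg, hk, hsplit, hx1, hx2, hsign]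
    have h1 := hd j
    have h2 : 1 - ((t ^ 24) ^ (11 * (j + 1)))⁻¹ ≠ 0 := by
      intro h
      rw [sub_eq_zero, eq_comm, inv_eq_one] at h
      rw [h, sub_self] at h1
      exact h1 rfl
    have h3 : 1 - ((t ^ 24) ^ (11 * (j + 1)))⁻¹ =
        -(1 - (t ^ 24) ^ (11 * (j + 1))) / (t ^ 24) ^ (11 * (j + 1)) := by
      field_simp
      ring
    rw [h3]
    generalize (t ^ 24) ^ (11 * (j + 1)) = A at *
    generalize (t ^ 24) ^ (a * (j + 1)) = B at *
    field_simp

end LambertDifference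

section Count
variable {q : ℂ}

theorem hasSum_gfM_count (hq : ‖q‖ < 1 / 2) {S : Set (Multiset ℕ)} (hS : S ⊆ posM) :
    HasSum (fun n : ℕ => (Nat.card {π : Nat.Partition n // π.parts ∈ S} : ℂ) * q ^ n) (gfM q S) := by
  refine (hasSum_gfM_fiber hq hS Multiset.sum).congr_fun fun n => ?_
  let e : {s | s ∈ S ∧ s.sum = n} ≃ {π : Nat.Partition n // π.parts ∈ S} :=
    { toFun := fun s => ⟨⟨s.1, fun {i} hi => Nat.pos_of_ne_zero fun h => hS s.2.1 (h ▸ hi), s.2.2⟩, s.2.1⟩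
      invFun := fun π => ⟨π.1.parts, π.2, π.1.parts_sum⟩
      left_inv := fun _ => rfl
      right_inv := fun _ => rfl }
  rw [gfM, ← Nat.card_congr e, ← nsmul_eq_mul, ← tsum_const]
  refine tsum_congr fun s => ?_
  rw [s.2.2]

theorem hasSum_partitionCount (hq : ‖q‖ < 1 / 2) :
    HasSum (fun n : ℕ => (partitionCount n : ℂ) * q ^ n) (gfM q posM) := by
  refine (hasSum_gfM_count hq subset_rfl).congr_fun fun n => ?_
  have h : ∀ π : Nat.Partition n, π.parts ∈ posM := fun π h => absurd (π.parts_pos h) (lt_irrefl 0)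
  rw [partitionCount, ← Nat.card_eq_fintype_card, Nat.card_congr (Equiv.subtypeUnivEquiv h)]

theorem hasSum_rankCount (hq : ‖q‖ < 1 / 2) (a : ℤ) :
    HasSum (fun n : ℕ => (rankCount a 11 n : ℂ) * q ^ n)
      ((if a % 11 = 0 then 1 else 0) + gfM q (rankMod a)) := by
  have hS : {s : Multiset ℕ | s ∈ posM ∧ ((s.sup : ℤ) - s.card) % 11 = a % 11} ⊆ posM := fun s h => h.1
  have hz : (0 : Multiset ℕ) ∈ posM := by simp [posM]
  have e : gfM q {s : Multiset ℕ | s ∈ posM ∧ ((s.sup : ℤ) - s.card) % 11 = a % 11} =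
      (if a % 11 = 0 then 1 else 0) + gfM q (rankMod a) := by
    split_ifs with h
    · have h1 : {s : Multiset ℕ | s ∈ posM ∧ ((s.sup : ℤ) - s.card) % 11 = a % 11} = {0} ∪ rankMod a := by
        ext s
        constructor
        · rintro ⟨h1, h2⟩
          by_cases h0 : s = 0
          · exact Or.inl h0
          · exact Or.inr ⟨h1, h0, h2⟩
        · rintro (rfl | h1)
          · exact ⟨hz, by simp [h]⟩
          · exact ⟨h1.1, h1.2.2⟩
      rw [h1, gfM_union hq, gfM_singleton_zero]
      · simpa using hz
      · exact fun s hs => hs.1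
      · rw [Set.disjoint_singleton_left]
        exact fun hs => hs.2.1 rfl
    · rw [zero_add]
      congr 1
      ext s
      constructor
      · rintro ⟨h1, h2⟩
        refine ⟨h1, ?_, h2⟩
        rintro rfl
        simp at h2
        exact h (by omega)
      · rintro ⟨h1, -, h2⟩
        exact ⟨h1, h2⟩
  rw [← e]
  refine (hasSum_gfM_count hq hS).congr_fun fun n => ?_
  have h : ∀ π : Nat.Partition n, π.parts ∈ posM := fun π h => absurd (π.parts_pos h) (lt_irrefl 0)
  rw [rankCount, ← Fintype.card_subtype, ← Nat.card_eq_fintype_card]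
  congr 1
  refine congrArg _ (Nat.card_congr (Equiv.subtypeEquivRight fun π => ?_))
  simp only [Set.mem_setOf_eq, partitionRank, h π, true_and]

end Count

/-- The theta series `Σ (-1)^n q^(n (3 n + 1) / 2 + b n)` at `q = t ^ 24`. -/
noncomputable def eulS (t : ℂ) (b : ℤ) : ℂ := ∑' n : ℤ, (-1) ^ n * t ^ (12 * n * (3 * n + 1) + 24 * b * n)

/-- The right-hand side of the quotient formula attached to the multiplier `l`. -/
noncomputable def quotSide (t : ℂ) (l : ℤ) : ℂ :=
  -(11 * t ^ (396 * l - 36 * l ^ 2) * App (t ^ 2904) (t ^ (264 * l)) 1) -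
    thD t ^ 5 * ∑ c ∈ Finset.range 11, gradedTerm t l c

/-- The normalized Lambert series. -/
noncomputable def lamN (t : ℂ) (b : ℤ) : ℂ := lamS t b - (b - 5) / 11

theorem eulS_neg_one_reflect (t : ℂ) (s b : ℤ) (hs : Odd s) (h : 3 * s + 1 + 2 * b = 0) : eulS t b = 0 := by
  have h1 : eulS t b = -eulS t b := by
    conv_lhs => rw [eulS, ← (Equiv.subLeft s).tsum_eq]
    rw [eulS, ← tsum_neg]
    refine tsum_congr fun n => ?_
    have e : 12 * (s - n) * (3 * (s - n) + 1) + 24 * b * (s - n) = 12 * n * (3 * n + 1) + 24 * b * n := by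
      linear_combination 12 * (s - 2 * n) * h
    rw [Equiv.subLeft_apply, e, sub_eq_add_neg, zpow_add₀ (by norm_num), hs.neg_one_zpow, neg_one_zpow_neg]
    ring
  exact self_eq_neg.mp h1

section Lambert
variable {t : ℂ} (t0 : t ≠ 0) (t1 : ‖t‖ < 1)

theorem lamS_reflect (t : ℂ) (t0 : t ≠ 0) (b : ℤ) : lamS t (10 - b) = -lamS t b := by
  rw [lamS, lamS, ← (Equiv.neg ℤ).tsum_eq, ← tsum_neg]
  refine tsum_congr fun n => ?_
  rw [Equiv.neg_apply]
  by_cases hn : n = 0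
  · simp [hn]
  have hn' : -n ≠ 0 := by omega
  rw [if_neg hn, if_neg hn', neg_one_zpow_neg]
  have e : 12 * -n * (3 * -n + 1) + 24 * (10 - b) * -n = 12 * n * (3 * n + 1) + 24 * b * n + -(264 * n) := by
    ring
  have e2 : (264 * -n : ℤ) = -(264 * n) := by ring
  rw [e, e2, zpow_add₀ t0, zpow_neg]
  generalize t ^ (12 * n * (3 * n + 1) + 24 * b * n) = A
  have hB := zpow_ne_zero (264 * n) t0
  generalize t ^ (264 * n) = B at *
  by_cases h1 : 1 - B = 0
  · have : B = 1 := (sub_eq_zero.mp h1).symm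
    simp [this]
  have h2 : 1 - B⁻¹ = -(1 - B) / B := by field_simp; ring
  rw [h2]
  field_simp

include t0 t1

theorem summable_eulS (b : ℤ) : Summable fun n : ℤ => (-1) ^ n * t ^ (12 * n * (3 * n + 1) + 24 * b * n) := by
  refine ((summable_norm_gauss t0 t1 (a := 12 + 24 * b) 36 (by norm_num)).of_norm).congr fun n => ?_
  congr 2
  push_cast
  ring

theorem lamS_shift (b : ℤ) : lamS t b - lamS t (b + 11) = eulS t b - 1 := by
  have h1 : (∑' n : ℤ, if n = 0 then (1 : ℂ) else 0) = 1 := tsum_ite_eq 0 _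
  have hs : Summable fun n : ℤ => if n = 0 then (1 : ℂ) else 0 := (hasSum_ite_eq 0 1).summable
  rw [lamS, lamS, eulS, ← Summable.tsum_sub (summable_lamS t0 t1 _) (summable_lamS t0 t1 _)]
  have h3 := Summable.tsum_sub (summable_eulS t0 t1 b) hs
  rw [h1] at h3
  rw [← h3]
  refine tsum_congr fun n => ?_
  by_cases hn : n = 0
  · simp [hn]
  rw [if_neg hn, if_neg hn, if_neg hn]
  have hne : 1 - t ^ (264 * n) ≠ 0 := by
    have := zpow_ne_one t0 t1 (n := 264 * n) (by omega)
    exact sub_ne_zero.mpr this.symm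
  have e : 12 * n * (3 * n + 1) + 24 * (b + 11) * n = (12 * n * (3 * n + 1) + 24 * b * n) + 264 * n := by ring
  rw [e, zpow_add₀ t0 (12 * n * (3 * n + 1) + 24 * b * n)]
  generalize t ^ (12 * n * (3 * n + 1) + 24 * b * n) = A
  generalize t ^ (264 * n) = B at *
  rw [← sub_div, sub_zero, eq_comm, eq_div_iff hne]
  ring

theorem thC_eq_eulS : eulS t (-1) = qpi (t ^ 24) (t ^ 24) := by
  rw [← thC_one_one (pow_ne_zero _ t0) (norm_pow_lt_one t1 (by norm_num)), thC, eulS]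
  refine tsum_congr fun n => ?_
  have e : 12 * n * (3 * n + 1) + 24 * -1 * n = 24 * (3 * tri n + 1 * n) := by
    have := two_tri n
    linear_combination -36 * this
  rw [e, zpow_mul, one_zpow, mul_one]
  norm_cast

theorem eulS_two : eulS t 2 = -(t ^ (-24 : ℤ) * qpi (t ^ 24) (t ^ 24)) := by
  rw [← thC_eq_eulS t0 t1, eulS, eulS, ← (Equiv.subRight 1).tsum_eq, ← tsum_mul_left, ← tsum_neg]
  refine tsum_congr fun n => ?_
  have e : 12 * (n - 1) * (3 * (n - 1) + 1) + 24 * 2 * (n - 1) =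
    -24 + (12 * n * (3 * n + 1) + 24 * -1 * n) := by ring
  rw [Equiv.subRight_apply, e, zpow_add₀ t0, zpow_sub_one₀ (by norm_num)]
  norm_num
  ring

theorem lamN_five : lamN t 5 = 0 := by
  have h := lamS_reflect t t0 5
  norm_num at h
  rw [lamN, self_eq_neg.mp h]
  norm_num

theorem lamN_four : lamN t 4 = -lamN t (-5) := by
  have h := lamS_reflect t t0 4
  have h2 := lamS_shift t0 t1 (-5)
  rw [eulS_neg_one_reflect t 3 (-5) (by decide) (by norm_num)] at h2
  norm_num at h h2
  simp only [lamN]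
  push_cast
  linear_combination h + h2

theorem lamN_three : lamN t 3 = -lamN t 7 := by
  have h := lamS_reflect t t0 3
  norm_num at h
  simp only [lamN]
  push_cast
  linear_combination h

theorem lamN_two : lamN t 2 = lamN t 13 - t ^ (-24 : ℤ) * qpi (t ^ 24) (t ^ 24) := by
  have h2 := lamS_shift t0 t1 2
  rw [eulS_two t0 t1] at h2
  norm_num at h2 ⊢
  simp only [lamN]
  push_cast
  linear_combination h2

theorem lamN_zero : lamN t 0 = lamN t (-11) := by
  have h2 := lamS_shift t0 t1 (-11)
  rw [eulS_neg_one_reflect t 7 (-11) (by decide) (by norm_num)] at h2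
  norm_num at h2
  simp only [lamN]
  push_cast
  linear_combination -h2

theorem lamN_neg_one : lamN t (-1) = -lamN t (-11) + qpi (t ^ 24) (t ^ 24) := by
  have h2 := lamS_shift t0 t1 (-1)
  have h3 := lamS_reflect t t0 0
  have h4 := lamN_zero t0 t1
  rw [thC_eq_eulS t0 t1] at h2
  norm_num at h2 h3
  rw [← h4]
  simp only [lamN]
  push_cast
  linear_combination h2 + h3

/-- The generating function of the deviation of the rank. -/
noncomputable def devG (t : ℂ) (a : ℤ) : ℂ :=
  ∑' n : ℕ, (11 * (rankCount a 11 n : ℂ) - (partitionCount n : ℂ)) * (t ^ 24) ^ n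

omit t1 in
theorem hasSum_devG (tq : ‖t ^ 24‖ < 1 / 2) (a : ℤ) :
    HasSum (fun n : ℕ => (11 * (rankCount a 11 n : ℂ) - (partitionCount n : ℂ)) * (t ^ 24) ^ n)
      (11 * ((if a % 11 = 0 then 1 else 0) + gfM (t ^ 24) (rankMod a)) - gfM (t ^ 24) posM) := by
  refine (((hasSum_rankCount tq a).mul_left 11).sub (hasSum_partitionCount tq)).congr_fun fun n => ?_
  ring

theorem qpi_mul_devG (tq : ‖t ^ 24‖ < 1 / 2) {a : ℕ} (ha : a ≤ 10) :
    qpi (t ^ 24) (t ^ 24) * devG t a =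
      11 * (if a = 0 then qpi (t ^ 24) (t ^ 24) else 0) + 11 * (lamN t a - lamN t (a - 1)) := by
  have hP := gfM_mul_qpi (pow_ne_zero 24 t0) tq
  have h1 := gfM_rankMod tq ha
  rw [← lamS_sub_lamS t0 t1 a (by omega)] at h1
  have e : ((a : ℤ) % 11 = 0) = (a = 0) := by
    apply propext; omega
  rw [devG, (hasSum_devG t0 tq a).tsum_eq, h1]
  simp only [e, lamN]
  push_cast
  split_ifs <;> linear_combination (11 * (lamS t a - lamS t (a - 1)) - 1) * hP

theorem lamN_quotient (tq : ‖t ^ 24‖ < 1 / 2) {l : ℤ} (hl : ¬ (11 : ℤ) ∣ l) (hl2 : Odd l) :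
    t ^ 120 * qpi (t ^ 2904) (t ^ 2904) * (11 * lamN t (16 - 3 * l)) = qpi (t ^ 24) (t ^ 24) * quotSide t l := by
  rw [quotSide, ← lamS_quotient t0 t1 hl hl2, lamN]
  push_cast
  ring

theorem devG_zero (tq : ‖t ^ 24‖ < 1 / 2) :
    t ^ 120 * qpi (t ^ 2904) (t ^ 2904) * devG t 0 = 2 * quotSide t 9 := by
  have hJ : qpi (t ^ 24) (t ^ 24) ≠ 0 := right_ne_zero_of_mul_eq_one (gfM_mul_qpi (pow_ne_zero 24 t0) tq)
  have h := qpi_mul_devG t0 t1 tq (a := 0) (by norm_num)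
  have h9 := lamN_quotient t0 t1 tq (l := 9) (by decide) (by decide)
  have e0 := lamN_zero t0 t1
  have e1 := lamN_neg_one t0 t1
  norm_num at h h9
  rw [e0, e1] at h
  apply mul_left_cancel₀ hJ
  linear_combination t ^ 120 * qpi (t ^ 2904) (t ^ 2904) * h + 2 * h9

theorem devG_one (tq : ‖t ^ 24‖ < 1 / 2) :
    t ^ 120 * qpi (t ^ 2904) (t ^ 2904) * devG t 1 = quotSide t 5 - quotSide t 9 := by
  have hJ : qpi (t ^ 24) (t ^ 24) ≠ 0 := right_ne_zero_of_mul_eq_one (gfM_mul_qpi (pow_ne_zero 24 t0) tq)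
  have h := qpi_mul_devG t0 t1 tq (a := 1) (by norm_num)
  have h9 := lamN_quotient t0 t1 tq (l := 9) (by decide) (by decide)
  have h5 := lamN_quotient t0 t1 tq (l := 5) (by decide) (by decide)
  have e0 := lamN_zero t0 t1
  norm_num at h h9 h5
  rw [e0] at h
  apply mul_left_cancel₀ hJ
  linear_combination t ^ 120 * qpi (t ^ 2904) (t ^ 2904) * h + h5 - h9

theorem devG_two (tq : ‖t ^ 24‖ < 1 / 2) :
    t ^ 120 * qpi (t ^ 2904) (t ^ 2904) * devG t 2 =
      quotSide t 1 - quotSide t 5 - 11 * t ^ 96 * qpi (t ^ 2904) (t ^ 2904) := by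
  have hJ : qpi (t ^ 24) (t ^ 24) ≠ 0 := right_ne_zero_of_mul_eq_one (gfM_mul_qpi (pow_ne_zero 24 t0) tq)
  have h := qpi_mul_devG t0 t1 tq (a := 2) (by norm_num)
  have h5 := lamN_quotient t0 t1 tq (l := 5) (by decide) (by decide)
  have h1 := lamN_quotient t0 t1 tq (l := 1) (by decide) (by decide)
  have e0 := lamN_two t0 t1
  have z : t ^ 120 * (t ^ 24)⁻¹ = t ^ 96 := by
    rw [mul_inv_eq_iff_eq_mul₀ (pow_ne_zero _ t0), ← pow_add]
  norm_num at h h1 h5 e0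
  rw [e0] at h
  apply mul_left_cancel₀ hJ
  linear_combination t ^ 120 * qpi (t ^ 2904) (t ^ 2904) * h + h1 - h5 -
    11 * qpi (t ^ 24) (t ^ 24) * qpi (t ^ 2904) (t ^ 2904) * z

theorem devG_three (tq : ‖t ^ 24‖ < 1 / 2) :
    t ^ 120 * qpi (t ^ 2904) (t ^ 2904) * devG t 3 =
      -quotSide t 3 - quotSide t 1 + 11 * t ^ 96 * qpi (t ^ 2904) (t ^ 2904) := by
  have hJ : qpi (t ^ 24) (t ^ 24) ≠ 0 := right_ne_zero_of_mul_eq_one (gfM_mul_qpi (pow_ne_zero 24 t0) tq)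
  have h := qpi_mul_devG t0 t1 tq (a := 3) (by norm_num)
  have h3 := lamN_quotient t0 t1 tq (l := 3) (by decide) (by decide)
  have h1 := lamN_quotient t0 t1 tq (l := 1) (by decide) (by decide)
  have e0 := lamN_two t0 t1
  have e1 := lamN_three t0 t1
  have z : t ^ 120 * (t ^ 24)⁻¹ = t ^ 96 := by
    rw [mul_inv_eq_iff_eq_mul₀ (pow_ne_zero _ t0), ← pow_add]
  norm_num at h h1 h3 e0
  rw [e0, e1] at h
  apply mul_left_cancel₀ hJ
  linear_combination t ^ 120 * qpi (t ^ 2904) (t ^ 2904) * h - h1 - h3 +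
    11 * qpi (t ^ 24) (t ^ 24) * qpi (t ^ 2904) (t ^ 2904) * z

theorem devG_four (tq : ‖t ^ 24‖ < 1 / 2) :
    t ^ 120 * qpi (t ^ 2904) (t ^ 2904) * devG t 4 = -quotSide t 7 + quotSide t 3 := by
  have hJ : qpi (t ^ 24) (t ^ 24) ≠ 0 := right_ne_zero_of_mul_eq_one (gfM_mul_qpi (pow_ne_zero 24 t0) tq)
  have h := qpi_mul_devG t0 t1 tq (a := 4) (by norm_num)
  have h3 := lamN_quotient t0 t1 tq (l := 3) (by decide) (by decide)
  have h7 := lamN_quotient t0 t1 tq (l := 7) (by decide) (by decide)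
  have e0 := lamN_four t0 t1
  have e1 := lamN_three t0 t1
  norm_num at h h7 h3
  rw [e0, e1] at h
  apply mul_left_cancel₀ hJ
  linear_combination t ^ 120 * qpi (t ^ 2904) (t ^ 2904) * h - h7 + h3

theorem devG_five (tq : ‖t ^ 24‖ < 1 / 2) :
    t ^ 120 * qpi (t ^ 2904) (t ^ 2904) * devG t 5 = quotSide t 7 := by
  have hJ : qpi (t ^ 24) (t ^ 24) ≠ 0 := right_ne_zero_of_mul_eq_one (gfM_mul_qpi (pow_ne_zero 24 t0) tq)
  have h := qpi_mul_devG t0 t1 tq (a := 5) (by norm_num)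
  have h7 := lamN_quotient t0 t1 tq (l := 7) (by decide) (by decide)
  have e0 := lamN_four t0 t1
  have e1 := lamN_five t0 t1
  norm_num at h h7
  rw [e0, e1] at h
  apply mul_left_cancel₀ hJ
  linear_combination t ^ 120 * qpi (t ^ 2904) (t ^ 2904) * h + h7

end Lambert

/-- The quotients of theta functions that occur in the residue class `6`. -/
noncomputable def quoV (y Q : ℂ) (b1 b2 b3 b4 b5 : ℂ) : ℂ :=
  qpi Q Q ^ 14 * ((jt Q y * jt Q (y ^ 2) * jt Q (y ^ 3) * jt Q (y ^ 4) * jt Q (y ^ 5)) ^ 2)⁻¹ *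
    (b1 * (y ^ 2 * (jt Q (y ^ 4))⁻¹ * ((jt Q (y ^ 5))⁻¹) ^ 2) + b2 * (((jt Q y)⁻¹) ^ 2 * (jt Q (y ^ 3))⁻¹) +
      b3 * (y * (jt Q y)⁻¹ * ((jt Q (y ^ 4))⁻¹) ^ 2) + b4 * (y * ((jt Q (y ^ 2))⁻¹) ^ 2 * (jt Q (y ^ 5))⁻¹) +
      b5 * (y * (jt Q (y ^ 2))⁻¹ * ((jt Q (y ^ 3))⁻¹) ^ 2))

/-- The section of the deviation of the rank in the residue class `6` modulo `11`. -/
noncomputable def secG (t : ℂ) (a : ℤ) : ℂ :=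
  ∑' m : ℕ, (11 * (rankCount a 11 (11 * m + 6) : ℂ) - (partitionCount (11 * m + 6) : ℂ)) * (t ^ 264) ^ m

theorem IsPrimitiveRoot.sum_zpow_eleven {w : ℂ} (hw : IsPrimitiveRoot w 11) (k : ℤ) :
    ∑ j ∈ range 11, (w ^ j) ^ k = if (11 : ℤ) ∣ k then 11 else 0 := by
  have w0 : w ≠ 0 := hw.ne_zero (by norm_num)
  have e : ∀ j : ℕ, (w ^ j) ^ k = (w ^ k) ^ j := fun j => by
    rw [← zpow_natCast, ← zpow_natCast, ← zpow_mul, ← zpow_mul, mul_comm]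
  simp only [e]
  split_ifs with h
  · have : w ^ k = 1 := (hw.zpow_eq_one_iff_dvd k).mpr (by exact_mod_cast h)
    simp [this]
  · have h1 : w ^ k ≠ 1 := fun h2 => h (by exact_mod_cast (hw.zpow_eq_one_iff_dvd k).mp h2)
    have h11 : (w ^ k) ^ 11 = 1 := by
      rw [← zpow_natCast, ← zpow_mul, mul_comm, zpow_mul, zpow_natCast, hw.pow_eq_one, one_zpow]
    have := mul_geom_sum (w ^ k) 11
    rw [h11, sub_self] at this
    exact (mul_eq_zero.mp this).resolve_left (sub_ne_zero.mpr h1)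

section Twist
variable {t w : ℂ} (t0 : t ≠ 0) (t1 : ‖t‖ < 1) (hw : w ^ 11 = 1)
include hw

theorem mul_pow_eleven_mul (k : ℕ) : (w * t) ^ (11 * k) = t ^ (11 * k) := by
  rw [mul_pow, pow_mul, hw, one_pow, one_mul]

theorem mul_zpow_eleven_mul (k : ℤ) : (w * t) ^ (11 * k) = t ^ (11 * k) := by
  rw [mul_zpow, zpow_mul]
  norm_cast
  simp [hw]

theorem zpow_eq_of_eleven (w0 : w ≠ 0) {a b : ℤ} (k : ℤ) (h : a = b + 11 * k) : w ^ a = w ^ b := by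
  rw [h, zpow_add₀ w0, zpow_mul]
  norm_cast
  simp [hw]

theorem thD_twist : thD (w * t) = thD t := by
  rw [thD, thD, mul_pow_eleven_mul hw 33, mul_pow_eleven_mul hw 264]

theorem mul_zpow_twist (n : ℤ) : (w * t) ^ (264 * n) = t ^ (264 * n) := by
  have := mul_zpow_eleven_mul hw (t := t) (24 * n)
  rwa [← mul_assoc] at this

include t0 t1

theorem thw_twist (n : ℤ) : thw (w * t) n = w ^ (n ^ 2) * thw t n := by
  have w0 : w ≠ 0 := by rintro rfl; norm_num at hw
  rw [thw_eq (mul_ne_zero w0 t0), thw_eq t0, mul_pow_eleven_mul hw 264, mul_zpow_twist hw, mul_zpow,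
    zpow_eq_of_eleven hw w0 (n ^ 2 + 33 - 12 * n) (a := 12 * n ^ 2 + 363 - 132 * n) (b := n ^ 2) (by ring), mul_assoc]

theorem gradedTerm_twist (l : ℤ) {c : ℕ} (hc : c < 11) :
    gradedTerm (w * t) l c = (w ^ (l ^ 2)) ^ c * gradedTerm t l c := by
  have hw' : (w ^ (l ^ 2)) ^ 11 = 1 := by
    rw [← zpow_natCast, ← zpow_mul, mul_comm, zpow_mul]
    norm_cast
    simp [hw]
  have e : ∀ n : ℤ, ∀ k : ℕ, n ^ 2 = k → thw (w * t) (l * n) = (w ^ (l ^ 2)) ^ k * thw t (l * n) := fun n k h => by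
    rw [thw_twist t0 t1 hw, mul_pow, h, zpow_mul, zpow_natCast]
  have e1 := e 1 1 (by norm_num)
  rw [pow_one] at e1
  exact numer_twist hw' e1 (e 2 4 (by norm_num)) (e 3 9 (by norm_num)) (e 4 16 (by norm_num))
    (e 5 25 (by norm_num)) hc

theorem quotSide_twist (l : ℤ) : quotSide (w * t) l =
    -(11 * t ^ (396 * l - 36 * l ^ 2) * App (t ^ 2904) (t ^ (264 * l)) 1) * w ^ (-(3 * l ^ 2)) -
      thD t ^ 5 * ∑ c ∈ Finset.range 11, gradedTerm t l c * w ^ (l ^ 2 * c) := by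
  have w0 : w ≠ 0 := by rintro rfl; norm_num at hw
  rw [quotSide, thD_twist hw, mul_pow_eleven_mul hw 264, mul_zpow_twist hw, mul_zpow,
    zpow_eq_of_eleven hw w0 (36 * l - 3 * l ^ 2) (a := 396 * l - 36 * l ^ 2) (b := -(3 * l ^ 2)) (by ring)]
  congr 1
  · ring
  · congr 1
    refine sum_congr rfl fun c hc => ?_
    rw [gradedTerm_twist t0 t1 hw l (mem_range.mp hc), zpow_mul, zpow_natCast, mul_comm]

end Twist

section Average
variable {t w : ℂ} (t0 : t ≠ 0) (t1 : ‖t‖ < 1) (hw : IsPrimitiveRoot w 11)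
include t0 t1 hw

theorem sum_quotSide {l : ℤ} (hl : ¬ (11 : ℤ) ∣ l) :
    ∑ j ∈ range 11, quotSide (w ^ j * t) l = -(11 * thD t ^ 5 * gradedTerm t l 0) := by
  have hp : Prime (11 : ℤ) := Int.prime_iff_natAbs_prime.mpr (by norm_num)
  have hl2 : ¬ (11 : ℤ) ∣ l ^ 2 := fun h => hl (hp.dvd_of_dvd_pow h)
  have e : ∀ j : ℕ, quotSide (w ^ j * t) l = _ := fun j =>
    quotSide_twist t0 t1 (w := w ^ j) (by rw [← pow_mul, mul_comm, pow_mul, hw.pow_eq_one, one_pow]) l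
  simp only [e]
  rw [sum_sub_distrib, ← mul_sum, ← mul_sum, hw.sum_zpow_eleven, if_neg, sum_comm]
  · simp only [← mul_sum, hw.sum_zpow_eleven]
    rw [sum_eq_single 0]
    · norm_num; ring
    · intro c hc hc0
      rw [if_neg, mul_zero]
      intro h
      rcases hp.dvd_or_dvd h with h | h
      · exact hl2 h
      · have := mem_range.mp hc
        omega
    · simp
  · intro h
    rw [dvd_neg] at h
    rcases hp.dvd_or_dvd h with h | h
    · norm_num at h
    · exact hl2 h

theorem sum_pow_mul_qpi : ∑ j ∈ range 11, (w ^ j * t) ^ 96 * qpi ((w ^ j * t) ^ 2904) ((w ^ j * t) ^ 2904) = 0 := by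
  have e : ∀ j : ℕ, (w ^ j * t) ^ 96 * qpi ((w ^ j * t) ^ 2904) ((w ^ j * t) ^ 2904) =
      (w ^ j) ^ (96 : ℤ) * (t ^ 96 * qpi (t ^ 2904) (t ^ 2904)) := fun j => by
    rw [mul_pow_eleven_mul (k := 264) (by rw [← pow_mul, mul_comm, pow_mul, hw.pow_eq_one, one_pow]), mul_pow, mul_assoc]
    rfl
  simp only [e]
  rw [← sum_mul, hw.sum_zpow_eleven]
  norm_num

theorem sum_devG (tq : ‖t ^ 24‖ < 1 / 2) (a : ℤ) :
    ∑ j ∈ range 11, (w ^ j * t) ^ 120 * qpi ((w ^ j * t) ^ 2904) ((w ^ j * t) ^ 2904) * devG (w ^ j * t) a =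
      11 * t ^ 264 * qpi (t ^ 2904) (t ^ 2904) * secG t a := by
  have w0 : w ≠ 0 := hw.ne_zero (by norm_num)
  have hj : ∀ j : ℕ, (w ^ j) ^ 11 = 1 := fun j => by rw [← pow_mul, mul_comm, pow_mul, hw.pow_eq_one, one_pow]
  have nj : ∀ j : ℕ, ‖w ^ j‖ = 1 := fun j => Complex.norm_eq_one_of_pow_eq_one (hj j) (by norm_num)
  set r : ℕ → ℂ := fun n => 11 * (rankCount a 11 n : ℂ) - (partitionCount n : ℂ) with hr
  set J := qpi (t ^ 2904) (t ^ 2904) with hJ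
  have hs : ∀ j ∈ range 11, HasSum (fun n : ℕ => (w ^ j) ^ (10 + 2 * n : ℤ) * (t ^ 120 * J * (r n * (t ^ 24) ^ n)))
      ((w ^ j * t) ^ 120 * qpi ((w ^ j * t) ^ 2904) ((w ^ j * t) ^ 2904) * devG (w ^ j * t) a) := fun j _ => by
    have h := (hasSum_devG (t := w ^ j * t) (mul_ne_zero (pow_ne_zero _ w0) t0)
      (by rw [mul_pow, norm_mul, norm_pow (w ^ j), nj, one_pow, one_mul]; exact tq) a).summable.hasSum.mul_left
        ((w ^ j * t) ^ 120 * J)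
    rw [mul_pow_eleven_mul (hj j) 264]
    refine h.congr_fun fun n => ?_
    have e : (w ^ j) ^ (10 + 2 * n : ℤ) = (w ^ j) ^ 120 * ((w ^ j) ^ 24) ^ n := by
      rw [← pow_mul (w ^ j) 24 n, ← pow_add, ← zpow_natCast (w ^ j) (120 + 24 * n)]
      refine (zpow_eq_of_eleven (hj j) (pow_ne_zero _ w0) (10 + 2 * n) ?_).symm
      push_cast
      ring
    rw [e, mul_pow, mul_pow, mul_pow]
    ring
  have h := hasSum_sum hs
  have inj : Function.Injective fun m : ℕ => 11 * m + 6 := fun x y h => by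
    simp only at h; omega
  have h2 := (inj.hasSum_iff (f := fun n : ℕ => ∑ j ∈ range 11, (w ^ j) ^ (10 + 2 * n : ℤ) * (t ^ 120 * J * (r n * (t ^ 24) ^ n)))
    (by
      intro n hn
      rw [← sum_mul, hw.sum_zpow_eleven, if_neg, zero_mul]
      intro hd
      exact hn ⟨(n - 6) / 11, by simp only; omega⟩)).mpr h
  rw [← h2.tsum_eq, secG, ← tsum_mul_left]
  refine tsum_congr fun m => ?_
  simp only [Function.comp]
  rw [← sum_mul, hw.sum_zpow_eleven, if_pos (by push_cast; omega)]
  simp only [hr, ← pow_mul]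
  have : t ^ (24 * (11 * m + 6)) = t ^ 144 * t ^ (264 * m) := by rw [← pow_add]; congr 1; ring
  rw [this]
  ring

end Average

section Explicit
variable {t : ℂ} (t0 : t ≠ 0) (t1 : ‖t‖ < 1)
include t0 t1

theorem thw_nat (n : ℕ) {k : ℕ} (hk : 12 * (n : ℤ) ^ 2 + 363 - 132 * n = k) :
    thw t n = t ^ k * jt (t ^ 2904) ((t ^ 264) ^ n) := by
  rw [thw_eq t0, hk, zpow_natCast, ← pow_mul]
  congr 2

theorem thw_jt : (thw t 1 = t ^ 243 * jt (t ^ 2904) (t ^ 264) ∧ thw t 2 = t ^ 147 * jt (t ^ 2904) ((t ^ 264) ^ 2) ∧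
    thw t 3 = t ^ 75 * jt (t ^ 2904) ((t ^ 264) ^ 3) ∧ thw t 4 = t ^ 27 * jt (t ^ 2904) ((t ^ 264) ^ 4) ∧
    thw t 5 = t ^ 3 * jt (t ^ 2904) ((t ^ 264) ^ 5)) := by
  refine ⟨?_, thw_nat t0 t1 2 (by norm_num), thw_nat t0 t1 3 (by norm_num), thw_nat t0 t1 4 (by norm_num),
    thw_nat t0 t1 5 (by norm_num)⟩
  have := thw_nat t0 t1 1 (k := 243) (by norm_num)
  rwa [pow_one] at this

/-- The theta quotients of the graded piece of degree zero attached to the values `u, v, x, z, r`. -/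
theorem gradedTerm_eq {l : ℤ} (hl : ¬ (11 : ℤ) ∣ l) (hl2 : Odd l) {u v x z r : ℂ}
    (hu : thw t (l * 1) = u) (hv : thw t (l * 2) = v) (hx : thw t (l * 3) = x) (hz : thw t (l * 4) = z)
    (hr : thw t (l * 5) = r) : gradedTerm t l 0 = 11 * ((u * v * x * z * r) ^ 2)⁻¹ *
      (-((u ^ 2)⁻¹ * x⁻¹) + u⁻¹ * (z ^ 2)⁻¹ - (v ^ 2)⁻¹ * r⁻¹) := by
  have h := (thetaData t0 t1).scale hl2 hl
  obtain ⟨h1, h2, h3, h4, h5⟩ := h.ne_values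
  have key : ∀ a b c d e : ℕ, mn (fun n => thw t (l * n)) (-a) (-b) (-c) (-d) (-e) =
      (u ^ a)⁻¹ * (v ^ b)⁻¹ * (x ^ c)⁻¹ * (z ^ d)⁻¹ * (r ^ e)⁻¹ := fun a b c d e => by
    simp only [mn, hu, hv, hx, hz, hr, zpow_neg, zpow_natCast]
  have k1 := key 4 2 3 2 2
  have k2 := key 3 2 2 4 2
  have k3 := key 2 4 2 2 3
  push_cast at k1 k2 k3
  rw [gradedTerm, h.numer_zero, k1, k2, k3]
  ring

theorem pow_mul_gradedTerm {l : ℤ} {b1 b2 b3 b4 b5 : ℂ}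
    (h : gradedTerm t l 0 = 11 * ((thw t 1 * thw t 2 * thw t 3 * thw t 4 * thw t 5) ^ 2)⁻¹ *
      (b1 * ((thw t 4)⁻¹ * (thw t 5 ^ 2)⁻¹) + b2 * ((thw t 1 ^ 2)⁻¹ * (thw t 3)⁻¹) +
        b3 * ((thw t 1)⁻¹ * (thw t 4 ^ 2)⁻¹) + b4 * ((thw t 2 ^ 2)⁻¹ * (thw t 5)⁻¹) +
        b5 * ((thw t 2)⁻¹ * (thw t 3 ^ 2)⁻¹))) :
    thD t ^ 5 * gradedTerm t l 0 =
      11 * t ^ 264 * qpi (t ^ 2904) (t ^ 2904) * quoV (t ^ 264) (t ^ 2904) b1 b2 b3 b4 b5 := by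
  obtain ⟨e1, e2, e3, e4, e5⟩ := thw_jt t0 t1
  obtain ⟨h1, h2, h3, h4, h5⟩ := (thetaData t0 t1).ne_values
  rw [e1] at h1
  rw [e2] at h2
  rw [e3] at h3
  rw [e4] at h4
  rw [e5] at h5
  rw [h, e1, e2, e3, e4, e5, thD, quoV]
  replace h1 := right_ne_zero_of_mul h1
  replace h2 := right_ne_zero_of_mul h2
  replace h3 := right_ne_zero_of_mul h3
  replace h4 := right_ne_zero_of_mul h4
  replace h5 := right_ne_zero_of_mul h5
  generalize jt (t ^ 2904) (t ^ 264) = P1 at *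
  generalize jt (t ^ 2904) ((t ^ 264) ^ 2) = P2 at *
  generalize jt (t ^ 2904) ((t ^ 264) ^ 3) = P3 at *
  generalize jt (t ^ 2904) ((t ^ 264) ^ 4) = P4 at *
  generalize jt (t ^ 2904) ((t ^ 264) ^ 5) = P5 at *
  generalize qpi (t ^ 2904) (t ^ 2904) = J
  field_simp
  try ring

theorem graded_one : thD t ^ 5 * gradedTerm t 1 0 =
    11 * t ^ 264 * qpi (t ^ 2904) (t ^ 2904) * quoV (t ^ 264) (t ^ 2904) 0 (-1) 1 (-1) 0 := by
  refine pow_mul_gradedTerm t0 t1 ?_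
  rw [gradedTerm_eq t0 t1 (l := 1) (by decide) (by decide) rfl rfl rfl rfl rfl]
  simp only [one_mul]
  ring

theorem thw_eleven_add (n : ℤ) : thw t (n + 11) = -thw t n := (thetaData t0 t1).antiper n

theorem thw_eleven_sub (n : ℤ) : thw t (11 - n) = thw t n := (thetaData t0 t1).eleven_sub n

theorem thw_add_twenty_two (n : ℤ) : thw t (n + 22) = thw t n := by
  rw [show n + 22 = n + 11 + 11 by ring, thw_eleven_add t0 t1, thw_eleven_add t0 t1, neg_neg]

theorem graded_three : thD t ^ 5 * gradedTerm t 3 0 =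
    11 * t ^ 264 * qpi (t ^ 2904) (t ^ 2904) * quoV (t ^ 264) (t ^ 2904) 1 1 0 0 (-1) := by
  refine pow_mul_gradedTerm t0 t1 ?_
  rw [gradedTerm_eq t0 t1 (l := 3) (by decide) (by decide) rfl (thw_eleven_sub t0 t1 5) (thw_eleven_sub t0 t1 2)
    (thw_eleven_add t0 t1 1) (thw_eleven_add t0 t1 4)]
  norm_num [inv_neg]
  ring

theorem graded_five : thD t ^ 5 * gradedTerm t 5 0 =
    11 * t ^ 264 * qpi (t ^ 2904) (t ^ 2904) * quoV (t ^ 264) (t ^ 2904) 1 (-1) 0 1 0 := by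
  refine pow_mul_gradedTerm t0 t1 ?_
  rw [gradedTerm_eq t0 t1 (l := 5) (by decide) (by decide) rfl (thw_eleven_sub t0 t1 1) (thw_eleven_add t0 t1 4)
    ((thw_eleven_add t0 t1 9).trans (congrArg _ (thw_eleven_sub t0 t1 2))) (thw_add_twenty_two t0 t1 3)]
  norm_num [inv_neg]
  ring

theorem graded_seven : thD t ^ 5 * gradedTerm t 7 0 =
    11 * t ^ 264 * qpi (t ^ 2904) (t ^ 2904) * quoV (t ^ 264) (t ^ 2904) 1 0 1 0 1 := by
  refine pow_mul_gradedTerm t0 t1 ?_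
  rw [gradedTerm_eq t0 t1 (l := 7) (by decide) (by decide) (thw_eleven_sub t0 t1 4) (thw_eleven_add t0 t1 3)
    ((thw_eleven_add t0 t1 10).trans (congrArg _ (thw_eleven_sub t0 t1 1)))
    ((thw_add_twenty_two t0 t1 6).trans (thw_eleven_sub t0 t1 5)) ((thw_add_twenty_two t0 t1 13).trans (thw_eleven_add t0 t1 2))]
  norm_num [inv_neg]
  ring

theorem graded_nine : thD t ^ 5 * gradedTerm t 9 0 =
    11 * t ^ 264 * qpi (t ^ 2904) (t ^ 2904) * quoV (t ^ 264) (t ^ 2904) 0 0 (-1) (-1) 1 := by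
  refine pow_mul_gradedTerm t0 t1 ?_
  rw [gradedTerm_eq t0 t1 (l := 9) (by decide) (by decide) (thw_eleven_sub t0 t1 2)
    ((thw_eleven_add t0 t1 7).trans (congrArg _ (thw_eleven_sub t0 t1 4))) (thw_add_twenty_two t0 t1 5)
    ((thw_add_twenty_two t0 t1 14).trans (thw_eleven_add t0 t1 3))
    ((thw_add_twenty_two t0 t1 23).trans (thw_add_twenty_two t0 t1 1))]
  norm_num [inv_neg]
  ring

theorem secG_eq (tq : ‖t ^ 24‖ < 1 / 2) :
    secG t 0 = 11 * quoV (t ^ 264) (t ^ 2904) 0 0 2 2 (-2) ∧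
    secG t 1 = 11 * quoV (t ^ 264) (t ^ 2904) (-1) 1 (-1) (-2) 1 ∧
    secG t 2 = 11 * quoV (t ^ 264) (t ^ 2904) 1 0 (-1) 2 0 ∧
    secG t 3 = 11 * quoV (t ^ 264) (t ^ 2904) 1 0 1 (-1) (-1) ∧
    secG t 4 = 11 * quoV (t ^ 264) (t ^ 2904) 0 (-1) 1 0 2 ∧
    secG t 5 = 11 * quoV (t ^ 264) (t ^ 2904) (-1) 0 (-1) 0 (-1) := by
  have hw : IsPrimitiveRoot (Complex.exp (2 * Real.pi * Complex.I / (11 : ℕ))) 11 :=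
    Complex.isPrimitiveRoot_exp 11 (by norm_num)
  generalize Complex.exp (2 * Real.pi * Complex.I / (11 : ℕ)) = w at hw
  have w0 : w ≠ 0 := hw.ne_zero (by norm_num)
  have hj : ∀ j : ℕ, (w ^ j) ^ 11 = 1 := fun j => by rw [← pow_mul, mul_comm, pow_mul, hw.pow_eq_one, one_pow]
  have nj : ∀ j : ℕ, ‖w ^ j‖ = 1 := fun j => Complex.norm_eq_one_of_pow_eq_one (hj j) (by norm_num)
  have s0 : ∀ j : ℕ, w ^ j * t ≠ 0 := fun j => mul_ne_zero (pow_ne_zero _ w0) t0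
  have s1 : ∀ j : ℕ, ‖w ^ j * t‖ < 1 := fun j => by rw [norm_mul, nj, one_mul]; exact t1
  have sq : ∀ j : ℕ, ‖(w ^ j * t) ^ 24‖ < 1 / 2 := fun j => by
    rw [mul_pow, norm_mul, norm_pow (w ^ j), nj, one_pow, one_mul]; exact tq
  have d := fun a => sum_devG t0 t1 hw tq a
  have hz := sum_pow_mul_qpi t0 t1 hw
  have q1 := sum_quotSide t0 t1 hw (l := 1) (by decide)
  have q3 := sum_quotSide t0 t1 hw (l := 3) (by decide)
  have q5 := sum_quotSide t0 t1 hw (l := 5) (by decide)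
  have q7 := sum_quotSide t0 t1 hw (l := 7) (by decide)
  have q9 := sum_quotSide t0 t1 hw (l := 9) (by decide)
  have g1 := graded_one t0 t1
  have g3 := graded_three t0 t1
  have g5 := graded_five t0 t1
  have g7 := graded_seven t0 t1
  have g9 := graded_nine t0 t1
  have hJ : qpi (t ^ 2904) (t ^ 2904) ≠ 0 :=
    qpi_self_ne_zero (norm_pow_lt_one t1 (by norm_num))
  have hc : (11 * t ^ 264 * qpi (t ^ 2904) (t ^ 2904)) ≠ 0 :=
    mul_ne_zero (mul_ne_zero (by norm_num) (pow_ne_zero _ t0)) hJ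
  have d0 := d 0
  have d1 := d 1
  have d2 := d 2
  have d3 := d 3
  have d4 := d 4
  have d5 := d 5
  simp only [fun j => devG_zero (s0 j) (s1 j) (sq j), ← mul_sum, q9] at d0
  simp only [fun j => devG_one (s0 j) (s1 j) (sq j), sum_sub_distrib, q9, q5] at d1
  simp only [fun j => devG_two (s0 j) (s1 j) (sq j), sum_sub_distrib, mul_assoc (11 : ℂ), ← mul_sum, hz, q1, q5] at d2
  simp only [fun j => devG_three (s0 j) (s1 j) (sq j), sum_sub_distrib, sum_add_distrib, sum_neg_distrib,
    mul_assoc (11 : ℂ), ← mul_sum, hz, q1, q3] at d3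
  simp only [fun j => devG_four (s0 j) (s1 j) (sq j), sum_add_distrib, sum_neg_distrib, q7, q3] at d4
  simp only [fun j => devG_five (s0 j) (s1 j) (sq j), q7] at d5
  unfold quoV at *
  refine ⟨?_, ?_, ?_, ?_, ?_, ?_⟩ <;> apply mul_left_cancel₀ hc
  · linear_combination -d0 - 22 * g9
  · linear_combination -d1 - 11 * g5 + 11 * g9
  · linear_combination -d2 - 11 * g1 + 11 * g5
  · linear_combination -d3 + 11 * g3 + 11 * g1
  · linear_combination -d4 + 11 * g7 - 11 * g3
  · linear_combination -d5 - 11 * g7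

end Explicit

/-- The power series `f` converges absolutely at `y`, with value `v`. -/
def EvalsTo (y : ℂ) (f : PowerSeries ℚ) (v : ℂ) : Prop :=
  Summable (fun n => ‖((PowerSeries.coeff n f : ℚ) : ℂ) * y ^ n‖) ∧ ∑' n, ((PowerSeries.coeff n f : ℚ) : ℂ) * y ^ n = v

namespace EvalsTo
variable {y : ℂ} {f g : PowerSeries ℚ} {v w : ℂ}

theorem add (hf : EvalsTo y f v) (hg : EvalsTo y g w) : EvalsTo y (f + g) (v + w) := by
  have e : ∀ n, ((PowerSeries.coeff n (f + g) : ℚ) : ℂ) * y ^ n =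
      ((PowerSeries.coeff n f : ℚ) : ℂ) * y ^ n + ((PowerSeries.coeff n g : ℚ) : ℂ) * y ^ n := fun n => by
    rw [map_add]; push_cast; ring
  refine ⟨(hf.1.of_norm.add hg.1.of_norm).norm.congr fun n => by rw [e], ?_⟩
  simp only [e]
  rw [hf.1.of_norm.tsum_add hg.1.of_norm, hf.2, hg.2]

theorem mul (hf : EvalsTo y f v) (hg : EvalsTo y g w) : EvalsTo y (f * g) (v * w) := by
  have e : ∀ n, ((PowerSeries.coeff n (f * g) : ℚ) : ℂ) * y ^ n = ∑ kl ∈ antidiagonal n,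
      ((PowerSeries.coeff kl.1 f : ℚ) : ℂ) * y ^ kl.1 * (((PowerSeries.coeff kl.2 g : ℚ) : ℂ) * y ^ kl.2) := fun n => by
    rw [PowerSeries.coeff_mul]
    push_cast
    rw [sum_mul]
    refine sum_congr rfl fun kl h => ?_
    rw [← mem_antidiagonal.mp h, pow_add]
    ring
  refine ⟨(summable_norm_sum_mul_antidiagonal_of_summable_norm hf.1 hg.1).congr fun n => by rw [e], ?_⟩
  simp only [e]
  rw [← tsum_mul_tsum_eq_tsum_sum_antidiagonal_of_summable_norm hf.1 hg.1, hf.2, hg.2]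

theorem monomial (y : ℂ) (k : ℕ) (c : ℚ) : EvalsTo y (PowerSeries.monomial k c) (c * y ^ k) := by
  have e : ∀ n ∉ ({k} : Finset ℕ), ((PowerSeries.coeff n (PowerSeries.monomial k c) : ℚ) : ℂ) * y ^ n = 0 := fun n hn => by
    rw [PowerSeries.coeff_monomial, if_neg (by simpa using hn)]; simp
  refine ⟨summable_of_ne_finset_zero (s := {k}) fun n hn => by rw [e n hn, norm_zero], ?_⟩
  rw [tsum_eq_sum e, sum_singleton, PowerSeries.coeff_monomial, if_pos rfl]

theorem intCast (y : ℂ) (c : ℤ) : EvalsTo y (c : PowerSeries ℚ) c := by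
  have h := monomial y 0 c
  have e : (PowerSeries.monomial 0 (c : ℚ)) = (c : PowerSeries ℚ) := by
    rw [PowerSeries.monomial_zero_eq_C_apply, map_intCast]
  rw [e] at h
  simpa using h

theorem X (y : ℂ) : EvalsTo y PowerSeries.X y := by
  have h := monomial y 1 1
  rw [← PowerSeries.X_eq] at h
  simpa only [Rat.cast_one, one_mul, pow_one] using h

theorem pow (hf : EvalsTo y f v) (n : ℕ) : EvalsTo y (f ^ n) (v ^ n) := by
  induction n with
  | zero => simpa using intCast y 1
  | succ n ih => rw [pow_succ, pow_succ]; exact ih.mul hf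

theorem eq_of_eventually (h : ∀ᶠ y in 𝓝[≠] (0 : ℂ), ∃ v, EvalsTo y f v ∧ EvalsTo y g v) : f = g := by
  by_contra hne
  have hne' : f - g ≠ 0 := sub_ne_zero.mpr hne
  set p : FormalMultilinearSeries ℂ ℂ ℂ :=
    FormalMultilinearSeries.ofScalars ℂ fun n => ((PowerSeries.coeff n (f - g) : ℚ) : ℂ) with hp
  have hz : ∀ᶠ y in 𝓝[≠] (0 : ℂ), HasSum (fun n => ((PowerSeries.coeff n (f - g) : ℚ) : ℂ) * y ^ n) 0 := by
    filter_upwards [h] with y hy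
    obtain ⟨v, hf, hg⟩ := hy
    have h1 := hf.1.of_norm.hasSum.sub hg.1.of_norm.hasSum
    rw [hf.2, hg.2, sub_self] at h1
    refine h1.congr_fun fun n => ?_
    rw [map_sub]; push_cast; ring
  have hs : HasFPowerSeriesAt (fun y => ∑' n, ((PowerSeries.coeff n (f - g) : ℚ) : ℂ) * y ^ n) p 0 := by
    rw [hasFPowerSeriesAt_iff]
    rw [eventually_nhdsWithin_iff] at hz
    filter_upwards [hz] with y hy
    have : Summable (fun n => ((PowerSeries.coeff n (f - g) : ℚ) : ℂ) * y ^ n) := by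
      by_cases h0 : y = 0
      · subst h0
        exact summable_of_ne_finset_zero (s := {0}) fun n hn => by
          rw [zero_pow (by simpa using hn), mul_zero]
      · exact (hy h0).summable
    rw [zero_add]
    refine this.hasSum.congr_fun fun n => ?_
    rw [hp, FormalMultilinearSeries.coeff_ofScalars, smul_eq_mul, mul_comm]
  have hp0 : p ≠ 0 := by
    intro h0
    apply hne'
    ext n
    have h1 : p.coeff n = 0 := by rw [h0]; rfl
    rw [hp, FormalMultilinearSeries.coeff_ofScalars] at h1
    rw [map_zero]
    exact_mod_cast h1
  obtain ⟨y, h1, h2⟩ := ((hs.locally_ne_zero hp0).and hz).exists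
  exact h1 h2.tsum_eq

end EvalsTo

theorem HasSum.sum_fiber {α : Type*} [NormedAddCommGroup α] [CompleteSpace α] {E : ℤ → ℤ} (hE : ∀ k, |k| ≤ E k) {u : ℤ → α} {S : α}
    (h : HasSum u S) : HasSum (fun n : ℕ => ∑ k ∈ (Icc (-(n : ℤ)) n).filter fun k => E k = n, u k) S := by
  have h1 := ((Equiv.sigmaFiberEquiv fun k => (E k).toNat).hasSum_iff.mpr h)
  refine h1.sigma fun n => ?_
  have hiff : ∀ k, k ∈ (Icc (-(n : ℤ)) n).filter (fun k => E k = n) ↔ (E k).toNat = n := fun k => by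
    have h2 := abs_le.mp (hE k)
    have h3 := abs_nonneg k
    have h4 := hE k
    simp only [mem_filter, mem_Icc]
    omega
  have h2 := Finset.hasSum ((Icc (-(n : ℤ)) n).filter fun k => E k = n) u
  exact ((Equiv.subtypeEquivRight hiff).symm.hasSum_iff.mpr h2)

theorem evalsTo_theta {y : ℂ} {E : ℤ → ℤ} (hE : ∀ k, |k| ≤ E k) (h : Summable fun k : ℤ => (-1) ^ k * y ^ E k) :
    EvalsTo y (PowerSeries.mk fun n => ∑ k ∈ Icc (-(n : ℤ)) n, if E k = n then (-1 : ℚ) ^ k.natAbs else 0)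
      (∑' k : ℤ, (-1) ^ k * y ^ E k) := by
  have hsgn : ∀ k : ℤ, (-1 : ℂ) ^ k.natAbs = (-1) ^ k := fun k => by
    rcases Int.even_or_odd k with hk | hk
    · rw [hk.neg_one_zpow, (Int.natAbs_even.mpr hk).neg_one_pow]
    · rw [hk.neg_one_zpow, (Int.natAbs_odd.mpr hk).neg_one_pow]
  have e : ∀ n : ℕ, ((PowerSeries.coeff n (PowerSeries.mk fun n : ℕ => ∑ k ∈ Icc (-(n : ℤ)) n,
      if E k = n then (-1 : ℚ) ^ k.natAbs else 0) : ℚ) : ℂ) * y ^ n =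
      ∑ k ∈ (Icc (-(n : ℤ)) n).filter fun k => E k = n, (-1) ^ k * y ^ E k := fun n => by
    rw [PowerSeries.coeff_mk, ← sum_filter]
    push_cast
    rw [sum_mul]
    refine sum_congr rfl fun k hk => ?_
    rw [hsgn, (mem_filter.mp hk).2, zpow_natCast]
  refine ⟨Summable.of_nonneg_of_le (fun n => norm_nonneg _) (fun n => ?_) (h.norm.hasSum.sum_fiber hE).summable, ?_⟩
  · rw [e]
    exact norm_sum_le _ _
  · simp only [e]
    exact (h.hasSum.sum_fiber hE).tsum_eq

section Bases
variable {y : ℂ} (h0 : y ≠ 0) (h1 : ‖y‖ < 1)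
include h0 h1

theorem evalsTo_jtheta {m a : ℕ} (ha : 0 < a) (ham : 2 * a < m) : EvalsTo y (jtheta a m) (jt (y ^ m) (y ^ a)) := by
  have h2 : ‖y ^ m‖ < 1 := norm_pow_lt_one h1 (by omega)
  have hE : ∀ k : ℤ, |k| ≤ m * tri k + a * k := fun k => by
    have ht := two_tri k
    zify at ha ham
    rcases le_or_gt 1 k with hk | hk
    · rw [abs_of_pos (by omega)]
      nlinarith [mul_nonneg (by omega : (0 : ℤ) ≤ k) (by omega : 0 ≤ k - 1), mul_nonneg (by omega : (0 : ℤ) ≤ m) (by nlinarith : 0 ≤ tri k)]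
    · rw [abs_of_nonpos (by omega)]
      have h3 : 0 ≤ -k * (-k + 1 - 1) := by nlinarith
      have h4 : -k ≤ tri k ∨ k = 0 := by
        rcases eq_or_ne k 0 with h | h
        · exact Or.inr h
        · left; nlinarith [mul_nonneg (by omega : (0 : ℤ) ≤ -k) (by omega : 0 ≤ -k - 1)]
      rcases h4 with h4 | h4
      · nlinarith [mul_le_mul_of_nonneg_left h4 (by omega : (0 : ℤ) ≤ m), mul_nonneg (by omega : (0 : ℤ) ≤ -k) (by omega : (0 : ℤ) ≤ m - a - 1)]
      · subst h4; simp [tri]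
  have e : ∀ k : ℤ, (-1) ^ k * (y ^ m) ^ tri k * (y ^ a) ^ k = (-1) ^ k * y ^ (m * tri k + a * k : ℤ) := fun k => by
    rw [zpow_add₀ h0, zpow_mul, zpow_mul, zpow_natCast, zpow_natCast, mul_assoc]
  have hs := (summable_jt (pow_ne_zero m h0) h2 (pow_ne_zero a h0)).congr fun k => e k
  have h := evalsTo_theta hE hs
  rw [jt]
  simp only [e]
  convert h using 1
  rw [jtheta]
  congr 1
  funext n
  refine sum_congr rfl fun k _ => ?_
  have ht := two_tri k
  have h5 : (m : ℤ) * (k * (k - 1)) + 2 * a * k = 2 * (m * tri k + a * k) := by linear_combination (-(m : ℤ)) * ht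
  congr 1
  rw [h5]
  exact propext (mul_right_inj' two_ne_zero)

theorem evalsTo_Jser {m : ℕ} (hm : 0 < m) : EvalsTo y (Jser m) (qpi (y ^ m) (y ^ m)) := by
  have h2 : ‖y ^ m‖ < 1 := norm_pow_lt_one h1 (by omega)
  have hE : ∀ k : ℤ, |k| ≤ m * (3 * tri k + k) := fun k => by
    have ht := two_tri k
    zify at hm
    have h3 : |k| ≤ 3 * tri k + k := by
      rcases le_or_gt 1 k with hk | hk
      · rw [abs_of_pos (by omega)]
        nlinarith
      · rw [abs_of_nonpos (by omega)]
        rcases eq_or_ne k 0 with h | h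
        · subst h; simp [tri]
        · nlinarith [mul_nonneg (by omega : (0 : ℤ) ≤ -k) (by omega : 0 ≤ -k - 1)]
    nlinarith [abs_nonneg k]
  have e : ∀ k : ℤ, (-1) ^ k * (y ^ m) ^ (3 * tri k + 1 * k) * 1 ^ k = (-1) ^ k * y ^ (m * (3 * tri k + k) : ℤ) := fun k => by
    rw [zpow_mul, zpow_natCast, one_zpow, mul_one, one_mul]
  have hs : Summable fun k : ℤ => (-1) ^ k * y ^ (m * (3 * tri k + k) : ℤ) := by
    have := summable_jt (pow_ne_zero 3 (pow_ne_zero m h0)) (norm_pow_lt_one h2 (by norm_num)) (pow_ne_zero m h0)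
    refine this.congr fun k => ?_
    rw [zpow_mul, zpow_natCast, zpow_add₀ (pow_ne_zero m h0), zpow_mul, mul_assoc]
    norm_cast
  have h := evalsTo_theta hE hs
  rw [← thC_one_one (pow_ne_zero m h0) h2, thC]
  simp only [e]
  convert h using 1
  rw [Jser]
  congr 1
  funext n
  refine sum_congr rfl fun k _ => ?_
  have ht := two_tri k
  have h5 : (m : ℤ) * (k * (3 * k - 1)) = 2 * (m * (3 * tri k + k)) := by linear_combination (-3 * (m : ℤ)) * ht
  congr 1
  rw [h5]
  exact propext (mul_right_inj' two_ne_zero)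

/-- The product of the five theta functions. -/
theorem qpi_mul_qpi_pow : qpi y y * qpi (y ^ 11) (y ^ 11) ^ 4 =
    jt (y ^ 11) y * jt (y ^ 11) (y ^ 2) * jt (y ^ 11) (y ^ 3) * jt (y ^ 11) (y ^ 4) * jt (y ^ 11) (y ^ 5) := by
  have hQ : ‖y ^ 11‖ < 1 := norm_pow_lt_one h1 (by norm_num)
  have e : ∀ i j : ℕ, i + j = 11 → jt (y ^ 11) (y ^ i) = qpi (y ^ 11) (y ^ 11) * qpi (y ^ 11) (y ^ i) * qpi (y ^ 11) (y ^ j) :=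
    fun i j h => by
      rw [jt_eq_prod (pow_ne_zero _ h0) hQ (pow_ne_zero _ h0), ← h, pow_add, mul_div_cancel_left₀ _ (pow_ne_zero _ h0)]
  have e1 := e 1 10 rfl
  rw [pow_one] at e1
  rw [qpi_split_nat h1 y (r := 11) (by norm_num), e1, e 2 9 rfl, e 3 8 rfl, e 4 7 rfl, e 5 6 rfl]
  simp only [Fin.prod_univ_succ, ← pow_succ']
  norm_num [Fin.prod_univ_succ, ← pow_succ']
  ring

end Bases

theorem constantCoeff_Jser (m : ℤ) : PowerSeries.constantCoeff (Jser m) = 1 := by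
  rw [Jser, ← PowerSeries.coeff_zero_eq_constantCoeff_apply, PowerSeries.coeff_mk]
  simp

theorem constantCoeff_Pser (i : ℤ) : PowerSeries.constantCoeff (Pser i) = 1 := by
  rw [Pser, jtheta, ← PowerSeries.coeff_zero_eq_constantCoeff_apply, PowerSeries.coeff_mk]
  simp

theorem Jser_mul_inv (m : ℤ) : Jser m * (Jser m)⁻¹ = 1 :=
  PowerSeries.mul_inv_cancel _ (by rw [constantCoeff_Jser]; exact one_ne_zero)

theorem Pser_mul_inv (i : ℤ) : Pser i * (Pser i)⁻¹ = 1 :=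
  PowerSeries.mul_inv_cancel _ (by rw [constantCoeff_Pser]; exact one_ne_zero)

/-- The generating function of the deviation of the rank in the residue class `6` modulo `11`. -/
noncomputable def devSer (a : ℤ) : PowerSeries ℚ :=
  PowerSeries.mk fun n => ((11 * (rankCount a 11 (11 * n + 6) : ℤ) - (partitionCount (11 * n + 6) : ℤ) : ℤ) : ℚ)

theorem evalsTo_devSer {t : ℂ} (t0 : t ≠ 0) (tq : ‖t ^ 24‖ < 1 / 2) (a : ℤ) : EvalsTo (t ^ 264) (devSer a) (secG t a) := by
  have inj : Function.Injective fun m : ℕ => 11 * m + 6 := fun x y h => by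
    simp only at h; omega
  have h := ((hasSum_devG t0 tq a).summable.comp_injective inj).mul_left (t ^ 144)⁻¹
  have e : ∀ m : ℕ, ((PowerSeries.coeff m (devSer a) : ℚ) : ℂ) * (t ^ 264) ^ m =
      (11 * (rankCount a 11 (11 * m + 6) : ℂ) - (partitionCount (11 * m + 6) : ℂ)) * (t ^ 264) ^ m := fun m => by
    rw [devSer, PowerSeries.coeff_mk]
    push_cast
    ring
  refine ⟨(h.congr fun m => ?_).norm, tsum_congr e⟩
  rw [e]
  have h2 : (t ^ 24) ^ (11 * m + 6) = t ^ 144 * (t ^ 264) ^ m := by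
    rw [← pow_mul, ← pow_mul, ← pow_add]; congr 1; ring
  simp only [Function.comp, h2]
  field_simp [pow_ne_zero 144 t0]

/-- The numerator of the theta combination over the common denominator. -/
noncomputable def thetaNum {R : Type*} [CommRing R] (b1 b2 b3 b4 b5 y p1 p2 p3 p4 p5 : R) : R :=
  b1 * y ^ 2 * p1 ^ 2 * p2 ^ 2 * p3 ^ 2 * p4 + b2 * p2 ^ 2 * p3 * p4 ^ 2 * p5 ^ 2 + b3 * y * p1 * p2 ^ 2 * p3 ^ 2 * p5 ^ 2 +
    b4 * y * p1 ^ 2 * p3 ^ 2 * p4 ^ 2 * p5 + b5 * y * p1 ^ 2 * p2 * p4 ^ 2 * p5 ^ 2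

theorem ThetaSer_eq (b1 b2 b3 b4 b5 : ℤ) : ThetaSer b1 b2 b3 b4 b5 =
    Jser 11 ^ 6 * ((Jser 1)⁻¹) ^ 2 * (thetaNum (b1 : PowerSeries ℚ) b2 b3 b4 b5 PowerSeries.X (Pser 1) (Pser 2) (Pser 3)
      (Pser 4) (Pser 5) * ((Pser 1)⁻¹ * (Pser 2)⁻¹ * (Pser 3)⁻¹ * (Pser 4)⁻¹ * (Pser 5)⁻¹) ^ 2) := by
  rw [ThetaSer]
  have h1 := Pser_mul_inv 1
  have h2 := Pser_mul_inv 2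
  have h3 := Pser_mul_inv 3
  have h4 := Pser_mul_inv 4
  have h5 := Pser_mul_inv 5
  generalize (Pser 1)⁻¹ = q1 at *
  generalize (Pser 2)⁻¹ = q2 at *
  generalize (Pser 3)⁻¹ = q3 at *
  generalize (Pser 4)⁻¹ = q4 at *
  generalize (Pser 5)⁻¹ = q5 at *
  generalize Pser 1 = p1 at *
  generalize Pser 2 = p2 at *
  generalize Pser 3 = p3 at *
  generalize Pser 4 = p4 at *
  generalize Pser 5 = p5 at *
  congr 1
  calc _ = (b1 : PowerSeries ℚ) * PowerSeries.X ^ 2 * q4 * q5 ^ 2 * (p1 * q1) ^ 2 * (p2 * q2) ^ 2 * (p3 * q3) ^ 2 * (p4 * q4) +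
        (b2 : PowerSeries ℚ) * q1 ^ 2 * q3 * (p2 * q2) ^ 2 * (p3 * q3) * (p4 * q4) ^ 2 * (p5 * q5) ^ 2 +
        (b3 : PowerSeries ℚ) * PowerSeries.X * q1 * q4 ^ 2 * (p1 * q1) * (p2 * q2) ^ 2 * (p3 * q3) ^ 2 * (p5 * q5) ^ 2 +
        (b4 : PowerSeries ℚ) * PowerSeries.X * q2 ^ 2 * q5 * (p1 * q1) ^ 2 * (p3 * q3) ^ 2 * (p4 * q4) ^ 2 * (p5 * q5) +
        (b5 : PowerSeries ℚ) * PowerSeries.X * q2 * q3 ^ 2 * (p1 * q1) ^ 2 * (p2 * q2) * (p4 * q4) ^ 2 * (p5 * q5) ^ 2 := by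
        simp only [h1, h2, h3, h4, h5, one_pow, mul_one]
    _ = _ := by rw [thetaNum]; ring

theorem devSer_eq {a b1 b2 b3 b4 b5 : ℤ} (h : ∀ t : ℂ, t ≠ 0 → ‖t‖ < 1 → ‖t ^ 24‖ < 1 / 2 →
    secG t a = 11 * quoV (t ^ 264) (t ^ 2904) b1 b2 b3 b4 b5) : devSer a = 11 * ThetaSer b1 b2 b3 b4 b5 := by
  have key : Jser 1 ^ 2 * (Pser 1 * Pser 2 * Pser 3 * Pser 4 * Pser 5) ^ 2 * devSer a =
      (11 : ℤ) * (Jser 11 ^ 6 * thetaNum (b1 : PowerSeries ℚ) b2 b3 b4 b5 PowerSeries.X (Pser 1) (Pser 2) (Pser 3)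
        (Pser 4) (Pser 5)) := by
    apply EvalsTo.eq_of_eventually
    rw [eventually_nhdsWithin_iff]
    filter_upwards [Metric.ball_mem_nhds (0 : ℂ) (ε := (1 / 2) ^ 11) (by norm_num)] with y hy y0
    rw [Set.mem_compl_singleton_iff] at y0
    rw [mem_ball_zero_iff] at hy
    obtain ⟨t, rfl⟩ := IsAlgClosed.exists_pow_nat_eq y (n := 264) (by norm_num)
    have t0 : t ≠ 0 := by rintro rfl; norm_num at y0
    have tq : ‖t ^ 24‖ < 1 / 2 := by
      have e : ‖t ^ 264‖ = ‖t ^ 24‖ ^ 11 := by rw [← norm_pow, ← pow_mul]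
      rw [e] at hy
      exact lt_of_pow_lt_pow_left₀ 11 (by norm_num) hy
    have t1 : ‖t‖ < 1 := by
      rw [norm_pow] at tq
      exact lt_of_pow_lt_pow_left₀ 24 (by norm_num) (by rw [one_pow]; linarith)
    have y1 : ‖t ^ 264‖ < 1 := norm_pow_lt_one t1 (by norm_num)
    have hy11 : (t ^ 264) ^ 11 = t ^ 2904 := by rw [← pow_mul]
    have E : ∀ i : ℕ, 0 < i → 2 * i < 11 → EvalsTo (t ^ 264) (Pser i) (jt (t ^ 2904) ((t ^ 264) ^ i)) := fun i hi hi2 => by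
      have := evalsTo_jtheta y0 y1 (m := 11) hi hi2
      rwa [hy11] at this
    have E1 : EvalsTo (t ^ 264) (Pser 1) _ := E 1 (by norm_num) (by norm_num)
    have E2 : EvalsTo (t ^ 264) (Pser 2) _ := E 2 (by norm_num) (by norm_num)
    have E3 : EvalsTo (t ^ 264) (Pser 3) _ := E 3 (by norm_num) (by norm_num)
    have E4 : EvalsTo (t ^ 264) (Pser 4) _ := E 4 (by norm_num) (by norm_num)
    have E5 : EvalsTo (t ^ 264) (Pser 5) _ := E 5 (by norm_num) (by norm_num)
    have EJ : EvalsTo (t ^ 264) (Jser 1) _ := evalsTo_Jser y0 y1 (m := 1) (by norm_num)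
    have EK : EvalsTo (t ^ 264) (Jser 11) _ := evalsTo_Jser y0 y1 (m := 11) (by norm_num)
    have EX := EvalsTo.X (t ^ 264)
    have EB := fun b : ℤ => EvalsTo.intCast (t ^ 264) b
    rw [pow_one] at E1 EJ
    rw [hy11] at EK
    have hprod := qpi_mul_qpi_pow y0 y1
    rw [hy11] at hprod
    have hne : jt (t ^ 2904) (t ^ 264) * jt (t ^ 2904) ((t ^ 264) ^ 2) * jt (t ^ 2904) ((t ^ 264) ^ 3) *
        jt (t ^ 2904) ((t ^ 264) ^ 4) * jt (t ^ 2904) ((t ^ 264) ^ 5) ≠ 0 := by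
      obtain ⟨e1, e2, e3, e4, e5⟩ := thw_jt t0 t1
      obtain ⟨h1, h2, h3, h4, h5⟩ := (thetaData t0 t1).ne_values
      rw [e1] at h1
      rw [e2] at h2
      rw [e3] at h3
      rw [e4] at h4
      rw [e5] at h5
      exact mul_ne_zero (mul_ne_zero (mul_ne_zero (mul_ne_zero (right_ne_zero_of_mul h1) (right_ne_zero_of_mul h2))
        (right_ne_zero_of_mul h3)) (right_ne_zero_of_mul h4)) (right_ne_zero_of_mul h5)
    have L := ((EJ.pow 2).mul (((((E1.mul E2).mul E3).mul E4).mul E5).pow 2)).mul (evalsTo_devSer t0 tq a)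
    have R := (EB 11).mul ((EK.pow 6).mul
      ((((((((EB b1).mul (EX.pow 2)).mul (E1.pow 2)).mul (E2.pow 2)).mul (E3.pow 2)).mul E4).add
        (((((EB b2).mul (E2.pow 2)).mul E3).mul (E4.pow 2)).mul (E5.pow 2))).add
        ((((((EB b3).mul EX).mul E1).mul (E2.pow 2)).mul (E3.pow 2)).mul (E5.pow 2)) |>.add
        ((((((EB b4).mul EX).mul (E1.pow 2)).mul (E3.pow 2)).mul (E4.pow 2)).mul E5) |>.add
        ((((((EB b5).mul EX).mul (E1.pow 2)).mul E2).mul (E4.pow 2)).mul (E5.pow 2))))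
    refine ⟨_, L, ?_⟩
    rw [thetaNum]
    convert R using 1
    rw [h t t0 t1 tq, quoV]
    generalize jt (t ^ 2904) (t ^ 264) = P1 at *
    generalize jt (t ^ 2904) ((t ^ 264) ^ 2) = P2 at *
    generalize jt (t ^ 2904) ((t ^ 264) ^ 3) = P3 at *
    generalize jt (t ^ 2904) ((t ^ 264) ^ 4) = P4 at *
    generalize jt (t ^ 2904) ((t ^ 264) ^ 5) = P5 at *
    generalize qpi (t ^ 2904) (t ^ 2904) = J at *
    generalize qpi (t ^ 264) (t ^ 264) = K at *
    generalize t ^ 264 = y at *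
    have hJ : J ^ 14 * K ^ 2 = J ^ 6 * (P1 * P2 * P3 * P4 * P5) ^ 2 := by rw [← hprod]; ring
    have n1 : P1 ≠ 0 := by rintro rfl; simp at hne
    have n2 : P2 ≠ 0 := by rintro rfl; simp at hne
    have n3 : P3 ≠ 0 := by rintro rfl; simp at hne
    have n4 : P4 ≠ 0 := by rintro rfl; simp at hne
    have n5 : P5 ≠ 0 := by rintro rfl; simp at hne
    have hW : K ^ 2 * (P1 * P2 * P3 * P4 * P5) ^ 2 * (J ^ 14 * ((P1 * P2 * P3 * P4 * P5) ^ 2)⁻¹) =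
        J ^ 6 * (P1 * P2 * P3 * P4 * P5) ^ 2 := by
      rw [← hJ]
      field_simp
    rw [mul_left_comm, ← mul_assoc (K ^ 2 * _), hW]
    push_cast
    field_simp
    try ring
  have hj := Jser_mul_inv 1
  have h1 := Pser_mul_inv 1
  have h2 := Pser_mul_inv 2
  have h3 := Pser_mul_inv 3
  have h4 := Pser_mul_inv 4
  have h5 := Pser_mul_inv 5
  rw [ThetaSer_eq]
  push_cast at key
  generalize thetaNum (b1 : PowerSeries ℚ) b2 b3 b4 b5 PowerSeries.X (Pser 1) (Pser 2) (Pser 3) (Pser 4) (Pser 5) = N at *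
  generalize (Pser 1)⁻¹ = q1 at *
  generalize (Pser 2)⁻¹ = q2 at *
  generalize (Pser 3)⁻¹ = q3 at *
  generalize (Pser 4)⁻¹ = q4 at *
  generalize (Pser 5)⁻¹ = q5 at *
  generalize (Jser 1)⁻¹ = k at *
  calc devSer a = (Jser 1 * k) ^ 2 * (Pser 1 * q1) ^ 2 * (Pser 2 * q2) ^ 2 * (Pser 3 * q3) ^ 2 * (Pser 4 * q4) ^ 2 *
        (Pser 5 * q5) ^ 2 * devSer a := by
        simp only [hj, h1, h2, h3, h4, h5, one_pow, one_mul]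
    _ = k ^ 2 * (q1 * q2 * q3 * q4 * q5) ^ 2 *
        (Jser 1 ^ 2 * (Pser 1 * Pser 2 * Pser 3 * Pser 4 * Pser 5) ^ 2 * devSer a) := by ring
    _ = _ := by rw [key]; ring

end

/-- The dissection elements of the deviation of the rank modulo 11 for the residue 6. -/
theorem rank_dissection_mod_eleven_residue_six :
    ((PowerSeries.mk fun n => ((11 * (rankCount 0 11 (11 * n + 6) : ℤ) - (partitionCount (11 * n + 6) : ℤ) : ℤ) : ℚ)) =
      11 * ThetaSer 0 0 2 2 (-2))
    ∧ ((PowerSeries.mk fun n => ((11 * (rankCount 1 11 (11 * n + 6) : ℤ) - (partitionCount (11 * n + 6) : ℤ) : ℤ) : ℚ)) =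
      11 * ThetaSer (-1) 1 (-1) (-2) 1)
    ∧ ((PowerSeries.mk fun n => ((11 * (rankCount 2 11 (11 * n + 6) : ℤ) - (partitionCount (11 * n + 6) : ℤ) : ℤ) : ℚ)) =
      11 * ThetaSer 1 0 (-1) 2 0)
    ∧ ((PowerSeries.mk fun n => ((11 * (rankCount 3 11 (11 * n + 6) : ℤ) - (partitionCount (11 * n + 6) : ℤ) : ℤ) : ℚ)) =
      11 * ThetaSer 1 0 1 (-1) (-1))
    ∧ ((PowerSeries.mk fun n => ((11 * (rankCount 4 11 (11 * n + 6) : ℤ) - (partitionCount (11 * n + 6) : ℤ) : ℤ) : ℚ)) =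
      11 * ThetaSer 0 (-1) 1 0 2)
    ∧ ((PowerSeries.mk fun n => ((11 * (rankCount 5 11 (11 * n + 6) : ℤ) - (partitionCount (11 * n + 6) : ℤ) : ℤ) : ℚ)) =
      11 * ThetaSer (-1) 0 (-1) 0 (-1)) := by
  have h0 : devSer 0 = 11 * ThetaSer 0 0 2 2 (-2) := devSer_eq fun t t0 t1 tq => by
    have := (secG_eq t0 t1 tq).1
    push_cast
    exact this
  have h1 : devSer 1 = 11 * ThetaSer (-1) 1 (-1) (-2) 1 := devSer_eq fun t t0 t1 tq => by
    have := (secG_eq t0 t1 tq).2.1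
    push_cast
    exact this
  have h2 : devSer 2 = 11 * ThetaSer 1 0 (-1) 2 0 := devSer_eq fun t t0 t1 tq => by
    have := (secG_eq t0 t1 tq).2.2.1
    push_cast
    exact this
  have h3 : devSer 3 = 11 * ThetaSer 1 0 1 (-1) (-1) := devSer_eq fun t t0 t1 tq => by
    have := (secG_eq t0 t1 tq).2.2.2.1
    push_cast
    exact this
  have h4 : devSer 4 = 11 * ThetaSer 0 (-1) 1 0 2 := devSer_eq fun t t0 t1 tq => by
    have := (secG_eq t0 t1 tq).2.2.2.2.1
    push_cast
    exact this
  have h5 : devSer 5 = 11 * ThetaSer (-1) 0 (-1) 0 (-1) := devSer_eq fun t t0 t1 tq => by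
    have := (secG_eq t0 t1 tq).2.2.2.2.2
    push_cast
    exact this
  unfold devSer at h0 h1 h2 h3 h4 h5
  exact ⟨h0, h1, h2, h3, h4, h5⟩

end
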